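/- Given a natural number n > 0, the following statements are equiconsistent over ZFC: (1) there exists a C^(n)-weakly shrewd cardinal that is not C^(n)-strongly unfoldable; (2) there exists a subtle cardinal. -/

import Mathlib

namespace Paper

/-- First-order formulas in the language of set theory (one binary relation, membership),
using de Bruijn variables; `all` binds the last variable. -/
inductive SetFormula : ℕ → Type
  | mem {n : ℕ} (i j : Fin n) : SetFormula n
  | eq {n : ℕ} (i j : Fin n) : SetFormula n
  | fal {n : ℕ} : SetFormula n
  | imp {n : ℕ} (φ ψ : SetFormula n) : SetFormula n
  | all {n : ℕ} (φ : SetFormula (n + 1)) : SetFormula n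

namespace SetFormula

/-- Negation. -/
def not {n : ℕ} (φ : SetFormula n) : SetFormula n := φ.imp .fal

/-- Conjunction. -/
def and {n : ℕ} (φ ψ : SetFormula n) : SetFormula n := (φ.imp ψ.not).not

/-- Existential quantification (over the last variable). -/
def ex {n : ℕ} (φ : SetFormula (n + 1)) : SetFormula n := (SetFormula.all φ.not).not

end SetFormula

/-- Satisfaction of a set-theoretic formula in a structure `(M, E)`, where `E` interprets
the membership relation. -/
def Realize {M : Type*} (E : M → M → Prop) : ∀ {n : ℕ}, SetFormula n → (Fin n → M) → Prop
  | _, .mem i j, v => E (v i) (v j)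
  | _, .eq i j, v => v i = v j
  | _, .fal, _ => False
  | _, .imp φ ψ, v => Realize E φ v → Realize E ψ v
  | _, .all φ, v => ∀ a, Realize E φ (Fin.snoc v a)

/-- Satisfaction of a formula relativized to the subclass `S` of `M`; all quantifiers
range over `S`, and the assignment is required to take values in `S`. -/
def RealizeIn {M : Type*} (E : M → M → Prop) (S : M → Prop) {n : ℕ}
    (φ : SetFormula n) (v : Fin n → M) : Prop :=
  ∃ h : ∀ i, S (v i),
    Realize (fun a b : {x : M // S x} => E a.1 b.1) φ fun i => ⟨v i, h i⟩

/-- `Δ₀`-formulas: formulas all of whose quantifiers are bounded. -/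
inductive IsDelta0 : ∀ {n : ℕ}, SetFormula n → Prop
  | mem {n : ℕ} (i j : Fin n) : IsDelta0 (.mem i j)
  | eq {n : ℕ} (i j : Fin n) : IsDelta0 (.eq i j)
  | fal {n : ℕ} : IsDelta0 (n := n) .fal
  | imp {n : ℕ} {φ ψ : SetFormula n} : IsDelta0 φ → IsDelta0 ψ → IsDelta0 (φ.imp ψ)
  | ball {n : ℕ} (j : Fin n) {φ : SetFormula (n + 1)} :
      IsDelta0 φ → IsDelta0 (.all ((SetFormula.mem (Fin.last n) j.castSucc).imp φ))
  | bex {n : ℕ} (j : Fin n) {φ : SetFormula (n + 1)} :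
      IsDelta0 φ → IsDelta0 (SetFormula.ex ((SetFormula.mem (Fin.last n) j.castSucc).and φ))

mutual
  /-- `Σₙ`-formulas of the Lévy hierarchy. -/
  inductive IsSigma : ℕ → ∀ {n : ℕ}, SetFormula n → Prop
    | ofDelta0 {k n : ℕ} {φ : SetFormula n} : IsDelta0 φ → IsSigma k φ
    | ofPi {k n : ℕ} {φ : SetFormula n} : IsPi k φ → IsSigma (k + 1) φ
    | ex {k n : ℕ} {φ : SetFormula (n + 1)} : IsSigma (k + 1) φ → IsSigma (k + 1) φ.ex
  /-- `Πₙ`-formulas of the Lévy hierarchy. -/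
  inductive IsPi : ℕ → ∀ {n : ℕ}, SetFormula n → Prop
    | ofDelta0 {k n : ℕ} {φ : SetFormula n} : IsDelta0 φ → IsPi k φ
    | ofSigma {k n : ℕ} {φ : SetFormula n} : IsSigma k φ → IsPi (k + 1) φ
    | all {k n : ℕ} {φ : SetFormula (n + 1)} : IsPi (k + 1) φ → IsPi (k + 1) φ.all
end

end Paper
namespace Paper

section Generic

variable {M : Type*} (E : M → M → Prop)

/-- `x` is a transitive set (relative to the membership relation `E`). -/
def TransE (x : M) : Prop := ∀ y, E y x → ∀ z, E z y → E z x

/-- `x` is an ordinal: a transitive set all of whose elements are transitive. -/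
def OrdE (x : M) : Prop := TransE E x ∧ ∀ y, E y x → TransE E y

/-- `a ⊆ b`. -/
def SubE (a b : M) : Prop := ∀ z, E z a → E z b

/-- `a ≤ b` for ordinals. -/
def LeE (a b : M) : Prop := E a b ∨ a = b

/-- `x` is the empty set. -/
def EmptyE (x : M) : Prop := ∀ z, ¬ E z x

/-- `s = y ∪ {y}`. -/
def SuccSpecE (s y : M) : Prop := ∀ z, E z s ↔ (E z y ∨ z = y)

/-- `l` is a (nonzero) limit ordinal. -/
def LimitE (l : M) : Prop := OrdE E l ∧ (∃ w, E w l) ∧ ∀ α, E α l → ∃ β, E β l ∧ E α β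

/-- `w` is the first infinite ordinal `ω`. -/
def OmegaSpecE (w : M) : Prop := LimitE E w ∧ ∀ x, E x w → ¬ LimitE E x

/-- `x` is an infinite ordinal, i.e. an ordinal with `ω ≤ x`. -/
def InfiniteOrdE (x : M) : Prop := OrdE E x ∧ ∃ w, OmegaSpecE E w ∧ LeE E w x

/-- `p = {a, b}`. -/
def UPairE (p a b : M) : Prop := ∀ z, E z p ↔ (z = a ∨ z = b)

/-- `p` is the Kuratowski ordered pair `⟨a, b⟩`. -/
def OPairE (p a b : M) : Prop :=
  ∃ s t, UPairE E s a a ∧ UPairE E t a b ∧ UPairE E p s t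

/-- The ordered pair `⟨x, y⟩` is an element of `f`. -/
def PairMemE (f x y : M) : Prop := ∃ p, E p f ∧ OPairE E p x y

/-- `f` is (the graph of) a function from `a` to `b`. -/
def IsFuncE (f a b : M) : Prop :=
  (∀ p, E p f → ∃ x y, E x a ∧ E y b ∧ OPairE E p x y) ∧
    ∀ x, E x a → (∃ y, PairMemE E f x y) ∧
      ∀ y y', PairMemE E f x y → PairMemE E f x y' → y = y'

/-- `f` is a surjection from `a` onto `b`. -/
def SurjE (f a b : M) : Prop :=
  IsFuncE E f a b ∧ ∀ y, E y b → ∃ x, E x a ∧ PairMemE E f x y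

/-- `f` is an injection from `a` into `b`. -/
def InjE (f a b : M) : Prop :=
  IsFuncE E f a b ∧ ∀ x x' y, E x a → E x' a →
    PairMemE E f x y → PairMemE E f x' y → x = x'

/-- `f` is a bijection between `a` and `b`. -/
def BijE (f a b : M) : Prop := SurjE E f a b ∧ InjE E f a b

/-- `κ` is a cardinal: an ordinal not in bijection with any of its elements. -/
def CardE (κ : M) : Prop := OrdE E κ ∧ ∀ α, E α κ → ¬ ∃ f, BijE E f α κ

/-- `κ` is an infinite cardinal. -/
def InfCardE (κ : M) : Prop := CardE E κ ∧ InfiniteOrdE E κ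

/-- `b = a ∩ c`. -/
def InterSpecE (b a c : M) : Prop := ∀ z, E z b ↔ (E z a ∧ E z c)

/-- `c` is unbounded in the ordinal `κ`. -/
def UnboundedInE (c κ : M) : Prop := ∀ α, E α κ → ∃ β, E β c ∧ E α β

/-- `c` is closed in the ordinal `κ`: it contains each of its limit points below `κ`. -/
def ClosedInE (c κ : M) : Prop :=
  ∀ l, E l κ → (∃ w, E w l) → (∀ α, E α l → ∃ β, E β c ∧ E α β ∧ E β l) → E l c

/-- `c` is a closed unbounded subset of the ordinal `κ`. -/
def ClubInE (c κ : M) : Prop := SubE E c κ ∧ UnboundedInE E c κ ∧ ClosedInE E c κ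

/-- `f` is (the graph of) a sequence `⟨A_α | α < κ⟩` with `A_α ⊆ α` for all `α < κ`. -/
def SeqSpecE (f κ : M) : Prop :=
  ∀ α, E α κ → (∃ A, PairMemE E f α A ∧ SubE E A α) ∧
    ∀ A A', PairMemE E f α A → PairMemE E f α A' → A = A'

/-- `κ` is a subtle cardinal. -/
def SubtleE (κ : M) : Prop :=
  InfCardE E κ ∧ ∀ f, SeqSpecE E f κ → ∀ c, ClubInE E c κ →
    ∃ α β, E α c ∧ E β c ∧ E α β ∧
      ∃ A B, PairMemE E f α A ∧ PairMemE E f β B ∧ InterSpecE E A B α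

/-- `κ` is a regular ordinal: every function from an element of `κ` to `κ` has
bounded range. -/
def RegularE (κ : M) : Prop :=
  OrdE E κ ∧ ∀ γ f, E γ κ → IsFuncE E f γ κ →
    ∃ β, E β κ ∧ ∀ x y, PairMemE E f x y → E y β

/-- `p = 𝒫(a)`. -/
def PowSpecE (p a : M) : Prop := ∀ z, E z p ↔ SubE E z a

/-- `κ` is a strong limit cardinal: for every `α < κ`, `2^|α| < κ`. -/
def StrongLimitE (κ : M) : Prop :=
  ∀ α, E α κ → ∀ p, PowSpecE E p α → ∃ β f, E β κ ∧ InjE E f p β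

/-- `κ` is a strongly inaccessible cardinal: an uncountable regular strong limit
cardinal. -/
def InaccE (κ : M) : Prop :=
  CardE E κ ∧ (∃ w, OmegaSpecE E w ∧ E w κ) ∧ RegularE E κ ∧ StrongLimitE E κ

/-- `z` belongs to the transitive closure of `x`. -/
def TCMemE (z x : M) : Prop := ∀ t, TransE E t → SubE E x t → E z t

/-- `x ∈ H(θ)`: the transitive closure of `x` has cardinality less than `θ`. -/
def HMemE (x θ : M) : Prop :=
  ∃ t, TransE E t ∧ SubE E x t ∧ ∃ β f, E β θ ∧ SurjE E f β t

/-- `f` is (the graph of) the cumulative-hierarchy sequence `⟨V_β | β < α⟩`,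
determined by the recursion `V_β = {z | ∃ γ < β, z ⊆ V_γ}`. -/
def VHierE (f α : M) : Prop :=
  OrdE E α ∧ ∀ β, E β α →
    (∃ w, PairMemE E f β w ∧
      ∀ z, E z w ↔ ∃ γ, E γ β ∧ ∃ u, PairMemE E f γ u ∧ SubE E z u) ∧
    ∀ w w', PairMemE E f β w → PairMemE E f β w' → w = w'

/-- `x ∈ V_α`. -/
def VMemE (x α : M) : Prop :=
  OrdE E α ∧ ∃ f, VHierE E f α ∧ ∃ β u, E β α ∧ PairMemE E f β u ∧ SubE E x u

/-- The class `S` is a `Σₙ`-elementary subclass of the class `T`. -/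
def SigmaElemPairE (n : ℕ) (S T : M → Prop) : Prop :=
  (∀ x, S x → T x) ∧
    ∀ ⦃k : ℕ⦄ (φ : SetFormula k), IsSigma n φ → ∀ v : Fin k → M, (∀ i, S (v i)) →
      (RealizeIn E S φ v ↔ RealizeIn E T φ v)

/-- The class `S` is a (fully) elementary subclass of the class `T`. -/
def ElemPairE (S T : M → Prop) : Prop :=
  (∀ x, S x → T x) ∧
    ∀ ⦃k : ℕ⦄ (φ : SetFormula k) (v : Fin k → M), (∀ i, S (v i)) →
      (RealizeIn E S φ v ↔ RealizeIn E T φ v)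

/-- `j` is an elementary map from the class `S` into the class `T`. -/
def ElemMapE (S T : M → Prop) (j : M → M) : Prop :=
  (∀ x, S x → T (j x)) ∧
    ∀ ⦃k : ℕ⦄ (φ : SetFormula k) (v : Fin k → M), (∀ i, S (v i)) →
      (RealizeIn E S φ v ↔ RealizeIn E T φ fun i => j (v i))

/-- `α ∈ C⁽ⁿ⁾`: the ordinal `α` is `Σₙ`-correct, i.e. `V_α` is a `Σₙ`-elementary
submodel of the universe. -/
def CnE (n : ℕ) (α : M) : Prop :=
  OrdE E α ∧ SigmaElemPairE E n (fun x => VMemE E x α) fun _ => True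

/-- `κ` is a weakly shrewd cardinal. -/
def WeaklyShrewdE (κ : M) : Prop :=
  CardE E κ ∧ ∀ (φ : SetFormula 2) (θ z : M), CardE E θ → E κ θ → SubE E z κ →
    RealizeIn E (fun x => HMemE E x θ) φ ![z, κ] →
    ∃ κ' θ' z', CardE E κ' ∧ CardE E θ' ∧ E κ' θ' ∧ E κ' κ ∧
      InterSpecE E z' z κ' ∧ RealizeIn E (fun x => HMemE E x θ') φ ![z', κ']

/-- `κ` is a `C⁽ⁿ⁾`-weakly shrewd cardinal. -/
def CnWeaklyShrewdE (n : ℕ) (κ : M) : Prop :=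
  CardE E κ ∧ ∀ (φ : SetFormula 2) (θ z : M), CardE E θ → CnE E n θ → E κ θ →
    SubE E z κ → RealizeIn E (fun x => HMemE E x θ) φ ![z, κ] →
    ∃ κ' θ' z', CardE E κ' ∧ CardE E θ' ∧ CnE E n θ' ∧ E κ' θ' ∧ E κ' κ ∧
      InterSpecE E z' z κ' ∧ RealizeIn E (fun x => HMemE E x θ') φ ![z', κ']

/-- Axiom of extensionality for `(M, E)`. -/
def AxExtE : Prop := ∀ x y : M, (∀ z, E z x ↔ E z y) → x = y

/-- Axiom of pairing for `(M, E)`. -/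
def AxPairE : Prop := ∀ a b : M, ∃ p, UPairE E p a b

/-- Axiom of union for `(M, E)`. -/
def AxUnionE : Prop := ∀ a : M, ∃ u, ∀ z, E z u ↔ ∃ y, E y a ∧ E z y

/-- Axiom of power set for `(M, E)`. -/
def AxPowE : Prop := ∀ a : M, ∃ p, PowSpecE E p a

/-- Axiom of infinity for `(M, E)`. -/
def AxInfE : Prop :=
  ∃ I : M, (∃ e, E e I ∧ EmptyE E e) ∧ ∀ y, E y I → ∃ s, E s I ∧ SuccSpecE E s y

/-- Axiom of foundation for `(M, E)`. -/
def AxFoundE : Prop :=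
  ∀ a : M, (∃ z, E z a) → ∃ m, E m a ∧ ∀ z, E z a → ¬ E z m

/-- Separation scheme for `(M, E)`. -/
def AxSepE : Prop :=
  ∀ (k : ℕ) (φ : SetFormula (k + 1)) (p : Fin k → M) (a : M),
    ∃ s : M, ∀ z, E z s ↔ (E z a ∧ Realize E φ (Fin.cons z p))

/-- Replacement scheme for `(M, E)`. -/
def AxReplE : Prop :=
  ∀ (k : ℕ) (φ : SetFormula (k + 2)) (p : Fin k → M) (a : M),
    (∀ x, E x a → ∀ y y', Realize E φ (Fin.cons x (Fin.cons y p)) →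
      Realize E φ (Fin.cons x (Fin.cons y' p)) → y = y') →
    ∃ b : M, ∀ y, E y b ↔ ∃ x, E x a ∧ Realize E φ (Fin.cons x (Fin.cons y p))

/-- Axiom of choice for `(M, E)`. -/
def AxChoiceE : Prop :=
  ∀ a : M, (∀ x, E x a → ∃ z, E z x) →
    (∀ x y, E x a → E y a → x ≠ y → ¬ ∃ z, E z x ∧ E z y) →
    ∃ c, ∀ x, E x a → ∃ z, E z c ∧ E z x ∧ ∀ z', E z' c → E z' x → z' = z

/-- `(M, E)` is a model of `ZF⁻` (Zermelo–Fraenkel set theory without the power set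
axiom). -/
def IsZFMinusE : Prop :=
  AxExtE E ∧ AxPairE E ∧ AxUnionE E ∧ AxInfE E ∧ AxFoundE E ∧ AxSepE E ∧ AxReplE E

/-- `(M, E)` is a model of `ZFC`. -/
def IsZFCE : Prop :=
  Nonempty M ∧ IsZFMinusE E ∧ AxPowE E ∧ AxChoiceE E

/-- The set `m` is, with the induced membership relation, a transitive model
of `ZF⁻`. -/
def ZFMinusModelE (m : M) : Prop :=
  IsZFMinusE fun a b : {x : M // E x m} => E a.1 b.1

/-- `x` has cardinality `κ`. -/
def CardEqE (x κ : M) : Prop := ∃ f, BijE E f κ x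

/-- `m` is closed under sequences of length less than `κ`: `^{<κ}m ⊆ m`. -/
def SmallSeqClosedE (m κ : M) : Prop := ∀ γ f, E γ κ → IsFuncE E f γ m → E f m

/-- `κ` is a `C⁽ⁿ⁾`-strongly unfoldable cardinal. -/
def CnStronglyUnfoldableE (n : ℕ) (κ : M) : Prop :=
  InaccE E κ ∧ ∀ lam, CnE E n lam → E κ lam →
    ∀ m, TransE E m → ZFMinusModelE E m → CardEqE E m κ → E κ m →
      SmallSeqClosedE E m κ →
      ∃ N j κ', TransE E N ∧ (∀ x, VMemE E x lam → E x N) ∧ IsFuncE E j m N ∧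
        (∀ ⦃k : ℕ⦄ (φ : SetFormula k) (v w : Fin k → M), (∀ i, E (v i) m) →
          (∀ i, PairMemE E j (v i) (w i)) →
          (RealizeIn E (fun x => E x m) φ v ↔ RealizeIn E (fun x => E x N) φ w)) ∧
        (∀ α, E α κ → PairMemE E j α α) ∧ PairMemE E j κ κ' ∧ E lam κ' ∧
        SigmaElemPairE E n (fun x => VMemE E x lam) fun x => E x N ∧ VMemE E x κ'

/-- `x` is ordinal definable. -/
def IsODE (x : M) : Prop :=
  ∃ (k : ℕ) (φ : SetFormula (k + 1)) (p : Fin k → M), (∀ i, OrdE E (p i)) ∧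
    Realize E φ (Fin.cons x p) ∧ ∀ y, Realize E φ (Fin.cons y p) → y = x

/-- `x` is hereditarily ordinal definable, i.e. `x ∈ HOD`. -/
def IsHODE (x : M) : Prop := IsODE E x ∧ ∀ z, TCMemE E z x → IsODE E z

/-- The instance of the principle "`Ord` is essentially faint" for the class
sequence `⟨{A | Efam α A} | α ∈ Ord⟩`. -/
def FaintForE (Efam : M → M → Prop) : Prop :=
  (∀ α, OrdE E α → (∃ A, Efam α A) ∧ ∀ A, Efam α A → SubE E A α) →
    ∀ ξ, OrdE E ξ → ∃ α β A B, OrdE E α ∧ OrdE E β ∧ E ξ α ∧ E α β ∧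
      Efam β A ∧ InterSpecE E B A α ∧ Efam α B

/-- `C` is a closed unbounded class of ordinals. -/
def ClubClassE (C : M → Prop) : Prop :=
  (∀ x, C x → OrdE E x) ∧ (∀ α, OrdE E α → ∃ β, C β ∧ E α β) ∧
    ∀ l, OrdE E l → (∃ w, E w l) → (∀ α, E α l → ∃ β, C β ∧ E α β ∧ E β l) → C l

/-- The instance of the principle "`Ord` is essentially subtle" for the class
sequence `⟨{A | Efam α A} | α ∈ Ord⟩` and the class `C`. -/
def SubtleForE (Efam : M → M → Prop) (C : M → Prop) : Prop :=
  (∀ α, OrdE E α → (∃ A, Efam α A) ∧ ∀ A, Efam α A → SubE E A α) →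
    ClubClassE E C →
    ∃ α β A B, C α ∧ C β ∧ E α β ∧ Efam β A ∧ InterSpecE E B A α ∧ Efam α B

/-- The scheme "`Ord` is essentially faint" holds in `(M, E)`: every instance for a
definable (with parameters) class sequence holds. -/
def OrdFaintDefE : Prop :=
  ∀ (k : ℕ) (φ : SetFormula (k + 2)) (p : Fin k → M),
    FaintForE E fun α A => Realize E φ (Fin.cons α (Fin.cons A p))

/-- The scheme "`Ord` is essentially subtle" holds in `(M, E)`: every instance for
definable (with parameters) class sequences and club classes holds. -/
def OrdSubtleDefE : Prop :=
  ∀ (k k' : ℕ) (φ : SetFormula (k + 2)) (p : Fin k → M)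
    (ψ : SetFormula (k' + 1)) (q : Fin k' → M),
    SubtleForE E (fun α A => Realize E φ (Fin.cons α (Fin.cons A p)))
      fun x => Realize E ψ (Fin.cons x q)

/-- There is a proper class of subtle cardinals in `(M, E)`. -/
def ProperClassSubtleE : Prop := ∀ α, OrdE E α → ∃ κ, SubtleE E κ ∧ E α κ

/-- There are no strongly inaccessible cardinals in `(M, E)`. -/
def NoInaccE : Prop := ∀ κ, ¬ InaccE E κ

end Generic

end Paper

set_option linter.all false
set_option linter.unusedSectionVars false
set_option linter.unusedVariables false
set_option linter.unusedTactic false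
set_option linter.unusedSimpArgs false
namespace Paper

/-! ## Renaming of formulas -/

theorem snoc_comp_lift {M : Type} {n m : ℕ} (σ : Fin n → Fin m) (v : Fin m → M) (a : M) :
    (Fin.snoc v a : Fin (m+1) → M) ∘ (Fin.snoc (fun i => (σ i).castSucc) (Fin.last m) :
      Fin (n+1) → Fin (m+1)) = Fin.snoc (v ∘ σ) a := by
  funext i
  refine Fin.lastCases ?_ (fun i => ?_) i <;> simp

def SetFormula.ren : ∀ {n m : ℕ}, (Fin n → Fin m) → SetFormula n → SetFormula m
  | _, _, σ, .mem i j => .mem (σ i) (σ j)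
  | _, _, σ, .eq i j => .eq (σ i) (σ j)
  | _, _, _, .fal => .fal
  | _, _, σ, .imp φ ψ => .imp (φ.ren σ) (ψ.ren σ)
  | _, m, σ, .all φ => .all (φ.ren (Fin.snoc (fun i => (σ i).castSucc) (Fin.last m)))

theorem realize_ren {M : Type} (E : M → M → Prop) {n : ℕ} (φ : SetFormula n) :
    ∀ {m : ℕ} (σ : Fin n → Fin m) (v : Fin m → M),
      Realize E (φ.ren σ) v ↔ Realize E φ (v ∘ σ) := by
  induction φ with
  | mem i j => intros; rfl
  | eq i j => intros; rfl
  | fal => intros; rfl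
  | imp φ ψ h1 h2 => intro m σ v; simp only [SetFormula.ren, Realize, h1, h2]
  | all φ h => intro m σ v; simp only [SetFormula.ren, Realize, h, snoc_comp_lift]

section
variable {M : Type} (E : M → M → Prop) {n : ℕ}
@[simp] theorem realize_not (φ : SetFormula n) (v : Fin n → M) :
    Realize E φ.not v ↔ ¬ Realize E φ v := Iff.rfl
@[simp] theorem realize_and (φ ψ : SetFormula n) (v : Fin n → M) :
    Realize E (φ.and ψ) v ↔ (Realize E φ v ∧ Realize E ψ v) := by
  simp only [SetFormula.and, SetFormula.not, Realize]; tauto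
@[simp] theorem realize_ex (φ : SetFormula (n+1)) (v : Fin n → M) :
    Realize E φ.ex v ↔ ∃ a, Realize E φ (Fin.snoc v a) := by
  simp [SetFormula.ex, SetFormula.not, Realize]
@[simp] theorem realize_imp (φ ψ : SetFormula n) (v : Fin n → M) :
    Realize E (φ.imp ψ) v ↔ (Realize E φ v → Realize E ψ v) := Iff.rfl
@[simp] theorem realize_all (φ : SetFormula (n+1)) (v : Fin n → M) :
    Realize E φ.all v ↔ ∀ a, Realize E φ (Fin.snoc v a) := Iff.rfl
@[simp] theorem realize_mem (i j : Fin n) (v : Fin n → M) :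
    Realize E (.mem i j) v ↔ E (v i) (v j) := Iff.rfl
@[simp] theorem realize_eq (i j : Fin n) (v : Fin n → M) :
    Realize E (.eq i j) v ↔ v i = v j := Iff.rfl
@[simp] theorem realize_fal (v : Fin n → M) :
    Realize E .fal v ↔ False := Iff.rfl
end

theorem ren_not {n m : ℕ} (σ : Fin n → Fin m) (φ : SetFormula n) :
    φ.not.ren σ = (φ.ren σ).not := rfl
theorem ren_and {n m : ℕ} (σ : Fin n → Fin m) (φ ψ : SetFormula n) :
    (φ.and ψ).ren σ = (φ.ren σ).and (ψ.ren σ) := rfl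

theorem IsDelta0.ren {n : ℕ} {φ : SetFormula n} (h : IsDelta0 φ) :
    ∀ {m : ℕ} (σ : Fin n → Fin m), IsDelta0 (φ.ren σ) := by
  induction h with
  | mem i j => intros; exact .mem _ _
  | eq i j => intros; exact .eq _ _
  | fal => intros; exact .fal
  | imp _ _ h1 h2 => intro m σ; exact .imp (h1 σ) (h2 σ)
  | ball j _ h =>
    intro m σ
    have := IsDelta0.ball (σ j) (h (Fin.snoc (fun i => (σ i).castSucc) (Fin.last m)))
    simpa [SetFormula.ren] using this
  | bex j _ h =>
    intro m σ
    have := IsDelta0.bex (σ j) (h (Fin.snoc (fun i => (σ i).castSucc) (Fin.last m)))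
    simpa [SetFormula.ren, SetFormula.ex, SetFormula.and, SetFormula.not] using this

/-! ## Models of ZFC and definability calculi -/

class ZFM (M : Type) where
  E : M → M → Prop
  zfc : IsZFCE E

instance instMemZFM {M : Type} [ZFM M] : Membership M M := ⟨fun y x => ZFM.E x y⟩

theorem mem_def {M : Type} [ZFM M] {x y : M} : ZFM.E x y ↔ x ∈ y := Iff.rfl

/-- contexts: finite tuples of elements of `M` -/
class Ctx (M : outParam Type) (G : Type) where
  k : ℕ
  get : G → Fin k → M

instance ctxM {M : Type} [ZFM M] : Ctx M M := ⟨1, fun x _ => x⟩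
instance ctxProd {M A B : Type} [ZFM M] [Ctx M A] [Ctx M B] : Ctx M (A × B) :=
  ⟨Ctx.k A + Ctx.k B, fun q => Fin.append (Ctx.get q.1) (Ctx.get q.2)⟩

/-- definability with parameters from `A` -/
def AnyQ {M : Type} [ZFM M] (A : M → Prop) {k : ℕ} (P : (Fin k → M) → Prop) : Prop :=
  ∃ (m : ℕ) (p : Fin m → M) (φ : SetFormula (m + k)), (∀ i, A (p i)) ∧
    ∀ v, P v ↔ Realize ZFM.E φ (Fin.append p v)

structure Calc (M : Type) [ZFM M] where
  Q : ∀ {k : ℕ}, ((Fin k → M) → Prop) → Prop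
  le : ∀ {k : ℕ} {P : (Fin k → M) → Prop}, Q P → AnyQ (fun _ => True) P
  mem : Q (fun v : Fin 2 → M => v 0 ∈ v 1)
  nmem : Q (fun v : Fin 2 → M => ¬ v 0 ∈ v 1)
  eq : Q (fun v : Fin 2 → M => v 0 = v 1)
  neq : Q (fun v : Fin 2 → M => ¬ v 0 = v 1)
  tt : Q (fun _ : Fin 0 → M => True)
  ff : Q (fun _ : Fin 0 → M => False)
  and : ∀ {k : ℕ} {P R : (Fin k → M) → Prop}, Q P → Q R → Q (fun v => P v ∧ R v)
  or : ∀ {k : ℕ} {P R : (Fin k → M) → Prop}, Q P → Q R → Q (fun v => P v ∨ R v)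
  ex : ∀ {k : ℕ} {P : (Fin (k+1) → M) → Prop}, Q P → Q (fun v => ∃ y, P (Fin.snoc v y))
  ball : ∀ {k : ℕ} {P : (Fin (k+1) → M) → Prop} (j : Fin k), Q P →
    Q (fun v => ∀ y, y ∈ v j → P (Fin.snoc v y))
  re : ∀ {k l : ℕ} {P : (Fin k → M) → Prop} (σ : Fin k → Fin l), Q P → Q (fun v => P (v ∘ σ))

class Calc.Full {M : Type} [ZFM M] (c : Calc M) : Prop where
  neg : ∀ {k : ℕ} {P : (Fin k → M) → Prop}, c.Q P → c.Q (fun v => ¬ P v)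

section AnyCalc
variable {M : Type} [ZFM M] {A : M → Prop}

theorem append_snoc' {m k : ℕ} (p : Fin m → M) (v : Fin k → M) (y : M) :
    (Fin.append p (Fin.snoc v y : Fin (k+1) → M) : Fin (m + (k + 1)) → M) =
      (Fin.snoc (Fin.append p v) y : Fin (m + k + 1) → M) := by
  funext i
  refine Fin.addCases (fun i => ?_) (fun i => ?_) i
  · rw [Fin.append_left]
    have : (Fin.castAdd (k+1) i : Fin (m + k + 1)) = (Fin.castAdd k i).castSucc := rfl
    erw [this, Fin.snoc_castSucc, Fin.append_left]
  · rw [Fin.append_right]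
    refine Fin.lastCases ?_ (fun i => ?_) i
    · have : (Fin.natAdd m (Fin.last k) : Fin (m + k + 1)) = Fin.last _ := rfl
      rw [this]; simp
    · have : (Fin.natAdd m i.castSucc : Fin (m + k + 1)) = (Fin.natAdd m i).castSucc := rfl
      rw [this, Fin.snoc_castSucc]; erw [Fin.snoc_castSucc]; rw [Fin.append_right]

theorem AnyQ.congr {k : ℕ} {P R : (Fin k → M) → Prop} (h : AnyQ A P) (e : ∀ v, R v ↔ P v) :
    AnyQ A R := by
  have : R = P := funext fun v => propext (e v)
  rwa [this]

theorem AnyQ.form {k : ℕ} (φ : SetFormula k) : AnyQ A (fun v : Fin k → M => Realize ZFM.E φ v) := by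
  refine ⟨0, Fin.elim0, φ.ren (Fin.natAdd 0), fun i => i.elim0, fun v => ?_⟩
  rw [realize_ren]
  have : (Fin.append Fin.elim0 v : Fin (0 + k) → M) ∘ Fin.natAdd 0 = v := by
    funext i; simp
  rw [this]

theorem AnyQ.re {k l : ℕ} {P : (Fin k → M) → Prop} (σ : Fin k → Fin l) (h : AnyQ A P) :
    AnyQ A (fun v => P (v ∘ σ)) := by
  obtain ⟨m, p, φ, hp, h⟩ := h
  refine ⟨m, p, φ.ren (Fin.addCases (fun i => Fin.castAdd l i) fun i => Fin.natAdd m (σ i)), hp,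
    fun v => ?_⟩
  rw [realize_ren]; beta_reduce; rw [h]
  have : Fin.append p (v ∘ σ) = Fin.append p v ∘
      (Fin.addCases (fun i => Fin.castAdd l i) fun i => Fin.natAdd m (σ i)) := by
    funext i
    refine Fin.addCases (fun i => ?_) (fun i => ?_) i <;> simp
  rw [this]

theorem AnyQ.neg {k : ℕ} {P : (Fin k → M) → Prop} (h : AnyQ A P) : AnyQ A (fun v => ¬ P v) := by
  obtain ⟨m, p, φ, hp, h⟩ := h
  exact ⟨m, p, φ.not, hp, fun v => by simp [h]⟩

theorem AnyQ.and {k : ℕ} {P R : (Fin k → M) → Prop} (h : AnyQ A P) (h' : AnyQ A R) :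
    AnyQ A (fun v => P v ∧ R v) := by
  obtain ⟨m, p, φ, hp, h⟩ := h
  obtain ⟨m', p', φ', hp', h'⟩ := h'
  refine ⟨m + m', Fin.append p p',
    (φ.ren (Fin.addCases (fun i => Fin.castAdd k (Fin.castAdd m' i))
      fun i => Fin.natAdd (m+m') i)).and
    (φ'.ren (Fin.addCases (fun i => Fin.castAdd k (Fin.natAdd m i))
      fun i => Fin.natAdd (m+m') i)), ?_, fun v => ?_⟩
  · intro i
    refine Fin.addCases (fun i => ?_) (fun i => ?_) i <;> simp [hp, hp']
  · rw [realize_and, realize_ren, realize_ren]; beta_reduce; rw [h, h']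
    have e1 : Fin.append p v = Fin.append (Fin.append p p') v ∘
      (Fin.addCases (fun i => Fin.castAdd k (Fin.castAdd m' i)) fun i => Fin.natAdd (m+m') i) := by
      funext i
      refine Fin.addCases (fun i => ?_) (fun i => ?_) i <;> simp
    have e2 : Fin.append p' v = Fin.append (Fin.append p p') v ∘
      (Fin.addCases (fun i => Fin.castAdd k (Fin.natAdd m i)) fun i => Fin.natAdd (m+m') i) := by
      funext i
      refine Fin.addCases (fun i => ?_) (fun i => ?_) i <;> simp
    rw [← e1, ← e2]

theorem AnyQ.ex {k : ℕ} {P : (Fin (k+1) → M) → Prop} (h : AnyQ A P) :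
    AnyQ A (fun v => ∃ y, P (Fin.snoc v y)) := by
  obtain ⟨m, p, φ, hp, h⟩ := h
  refine ⟨m, p, SetFormula.ex (n := m + k) φ, hp, fun v => ?_⟩
  rw [realize_ex]
  exact exists_congr fun y => by rw [h, ← append_snoc']

theorem AnyQ.mono {A B : M → Prop} (hAB : ∀ x, A x → B x) {k : ℕ} {P : (Fin k → M) → Prop}
    (h : AnyQ A P) : AnyQ B P := by
  obtain ⟨m, p, φ, hp, h⟩ := h
  exact ⟨m, p, φ, fun i => hAB _ (hp i), h⟩

theorem AnyQ.par {a : M} (h : A a) : AnyQ A (fun v : Fin 1 → M => v 0 = a) := by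
  refine ⟨1, fun _ => a, .eq 1 0, fun _ => h, fun v => ?_⟩
  simp only [realize_eq]
  have e1 : Fin.append (fun _ : Fin 1 => a) v 1 = v 0 := Fin.append_right (fun _ : Fin 1 => a) v 0
  have e2 : Fin.append (fun _ : Fin 1 => a) v 0 = a := Fin.append_left (fun _ : Fin 1 => a) v 0
  rw [e1, e2]

def any (A : M → Prop) : Calc M where
  Q := AnyQ A
  le := fun h => h.mono fun _ _ => trivial
  mem := (AnyQ.form (.mem 0 1)).congr fun v => by simp [mem_def]
  nmem := (AnyQ.form (SetFormula.mem 0 1).not).congr fun v => by simp [mem_def]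
  eq := (AnyQ.form (.eq 0 1)).congr fun v => by simp
  neq := (AnyQ.form (SetFormula.eq 0 1).not).congr fun v => by simp
  tt := (AnyQ.form SetFormula.fal.not).congr fun v => by simp
  ff := AnyQ.form .fal
  and := AnyQ.and
  or := fun h h' => (h.neg.and h'.neg).neg.congr fun v => by tauto
  ex := AnyQ.ex
  ball := fun {k P} j h => by
    have h1 : AnyQ A (fun v : Fin (k+1) → M => v (Fin.last k) ∈ v j.castSucc) :=
      (AnyQ.form (.mem (Fin.last k) j.castSucc)).congr fun v => by simp [mem_def]
    refine ((h1.and h.neg).ex).neg.congr fun v => ?_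
    simp
  re := AnyQ.re

instance fullAny : (any A).Full := ⟨AnyQ.neg⟩

end AnyCalc

/-! ## The fun_prop calculus -/
section DefCalc
variable {M : Type} [ZFM M] {G A B D : Type} [Ctx M G] [Ctx M A] [Ctx M B] [Ctx M D] {c : Calc M}

/-- semi-definable predicates -/
def SQ (c : Calc M) (P : G → Prop) : Prop :=
  ∃ R : (Fin (Ctx.k G) → M) → Prop, c.Q R ∧ ∀ g, P g ↔ R (Ctx.get g)

/-- (bi-)definable predicates -/
@[fun_prop] def DP (c : Calc M) (P : G → Prop) : Prop := SQ c P ∧ SQ c (fun g => ¬ P g)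

/-- definable functions -/
@[fun_prop] def DF (c : Calc M) (f : G → A) : Prop :=
  ∀ (D : Type) [Ctx M D] (P : D × A → Prop), SQ c P → SQ c (fun q : D × G => P (q.1, f q.2))

def Rearr (r : G → A) : Prop :=
  ∃ σ : Fin (Ctx.k A) → Fin (Ctx.k G), ∀ g, Ctx.get (r g) = Ctx.get g ∘ σ

theorem Rearr.fst : Rearr (fun q : A × B => q.1) :=
  ⟨Fin.castAdd _, fun g => by funext i; simp [Ctx.get]⟩
theorem Rearr.snd : Rearr (fun q : A × B => q.2) :=
  ⟨Fin.natAdd _, fun g => by funext i; simp [Ctx.get]⟩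
theorem Rearr.id : Rearr (fun q : A => q) := ⟨fun i => i, fun g => rfl⟩
theorem Rearr.comp {f : A → B} {r : G → A} (hf : Rearr f) (hr : Rearr r) :
    Rearr (fun g => f (r g)) := by
  obtain ⟨σ, h⟩ := hf; obtain ⟨τ, h'⟩ := hr
  exact ⟨τ ∘ σ, fun g => by rw [h, h']; rfl⟩
theorem Rearr.mk {r : G → A} {s : G → B} (hr : Rearr r) (hs : Rearr s) :
    Rearr (fun g => (r g, s g)) := by
  obtain ⟨σ, h⟩ := hr; obtain ⟨τ, h'⟩ := hs
  refine ⟨Fin.addCases σ τ, fun g => ?_⟩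
  funext i
  refine Fin.addCases (fun i => ?_) (fun i => ?_) i <;> simp [Ctx.get, h, h']

theorem SQ.re {P : A → Prop} (h : SQ c P) {r : G → A} (hr : Rearr r) : SQ c (fun g => P (r g)) := by
  obtain ⟨R, h1, h2⟩ := h; obtain ⟨σ, h⟩ := hr
  exact ⟨fun v => R (v ∘ σ), c.re σ h1, fun g => by beta_reduce; rw [h2, h]⟩

theorem DF.rearr {r : G → A} (hr : Rearr r) : DF c r := fun D _ _ hP =>
  hP.re (Rearr.mk Rearr.fst (hr.comp Rearr.snd))

theorem SQ.congr {P R : G → Prop} (h : SQ c P) (e : ∀ v, R v ↔ P v) : SQ c R := by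
  have : R = P := funext fun v => propext (e v)
  rwa [this]
theorem DP.congr {P R : G → Prop} (h : DP c P) (e : ∀ v, R v ↔ P v) : DP c R := by
  have : R = P := funext fun v => propext (e v)
  rwa [this]

theorem SQ.comp {P : A → Prop} (h : SQ c P) {f : G → A} (hf : DF c f) :
    SQ c (fun g => P (f g)) := by
  have := hf G (fun q => P q.2) (h.re Rearr.snd)
  exact this.re (Rearr.mk Rearr.id Rearr.id)
theorem DP.comp {P : A → Prop} (h : DP c P) {f : G → A} (hf : DF c f) :
    DP c (fun g => P (f g)) := ⟨h.1.comp hf, h.2.comp hf⟩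

@[fun_prop] theorem DF.id : DF c (fun x : A => x) := DF.rearr Rearr.id
@[fun_prop] theorem DF.comp (f : A → B) (g : G → A) (hf : DF c f) (hg : DF c g) :
    DF c (fun x => f (g x)) := fun D _ P hP => hg D (fun q => P (q.1, f q.2)) (hf D P hP)
@[fun_prop] theorem DF.fst : DF c (fun x : A × B => x.1) := DF.rearr Rearr.fst
@[fun_prop] theorem DF.snd : DF c (fun x : A × B => x.2) := DF.rearr Rearr.snd
@[fun_prop] theorem DF.mk (f : G → A) (g : G → B) (hf : DF c f) (hg : DF c g) :
    DF c (fun x => (f x, g x)) := by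
  intro D _ P hP
  have h1 : SQ c (fun q : (D × A) × B => P (q.1.1, (q.1.2, q.2))) := hP.re
    (Rearr.mk (Rearr.fst.comp Rearr.fst) (Rearr.mk (Rearr.snd.comp Rearr.fst) Rearr.snd))
  have h2 := hg _ _ h1
  have h3 : SQ c (fun q : (D × G) × A => P (q.1.1, (q.2, g q.1.2))) :=
    h2.re (r := fun q : (D × G) × A => ((q.1.1, q.2), q.1.2))
    (Rearr.mk (Rearr.mk (Rearr.fst.comp Rearr.fst) Rearr.snd) (Rearr.snd.comp Rearr.fst))
  have h4 := hf _ _ h3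
  exact h4.re (r := fun q : D × G => (q, q.2)) (Rearr.mk Rearr.id Rearr.snd)

theorem SQ.and {P R : G → Prop} (h : SQ c P) (h' : SQ c R) : SQ c (fun g => P g ∧ R g) := by
  obtain ⟨R1, h1, h2⟩ := h; obtain ⟨R2, h3, h4⟩ := h'
  exact ⟨_, c.and h1 h3, fun g => by beta_reduce; rw [h2, h4]⟩
theorem SQ.or {P R : G → Prop} (h : SQ c P) (h' : SQ c R) : SQ c (fun g => P g ∨ R g) := by
  obtain ⟨R1, h1, h2⟩ := h; obtain ⟨R2, h3, h4⟩ := h'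
  exact ⟨_, c.or h1 h3, fun g => by beta_reduce; rw [h2, h4]⟩

theorem get_snoc (g : G) (y : M) : (Ctx.get (g, y) : Fin (Ctx.k G + 1) → M) =
    Fin.snoc (Ctx.get g) y := by
  simp only [Ctx.get]
  exact Fin.append_right_eq_snoc _ _

theorem SQ.ex {P : G → M → Prop} (h : SQ c (fun q : G × M => P q.1 q.2)) :
    SQ c (fun g => ∃ y, P g y) := by
  obtain ⟨R, h1, h2⟩ := h
  refine ⟨_, c.ex h1, fun g => exists_congr fun y => ?_⟩
  exact (h2 (g, y)).trans (by rw [← get_snoc])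

theorem SQ.ballvar {P : G → M → Prop} (h : SQ c (fun q : G × M => P q.1 q.2)) :
    SQ c (fun q : G × M => ∀ y, y ∈ q.2 → P q.1 y) := by
  have h' : SQ c (fun q : (G × M) × M => P q.1.1 q.2) :=
    SQ.re (P := fun q : G × M => P q.1 q.2) h (r := fun q : (G × M) × M => (q.1.1, q.2))
    (Rearr.mk (Rearr.fst.comp Rearr.fst) Rearr.snd)
  obtain ⟨R, h1, h2⟩ := h'
  refine ⟨_, c.ball (Fin.last (Ctx.k G)) h1, fun g => forall_congr' fun y => ?_⟩
  have e : Ctx.get g (Fin.last (Ctx.k G)) = g.2 := by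
    rw [show g = (g.1, g.2) from rfl, get_snoc]; simp
  rw [e]
  exact imp_congr_right fun _ => (h2 (g, y)).trans (by rw [← get_snoc])

theorem SQ.memvar : SQ c (fun q : M × M => q.1 ∈ q.2) :=
  ⟨_, c.mem, fun _ => Iff.rfl⟩
theorem SQ.nmemvar : SQ c (fun q : M × M => ¬ q.1 ∈ q.2) :=
  ⟨_, c.nmem, fun _ => Iff.rfl⟩
theorem SQ.eqvar : SQ c (fun q : M × M => q.1 = q.2) :=
  ⟨_, c.eq, fun _ => Iff.rfl⟩
theorem SQ.neqvar : SQ c (fun q : M × M => ¬ q.1 = q.2) :=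
  ⟨_, c.neq, fun _ => Iff.rfl⟩
theorem SQ.true : SQ c (fun _ : G => True) := ⟨_, c.re Fin.elim0 c.tt, fun _ => Iff.rfl⟩
theorem SQ.false : SQ c (fun _ : G => False) := ⟨_, c.re Fin.elim0 c.ff, fun _ => Iff.rfl⟩

def ball (a : M) (P : M → Prop) : Prop := ∀ y, y ∈ a → P y
def bex (a : M) (P : M → Prop) : Prop := ∃ y, y ∈ a ∧ P y

theorem SQ.ball {P : G → M → Prop} {f : G → M} (hf : DF c f)
    (h : SQ c (fun q : G × M => P q.1 q.2)) : SQ c (fun g => ball (f g) (P g)) :=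
  (h.ballvar).comp (f := fun g => (g, f g)) (DF.mk _ _ DF.id hf)
theorem SQ.bex {P : G → M → Prop} {f : G → M} (hf : DF c f)
    (h : SQ c (fun q : G × M => P q.1 q.2)) : SQ c (fun g => bex (f g) (P g)) :=
  SQ.ex ((SQ.memvar.comp (f := fun q : G × M => (q.2, f q.1))
    (DF.mk _ _ DF.snd (DF.comp _ _ hf DF.fst))).and h)

@[fun_prop] theorem DP.mem (f g : G → M) (hf : DF c f) (hg : DF c g) : DP c (fun x => f x ∈ g x) :=
  ⟨SQ.memvar.comp (DF.mk _ _ hf hg), SQ.nmemvar.comp (DF.mk _ _ hf hg)⟩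
@[fun_prop] theorem DP.eq (f g : G → M) (hf : DF c f) (hg : DF c g) : DP c (fun x => f x = g x) :=
  ⟨SQ.eqvar.comp (DF.mk _ _ hf hg), SQ.neqvar.comp (DF.mk _ _ hf hg)⟩
@[fun_prop] theorem DP.true : DP c (fun _ : G => True) :=
  ⟨SQ.true, SQ.false.congr fun _ => by simp⟩
@[fun_prop] theorem DP.false : DP c (fun _ : G => False) :=
  ⟨SQ.false, SQ.true.congr fun _ => by simp⟩
theorem DP.const (p : Prop) : DP c (fun _ : G => p) := by
  by_cases h : p
  · exact DP.true.congr fun _ => by simp [h]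
  · exact DP.false.congr fun _ => by simp [h]
@[fun_prop] theorem DP.and (P R : G → Prop) (h : DP c P) (h' : DP c R) :
    DP c (fun x => P x ∧ R x) :=
  ⟨h.1.and h'.1, (h.2.or h'.2).congr fun _ => by tauto⟩
@[fun_prop] theorem DP.or (P R : G → Prop) (h : DP c P) (h' : DP c R) :
    DP c (fun x => P x ∨ R x) :=
  ⟨h.1.or h'.1, (h.2.and h'.2).congr fun _ => by tauto⟩
@[fun_prop] theorem DP.not (P : G → Prop) (h : DP c P) : DP c (fun x => ¬ P x) :=
  ⟨h.2, h.1.congr fun _ => by tauto⟩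
@[fun_prop] theorem DP.imp (P R : G → Prop) (h : DP c P) (h' : DP c R) :
    DP c (fun x => P x → R x) :=
  ⟨(h.2.or h'.1).congr fun _ => by tauto, (h.1.and h'.2).congr fun _ => by tauto⟩
@[fun_prop] theorem DP.iff (P R : G → Prop) (h : DP c P) (h' : DP c R) :
    DP c (fun x => P x ↔ R x) :=
  (DP.and _ _ (DP.imp _ _ h h') (DP.imp _ _ h' h)).congr fun _ => iff_def
@[fun_prop] theorem DP.ball (f : G → M) (P : G → M → Prop) (hf : DF c f)
    (h : DP c (fun q : G × M => P q.1 q.2)) : DP c (fun x => ball (f x) (fun y => P x y)) :=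
  ⟨SQ.ball hf h.1, (SQ.bex (P := fun x y => ¬ P x y) hf h.2).congr fun _ => by simp [Paper.ball, Paper.bex]⟩
@[fun_prop] theorem DP.bex (f : G → M) (P : G → M → Prop) (hf : DF c f)
    (h : DP c (fun q : G × M => P q.1 q.2)) : DP c (fun x => bex (f x) (fun y => P x y)) :=
  ⟨SQ.bex hf h.1, (SQ.ball (P := fun x y => ¬ P x y) hf h.2).congr fun _ => by simp [Paper.ball, Paper.bex]⟩

theorem SQ.neg [c.Full] {P : G → Prop} (h : SQ c P) : SQ c (fun g => ¬ P g) := by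
  obtain ⟨R, h1, h2⟩ := h
  exact ⟨_, Calc.Full.neg h1, fun g => by beta_reduce; rw [h2]⟩
theorem SQ.dp [c.Full] {P : G → Prop} (h : SQ c P) : DP c P := ⟨h, h.neg⟩
@[fun_prop] theorem DP.ex [c.Full] (P : G → M → Prop) (h : DP c (fun q : G × M => P q.1 q.2)) :
    DP c (fun x => ∃ y, P x y) := (SQ.ex h.1).dp
@[fun_prop] theorem DP.all [c.Full] (P : G → M → Prop) (h : DP c (fun q : G × M => P q.1 q.2)) :
    DP c (fun x => ∀ y, P x y) :=
  (SQ.ex (P := fun x y => ¬ P x y) h.2).neg.dp.congr fun _ => by simp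

theorem DF.of_sq {f : G → M} (h : SQ c (fun q : G × M => q.2 = f q.1)) : DF c f := by
  intro D _ P hP
  have h1 : SQ c (fun q : (D × G) × M => q.2 = f q.1.2 ∧ P (q.1.1, q.2)) :=
    (h.re (r := fun q : (D × G) × M => (q.1.2, q.2))
      (Rearr.mk (Rearr.snd.comp Rearr.fst) Rearr.snd)).and
    (hP.re (r := fun q : (D × G) × M => (q.1.1, q.2))
      (Rearr.mk (Rearr.fst.comp Rearr.fst) Rearr.snd))
  refine (SQ.ex (P := fun (q : D × G) y => y = f q.2 ∧ P (q.1, y)) h1).congr fun q => ?_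
  simp
theorem DF.of_dp {f : G → M} (P : G → M → Prop) (h : DP c (fun q : G × M => P q.1 q.2))
    (e : ∀ g y, y = f g ↔ P g y) : DF c f :=
  DF.of_sq (h.1.congr fun q => e _ _)
theorem DF.graph {f : G → M} (h : DF c f) : DP c (fun q : G × M => q.2 = f q.1) :=
  DP.eq _ _ DF.snd (DF.comp _ _ h DF.fst)

theorem DF.par {A : M → Prop} {a : M} (h : A a) : DF (any A) (fun _ : G => a) := by
  refine DF.of_sq ?_
  have h1 : SQ (any A) (fun x : M => x = a) := ⟨_, AnyQ.par h, fun _ => Iff.rfl⟩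
  exact h1.re Rearr.snd
theorem DF.con (a : M) : DF (any fun _ : M => True) (fun _ : G => a) := DF.par trivial

/-- `DefF`, `DefP`: definability with arbitrary parameters -/
abbrev full : Calc M := any fun _ => True

theorem SQ.le {P : G → Prop} (h : SQ c P) : SQ full P := by
  obtain ⟨R, h1, h2⟩ := h; exact ⟨R, c.le h1, h2⟩
theorem DP.le {P : G → Prop} (h : DP c P) : DP full P := ⟨h.1.le, h.2.le⟩
theorem DF.le {f : G → M} (h : DF c f) : DF full f := DF.of_sq h.graph.1.le

theorem DF.ite (P : G → Prop) (f g : G → M) [∀ x, Decidable (P x)] (h : DP c P) (hf : DF c f) (hg : DF c g) :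
    DF c (fun x => if P x then f x else g x) :=
  DF.of_dp (fun x y => (P x ∧ y = f x) ∨ (¬ P x ∧ y = g x))
    (DP.or _ _ (DP.and _ _ (h.comp DF.fst) hf.graph) (DP.and _ _ (DP.not _ (h.comp DF.fst)) hg.graph))
    (fun x y => by by_cases hP : P x <;> simp [hP])
end DefCalc
attribute [fun_prop] DF.con DF.ite
end Paper
namespace Paper
section Basic
variable {M : Type} [ZFM M] {G : Type} [Ctx M G] {c : Calc M}

theorem ext {x y : M} (h : ∀ z, z ∈ x ↔ z ∈ y) : x = y := (ZFM.zfc (M := M)).2.1.1 x y h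
theorem ext_iff' {x y : M} : x = y ↔ ∀ z, z ∈ x ↔ z ∈ y := ⟨by rintro rfl; simp, ext⟩

theorem DP.form {P : M → Prop} (h : DP full P) :
    ∃ (m : ℕ) (p : Fin m → M) (φ : SetFormula (m+1)), ∀ z, P z ↔ Realize ZFM.E φ (Fin.cons z p) := by
  obtain ⟨⟨R, ⟨m, p, φ, -, h1⟩, h2⟩, -⟩ := h
  refine ⟨m, p, φ.ren (Fin.addCases Fin.succ fun _ => 0), fun z => ?_⟩
  rw [h2, h1, realize_ren]
  have : Fin.append p (Ctx.get z) = (Fin.cons z p : Fin (m+1) → M) ∘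
      (Fin.addCases Fin.succ fun _ => 0) := by
    funext i
    refine Fin.addCases (fun i => ?_) (fun i => ?_) i
    · simp
    · simp [Ctx.get]
  rw [this]

theorem DP.form2 {P : M × M → Prop} (h : DP full P) :
    ∃ (m : ℕ) (p : Fin m → M) (φ : SetFormula (m+2)),
      ∀ x y, P (x, y) ↔ Realize ZFM.E φ (Fin.cons x (Fin.cons y p)) := by
  obtain ⟨⟨R, ⟨m, p, φ, -, h1⟩, h2⟩, -⟩ := h
  refine ⟨m, p, φ.ren (Fin.addCases (fun i => i.succ.succ)
    (Fin.addCases (fun _ => 0) fun _ => 1)), fun x y => ?_⟩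
  rw [h2, h1, realize_ren]
  have : Fin.append p (Ctx.get (x, y)) = (Fin.cons x (Fin.cons y p : Fin (m+1) → M) : Fin (m+2) → M) ∘
      (Fin.addCases (fun i => i.succ.succ) (Fin.addCases (fun _ => 0) fun _ => 1)) := by
    funext i
    refine Fin.addCases (fun i => ?_) (fun i => ?_) i
    · simp only [Fin.append_left, Function.comp]
      erw [Fin.addCases_left]; rfl
    · refine Fin.addCases (fun i => ?_) (fun i => ?_) i
      · simp [Ctx.get]
      · simp only [Ctx.get, Function.comp, Fin.append_right, Fin.addCases_right]; rfl
  rw [this]; rfl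

theorem sep_exists {P : M → Prop} (h : DP full P) (a : M) : ∃ s : M, ∀ z, z ∈ s ↔ z ∈ a ∧ P z := by
  obtain ⟨m, p, φ, h⟩ := h.form
  obtain ⟨s, hs⟩ := (ZFM.zfc (M := M)).2.1.2.2.2.2.2.1 m φ p a
  exact ⟨s, fun z => by rw [h]; exact hs z⟩

theorem repl_exists {F : M → M} (h : DF full F) (a : M) :
    ∃ s : M, ∀ z, z ∈ s ↔ ∃ x, x ∈ a ∧ z = F x := by
  obtain ⟨m, p, φ, h⟩ := h.graph.form2
  obtain ⟨s, hs⟩ := (ZFM.zfc (M := M)).2.1.2.2.2.2.2.2 m φ p a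
    (fun x _ y y' h1 h2 => by rw [← h] at h1 h2; exact h1.trans h2.symm)
  refine ⟨s, fun z => (hs z).trans (exists_congr fun x => ?_)⟩
  rw [← h]; rfl

open Classical in
noncomputable def sep (a : M) (P : M → Prop) : M :=
  if h : ∃ s : M, ∀ z, z ∈ s ↔ z ∈ a ∧ P z then h.choose else a
theorem mem_sep {P : M → Prop} (h : DP full P) {a z : M} : z ∈ sep a P ↔ z ∈ a ∧ P z := by
  have := sep_exists h a
  rw [sep, dif_pos this]; exact this.choose_spec z
open Classical in
noncomputable def img (a : M) (F : M → M) : M :=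
  if h : ∃ s : M, ∀ z, z ∈ s ↔ ∃ x, x ∈ a ∧ z = F x then h.choose else a
theorem mem_img {F : M → M} (h : DF full F) {a z : M} : z ∈ img a F ↔ ∃ x, x ∈ a ∧ z = F x := by
  have := repl_exists h a
  rw [img, dif_pos this]; exact this.choose_spec z

theorem DP.slice {P : G → M → Prop} (h : DP c (fun q : G × M => P q.1 q.2)) (g : G) :
    DP full (P g) := by
  have key : ∀ {R : G × M → Prop}, SQ full R → SQ full (fun y => R (g, y)) := by
    rintro R ⟨R', ⟨m, p, φ, -, h1⟩, h2⟩
    refine ⟨fun v => Realize ZFM.E φ (Fin.append p (Fin.append (Ctx.get g) v)),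
      ⟨m + Ctx.k G, Fin.append p (Ctx.get g), φ.ren (Fin.cast (by
        simp only [Ctx.k]; omega)), fun _ => trivial, fun v => ?_⟩, fun y => ?_⟩
    · rw [realize_ren, Fin.append_assoc]
      have : ∀ {a b : ℕ} (h : a = b) (w : Fin a → M), (w ∘ Fin.cast h.symm) ∘ Fin.cast h = w := by
        intro a b h w; subst h; rfl
      rw [Iff.comm, iff_iff_eq]
      congr 1
    · beta_reduce; rw [h2, h1]; rfl
  exact ⟨key h.le.1, key h.le.2⟩
theorem DF.slice {F : G → M → M} (h : DF c (fun q : G × M => F q.1 q.2)) (g : G) :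
    DF full (F g) := by
  have h1 : DP full (fun q : (G × M) × M => q.2 = F q.1.1 q.1.2) := h.graph.le
  have h2 : DP full (fun q : G × (M × M) => q.2.2 = F q.1 q.2.1) :=
    h1.comp (f := fun q : G × (M × M) => ((q.1, q.2.1), q.2.2)) (by fun_prop)
  refine DF.of_sq ?_
  have key : ∀ {R : G × (M × M) → Prop}, SQ full R → SQ full (fun y => R (g, y)) := by
    rintro R ⟨R', ⟨m, p, φ, -, h1⟩, h2⟩
    refine ⟨fun v => Realize ZFM.E φ (Fin.append p (Fin.append (Ctx.get g) v)),
      ⟨m + Ctx.k G, Fin.append p (Ctx.get g), φ.ren (Fin.cast (by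
        simp only [Ctx.k]; omega)), fun _ => trivial, fun v => ?_⟩, fun y => ?_⟩
    · rw [realize_ren, Fin.append_assoc]
      rw [Iff.comm, iff_iff_eq]
      congr 1
    · beta_reduce; rw [h2, h1]; rfl
  exact key h2.1

@[fun_prop] theorem DF.sep (f : G → M) (P : G → M → Prop) (hf : DF c f)
    (h : DP c (fun q : G × M => P q.1 q.2)) : DF c (fun x => sep (f x) (fun y => P x y)) := by
  refine DF.of_dp (fun g y => Paper.ball y (fun z => z ∈ f g ∧ P g z) ∧
      Paper.ball (f g) (fun z => P g z → z ∈ y)) ?_ fun g y => ?_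
  · have h' : DP c (fun q : (G × M) × M => P q.1.1 q.2) :=
      h.comp (f := fun q : (G × M) × M => (q.1.1, q.2)) (by fun_prop)
    exact DP.and _ _ (DP.ball (fun q : G × M => q.2) (fun q z => z ∈ f q.1 ∧ P q.1 z) (by fun_prop)
      (DP.and _ _ (by fun_prop) h')) (DP.ball (fun q : G × M => f q.1) (fun q z => P q.1 z → z ∈ q.2)
      (by fun_prop) (DP.imp _ _ h' (by fun_prop)))
  · rw [ext_iff']
    simp only [mem_sep (h.slice g), Paper.ball]
    constructor
    · intro h; exact ⟨fun z hz => (h z).1 hz, fun z hz hP => (h z).2 ⟨hz, hP⟩⟩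
    · intro h z; exact ⟨fun hz => h.1 z hz, fun hz => h.2 z hz.1 hz.2⟩
@[fun_prop] theorem DF.img (f : G → M) (F : G → M → M) (hf : DF c f)
    (h : DF c (fun q : G × M => F q.1 q.2)) : DF c (fun x => img (f x) (fun y => F x y)) := by
  refine DF.of_dp (fun g y => Paper.ball y (fun z => Paper.bex (f g) fun x => z = F g x) ∧
      Paper.ball (f g) (fun x => F g x ∈ y)) ?_ fun g y => ?_
  · have h' : DF c (fun q : (G × M) × M => F q.1.1 q.2) :=
      DF.comp (fun q : G × M => F q.1 q.2) (fun q : (G × M) × M => (q.1.1, q.2)) h (by fun_prop)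
    have h'' : DF c (fun q : ((G × M) × M) × M => F q.1.1.1 q.2) :=
      DF.comp (fun q : G × M => F q.1 q.2) (fun q : ((G × M) × M) × M => (q.1.1.1, q.2)) h
        (by fun_prop)
    fun_prop
  · rw [ext_iff']
    simp only [mem_img (h.slice g), Paper.ball, Paper.bex]
    constructor
    · intro h; exact ⟨fun z hz => (h z).1 hz, fun z hz => (h _).2 ⟨z, hz, rfl⟩⟩
    · rintro ⟨h1, h2⟩ z
      exact ⟨fun hz => h1 z hz, by rintro ⟨x, hx, rfl⟩; exact h2 x hx⟩

/-! basic operations -/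
theorem up_exists (a b : M) : ∃ s : M, ∀ z, z ∈ s ↔ z = a ∨ z = b := (ZFM.zfc (M := M)).2.1.2.1 a b
noncomputable def up (a b : M) : M := (up_exists a b).choose
@[simp] theorem mem_up {a b z : M} : z ∈ up a b ↔ z = a ∨ z = b := (up_exists a b).choose_spec z
theorem sU_exists (a : M) : ∃ s : M, ∀ z, z ∈ s ↔ ∃ y, y ∈ a ∧ z ∈ y := (ZFM.zfc (M := M)).2.1.2.2.1 a
noncomputable def sU (a : M) : M := (sU_exists a).choose
@[simp] theorem mem_sU {a z : M} : z ∈ sU a ↔ ∃ y, y ∈ a ∧ z ∈ y := (sU_exists a).choose_spec z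
instance : HasSubset M := ⟨fun a b => ∀ z, z ∈ a → z ∈ b⟩
theorem sub_def {a b : M} : a ⊆ b ↔ ∀ z, z ∈ a → z ∈ b := Iff.rfl
theorem Sub.refl (a : M) : a ⊆ a := fun _ h => h
theorem Sub.trans {a b d : M} (h : a ⊆ b) (h' : b ⊆ d) : a ⊆ d := fun z hz => h' z (h z hz)
theorem Sub.antisymm {a b : M} (h : a ⊆ b) (h' : b ⊆ a) : a = b := ext fun z => ⟨h z, h' z⟩
theorem pow_exists (a : M) : ∃ s : M, ∀ z, z ∈ s ↔ z ⊆ a := (ZFM.zfc (M := M)).2.2.1 a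
noncomputable def pow (a : M) : M := (pow_exists a).choose
@[simp] theorem mem_pow {a z : M} : z ∈ pow a ↔ z ⊆ a := (pow_exists a).choose_spec z
theorem emp_exists : ∃ s : M, ∀ z, z ∉ s := by
  obtain ⟨I, ⟨e, -, he⟩, -⟩ := (ZFM.zfc (M := M)).2.1.2.2.2.1
  exact ⟨e, he⟩
noncomputable def emp : M := (emp_exists (M := M)).choose
@[simp] theorem mem_emp {z : M} : ¬ z ∈ (emp : M) := (emp_exists (M := M)).choose_spec z
theorem ne_emp {a : M} : a ≠ emp ↔ ∃ z, z ∈ a := by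
  rw [ne_eq, ext_iff']; simp
theorem emp_sub (a : M) : emp ⊆ a := fun z h => (mem_emp h).elim

@[fun_prop] theorem DP.sub (f g : G → M) (hf : DF c f) (hg : DF c g) : DP c (fun x => f x ⊆ g x) :=
  DP.congr (P := fun x => Paper.ball (f x) (fun z => z ∈ g x)) (by fun_prop) fun _ => Iff.rfl

@[fun_prop] theorem DF.up (f g : G → M) (hf : DF c f) (hg : DF c g) :
    DF c (fun x => up (f x) (g x)) :=
  DF.of_dp (fun x y => f x ∈ y ∧ g x ∈ y ∧ Paper.ball y fun z => z = f x ∨ z = g x)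
    (by fun_prop) fun x y => by
      rw [ext_iff']; simp only [mem_up, Paper.ball]
      constructor
      · intro h; simp [h]
      · rintro ⟨h1, h2, h3⟩ z
        exact ⟨h3 z, by rintro (rfl | rfl) <;> assumption⟩
@[fun_prop] theorem DF.sU (f : G → M) (hf : DF c f) : DF c (fun x => sU (f x)) :=
  DF.of_dp (fun x y => (Paper.ball y fun z => Paper.bex (f x) fun u => z ∈ u) ∧
      Paper.ball (f x) fun u => u ⊆ y)
    (by fun_prop) fun x y => by
      rw [ext_iff']; simp only [mem_sU, Paper.ball, Paper.bex]
      constructor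
      · intro h; exact ⟨fun z hz => (h z).1 hz, fun u hu z hz => (h z).2 ⟨u, hu, hz⟩⟩
      · rintro ⟨h1, h2⟩ z; exact ⟨h1 z, by rintro ⟨u, hu, hz⟩; exact h2 u hu z hz⟩
@[fun_prop] theorem DF.emp : DF c (fun _ : G => (emp : M)) :=
  DF.of_dp (fun x y => Paper.ball y fun z => False) (by fun_prop) fun x y => by
      rw [ext_iff']; simp [Paper.ball]
@[fun_prop] theorem DF.pow [c.Full] (f : G → M) (hf : DF c f) : DF c (fun x => pow (f x)) :=
  DF.of_dp (fun x y => ∀ z, z ∈ y ↔ z ⊆ f x)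
    (by fun_prop) fun x y => by
      rw [ext_iff']; simp only [mem_pow]

noncomputable def sing (a : M) : M := up a a
@[simp] theorem mem_sing {a z : M} : z ∈ sing a ↔ z = a := by simp [sing]
noncomputable def pair (a b : M) : M := up (up a a) (up a b)
noncomputable def cup (a b : M) : M := sU (up a b)
@[simp] theorem mem_cup {a b z : M} : z ∈ cup a b ↔ z ∈ a ∨ z ∈ b := by simp [cup]
noncomputable def suc (a : M) : M := cup a (sing a)
@[simp] theorem mem_suc {a z : M} : z ∈ suc a ↔ z ∈ a ∨ z = a := by simp [suc]
noncomputable def cap (a b : M) : M := sep a (fun z => z ∈ b)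
@[simp] theorem mem_cap {a b z : M} : z ∈ cap a b ↔ z ∈ a ∧ z ∈ b := mem_sep (by fun_prop)
noncomputable def diff (a b : M) : M := sep a (fun z => ¬ z ∈ b)
@[simp] theorem mem_diff {a b z : M} : z ∈ diff a b ↔ z ∈ a ∧ ¬ z ∈ b := mem_sep (by fun_prop)
theorem up_eq {a b x y : M} (h : up a b = up x y) : (a = x ∧ b = y) ∨ (a = y ∧ b = x) := by
  rw [ext_iff'] at h; simp only [mem_up] at h
  have h1 := h a; have h2 := h b; have h3 := h x; have h4 := h y
  simp only [true_or, or_true, true_iff, iff_true] at h1 h2 h3 h4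
  grind
theorem pair_inj {a b x y : M} : pair a b = pair x y ↔ a = x ∧ b = y := by
  constructor
  · intro h
    rcases up_eq h with ⟨h1, h2⟩ | ⟨h1, h2⟩
    · have := up_eq h1; have := up_eq h2; grind
    · have := up_eq h1; have := up_eq h2; grind
  · rintro ⟨rfl, rfl⟩; rfl
@[fun_prop] theorem DF.sing (f : G → M) (hf : DF c f) : DF c (fun x => sing (f x)) := by
  unfold Paper.sing; fun_prop
@[fun_prop] theorem DF.pair (f g : G → M) (hf : DF c f) (hg : DF c g) :
    DF c (fun x => pair (f x) (g x)) := by unfold Paper.pair; fun_prop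
@[fun_prop] theorem DF.cup (f g : G → M) (hf : DF c f) (hg : DF c g) :
    DF c (fun x => cup (f x) (g x)) := by unfold Paper.cup; fun_prop
@[fun_prop] theorem DF.suc (f : G → M) (hf : DF c f) : DF c (fun x => suc (f x)) := by
  unfold Paper.suc; fun_prop
@[fun_prop] theorem DF.cap (f g : G → M) (hf : DF c f) (hg : DF c g) :
    DF c (fun x => cap (f x) (g x)) := by unfold Paper.cap; fun_prop
@[fun_prop] theorem DF.diff (f g : G → M) (hf : DF c f) (hg : DF c g) :
    DF c (fun x => diff (f x) (g x)) := by unfold Paper.diff; fun_prop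

theorem upairE_iff {p a b : M} : UPairE ZFM.E p a b ↔ p = up a b := by
  rw [ext_iff']; simp only [mem_up]; rfl
theorem opairE_iff {p a b : M} : OPairE ZFM.E p a b ↔ p = pair a b := by
  simp only [OPairE, upairE_iff]; simp [pair]
theorem pairMemE_iff {f x y : M} : PairMemE ZFM.E f x y ↔ pair x y ∈ f := by
  simp only [PairMemE, opairE_iff]; simp [mem_def]

/-! functions -/
noncomputable def app (f x : M) : M := sU (sep (sU (sU f)) fun y => pair x y ∈ f)
@[fun_prop] theorem DF.app (f g : G → M) (hf : DF c f) (hg : DF c g) :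
    DF c (fun x => app (f x) (g x)) := by unfold Paper.app; fun_prop
theorem pair_mem_UU {f x y : M} (h : pair x y ∈ f) : x ∈ sU (sU f) ∧ y ∈ sU (sU f) := by
  simp only [mem_sU]
  exact ⟨⟨up x y, ⟨pair x y, h, by simp [pair]⟩, by simp⟩, ⟨up x y, ⟨pair x y, h, by simp [pair]⟩, by simp⟩⟩
theorem app_eq {f x y : M} (h : pair x y ∈ f) (hu : ∀ y', pair x y' ∈ f → y' = y) : app f x = y := by
  apply ext; intro z
  rw [app]
  simp (disch := fun_prop) only [mem_sU, mem_sep]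
  constructor
  · rintro ⟨w, ⟨-, h2⟩, hz⟩; rwa [hu w h2] at hz
  · intro hz
    exact ⟨y, ⟨by simpa using (pair_mem_UU h).2, h⟩, hz⟩

noncomputable def lam (a : M) (F : M → M) : M := img a fun x => pair x (F x)
theorem pairlam_df {F : M → M} (hF : DF full F) : DF full (fun x => pair x (F x)) := by fun_prop
theorem mem_lam {a z : M} {F : M → M} (hF : DF full F) :
    z ∈ lam a F ↔ ∃ x, x ∈ a ∧ z = pair x (F x) := mem_img (pairlam_df hF)
theorem pair_mem_lam {a x y : M} {F : M → M} (hF : DF full F) :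
    pair x y ∈ lam a F ↔ x ∈ a ∧ y = F x := by
  rw [mem_lam hF]
  constructor
  · rintro ⟨x', h, h'⟩; rw [pair_inj] at h'; obtain ⟨rfl, rfl⟩ := h'; exact ⟨h, rfl⟩
  · rintro ⟨h, rfl⟩; exact ⟨x, h, rfl⟩
theorem app_lam {a x : M} {F : M → M} (hF : DF full F) (h : x ∈ a) : app (lam a F) x = F x :=
  app_eq (by rw [pair_mem_lam hF]; exact ⟨h, rfl⟩) fun y' h' => ((pair_mem_lam hF).1 h').2
@[fun_prop] theorem DF.lam (f : G → M) (F : G → M → M) (hf : DF c f)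
    (h : DF c (fun q : G × M => F q.1 q.2)) : DF c (fun x => lam (f x) (fun y => F x y)) := by
  unfold Paper.lam; fun_prop
theorem lam_congr {a : M} {F F' : M → M} (hF : DF full F) (hF' : DF full F')
    (h : ∀ x, x ∈ a → F x = F' x) : lam a F = lam a F' := by
  apply ext; intro z; rw [mem_lam hF, mem_lam hF']
  exact exists_congr fun x => and_congr_right fun hx => by rw [h x hx]

theorem img_congr {a : M} {F F' : M → M} (hF : DF full F) (hF' : DF full F')
    (h : ∀ x, x ∈ a → F x = F' x) : img a F = img a F' := by
  apply ext; intro z; rw [mem_img hF, mem_img hF']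
  exact exists_congr fun x => and_congr_right fun hx => by rw [h x hx]

/-- `f` is a function with domain `a` -/
def Fn (f a : M) : Prop := f = lam a (fun x => app f x)
@[fun_prop] theorem DP.Fn (f g : G → M) (hf : DF c f) (hg : DF c g) :
    DP c (fun x => Fn (f x) (g x)) := by unfold Paper.Fn; fun_prop
theorem fn_lam (a : M) {F : M → M} (hF : DF full F) : Fn (lam a F) a :=
  lam_congr hF (by fun_prop) fun x hx => (app_lam hF hx).symm
theorem Fn.pair_mem {f a x y : M} (h : Fn f a) : pair x y ∈ f ↔ x ∈ a ∧ y = app f x := by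
  have := @pair_mem_lam M _ a x y (fun x => app f x) (by fun_prop)
  rwa [← show f = lam a (fun x => app f x) from h] at this
theorem Fn.mem {f a z : M} (h : Fn f a) : z ∈ f ↔ ∃ x, x ∈ a ∧ z = pair x (app f x) := by
  have := @mem_lam M _ a z (fun x => app f x) (by fun_prop)
  rwa [← show f = lam a (fun x => app f x) from h] at this
theorem Fn.ext {f g a : M} (h : Fn f a) (h' : Fn g a) (e : ∀ x, x ∈ a → app f x = app g x) : f = g := by
  rw [h, h']; exact lam_congr (by fun_prop) (by fun_prop) e
theorem fn_of {f a : M} (h1 : ∀ p, p ∈ f → ∃ x y, x ∈ a ∧ p = pair x y)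
    (h2 : ∀ x, x ∈ a → ∃ y, pair x y ∈ f) (h3 : ∀ x y y', pair x y ∈ f → pair x y' ∈ f → y' = y) :
    Fn f a := by
  apply Paper.ext; intro z
  rw [mem_lam (by fun_prop)]
  constructor
  · intro hz
    obtain ⟨x, y, hx, rfl⟩ := h1 z hz
    exact ⟨x, hx, by rw [app_eq hz fun y' h' => h3 _ _ _ hz h']⟩
  · rintro ⟨x, hx, rfl⟩
    obtain ⟨y, hy⟩ := h2 x hx
    rwa [app_eq hy fun y' h' => h3 _ _ _ hy h']

/-- `f : a → b` -/
def FnTo (f a b : M) : Prop := Fn f a ∧ ball a fun x => app f x ∈ b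
@[fun_prop] theorem DP.FnTo (f g h : G → M) (hf : DF c f) (hg : DF c g) (hh : DF c h) :
    DP c (fun x => FnTo (f x) (g x) (h x)) := by unfold Paper.FnTo; fun_prop
theorem isFuncE_iff {f a b : M} : IsFuncE ZFM.E f a b ↔ FnTo f a b := by
  constructor
  · rintro ⟨h1, h2⟩
    have hF : Fn f a := by
      refine fn_of (fun p hp => ?_) (fun x hx => ?_) fun x y y' hy hy' => ?_
      · obtain ⟨x, y, hx, -, h⟩ := h1 p hp
        exact ⟨x, y, hx, opairE_iff.1 h⟩
      · obtain ⟨y, hy⟩ := (h2 x hx).1; exact ⟨y, pairMemE_iff.1 hy⟩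
      · obtain ⟨x1, y1, hx, -, h⟩ := h1 _ hy
        rw [opairE_iff, pair_inj] at h; obtain ⟨rfl, rfl⟩ := h
        exact (h2 x hx).2 y' y (pairMemE_iff.2 hy') (pairMemE_iff.2 hy)
    refine ⟨hF, fun x hx => ?_⟩
    have : pair x (app f x) ∈ f := hF.pair_mem.2 ⟨hx, rfl⟩
    obtain ⟨x1, y1, hx, hy, h⟩ := h1 _ this
    rw [opairE_iff, pair_inj] at h; show app f x ∈ b; rw [h.2]; exact hy
  · rintro ⟨hF, h2⟩
    refine ⟨fun p hp => ?_, fun x hx => ⟨⟨app f x, ?_⟩, fun y y' hy hy' => ?_⟩⟩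
    · obtain ⟨x, hx, rfl⟩ := hF.mem.1 hp
      exact ⟨x, app f x, hx, h2 x hx, opairE_iff.2 rfl⟩
    · exact pairMemE_iff.2 (hF.pair_mem.2 ⟨hx, rfl⟩)
    · rw [pairMemE_iff, hF.pair_mem] at hy hy'; rw [hy.2, hy'.2]
theorem fnTo_lam {a b : M} {F : M → M} (hF : DF full F) (h : ∀ x, x ∈ a → F x ∈ b) :
    FnTo (lam a F) a b := ⟨fn_lam a hF, fun x hx => by show app _ x ∈ b; rw [app_lam hF hx]; exact h x hx⟩
def Inj (f a b : M) : Prop := FnTo f a b ∧ ball a fun x => ball a fun y => app f x = app f y → x = y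
def Sur (f a b : M) : Prop := FnTo f a b ∧ ball b fun y => bex a fun x => app f x = y
def Bij (f a b : M) : Prop := Inj f a b ∧ Sur f a b
@[fun_prop] theorem DP.Inj (f g h : G → M) (hf : DF c f) (hg : DF c g) (hh : DF c h) :
    DP c (fun x => Inj (f x) (g x) (h x)) := by unfold Paper.Inj; fun_prop
@[fun_prop] theorem DP.Sur (f g h : G → M) (hf : DF c f) (hg : DF c g) (hh : DF c h) :
    DP c (fun x => Sur (f x) (g x) (h x)) := by unfold Paper.Sur; fun_prop
@[fun_prop] theorem DP.Bij (f g h : G → M) (hf : DF c f) (hg : DF c g) (hh : DF c h) :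
    DP c (fun x => Bij (f x) (g x) (h x)) := by unfold Paper.Bij; fun_prop
theorem injE_iff {f a b : M} : InjE ZFM.E f a b ↔ Inj f a b := by
  rw [InjE, isFuncE_iff, Inj]
  refine and_congr_right fun h => ?_
  simp only [pairMemE_iff, h.1.pair_mem, ball]
  constructor
  · intro h x hx y hy e; exact h x y (app f x) hx hy ⟨hx, rfl⟩ ⟨hy, e⟩
  · rintro h x x' y hx hx' ⟨-, e⟩ ⟨-, e'⟩; exact h x hx x' hx' (e.symm.trans e')
theorem surjE_iff {f a b : M} : SurjE ZFM.E f a b ↔ Sur f a b := by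
  rw [SurjE, isFuncE_iff, Sur]
  refine and_congr_right fun h => ?_
  simp only [pairMemE_iff, h.1.pair_mem, ball, bex]
  refine forall_congr' fun y => imp_congr_right fun hy => exists_congr fun x => ?_
  constructor
  · rintro ⟨h1, h2, rfl⟩; exact ⟨h1, rfl⟩
  · rintro ⟨h1, rfl⟩; exact ⟨h1, h1, rfl⟩
theorem bijE_iff {f a b : M} : BijE ZFM.E f a b ↔ Bij f a b := by
  rw [BijE, injE_iff, surjE_iff, Bij, and_comm]

/-! foundation -/
theorem found {a : M} (h : ∃ z, z ∈ a) : ∃ m, m ∈ a ∧ ∀ z, z ∈ a → ¬ z ∈ m :=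
  (ZFM.zfc (M := M)).2.1.2.2.2.2.1 a h
theorem mem_irrefl (a : M) : ¬ a ∈ a := by
  obtain ⟨m, hm, h⟩ := found (a := sing a) ⟨a, by simp⟩
  rw [mem_sing] at hm; subst hm
  exact h m (by simp)
theorem mem_asymm {a b : M} (h : a ∈ b) : ¬ b ∈ a := by
  intro h'
  obtain ⟨m, hm, hh⟩ := found (a := up a b) ⟨a, by simp⟩
  rw [mem_up] at hm; rcases hm with rfl | rfl
  · exact hh b (by simp) h'
  · exact hh a (by simp) h
end Basic
end Paper
namespace Paper
section Ordi
variable {M : Type} [ZFM M] {G : Type} [Ctx M G] {c : Calc M}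

def Tr (x : M) : Prop := ball x fun y => y ⊆ x
@[fun_prop] theorem DP.Tr (f : G → M) (hf : DF c f) : DP c (fun x => Tr (f x)) := by
  unfold Paper.Tr; fun_prop
theorem transE_iff {x : M} : TransE ZFM.E x ↔ Tr x := Iff.rfl
theorem subE_iff {x y : M} : SubE ZFM.E x y ↔ x ⊆ y := Iff.rfl
def Ord (x : M) : Prop := Tr x ∧ ball x Tr
@[fun_prop] theorem DP.Ord (f : G → M) (hf : DF c f) : DP c (fun x => Ord (f x)) := by
  have : ∀ x : M, (Paper.Tr x ∧ Paper.ball x Paper.Tr ↔ Paper.Tr x ∧ Paper.ball x fun y => Paper.Tr y) :=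
    fun x => Iff.rfl
  unfold Paper.Ord; simp only [this]; fun_prop
theorem ordE_iff {x : M} : OrdE ZFM.E x ↔ Ord x := Iff.rfl

theorem Tr.mem {x y z : M} (h : Tr x) (hy : y ∈ x) (hz : z ∈ y) : z ∈ x := h y hy z hz
theorem Ord.tr {x : M} (h : Ord x) : Tr x := h.1
theorem Ord.mem {x y : M} (h : Ord x) (hy : y ∈ x) : Ord y :=
  ⟨h.2 y hy, fun z hz => h.2 z (h.1 y hy z hz)⟩
theorem Ord.sub {x y : M} (h : Ord x) (hy : y ∈ x) : y ⊆ x := h.1 y hy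
theorem Ord.trans {x y z : M} (h : Ord x) (hy : y ∈ x) (hz : z ∈ y) : z ∈ x := h.1 y hy z hz

theorem ord_min {P : M → Prop} (hP : DP full P) (h : ∃ x, Ord x ∧ P x) :
    ∃ x, Ord x ∧ P x ∧ ∀ y, y ∈ x → ¬ P y := by
  obtain ⟨x, hx, hp⟩ := h
  by_cases h : ∃ y, y ∈ x ∧ P y
  · obtain ⟨m, hm, h'⟩ := found (a := sep x P) (by
      obtain ⟨y, hy⟩ := h; exact ⟨y, (mem_sep hP).2 hy⟩)
    rw [mem_sep hP] at hm
    refine ⟨m, hx.mem hm.1, hm.2, fun y hy hpy => h' y ((mem_sep hP).2 ⟨hx.trans hm.1 hy, hpy⟩) hy⟩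
  · exact ⟨x, hx, hp, fun y hy hpy => h ⟨y, hy, hpy⟩⟩

theorem ord_ind {P : M → Prop} (hP : DP full P)
    (h : ∀ x, Ord x → (∀ y, y ∈ x → P y) → P x) (x : M) (hx : Ord x) : P x := by
  by_contra hn
  obtain ⟨m, hm, h1, h2⟩ := ord_min (P := fun x => ¬ P x) (DP.not _ hP) ⟨x, hx, hn⟩
  exact h1 (h m hm fun y hy => not_not.1 (h2 y hy))

theorem ord_tri {a b : M} (ha : Ord a) (hb : Ord b) : a ∈ b ∨ a = b ∨ b ∈ a := by
  have h1 : ∀ a : M, Ord a → ∀ b : M, Ord b → a ∈ b ∨ a = b ∨ b ∈ a := by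
    refine ord_ind (by fun_prop) fun a ha iha => ?_
    refine ord_ind (by fun_prop) fun b hb ihb => ?_
    by_cases h1 : ∃ b', b' ∈ b ∧ (a ∈ b' ∨ a = b')
    · obtain ⟨b', hb', h | rfl⟩ := h1
      · exact .inl (hb.trans hb' h)
      · exact .inl hb'
    by_cases h2 : ∃ a', a' ∈ a ∧ (a' = b ∨ b ∈ a')
    · obtain ⟨a', ha', rfl | h⟩ := h2
      · exact .inr (.inr ha')
      · exact .inr (.inr (ha.trans ha' h))
    push Not at h1 h2
    right; left
    apply ext; intro z
    constructor
    · intro hz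
      have := iha z hz b hb; have := h2 z hz; tauto
    · intro hz
      have := ihb z hz; have := h1 z hz; tauto
  exact h1 a ha b hb

theorem Ord.le_iff {a b : M} (ha : Ord a) (hb : Ord b) : a ⊆ b ↔ a ∈ b ∨ a = b := by
  constructor
  · intro h
    rcases ord_tri ha hb with h1 | h1 | h1
    · exact .inl h1
    · exact .inr h1
    · exact (mem_irrefl b (h b h1)).elim
  · rintro (h | rfl)
    · exact hb.sub h
    · exact Sub.refl _
theorem Ord.lt_or_le {a b : M} (ha : Ord a) (hb : Ord b) : a ∈ b ∨ b ⊆ a := by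
  rw [hb.le_iff ha]; rcases ord_tri ha hb with h | h | h <;> simp [h]
theorem Ord.not_lt {a b : M} (ha : Ord a) (hb : Ord b) : ¬ a ∈ b ↔ b ⊆ a :=
  ⟨fun h => (ha.lt_or_le hb).resolve_left h, fun h h' => mem_irrefl a (h a h')⟩
theorem Ord.not_le {a b : M} (ha : Ord a) (hb : Ord b) : ¬ a ⊆ b ↔ b ∈ a := by
  rw [← hb.not_lt ha, not_not]
theorem Ord.lt_of_le_of_lt {a b d : M} (ha : Ord a) (hd : Ord d) (h : a ⊆ b) (h' : b ∈ d) : a ∈ d := by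
  rcases (ha.le_iff (hd.mem h')).1 h with h | rfl
  · exact hd.trans h' h
  · exact h'
theorem Ord.of_tr {a b : M} (h : Ord b) (ha : Tr a) (hs : a ⊆ b) : Ord a :=
  ⟨ha, fun y hy => h.2 y (hs y hy)⟩

theorem ord_emp : Ord (emp : M) := ⟨fun y h => (mem_emp h).elim, fun y h => (mem_emp h).elim⟩
theorem Ord.suc {a : M} (h : Ord a) : Ord (suc a) := by
  refine ⟨fun y hy z hz => ?_, fun y hy => ?_⟩
  · rw [mem_suc] at hy ⊢
    rcases hy with hy | rfl
    · exact .inl (h.trans hy hz)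
    · exact .inl hz
  · rw [mem_suc] at hy
    rcases hy with hy | rfl
    · exact h.2 y hy
    · exact h.1
theorem ord_sU {a : M} (h : ∀ x, x ∈ a → Ord x) : Ord (sU a) := by
  refine ⟨fun y hy z hz => ?_, fun y hy => ?_⟩
  · rw [mem_sU] at hy ⊢; obtain ⟨u, hu, hy⟩ := hy; exact ⟨u, hu, (h u hu).trans hy hz⟩
  · rw [mem_sU] at hy; obtain ⟨u, hu, hy⟩ := hy; exact (h u hu).2 y hy
theorem Ord.cup {a b : M} (h : Ord a) (h' : Ord b) : Ord (cup a b) :=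
  ord_sU fun x hx => by rw [mem_up] at hx; rcases hx with rfl | rfl <;> assumption
theorem Ord.cap {a b : M} (h : Ord a) (h' : Ord b) : Ord (cap a b) :=
  h.of_tr (fun y hy z hz => by
    rw [mem_cap] at hy ⊢; exact ⟨h.trans hy.1 hz, h'.trans hy.2 hz⟩) fun z hz => (mem_cap.1 hz).1
theorem ord_of_tr {a : M} (h : Tr a) (h' : ∀ x, x ∈ a → Ord x) : Ord a := ⟨h, fun x hx => (h' x hx).1⟩
theorem self_mem_suc (a : M) : a ∈ suc a := by simp
theorem sub_suc (a : M) : a ⊆ suc a := fun z h => by simp [h]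
theorem Ord.suc_sub {a b : M} (h : Ord b) (ha : a ∈ b) : Paper.suc a ⊆ b := by
  intro z hz; rw [mem_suc] at hz
  rcases hz with hz | rfl
  · exact h.trans ha hz
  · exact ha
theorem Ord.mem_suc_iff {a b : M} (h : Ord a) (h' : Ord b) : a ∈ Paper.suc b ↔ a ⊆ b := by
  rw [mem_suc, h.le_iff h']
theorem suc_inj {a b : M} (h : suc a = suc b) : a = b := by
  have h1 : a ∈ suc b := by rw [← h]; simp
  have h2 : b ∈ suc a := by rw [h]; simp
  rw [mem_suc] at h1 h2
  rcases h1 with h1 | h1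
  · rcases h2 with h2 | h2
    · exact (mem_asymm h1 h2).elim
    · exact h2.symm
  · exact h1
theorem Ord.suc_mem_suc {a b : M} (h : Ord b) (ha : a ∈ b) : Paper.suc a ∈ Paper.suc b :=
  (Ord.mem_suc_iff (h.mem ha).suc h).2 (h.suc_sub ha)
theorem Ord.emp_mem {a : M} (h : Ord a) (h' : a ≠ emp) : emp ∈ a := by
  rcases ord_tri h ord_emp with h1 | h1 | h1
  · exact (mem_emp h1).elim
  · exact (h' h1).elim
  · exact h1

open Classical in
/-- least ordinal with property `P` -/
noncomputable def mu (P : M → Prop) : M :=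
  if h : ∃ x, Ord x ∧ P x ∧ ∀ y, y ∈ x → ¬ P y then h.choose else emp
theorem mu_spec {P : M → Prop} (hP : DP full P) (h : ∃ x, Ord x ∧ P x) :
    Ord (mu P) ∧ P (mu P) ∧ ∀ y, y ∈ mu P → ¬ P y := by
  have := ord_min hP h
  rw [mu, dif_pos this]; exact this.choose_spec
theorem mu_eq {P : M → Prop} {x : M} (hx : Ord x) (h : P x) (h' : ∀ y, y ∈ x → ¬ P y) : mu P = x := by
  have h1 : ∃ x, Ord x ∧ P x ∧ ∀ y, y ∈ x → ¬ P y := ⟨x, hx, h, h'⟩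
  rw [mu, dif_pos h1]
  obtain ⟨h2, h3, h4⟩ := h1.choose_spec
  rcases ord_tri h2 hx with h5 | h5 | h5
  · exact (h' _ h5 h3).elim
  · exact h5
  · exact (h4 _ h5 h).elim
theorem mu_le {P : M → Prop} (hP : DP full P) {x : M} (hx : Ord x) (h : P x) : mu P ⊆ x := by
  obtain ⟨h1, h2, h3⟩ := mu_spec hP ⟨x, hx, h⟩
  exact (hx.not_lt h1).1 fun h' => h3 x h' h
theorem ord_mu {P : M → Prop} : Ord (mu P) := by
  by_cases h : ∃ x, Ord x ∧ P x ∧ ∀ y, y ∈ x → ¬ P y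
  · rw [mu, dif_pos h]; exact h.choose_spec.1
  · rw [mu, dif_neg h]; exact ord_emp
@[fun_prop] theorem DF.mu [c.Full] (P : G → M → Prop)
    (h : DP c (fun q : G × M => P q.1 q.2)) : DF c (fun x => mu (fun y => P x y)) := by
  have h1 : DP c (fun q : (G × M) × M => P q.1.1 q.2) :=
    h.comp (f := fun q : (G × M) × M => (q.1.1, q.2)) (by fun_prop)
  have h2 : DP c (fun q : G × M => Paper.Ord q.2 ∧ P q.1 q.2 ∧ Paper.ball q.2 fun y => ¬ P q.1 y) := by
    refine DP.and _ _ (by fun_prop) (DP.and _ _ h (DP.ball (fun q : G × M => q.2) (fun q y => ¬ P q.1 y) (by fun_prop) ?_))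
    exact DP.not _ h1
  refine DF.of_dp (fun g y => (Paper.Ord y ∧ P g y ∧ Paper.ball y fun z => ¬ P g z) ∨
    (¬ (∃ y, Paper.Ord y ∧ P g y ∧ Paper.ball y fun z => ¬ P g z) ∧ y = Paper.emp)) ?_ ?_
  · refine DP.or _ _ h2 (DP.and _ _ (DP.not _ ?_) (by fun_prop))
    exact (DP.ex (fun g y => Paper.Ord y ∧ P g y ∧ Paper.ball y fun z => ¬ P g z) h2).comp (f := fun q : G × M => q.1) (by fun_prop)
  · intro g y
    constructor
    · rintro rfl
      by_cases h : ∃ x, Paper.Ord x ∧ P g x ∧ ∀ y, y ∈ x → ¬ P g y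
      · left; rw [Paper.mu, dif_pos h]; exact h.choose_spec
      · right; exact ⟨h, by rw [Paper.mu, dif_neg h]⟩
    · rintro (⟨h1, h2, h3⟩ | ⟨h1, rfl⟩)
      · exact (mu_eq h1 h2 h3).symm
      · rw [Paper.mu, dif_neg (show ¬ ∃ x, Paper.Ord x ∧ P g x ∧ ∀ y, y ∈ x → ¬ P g y from h1)]

/-! ω -/
def Nt (n : M) : Prop := Ord n ∧ ball (suc n) fun m => m = emp ∨ bex m fun k => m = suc k
@[fun_prop] theorem DP.Nt (f : G → M) (hf : DF c f) : DP c (fun x => Nt (f x)) := by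
  unfold Paper.Nt; fun_prop
theorem nt_emp : Nt (emp : M) := ⟨ord_emp, fun m hm => by simp at hm; exact .inl hm⟩
theorem Nt.suc {n : M} (h : Nt n) : Nt (suc n) := ⟨h.1.suc, fun m hm => by
  rw [mem_suc] at hm; rcases hm with hm | rfl
  · exact h.2 m hm
  · exact .inr ⟨n, by simp, rfl⟩⟩
theorem Nt.mem {n m : M} (h : Nt n) (hm : m ∈ n) : Nt m := ⟨h.1.mem hm, fun k hk => h.2 k (by
  rw [mem_suc] at hk ⊢; rcases hk with hk | rfl
  · exact .inl (h.1.trans hm hk)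
  · exact .inl hm)⟩
theorem Nt.cases {n : M} (h : Nt n) : n = emp ∨ ∃ k, Nt k ∧ n = Paper.suc k := by
  rcases h.2 n (by simp) with h' | ⟨k, hk, h'⟩
  · exact .inl h'
  · exact .inr ⟨k, h.mem hk, h'⟩
theorem nt_ind {P : M → Prop} (hP : DP full P) (h0 : P emp) (hs : ∀ n, Nt n → P n → P (suc n))
    (n : M) (hn : Nt n) : P n := by
  refine ord_ind (P := fun n => Nt n → P n) (DP.imp _ _ (by fun_prop) hP) (fun n _ ih hn => ?_) n hn.1 hn
  rcases hn.cases with rfl | ⟨k, hk, rfl⟩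
  · exact h0
  · exact hs k hk (ih k (by simp) hk)
theorem om_exists : ∃ w : M, ∀ n, n ∈ w ↔ Nt n := by
  obtain ⟨I, ⟨e, he, he'⟩, hI⟩ := (ZFM.zfc (M := M)).2.1.2.2.2.1
  have e1 : e = emp := by apply ext; intro z; simp; exact he' z
  subst e1
  have h2 : ∀ y : M, y ∈ I → suc y ∈ I := by
    intro y hy; obtain ⟨s, hs, h⟩ := hI y hy
    have : s = suc y := by apply ext; intro z; rw [mem_suc]; exact h z
    rwa [← this]
  refine ⟨sep I Nt, fun n => ?_⟩
  have d : DP full (fun n : M => Nt n) := by fun_prop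
  rw [mem_sep d, and_iff_right_iff_imp]
  exact nt_ind (P := fun n => n ∈ I) (by fun_prop) he (fun n _ h => h2 n h) n
noncomputable def om : M := (om_exists (M := M)).choose
@[simp] theorem mem_om {n : M} : n ∈ (om : M) ↔ Nt n := om_exists.choose_spec n
theorem ord_om : Ord (om : M) := ord_of_tr (fun y hy z hz => by
  rw [mem_om] at hy ⊢; exact hy.mem hz) fun x hx => (mem_om.1 hx).1
theorem emp_om : (emp : M) ∈ (om : M) := by simp [nt_emp]
theorem om_ne : (om : M) ≠ emp := fun h => by have := emp_om (M := M); rw [h] at this; simp at this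
theorem suc_om {n : M} (h : n ∈ (om : M)) : suc n ∈ (om : M) := by
  rw [mem_om] at h ⊢; exact h.suc
theorem om_ind {P : M → Prop} (hP : DP full P) (h0 : P emp) (hs : ∀ n, n ∈ (om : M) → P n → P (suc n))
    (n : M) (hn : n ∈ (om : M)) : P n :=
  nt_ind hP h0 (fun n hn => hs n (mem_om.2 hn)) n (mem_om.1 hn)
theorem om_cases {n : M} (h : n ∈ (om : M)) : n = emp ∨ ∃ k, k ∈ (om : M) ∧ n = suc k := by
  simpa using (mem_om.1 h).cases
@[fun_prop] theorem DF.om : DF c (fun _ : G => (om : M)) := by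
  refine DF.of_dp (fun g y => Paper.emp ∈ y ∧ Paper.ball y fun n => Paper.Nt n ∧ Paper.suc n ∈ y)
    (by fun_prop) fun g y => ?_
  constructor
  · rintro rfl; exact ⟨emp_om, fun n hn => ⟨mem_om.1 hn, suc_om hn⟩⟩
  · rintro ⟨h1, h2⟩
    apply ext; intro z
    rw [mem_om]
    exact ⟨fun h => (h2 z h).1, nt_ind (P := fun z => z ∈ y) (by fun_prop) h1
      (fun n _ h => (h2 n h).2) z⟩

def Lim (l : M) : Prop := Ord l ∧ l ≠ emp ∧ ball l fun a => suc a ∈ l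
@[fun_prop] theorem DP.Lim (f : G → M) (hf : DF c f) : DP c (fun x => Lim (f x)) := by
  unfold Paper.Lim; fun_prop
theorem limitE_iff {l : M} : LimitE ZFM.E l ↔ Lim l := by
  refine and_congr_right fun hl => and_congr ne_emp.symm ?_
  rw [ordE_iff] at hl
  constructor
  · intro h a ha
    obtain ⟨b, hb, hab⟩ := h a ha
    exact Ord.lt_of_le_of_lt (hl.mem ha).suc hl ((hl.mem hb).suc_sub hab) hb
  · intro h a ha
    exact ⟨suc a, h a ha, self_mem_suc a⟩
theorem lim_om : Lim (om : M) := ⟨ord_om, om_ne, fun n hn => suc_om hn⟩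
theorem Nt.not_lim {n : M} (h : Nt n) : ¬ Lim n := by
  rintro ⟨h1, h2, h3⟩
  rcases h.cases with rfl | ⟨k, hk, rfl⟩
  · exact h2 rfl
  · exact mem_irrefl _ (h3 k (by simp))
theorem Lim.om_le {l : M} (h : Lim l) : om ⊆ l :=
  (h.1.not_lt ord_om).1 fun h' => (mem_om.1 h').not_lim h
theorem omegaSpecE_iff {w : M} : OmegaSpecE ZFM.E w ↔ w = om := by
  simp only [OmegaSpecE, limitE_iff]
  constructor
  · rintro ⟨h1, h2⟩
    rcases ord_tri h1.1 ord_om with h | h | h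
    · exact ((mem_om.1 h).not_lim h1).elim
    · exact h
    · exact (h2 _ h lim_om).elim
  · rintro rfl; exact ⟨lim_om, fun x hx => (mem_om.1 hx).not_lim⟩
theorem infiniteOrdE_iff {x : M} : InfiniteOrdE ZFM.E x ↔ Ord x ∧ om ⊆ x := by
  simp only [InfiniteOrdE, omegaSpecE_iff, ordE_iff, exists_eq_left]
  exact and_congr_right fun h => (ord_om.le_iff h).symm
theorem interE_iff {b a d : M} : InterSpecE ZFM.E b a d ↔ b = cap a d := by
  rw [ext_iff']; simp only [mem_cap]; rfl
theorem powE_iff {p a : M} : PowSpecE ZFM.E p a ↔ p = pow a := by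
  rw [ext_iff']; simp only [mem_pow]; rfl
theorem emptyE_iff {p : M} : EmptyE ZFM.E p ↔ p = emp := by
  rw [ext_iff']; simp only [mem_emp, iff_false]; rfl
theorem ord_cases {a : M} (h : Ord a) : a = emp ∨ (∃ b, Ord b ∧ a = suc b) ∨ Lim a := by
  by_cases h0 : a = emp
  · exact .inl h0
  by_cases h1 : ∃ b, Ord b ∧ a = suc b
  · exact .inr (.inl h1)
  refine .inr (.inr ⟨h, h0, fun b hb => ?_⟩)
  rcases ord_tri (h.mem hb).suc h with h2 | h2 | h2
  · exact h2
  · exact (h1 ⟨b, h.mem hb, h2.symm⟩).elim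
  · exact (mem_irrefl a (h.suc_sub hb _ h2)).elim
end Ordi
end Paper
namespace Paper
section Recu
variable {M : Type} [ZFM M] {G : Type} [Ctx M G] {c : Calc M}

/-! ## Recursion -/
def Approx (H : M → M → M) (t f : M) : Prop :=
  Tr t ∧ Fn f t ∧ ball t fun y => app f y = H y (lam y fun z => app f z)

theorem approx_unique {H : M → M → M} {t f t' f' : M} (h : Approx H t f) (h' : Approx H t' f')
    {x : M} (hx : x ∈ t) (hx' : x ∈ t') : app f x = app f' x := by
  by_contra hn
  obtain ⟨m, hm, hmin⟩ := found (a := sep (cap t t') fun y => ¬ app f y = app f' y)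
    ⟨x, (mem_sep (by fun_prop)).2 ⟨mem_cap.2 ⟨hx, hx'⟩, hn⟩⟩
  rw [mem_sep (by fun_prop), mem_cap] at hm
  apply hm.2
  rw [h.2.2 m hm.1.1, h'.2.2 m hm.1.2]
  congr 1
  refine lam_congr (by fun_prop) (by fun_prop) fun z hz => ?_
  by_contra hn
  exact hmin z ((mem_sep (by fun_prop)).2 ⟨mem_cap.2 ⟨h.1.mem hm.1.1 hz, h'.1.mem hm.1.2 hz⟩, hn⟩) hz

open Classical in
noncomputable def recF (H : M → M → M) (x : M) : M :=
  if h : ∃ t f, Approx H t f ∧ x ∈ t then app h.choose_spec.choose x else emp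

theorem recF_eq {H : M → M → M} {t f x : M} (h : Approx H t f) (hx : x ∈ t) : recF H x = app f x := by
  have h1 : ∃ t f, Approx H t f ∧ x ∈ t := ⟨t, f, h, hx⟩
  rw [recF, dif_pos h1]
  exact approx_unique h1.choose_spec.choose_spec.1 h h1.choose_spec.choose_spec.2 hx

theorem DP.Approx (H : G → M → M → M) (t f : G → M) (ht : DF c t) (hf : DF c f)
    (hH : DF c (fun q : (G × M) × M => H q.1.1 q.1.2 q.2)) :
    DP c (fun x => Approx (H x) (t x) (f x)) := by
  have h1 : DF c (fun q : G × M => H q.1 q.2 (Paper.lam q.2 fun z => Paper.app (f q.1) z)) :=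
    DF.comp (fun q : (G × M) × M => H q.1.1 q.1.2 q.2)
      (fun q : G × M => ((q.1, q.2), Paper.lam q.2 fun z => Paper.app (f q.1) z)) hH (by fun_prop)
  unfold Paper.Approx
  refine DP.and _ _ (by fun_prop) (DP.and _ _ (by fun_prop) (DP.ball t
    (fun x y => Paper.app (f x) y = H x y (Paper.lam y fun z => Paper.app (f x) z)) ht ?_))
  exact DP.eq _ _ (by fun_prop) h1

theorem SQ.recG (H : G → M → M → M)
    (hH : DF c (fun q : (G × M) × M => H q.1.1 q.1.2 q.2)) :
    SQ c (fun q : G × M => ∃ t f, Approx (H q.1) t f ∧ q.2 ∈ t) := by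
  have h1 : DP c (fun q : ((G × M) × M) × M => Approx (H q.1.1.1) q.1.2 q.2 ∧ q.1.1.2 ∈ q.1.2) := by
    refine DP.and _ _ (DP.Approx (fun q : ((G × M) × M) × M => H q.1.1.1) _ _ (by fun_prop) (by fun_prop) ?_) (by fun_prop)
    exact DF.comp (fun q : (G × M) × M => H q.1.1 q.1.2 q.2)
      (fun q : ((((G × M) × M) × M) × M) × M => ((q.1.1.1.1.1, q.1.2), q.2)) hH (by fun_prop)
  exact SQ.ex (SQ.ex h1.1)
theorem SQ.recG2 (H : G → M → M → M)
    (hH : DF c (fun q : (G × M) × M => H q.1.1 q.1.2 q.2)) :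
    SQ c (fun q : (G × M) × M => ∃ t f, Approx (H q.1.1) t f ∧ q.1.2 ∈ t ∧ q.2 = app f q.1.2) := by
  have h1 : DP c (fun q : (((G × M) × M) × M) × M => Approx (H q.1.1.1.1) q.1.2 q.2 ∧ q.1.1.1.2 ∈ q.1.2 ∧
      q.1.1.2 = app q.2 q.1.1.1.2) := by
    refine DP.and _ _ (DP.Approx (fun q : (((G × M) × M) × M) × M => H q.1.1.1.1) _ _ (by fun_prop) (by fun_prop) ?_) (by fun_prop)
    exact DF.comp (fun q : (G × M) × M => H q.1.1 q.1.2 q.2)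
      (fun q : (((((G × M) × M) × M) × M) × M) × M => ((q.1.1.1.1.1.1, q.1.2), q.2)) hH (by fun_prop)
  exact SQ.ex (SQ.ex h1.1)

theorem recF_df_full [c.Full] (H : G → M → M → M)
    (hH : DF c (fun q : (G × M) × M => H q.1.1 q.1.2 q.2)) :
    DF c (fun q : G × M => recF (H q.1) q.2) := by
  refine DF.of_sq ?_
  have h1 := (SQ.recG H hH).neg.comp (f := fun q : (G × M) × M => q.1) (by fun_prop)
  refine SQ.congr (SQ.or (SQ.recG2 H hH) (h1.and
    (DP.eq (fun q : (G × M) × M => q.2) (fun _ => Paper.emp) (by fun_prop) (by fun_prop)).1)) fun q => ?_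
  constructor
  · intro hq
    by_cases h : ∃ t f, Approx (H q.1.1) t f ∧ q.1.2 ∈ t
    · obtain ⟨t, f, h1, h2⟩ := h
      exact .inl ⟨t, f, h1, h2, by rw [hq, recF_eq h1 h2]⟩
    · exact .inr ⟨h, by rw [hq, recF, dif_neg h]⟩
  · rintro (⟨t, f, h1, h2, h3⟩ | ⟨h1, h2⟩)
    · rw [h3, recF_eq h1 h2]
    · rw [h2, recF, dif_neg h1]

/-- uncurried definability of a two-place function -/
def DF2 (H : M → M → M) : Prop := DF full (fun q : M × M => H q.1 q.2)
theorem DF2.lift {H : M → M → M} (h : DF2 H) :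
    DF full (fun q : (M × M) × M => H q.1.2 q.2) :=
  DF.comp (fun q : M × M => H q.1 q.2) (fun q : (M × M) × M => (q.1.2, q.2)) h (by fun_prop)
theorem recF_df1 {H : M → M → M} (h : DF2 H) : DF full (recF H) :=
  DF.comp (fun q : M × M => recF H q.2) (fun x => (x, x))
    (recF_df_full (fun _ : M => H) h.lift) (by fun_prop)

theorem recF_good {H : M → M → M} (hH : DF2 H) {x s : M} (hs : Tr s) (hx : x ∈ s) :
    ∃ t f, Approx H t f ∧ x ∈ t := by
  have dgood : DP full (fun y : M => ∃ t f, Approx H t f ∧ y ∈ t) := by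
    have := (SQ.recG (fun _ : M => H) hH.lift).dp
    exact this.comp (f := fun x : M => (x, x)) (by fun_prop)
  have drec := recF_df1 hH
  by_contra hn
  obtain ⟨m, hm, hmin⟩ := found (a := sep s fun y => ¬ ∃ t f, Approx H t f ∧ y ∈ t)
    ⟨x, (mem_sep (DP.not _ dgood)).2 ⟨hx, hn⟩⟩
  rw [mem_sep (DP.not _ dgood)] at hm
  have hm2 : ∀ y, y ∈ m → ∃ t f, Approx H t f ∧ y ∈ t := fun y hy => by
    by_contra hn
    exact hmin y ((mem_sep (DP.not _ dgood)).2 ⟨hs.mem hm.1 hy, hn⟩) hy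
  apply hm.2
  classical
  set F : M → M := fun y => if y = m then H m (lam m (recF H)) else recF H y with hF
  have dF : DF full F := DF.ite _ _ _ (by fun_prop) (DF.con _) drec
  have d2 : DP full (fun y : M => (∃ t f, Approx H t f ∧ y ∈ t) ∨ y = m) :=
    DP.or _ _ dgood (by fun_prop)
  set t' := sep s fun y => (∃ t f, Approx H t f ∧ y ∈ t) ∨ y = m
  have mt : ∀ y, y ∈ t' ↔ y ∈ s ∧ ((∃ t f, Approx H t f ∧ y ∈ t) ∨ y = m) := fun y => mem_sep d2
  have ht' : Tr t' := by
    intro y hy z hz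
    rw [mt] at hy ⊢
    refine ⟨hs.mem hy.1 hz, .inl ?_⟩
    rcases hy.2 with ⟨t, f, h1, h2⟩ | rfl
    · exact ⟨t, f, h1, h1.1.mem h2 hz⟩
    · exact hm2 z hz
  refine ⟨t', lam t' F, ⟨ht', fn_lam _ dF, fun y hy => ?_⟩, (mt m).2 ⟨hm.1, .inr rfl⟩⟩
  show app (lam t' F) y = H y (lam y fun z => app (lam t' F) z)
  have e : (lam y fun z => app (lam t' F) z) = lam y (recF H) := by
    refine lam_congr (by fun_prop) drec fun z hz => ?_
    have hz' := ht' y hy z hz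
    rw [app_lam dF hz', hF]
    have hne : z ≠ m := by
      rintro rfl
      rcases ((mt y).1 hy).2 with ⟨t, f, h1, h2⟩ | rfl
      · exact hm.2 ⟨t, f, h1, h1.1.mem h2 hz⟩
      · exact mem_irrefl _ hz
    exact if_neg hne
  rw [app_lam dF hy, e, hF]
  by_cases hy' : y = m
  · subst hy'; exact if_pos rfl
  · beta_reduce; rw [if_neg hy']
    rcases ((mt y).1 hy).2 with ⟨t, f, h1, h2⟩ | rfl
    · rw [recF_eq h1 h2, h1.2.2 y h2]
      congr 1
      refine lam_congr (by fun_prop) drec fun z hz => ?_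
      rw [recF_eq h1 (h1.1.mem h2 hz)]
    · exact (hy' rfl).elim

theorem recF_spec' {H : M → M → M} (hH : DF2 H) {x s : M} (hs : Tr s) (hx : x ∈ s) :
    recF H x = H x (lam x (recF H)) := by
  obtain ⟨t, f, h1, h2⟩ := recF_good hH hs hx
  rw [recF_eq h1 h2, h1.2.2 x h2]
  congr 1
  refine lam_congr (by fun_prop) (recF_df1 hH) fun z hz => ?_
  rw [recF_eq h1 (h1.1.mem h2 hz)]

theorem tr_exists (a : M) : ∃ t : M, Tr t ∧ a ∈ t := by
  set H : M → M → M := fun n f => cup (sing a) (sU (sU (img n fun m => app f m))) with hH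
  have dH : DF2 H := by unfold DF2; rw [hH]; fun_prop
  have dr := recF_df1 dH
  have hU : ∀ n, n ∈ (om : M) → recF H n = cup (sing a) (sU (sU (img n (recF H)))) := by
    intro n hn
    rw [recF_spec' dH ord_om.tr hn, hH]
    beta_reduce; congr 3
    exact img_congr (by fun_prop) dr fun m hm => app_lam dr hm
  refine ⟨sU (img om (recF H)), fun y hy z hz => ?_, ?_⟩
  · simp only [mem_sU, mem_img dr] at hy ⊢
    obtain ⟨_, ⟨n, hn, rfl⟩, hy⟩ := hy
    refine ⟨_, ⟨suc n, suc_om hn, rfl⟩, ?_⟩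
    rw [hU _ (suc_om hn), mem_cup]
    right
    simp only [mem_sU, mem_img dr]
    exact ⟨y, ⟨_, ⟨n, by simp, rfl⟩, hy⟩, hz⟩
  · simp only [mem_sU, mem_img dr]
    exact ⟨_, ⟨emp, emp_om, rfl⟩, by rw [hU _ emp_om]; simp⟩

theorem recF_spec {H : M → M → M} (hH : DF2 H) (x : M) : recF H x = H x (lam x (recF H)) := by
  obtain ⟨t, h1, h2⟩ := tr_exists x; exact recF_spec' hH h1 h2

@[fun_prop] theorem DF.recF (H : G → M → M → M) (f : G → M)
    (hH : DF c (fun q : (G × M) × M => H q.1.1 q.1.2 q.2)) (hf : DF c f) :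
    DF c (fun x => recF (fun y z => H x y z) (f x)) := by
  have : DF c (fun q : G × M => Paper.recF (H q.1) q.2) := by
    refine DF.of_sq ((SQ.recG2 H hH).congr fun q => ?_)
    constructor
    · intro hq
      obtain ⟨t, h1, h2⟩ := tr_exists q.1.2
      have dH : DF2 (H q.1.1) := by
        have h0 : DF c (fun q : G × (M × M) => H q.1 q.2.1 q.2.2) :=
          DF.comp (fun q : (G × M) × M => H q.1.1 q.1.2 q.2)
            (fun q : G × (M × M) => ((q.1, q.2.1), q.2.2)) hH (by fun_prop)
        have key : ∀ (g : G) {R : G × ((M × M) × M) → Prop}, SQ full R → SQ full (fun y => R (g, y)) := by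
          rintro g R ⟨R', ⟨m, p, φ, -, h1⟩, h2⟩
          refine ⟨fun v => Realize ZFM.E φ (Fin.append p (Fin.append (Ctx.get g) v)),
            ⟨m + Ctx.k G, Fin.append p (Ctx.get g), φ.ren (Fin.cast (by
              simp only [Ctx.k]; omega)), fun _ => trivial, fun v => ?_⟩, fun y => ?_⟩
          · rw [realize_ren, Fin.append_assoc]
            rw [Iff.comm, iff_iff_eq]
            congr 1
          · beta_reduce; rw [h2, h1]; rfl
        have h3 : DP full (fun q : G × ((M × M) × M) => q.2.2 = H q.1 q.2.1.1 q.2.1.2) :=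
          h0.graph.le.comp (f := fun q : G × ((M × M) × M) => ((q.1, q.2.1), q.2.2)) (by fun_prop)
        exact DF.of_sq (key q.1.1 h3.1)
      obtain ⟨t, f, h1, h2⟩ := recF_good dH h1 h2
      exact ⟨t, f, h1, h2, by rw [hq, recF_eq h1 h2]⟩
    · rintro ⟨t, f, h1, h2, h3⟩
      rw [h3, recF_eq h1 h2]
  exact DF.comp _ (fun x => (x, f x)) this (by fun_prop)

theorem eps_ind {P : M → Prop} (hP : DP full P) (h : ∀ x, (∀ y, y ∈ x → P y) → P x) (x : M) : P x := by
  by_contra hn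
  obtain ⟨t, ht, hx⟩ := tr_exists x
  obtain ⟨m, hm, hmin⟩ := found (a := sep t fun y => ¬ P y) ⟨x, (mem_sep (DP.not _ hP)).2 ⟨hx, hn⟩⟩
  rw [mem_sep (DP.not _ hP)] at hm
  refine hm.2 (h m fun y hy => ?_)
  by_contra hn
  exact hmin y ((mem_sep (DP.not _ hP)).2 ⟨ht.mem hm.1 hy, hn⟩) hy

/-! ## transitive closure, rank, V -/
noncomputable def trcl : M → M := recF fun x f => cup x (sU (img x fun y => app f y))
@[fun_prop] theorem DF.trcl (f : G → M) (hf : DF c f) : DF c (fun x => trcl (f x)) := by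
  unfold Paper.trcl; fun_prop
theorem trcl_eq (x : M) : trcl x = cup x (sU (img x trcl)) := by
  have d : DF full (fun x : M => trcl x) := by fun_prop
  rw [trcl, recF_spec (by unfold DF2; fun_prop)]
  congr 2
  exact img_congr (by fun_prop) d fun m hm => app_lam d hm
theorem mem_trcl {x z : M} : z ∈ trcl x ↔ z ∈ x ∨ ∃ y, y ∈ x ∧ z ∈ trcl y := by
  have d : DF full (fun x : M => trcl x) := by fun_prop
  rw [trcl_eq, mem_cup, mem_sU]
  simp only [mem_img d]
  constructor
  · rintro (h | ⟨_, ⟨y, hy, rfl⟩, hz⟩)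
    · exact .inl h
    · exact .inr ⟨y, hy, hz⟩
  · rintro (h | ⟨y, hy, hz⟩)
    · exact .inl h
    · exact .inr ⟨_, ⟨y, hy, rfl⟩, hz⟩
theorem sub_trcl (x : M) : x ⊆ trcl x := fun z hz => mem_trcl.2 (.inl hz)
theorem tr_trcl : ∀ x : M, Tr (trcl x) := by
  refine eps_ind (by fun_prop) fun x ih y hy z hz => ?_
  rw [mem_trcl] at hy ⊢
  right
  rcases hy with hy | ⟨w, hw, hy⟩
  · exact ⟨y, hy, sub_trcl y z hz⟩
  · exact ⟨w, hw, ih w hw y hy z hz⟩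
theorem trcl_min {t : M} (ht : Tr t) : ∀ x : M, x ⊆ t → trcl x ⊆ t := by
  refine eps_ind (by fun_prop) fun x ih hx z hz => ?_
  rw [mem_trcl] at hz
  rcases hz with hz | ⟨y, hy, hz⟩
  · exact hx z hz
  · exact ih y hy (ht y (hx y hy)) z hz

noncomputable def rank : M → M := recF fun x f => sU (img x fun y => suc (app f y))
@[fun_prop] theorem DF.rank (f : G → M) (hf : DF c f) : DF c (fun x => rank (f x)) := by
  unfold Paper.rank; fun_prop
theorem rank_eq (x : M) : rank x = sU (img x fun y => suc (rank y)) := by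
  have d : DF full (fun x : M => rank x) := by fun_prop
  conv_lhs => rw [rank, recF_spec (by unfold DF2; fun_prop)]
  congr 1
  exact img_congr (by fun_prop) (by fun_prop) fun m hm => by beta_reduce; congr 1; exact app_lam d hm
theorem mem_rank {x a : M} : a ∈ rank x ↔ ∃ y, y ∈ x ∧ (a ∈ rank y ∨ a = rank y) := by
  rw [rank_eq, mem_sU]
  simp only [mem_img (show DF full (fun y : M => suc (rank y)) by fun_prop)]
  constructor
  · rintro ⟨_, ⟨y, hy, rfl⟩, h⟩; rw [mem_suc] at h; exact ⟨y, hy, h⟩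
  · rintro ⟨y, hy, h⟩; exact ⟨_, ⟨y, hy, rfl⟩, by rwa [mem_suc]⟩
theorem ord_rank : ∀ x : M, Ord (rank x) := by
  refine eps_ind (by fun_prop) fun x ih => ?_
  rw [rank_eq]
  refine ord_sU fun a ha => ?_
  rw [mem_img (by fun_prop)] at ha
  obtain ⟨y, hy, rfl⟩ := ha
  exact (ih y hy).suc
theorem rank_mem {x y : M} (h : y ∈ x) : rank y ∈ rank x := mem_rank.2 ⟨y, h, .inr rfl⟩
theorem rank_le {x a : M} (ha : Ord a) (h : ∀ y, y ∈ x → rank y ∈ a) : rank x ⊆ a := by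
  intro z hz; obtain ⟨y, hy, hz | rfl⟩ := mem_rank.1 hz
  · exact ha.trans (h y hy) hz
  · exact h y hy
theorem rank_mono {x y : M} (h : x ⊆ y) : rank x ⊆ rank y :=
  rank_le (ord_rank y) fun z hz => rank_mem (h z hz)
theorem rank_ord {a : M} (h : Ord a) : rank a = a := by
  refine ord_ind (P := fun a => rank a = a) (by fun_prop) (fun a ha ih => ?_) a h
  apply ext; intro z
  rw [mem_rank]
  constructor
  · rintro ⟨y, hy, h⟩; rw [ih y hy] at h; rcases h with h | rfl
    · exact ha.trans hy h
    · exact hy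
  · intro hz; exact ⟨z, hz, .inr (ih z hz).symm⟩

noncomputable def Vs : M → M := recF fun x f => sU (img x fun y => pow (app f y))
@[fun_prop] theorem DF.Vs [c.Full] (f : G → M) (hf : DF c f) : DF c (fun x => Vs (f x)) := by
  unfold Paper.Vs; fun_prop
theorem Vs_eq (a : M) : Vs a = sU (img a fun y => pow (Vs y)) := by
  have d : DF full (fun x : M => Vs x) := by fun_prop
  conv_lhs => rw [Vs, recF_spec (by unfold DF2; fun_prop)]
  congr 1
  exact img_congr (by fun_prop) (by fun_prop) fun m hm => by beta_reduce; congr 1; exact app_lam d hm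
theorem mem_Vs' {x a : M} : x ∈ Vs a ↔ ∃ b, b ∈ a ∧ x ⊆ Vs b := by
  rw [Vs_eq, mem_sU]; simp only [mem_img (show DF full (fun y : M => pow (Vs y)) by fun_prop)]
  constructor
  · rintro ⟨_, ⟨y, hy, rfl⟩, h⟩
    rw [mem_pow] at h; exact ⟨y, hy, h⟩
  · rintro ⟨y, hy, h⟩
    exact ⟨_, ⟨y, hy, rfl⟩, by rw [mem_pow]; exact h⟩
theorem mem_Vs {x a : M} (ha : Ord a) : x ∈ Vs a ↔ rank x ∈ a := by
  have : ∀ a : M, Ord a → ∀ x : M, x ∈ Vs a ↔ rank x ∈ a := by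
    refine ord_ind (by fun_prop) fun a ha ih x => ?_
    rw [mem_Vs']
    constructor
    · rintro ⟨b, hb, h⟩
      exact Ord.lt_of_le_of_lt (ord_rank x) ha
        (rank_le (ha.mem hb) fun y hy => (ih b hb y).1 (h y hy)) hb
    · intro h
      exact ⟨rank x, h, fun y hy => (ih _ h y).2 (rank_mem hy)⟩
  exact this a ha x
theorem tr_Vs {a : M} (ha : Ord a) : Tr (Vs a) := fun y hy z hz => by
  rw [mem_Vs ha] at hy ⊢; exact ha.trans hy (rank_mem hz)
theorem Vs_sub {x y a : M} (ha : Ord a) (h : x ⊆ y) (hy : y ∈ Vs a) : x ∈ Vs a := by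
  rw [mem_Vs ha] at hy ⊢; exact Ord.lt_of_le_of_lt (ord_rank x) ha (rank_mono h) hy
theorem Vs_mono {a b : M} (hb : Ord b) (h : a ∈ b) : Vs a ⊆ Vs b := fun z hz => by
  rw [mem_Vs hb]; rw [mem_Vs (hb.mem h)] at hz; exact hb.trans h hz
theorem Vs_mono' {a b : M} (ha : Ord a) (hb : Ord b) (h : a ⊆ b) : Vs a ⊆ Vs b := fun z hz => by
  rw [mem_Vs hb]; rw [mem_Vs ha] at hz; exact h _ hz
theorem ord_mem_Vs {a b : M} (ha : Ord a) (hb : Ord b) : b ∈ Vs a ↔ b ∈ a := by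
  rw [mem_Vs ha, rank_ord hb]
theorem mem_Vs_suc (x : M) : x ∈ Vs (suc (rank x)) := by
  rw [mem_Vs (ord_rank x).suc]; simp
theorem Vs_mem {a b : M} (hb : Ord b) (h : a ∈ b) : Vs a ∈ Vs b := mem_Vs'.2 ⟨a, h, Sub.refl _⟩
theorem rank_Vs {a : M} (h : Ord a) : rank (Vs a) = a := by
  apply Sub.antisymm
  · exact rank_le h fun y hy => (mem_Vs h).1 hy
  · have : a ⊆ Vs a := fun z hz => (ord_mem_Vs h (h.mem hz)).2 hz
    have := rank_mono this; rwa [rank_ord h] at this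

theorem vMemE_iff {x a : M} : VMemE ZFM.E x a ↔ Ord a ∧ x ∈ Vs a := by
  simp only [VMemE, VHierE, pairMemE_iff, ordE_iff, subE_iff]
  have dV : DF full (fun x : M => Vs x) := by fun_prop
  constructor
  · rintro ⟨ha, f, ⟨-, hf⟩, b, u, hb, hu, hx⟩
    refine ⟨ha, ?_⟩
    have key : ∀ b, Ord b → b ∈ a → ∀ w : M, pair b w ∈ f → w = Vs b := by
      refine ord_ind (by fun_prop) fun b hb ih hba w hw => ?_
      obtain ⟨⟨w', hw', h1⟩, h2⟩ := hf b hba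
      rw [h2 w w' hw hw']
      apply ext; intro z
      rw [h1 z |> (show z ∈ w' ↔ _ from ·), mem_Vs']
      constructor
      · rintro ⟨g, hg, u, hu, hz⟩
        rw [ih g hg (ha.trans hba hg) u hu] at hz; exact ⟨g, hg, hz⟩
      · rintro ⟨g, hg, hz⟩
        obtain ⟨⟨w'', hw'', -⟩, -⟩ := hf g (ha.trans hba hg)
        exact ⟨g, hg, w'', hw'', by rw [ih g hg (ha.trans hba hg) _ hw'']; exact hz⟩
    rw [key b (ha.mem hb) hb u hu] at hx
    exact mem_Vs'.2 ⟨b, hb, hx⟩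
  · rintro ⟨ha, hx⟩
    refine ⟨ha, lam a Vs, ⟨ha, fun b hb => ⟨⟨Vs b, (pair_mem_lam dV).2 ⟨hb, rfl⟩, fun z => ?_⟩, fun w w' hw hw' => ?_⟩⟩, ?_⟩
    · show z ∈ Vs b ↔ _
      rw [mem_Vs']
      refine exists_congr fun g => and_congr_right fun hg => ?_
      constructor
      · intro h; exact ⟨_, (pair_mem_lam dV).2 ⟨ha.trans hb hg, rfl⟩, h⟩
      · rintro ⟨u, hu, h⟩; rw [pair_mem_lam dV] at hu; rw [← hu.2]; exact h
    · rw [pair_mem_lam dV] at hw hw'; rw [hw.2, hw'.2]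
    · obtain ⟨b, hb, hx⟩ := mem_Vs'.1 hx
      exact ⟨b, Vs b, hb, (pair_mem_lam dV).2 ⟨hb, rfl⟩, hx⟩

theorem collection {P : M → M → Prop} (hP : DP full (fun q : M × M => P q.1 q.2)) (a : M) :
    ∃ b : M, ∀ x, x ∈ a → (∃ y, P x y) → ∃ y, y ∈ b ∧ P x y := by
  have d2 : DP full (fun q : (M × M) × M => P q.1.1 q.2) :=
    hP.comp (f := fun q : (M × M) × M => (q.1.1, q.2)) (by fun_prop)
  have d1 : DP full (fun q : M × M => ∃ y, rank y = q.2 ∧ P q.1 y) := by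
    refine DP.ex (fun (q : M × M) y => rank y = q.2 ∧ P q.1 y) (DP.and _ _ (by fun_prop) d2)
  have dm : DF full (fun x : M => suc (mu fun α => ∃ y, rank y = α ∧ P x y)) :=
    DF.suc _ (DF.mu (fun x α => ∃ y, rank y = α ∧ P x y) d1)
  have ho : Ord (sU (img a fun x : M => suc (mu fun α => ∃ y, rank y = α ∧ P x y))) :=
    ord_sU fun z hz => by
      rw [mem_img dm] at hz; obtain ⟨x, hx, rfl⟩ := hz; exact ord_mu.suc
  refine ⟨Vs (sU (img a fun x => suc (mu fun α => ∃ y, rank y = α ∧ P x y))), fun x hx ⟨y, hy⟩ => ?_⟩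
  obtain ⟨h1, ⟨y', hy', h2⟩, -⟩ := mu_spec (P := fun α => ∃ y, rank y = α ∧ P x y)
    (d1.slice (P := fun x α => ∃ y, rank y = α ∧ P x y) x) ⟨rank y, ord_rank y, y, rfl, hy⟩
  refine ⟨y', ?_, h2⟩
  rw [mem_Vs ho, mem_sU]
  simp only [mem_img dm]
  exact ⟨_, ⟨x, hx, rfl⟩, by rw [mem_suc]; exact .inr hy'⟩
end Recu
end Paper
namespace Paper
section Sig
variable {M : Type} [ZFM M]

/-- `Δ₀` relations -/
def D0 {k : ℕ} (P : (Fin k → M) → Prop) : Prop :=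
  ∃ φ : SetFormula k, IsDelta0 φ ∧ ∀ v, P v ↔ Realize ZFM.E φ v

theorem D0.congr {k : ℕ} {P R : (Fin k → M) → Prop} (h : D0 P) (e : ∀ v, R v ↔ P v) : D0 R := by
  have : R = P := funext fun v => propext (e v)
  rwa [this]
theorem D0.neg {k : ℕ} {P : (Fin k → M) → Prop} (h : D0 P) : D0 (fun v => ¬ P v) := by
  obtain ⟨φ, h1, h2⟩ := h
  exact ⟨φ.not, .imp h1 .fal, fun v => by simp [h2]⟩
theorem D0.imp {k : ℕ} {P R : (Fin k → M) → Prop} (h : D0 P) (h' : D0 R) : D0 (fun v => P v → R v) := by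
  obtain ⟨φ, h1, h2⟩ := h; obtain ⟨ψ, h3, h4⟩ := h'
  exact ⟨φ.imp ψ, .imp h1 h3, fun v => by simp [h2, h4]⟩
theorem D0.and {k : ℕ} {P R : (Fin k → M) → Prop} (h : D0 P) (h' : D0 R) : D0 (fun v => P v ∧ R v) :=
  (h.imp h'.neg).neg.congr fun v => by tauto
theorem D0.or {k : ℕ} {P R : (Fin k → M) → Prop} (h : D0 P) (h' : D0 R) : D0 (fun v => P v ∨ R v) :=
  (h.neg.imp h').congr fun v => by tauto
theorem D0.re {k l : ℕ} {P : (Fin k → M) → Prop} (σ : Fin k → Fin l) (h : D0 P) :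
    D0 (fun v => P (v ∘ σ)) := by
  obtain ⟨φ, h1, h2⟩ := h
  exact ⟨φ.ren σ, h1.ren σ, fun v => by beta_reduce; rw [realize_ren, h2]⟩
theorem D0.ball {k : ℕ} (j : Fin k) {P : (Fin (k+1) → M) → Prop} (h : D0 P) :
    D0 (fun v => ∀ y, y ∈ v j → P (Fin.snoc v y)) := by
  obtain ⟨φ, h1, h2⟩ := h
  exact ⟨_, .ball j h1, fun v => by simp [h2, mem_def]⟩
theorem D0.bex {k : ℕ} (j : Fin k) {P : (Fin (k+1) → M) → Prop} (h : D0 P) :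
    D0 (fun v => ∃ y, y ∈ v j ∧ P (Fin.snoc v y)) :=
  (h.neg.ball j).neg.congr fun v => by simp

def S1 {k : ℕ} (P : (Fin k → M) → Prop) : Prop :=
  ∃ R : (Fin (k+1) → M) → Prop, D0 R ∧ ∀ v, P v ↔ ∃ y, R (Fin.snoc v y)

theorem D0.s1 {k : ℕ} {P : (Fin k → M) → Prop} (h : D0 P) : S1 P :=
  ⟨_, h.re Fin.castSucc, fun v => by
    have : ∀ y, (Fin.snoc v y : Fin (k+1) → M) ∘ Fin.castSucc = v := fun y => by funext i; simp
    simp only [this]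
    exact ⟨fun h => ⟨emp, h⟩, fun ⟨_, h⟩ => h⟩⟩

theorem S1.congr {k : ℕ} {P R : (Fin k → M) → Prop} (h : S1 P) (e : ∀ v, R v ↔ P v) : S1 R := by
  have : R = P := funext fun v => propext (e v)
  rwa [this]

theorem snoc3a {k : ℕ} (v : Fin k → M) (w y z : M) :
    (Fin.snoc (Fin.snoc (Fin.snoc v w : Fin (k+1) → M) y : Fin (k+2) → M) z : Fin (k+3) → M) ∘
      (Fin.snoc (fun i => i.castSucc.castSucc.castSucc) (Fin.last (k+1)).castSucc : Fin (k+1) → Fin (k+3))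
      = (Fin.snoc v y : Fin (k+1) → M) := by
  funext i; refine Fin.lastCases ?_ (fun i => ?_) i <;> simp
theorem snoc3b {k : ℕ} (v : Fin k → M) (w y z : M) :
    (Fin.snoc (Fin.snoc (Fin.snoc v w : Fin (k+1) → M) y : Fin (k+2) → M) z : Fin (k+3) → M) ∘
      (Fin.snoc (fun i => i.castSucc.castSucc.castSucc) (Fin.last (k+2)) : Fin (k+1) → Fin (k+3))
      = (Fin.snoc v z : Fin (k+1) → M) := by
  funext i; refine Fin.lastCases ?_ (fun i => ?_) i <;> simp
theorem snoc3c {k : ℕ} (v : Fin k → M) (w y z : M) :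
    (Fin.snoc (Fin.snoc (Fin.snoc v w : Fin (k+1) → M) y : Fin (k+2) → M) z : Fin (k+3) → M) ∘
      (Fin.snoc (Fin.snoc (fun i => i.castSucc.castSucc.castSucc) (Fin.last (k+1)).castSucc
        : Fin (k+1) → Fin (k+3)) (Fin.last (k+2)) : Fin (k+2) → Fin (k+3))
      = (Fin.snoc (Fin.snoc v y : Fin (k+1) → M) z : Fin (k+2) → M) := by
  funext i; refine Fin.lastCases ?_ (fun i => ?_) i
  · simp
  · refine Fin.lastCases ?_ (fun i => ?_) i <;> simp

theorem S1.and {k : ℕ} {P R : (Fin k → M) → Prop} (h : S1 P) (h' : S1 R) : S1 (fun v => P v ∧ R v) := by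
  obtain ⟨A, h1, h2⟩ := h; obtain ⟨B, h3, h4⟩ := h'
  have d := ((h1.re (Fin.snoc (fun i => i.castSucc.castSucc.castSucc) (Fin.last (k+1)).castSucc :
    Fin (k+1) → Fin (k+3))).and (h3.re (Fin.snoc (fun i => i.castSucc.castSucc.castSucc)
    (Fin.last (k+2)) : Fin (k+1) → Fin (k+3)))).bex (Fin.last k).castSucc |>.bex (Fin.last k)
  refine ⟨_, d, fun v => ?_⟩
  simp only [snoc3a, snoc3b, Fin.snoc_castSucc, Fin.snoc_last, h2, h4]
  constructor
  · rintro ⟨⟨y, hy⟩, ⟨z, hz⟩⟩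
    exact ⟨up y z, y, by simp, z, by simp, hy, hz⟩
  · rintro ⟨w, y, -, z, -, hy, hz⟩; exact ⟨⟨y, hy⟩, ⟨z, hz⟩⟩
theorem S1.or {k : ℕ} {P R : (Fin k → M) → Prop} (h : S1 P) (h' : S1 R) : S1 (fun v => P v ∨ R v) := by
  obtain ⟨A, h1, h2⟩ := h; obtain ⟨B, h3, h4⟩ := h'
  refine ⟨_, h1.or h3, fun v => ?_⟩
  simp only [h2, h4, exists_or]
theorem S1.ex {k : ℕ} {P : (Fin (k+1) → M) → Prop} (h : S1 P) : S1 (fun v => ∃ y, P (Fin.snoc v y)) := by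
  obtain ⟨A, h1, h2⟩ := h
  have d := (h1.re (Fin.snoc (Fin.snoc (fun i => i.castSucc.castSucc.castSucc) (Fin.last (k+1)).castSucc
        : Fin (k+1) → Fin (k+3)) (Fin.last (k+2)) : Fin (k+2) → Fin (k+3))).bex (Fin.last k).castSucc
        |>.bex (Fin.last k)
  refine ⟨_, d, fun v => ?_⟩
  simp only [snoc3c, Fin.snoc_castSucc, Fin.snoc_last, h2]
  constructor
  · rintro ⟨y, z, hz⟩
    exact ⟨up y z, y, by simp, z, by simp, hz⟩
  · rintro ⟨w, y, -, z, -, hz⟩; exact ⟨y, z, hz⟩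

theorem D0.any {k : ℕ} {P : (Fin k → M) → Prop} (h : D0 P) : AnyQ (fun _ => True) P := by
  obtain ⟨φ, -, h2⟩ := h
  exact (AnyQ.form φ).congr h2

theorem S1.ball {k : ℕ} {P : (Fin (k+1) → M) → Prop} (j : Fin k) (h : S1 P) :
    S1 (fun v => ∀ y, y ∈ v j → P (Fin.snoc v y)) := by
  obtain ⟨A, h1, h2⟩ := h
  have d := ((h1.re (Fin.snoc (Fin.snoc (fun i => i.castSucc.castSucc.castSucc) (Fin.last (k+1)).castSucc
        : Fin (k+1) → Fin (k+3)) (Fin.last (k+2)) : Fin (k+2) → Fin (k+3))).bex (Fin.last k).castSucc).ball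
          (j.castSucc)
  refine ⟨_, d, fun v => ?_⟩
  simp only [snoc3c, Fin.snoc_castSucc, Fin.snoc_last, h2]
  constructor
  · intro h
    have dP : DP full (fun q : M × M => A (Fin.snoc (Fin.snoc v q.1 : Fin (k+1) → M) q.2)) := by
      refine SQ.dp ⟨fun u : Fin 2 → M => A (Fin.snoc (Fin.snoc v (u 0) : Fin (k+1) → M) (u 1)), ?_, fun q => ?_⟩
      · obtain ⟨φ, -, hφ⟩ := h1
        refine ⟨k, v, φ, fun _ => trivial, ?_⟩
        intro (u : Fin 2 → M)
        beta_reduce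
        rw [hφ]
        have e : u = Fin.snoc (fun _ : Fin 1 => u 0) (u 1) := by
          funext i; fin_cases i <;> rfl
        rw [e, append_snoc', Fin.append_right_eq_snoc]
        rfl
      · have e1 : Ctx.get q 0 = q.1 := rfl
        have e2 : Ctx.get q 1 = q.2 := rfl
        beta_reduce; rw [e1, e2]
    obtain ⟨b, hb⟩ := collection (P := fun x y => A (Fin.snoc (Fin.snoc v x : Fin (k+1) → M) y)) dP (v j)
    exact ⟨b, fun x hx => hb x hx (h x hx)⟩
  · rintro ⟨w, h⟩ y hy
    obtain ⟨z, -, hz⟩ := h y hy; exact ⟨z, hz⟩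

theorem S1.re {k l : ℕ} {P : (Fin k → M) → Prop} (σ : Fin k → Fin l) (h : S1 P) :
    S1 (fun v => P (v ∘ σ)) := by
  obtain ⟨A, h1, h2⟩ := h
  refine ⟨_, h1.re (Fin.snoc (fun i => (σ i).castSucc) (Fin.last l)), fun v => ?_⟩
  simp only [snoc_comp_lift, h2]

variable (M) in
def sig1 : Calc M where
  Q := S1
  le := by
    rintro k P ⟨A, h1, h2⟩
    exact h1.any.ex.congr h2
  mem := D0.s1 ⟨.mem 0 1, .mem _ _, fun v => Iff.rfl⟩
  nmem := D0.s1 (D0.neg ⟨.mem 0 1, .mem _ _, fun v => Iff.rfl⟩)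
  eq := D0.s1 ⟨.eq 0 1, .eq _ _, fun v => Iff.rfl⟩
  neq := D0.s1 (D0.neg ⟨.eq 0 1, .eq _ _, fun v => Iff.rfl⟩)
  tt := D0.s1 ((D0.neg ⟨.fal, .fal, fun v => Iff.rfl⟩).congr fun v => by simp)
  ff := D0.s1 ⟨.fal, .fal, fun v => Iff.rfl⟩
  and := S1.and
  or := S1.or
  ex := S1.ex
  ball := S1.ball
  re := S1.re
end Sig
end Paper
namespace Paper
section Card
variable {M : Type} [ZFM M] {G : Type} [Ctx M G] {c : Calc M}

theorem Inj.mem {f a b x : M} (h : Inj f a b) (hx : x ∈ a) : app f x ∈ b := h.1.2 x hx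
theorem Inj.inj {f a b x y : M} (h : Inj f a b) (hx : x ∈ a) (hy : y ∈ a) (e : app f x = app f y) : x = y :=
  h.2 x hx y hy e
theorem Sur.mem {f a b x : M} (h : Sur f a b) (hx : x ∈ a) : app f x ∈ b := h.1.2 x hx
theorem Sur.sur {f a b y : M} (h : Sur f a b) (hy : y ∈ b) : ∃ x, x ∈ a ∧ app f x = y := h.2 y hy
theorem inj_lam {a b : M} {F : M → M} (hF : DF full F) (h : ∀ x, x ∈ a → F x ∈ b)
    (h' : ∀ x, x ∈ a → ∀ y, y ∈ a → F x = F y → x = y) : Inj (lam a F) a b :=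
  ⟨fnTo_lam hF h, fun x hx y hy e => h' x hx y hy (by rwa [app_lam hF hx, app_lam hF hy] at e)⟩
theorem sur_lam {a b : M} {F : M → M} (hF : DF full F) (h : ∀ x, x ∈ a → F x ∈ b)
    (h' : ∀ y, y ∈ b → ∃ x, x ∈ a ∧ F x = y) : Sur (lam a F) a b :=
  ⟨fnTo_lam hF h, fun y hy => by
    obtain ⟨x, hx, e⟩ := h' y hy; exact ⟨x, hx, (app_lam hF hx).trans e⟩⟩

def LeC (a b : M) : Prop := ∃ f, Inj f a b
def EqC (a b : M) : Prop := ∃ f, Bij f a b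
@[fun_prop] theorem DP.LeC [c.Full] (f g : G → M) (hf : DF c f) (hg : DF c g) :
    DP c (fun x => LeC (f x) (g x)) := by unfold Paper.LeC; fun_prop
@[fun_prop] theorem DP.EqC [c.Full] (f g : G → M) (hf : DF c f) (hg : DF c g) :
    DP c (fun x => EqC (f x) (g x)) := by unfold Paper.EqC; fun_prop
theorem leC_of {a b : M} (F : M → M) (hF : DF full F) (h : ∀ x, x ∈ a → F x ∈ b)
    (h' : ∀ x, x ∈ a → ∀ y, y ∈ a → F x = F y → x = y) : LeC a b := ⟨_, inj_lam hF h h'⟩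
theorem leC_sub {a b : M} (h : a ⊆ b) : LeC a b := leC_of (fun x => x) (by fun_prop) h (fun _ _ _ _ e => e)
theorem LeC.refl (a : M) : LeC a a := leC_sub (Sub.refl a)
theorem LeC.trans {a b d : M} (h : LeC a b) (h' : LeC b d) : LeC a d := by
  obtain ⟨f, hf⟩ := h; obtain ⟨g, hg⟩ := h'
  exact leC_of (fun x => app g (app f x)) (by fun_prop) (fun x hx => hg.mem (hf.mem hx))
    (fun x hx y hy e => hf.inj hx hy (hg.inj (hf.mem hx) (hf.mem hy) e))
theorem EqC.le {a b : M} (h : EqC a b) : LeC a b := by obtain ⟨f, hf⟩ := h; exact ⟨f, hf.1⟩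
/-- inverse image point -/
noncomputable def finv (f a y : M) : M := sU (sep a fun x => app f x = y)
@[fun_prop] theorem DF.finv (f g h : G → M) (hf : DF c f) (hg : DF c g) (hh : DF c h) :
    DF c (fun x => finv (f x) (g x) (h x)) := by unfold Paper.finv; fun_prop
theorem finv_eq {f a x y : M} (h : ∀ x', x' ∈ a → app f x' = y → x' = x) (hx : x ∈ a) (e : app f x = y) :
    finv f a y = x := by
  apply ext; intro z
  rw [finv, mem_sU]
  constructor
  · rintro ⟨u, hu, hz⟩; rw [mem_sep (by fun_prop)] at hu; rwa [← h u hu.1 hu.2]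
  · intro hz; exact ⟨x, by rw [mem_sep (by fun_prop)]; exact ⟨hx, e⟩, hz⟩
theorem Inj.finv {f a b x : M} (h : Inj f a b) (hx : x ∈ a) : finv f a (app f x) = x :=
  finv_eq (fun x' hx' e => h.inj hx' hx e) hx rfl
theorem Bij.finv_mem {f a b y : M} (h : Bij f a b) (hy : y ∈ b) : Paper.finv f a y ∈ a := by
  obtain ⟨x, hx, rfl⟩ := h.2.sur hy; rwa [h.1.finv hx]
theorem Bij.app_finv {f a b y : M} (h : Bij f a b) (hy : y ∈ b) : app f (Paper.finv f a y) = y := by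
  obtain ⟨x, hx, rfl⟩ := h.2.sur hy; rw [h.1.finv hx]
theorem Bij.symm {f a b : M} (h : Bij f a b) : Bij (lam b (Paper.finv f a)) b a := by
  refine ⟨inj_lam (by fun_prop) (fun y hy => h.finv_mem hy) ?_, sur_lam (by fun_prop) (fun y hy => h.finv_mem hy) ?_⟩
  · intro x hx y hy e; rw [← h.app_finv hx, e, h.app_finv hy]
  · intro x hx; exact ⟨app f x, h.1.mem hx, h.1.finv hx⟩
theorem EqC.symm {a b : M} (h : EqC a b) : EqC b a := by obtain ⟨f, hf⟩ := h; exact ⟨_, hf.symm⟩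
theorem eqC_of {a b : M} (F : M → M) (hF : DF full F) (h : ∀ x, x ∈ a → F x ∈ b)
    (h' : ∀ x, x ∈ a → ∀ y, y ∈ a → F x = F y → x = y) (h'' : ∀ y, y ∈ b → ∃ x, x ∈ a ∧ F x = y) :
    EqC a b := ⟨_, inj_lam hF h h', sur_lam hF h h''⟩
theorem EqC.trans {a b d : M} (h : EqC a b) (h' : EqC b d) : EqC a d := by
  obtain ⟨f, hf⟩ := h; obtain ⟨g, hg⟩ := h'
  refine eqC_of (fun x => app g (app f x)) (by fun_prop) (fun x hx => hg.1.mem (hf.1.mem hx))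
    (fun x hx y hy e => hf.1.inj hx hy (hg.1.inj (hf.1.mem hx) (hf.1.mem hy) e)) ?_
  intro y hy
  obtain ⟨u, hu, rfl⟩ := hg.2.sur hy
  obtain ⟨x, hx, rfl⟩ := hf.2.sur hu
  exact ⟨x, hx, rfl⟩
theorem EqC.refl (a : M) : EqC a a :=
  eqC_of (fun x => x) (by fun_prop) (fun _ h => h) (fun _ _ _ _ e => e) (fun y hy => ⟨y, hy, rfl⟩)

open Classical in
theorem cantor_bernstein {a b : M} (h : LeC a b) (h' : LeC b a) : EqC a b := by
  obtain ⟨f, hf⟩ := h; obtain ⟨g, hg⟩ := h'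
  let Φ : M → M := fun X => diff a (img (diff b (img X (app f))) (app g))
  have dΦ : DF full Φ := by fun_prop
  have mono : ∀ X Y : M, X ⊆ Y → Φ X ⊆ Φ Y := by
    intro X Y hXY z hz
    simp only [Φ, mem_diff, mem_img (show DF full (app f) by fun_prop),
      mem_img (show DF full (app g) by fun_prop)] at hz ⊢
    refine ⟨hz.1, fun ⟨y, ⟨hy, hy'⟩, e⟩ => hz.2 ⟨y, ⟨hy, fun ⟨x, hx, e'⟩ => hy' ⟨x, hXY x hx, e'⟩⟩, e⟩⟩
  let S := sU (sep (pow a) fun X => X ⊆ Φ X)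
  have dS : DP full (fun X : M => X ⊆ Φ X) := by fun_prop
  have hS : S ⊆ Φ S := by
    intro z hz
    obtain ⟨X, hX, hzX⟩ := mem_sU.1 hz
    have hX2 := hX
    rw [mem_sep dS] at hX
    exact mono X S (fun u hu => mem_sU.2 ⟨X, hX2, hu⟩) z (hX.2 z hzX)
  have Φa : ∀ X, Φ X ⊆ a := fun X z hz => (mem_diff.1 hz).1
  have hS' : Φ S ⊆ S := fun z hz =>
    mem_sU.2 ⟨Φ S, by rw [mem_sep dS, mem_pow]; exact ⟨Φa _, mono _ _ hS⟩, hz⟩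
  have Sa : S ⊆ a := Sub.trans hS (Φa _)
  have out : ∀ z, z ∈ a → ¬ z ∈ S → ∃ y, y ∈ b ∧ z = app g y ∧ ∀ x, x ∈ S → y ≠ app f x := by
    intro z hz hzS
    by_contra hc
    refine hzS (hS' z (mem_diff.2 ⟨hz, fun hi => hc ?_⟩))
    obtain ⟨y, hy, e⟩ := (mem_img (show DF full (app g) by fun_prop)).1 hi
    rw [mem_diff, mem_img (show DF full (app f) by fun_prop)] at hy
    exact ⟨y, hy.1, e, fun x hx e => hy.2 ⟨x, hx, e⟩⟩
  let F : M → M := fun x => if x ∈ S then app f x else finv g b x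
  have F1 : ∀ x, x ∈ S → F x = app f x := fun x hx => if_pos hx
  have F2 : ∀ x, ¬ x ∈ S → F x = finv g b x := fun x hx => if_neg hx
  have F3 : ∀ x, x ∈ a → ¬ x ∈ S → F x ∈ b ∧ app g (F x) = x ∧ ∀ x', x' ∈ S → F x ≠ app f x' := by
    intro x hx hS
    obtain ⟨y, hy, e, h⟩ := out x hx hS
    rw [F2 x hS]
    have := hg.finv hy; rw [← e] at this; rw [this]; exact ⟨hy, e.symm, h⟩
  refine eqC_of F (by fun_prop) ?_ ?_ ?_
  · intro x hx
    by_cases hxS : x ∈ S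
    · rw [F1 x hxS]; exact hf.mem hx
    · exact (F3 x hx hxS).1
  · intro x hx y hy e
    by_cases hxS : x ∈ S <;> by_cases hyS : y ∈ S
    · rw [F1 x hxS, F1 y hyS] at e; exact hf.inj hx hy e
    · rw [F1 x hxS] at e; exact ((F3 y hy hyS).2.2 x hxS e.symm).elim
    · rw [F1 y hyS] at e; exact ((F3 x hx hxS).2.2 y hyS e).elim
    · rw [← (F3 x hx hxS).2.1, e, (F3 y hy hyS).2.1]
  · intro y hy
    by_cases hy' : ∃ x, x ∈ S ∧ y = app f x
    · obtain ⟨x, hx, e⟩ := hy'; exact ⟨x, Sa x hx, by rw [F1 x hx, e]⟩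
    · have hgy : ¬ app g y ∈ S := fun hc => by
        have := hS _ hc
        rw [mem_diff] at this
        refine this.2 ((mem_img (show DF full (app g) by fun_prop)).2 ⟨y, ?_, rfl⟩)
        rw [mem_diff, mem_img (show DF full (app f) by fun_prop)]
        exact ⟨hy, hy'⟩
      exact ⟨app g y, hg.mem hy, by rw [F2 _ hgy, hg.finv hy]⟩

/-! choice -/
theorem choice_fn (X : M) : ∃ g : M, ∀ s, s ⊆ X → (∃ z, z ∈ s) → app g s ∈ s := by
  have d0 : DF full (fun s : M => img s fun z => pair s z) := by fun_prop
  have d1 : DP full (fun s : M => bex s fun _ => True) := by fun_prop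
  let A := img (sep (pow X) fun s => bex s fun _ => True) fun s => img s fun z => pair s z
  have memA : ∀ t, t ∈ A ↔ ∃ s, (s ⊆ X ∧ ∃ z, z ∈ s) ∧ t = img s fun z => pair s z := by
    intro t; simp only [A, mem_img d0, mem_sep d1, mem_pow]; simp only [bex, and_true]
  have memT : ∀ s p : M, p ∈ (img s fun z => pair s z) ↔ ∃ z, z ∈ s ∧ p = pair s z := fun s p =>
    mem_img (by fun_prop)
  obtain ⟨k, hk⟩ := (ZFM.zfc (M := M)).2.2.2 A (by
      intro t ht
      obtain ⟨s, ⟨_, z, hz⟩, rfl⟩ := (memA t).1 ht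
      exact ⟨pair s z, (memT _ _).2 ⟨z, hz, rfl⟩⟩) (by
      rintro x y hx hy hxy ⟨p, hp, hp'⟩
      obtain ⟨s, _, rfl⟩ := (memA _).1 hx
      obtain ⟨s', _, rfl⟩ := (memA _).1 hy
      obtain ⟨z, -, rfl⟩ := (memT _ _).1 hp
      obtain ⟨z', -, e⟩ := (memT _ _).1 hp'
      obtain ⟨rfl, -⟩ := pair_inj.1 e
      exact hxy rfl)
  have dk : DP full (fun p : M => ∃ s z, z ∈ s ∧ p = pair s z) := by fun_prop
  refine ⟨sep k fun p => ∃ s z, z ∈ s ∧ p = pair s z, fun s hs hz => ?_⟩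
  obtain ⟨p, hp1, hp2, hp3⟩ := hk _ ((memA _).2 ⟨s, ⟨hs, hz⟩, rfl⟩)
  obtain ⟨z, hz, rfl⟩ := (memT _ _).1 hp2
  have : app (sep k fun p => ∃ s z, z ∈ s ∧ p = pair s z) s = z := by
    apply app_eq
    · rw [mem_sep dk]; exact ⟨hp1, s, z, hz, rfl⟩
    · intro y hy
      rw [mem_sep dk] at hy
      obtain ⟨h1, s', z', h2, e⟩ := hy
      obtain ⟨rfl, rfl⟩ := pair_inj.1 e
      exact (pair_inj.1 (hp3 _ h1 ((memT _ _).2 ⟨_, h2, rfl⟩))).2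
  rw [this]; exact hz

theorem no_all_ord (S : M) : ∃ a : M, Ord a ∧ ¬ a ∈ S :=
  ⟨rank S, ord_rank S, fun h => by
    have := rank_mem h; rw [rank_ord (ord_rank S)] at this; exact mem_irrefl _ this⟩

theorem eqC_ord (X : M) : ∃ a : M, Ord a ∧ EqC a X := by
  obtain ⟨g, hg⟩ := choice_fn X
  let F : M → M := recF fun x f => app g (diff X (img x (app f)))
  have dF : DF full F := recF_df1 (by unfold DF2; fun_prop)
  have eF : ∀ x, F x = app g (diff X (img x F)) := by
    intro x
    conv_lhs => rw [show F = recF _ from rfl, recF_spec (by unfold DF2; fun_prop)]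
    congr 2
    exact img_congr (by fun_prop) dF fun y hy => app_lam dF hy
  have mD : ∀ x z, z ∈ diff X (img x F) ↔ z ∈ X ∧ ∀ y, y ∈ x → z ≠ F y := by
    intro x z; rw [mem_diff, mem_img dF]; simp only [not_exists, not_and, ne_eq]
  have dfull : DP full (fun x : M => diff X (img x F) = emp) := by fun_prop
  have good : ∀ x, diff X (img x F) ≠ emp → F x ∈ X ∧ ∀ y, y ∈ x → F x ≠ F y := by
    intro x hx
    have := hg _ (fun z hz => ((mD x z).1 hz).1) (ne_emp.1 hx)
    rw [← eF, mD] at this; exact this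
  have ex : ∃ a : M, Ord a ∧ diff X (img a F) = emp := by
    by_contra hc
    push Not at hc
    obtain ⟨a, ha, hn⟩ := no_all_ord (img X fun y => mu fun a => F a = y)
    refine hn ?_
    rw [mem_img (by fun_prop)]
    refine ⟨F a, (good a (hc a ha)).1, (mu_eq (P := fun b => F b = F a) ha rfl fun y hy e => ?_).symm⟩
    exact (good a (hc a ha)).2 y hy e.symm
  obtain ⟨a, ha, h1, h2⟩ := ord_min dfull ex
  refine ⟨a, ha, eqC_of F dF (fun x hx => (good x (h2 x hx)).1) ?_ ?_⟩
  · intro x hx y hy e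
    rcases ord_tri (ha.mem hx) (ha.mem hy) with h | h | h
    · exact ((good y (h2 y hy)).2 x h e.symm).elim
    · exact h
    · exact ((good x (h2 x hx)).2 y h e).elim
  · intro y hy
    by_contra hc
    have : y ∈ diff X (img a F) := (mD a y).2 ⟨hy, fun x hx e => hc ⟨x, hx, e.symm⟩⟩
    rw [h1] at this; exact mem_emp this

/-! cardinals -/
def Cd (a : M) : Prop := Ord a ∧ ball a fun x => ¬ EqC x a
@[fun_prop] theorem DP.Cd [c.Full] (f : G → M) (hf : DF c f) : DP c (fun x => Cd (f x)) := by
  unfold Paper.Cd; fun_prop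
theorem cardE_iff {a : M} : CardE ZFM.E a ↔ Cd a := by
  simp only [CardE, Cd, ball, EqC, bijE_iff]; rfl
theorem Cd.ord {a : M} (h : Cd a) : Ord a := h.1
theorem Cd.not_le {a b : M} (h : Cd a) (hb : b ∈ a) : ¬ LeC a b := fun hl =>
  h.2 b hb (cantor_bernstein (leC_sub (h.1.sub hb)) hl)
theorem eqC_cd (X : M) : ∃ a : M, Cd a ∧ EqC a X := by
  obtain ⟨a, ha, h1, h2⟩ := ord_min (P := fun a => EqC a X) (by fun_prop) (eqC_ord X)
  exact ⟨a, ⟨ha, fun x hx e => h2 x hx (e.trans h1)⟩, h1⟩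
theorem cantor (X : M) : ¬ LeC (pow X) X := by
  rintro ⟨f, hf⟩
  have d : DP full (fun x : M => ¬ x ∈ finv f (pow X) x) := by fun_prop
  let D := sep X fun x => ¬ x ∈ finv f (pow X) x
  have hD : D ∈ pow X := mem_pow.2 fun z hz => ((mem_sep d).1 hz).1
  have := mem_sep d (a := X) (z := app f D)
  rw [hf.finv hD] at this
  have h2 := hf.mem hD
  change app f D ∈ D ↔ _ at this
  tauto
theorem Sur.leC {f a b : M} (ha : Ord a) (h : Sur f a b) : LeC b a := by
  have d : ∀ y : M, DP full (fun x : M => x ∈ a ∧ app f x = y) := fun y => by fun_prop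
  have s : ∀ y, y ∈ b → _ := fun y hy => mu_spec (d y) (by
    obtain ⟨x, hx, e⟩ := h.sur hy; exact ⟨x, ha.mem hx, hx, e⟩)
  refine leC_of (fun y => mu fun x => x ∈ a ∧ app f x = y) (by fun_prop) (fun y hy => (s y hy).2.1.1) ?_
  intro x hx y hy e
  rw [← (s x hx).2.1.2, ← (s y hy).2.1.2]; beta_reduce at e; rw [e]
theorem leC_of_sur {f a b : M} (h : Sur f a b) : LeC b a := by
  obtain ⟨d, hd, g, hg⟩ := eqC_ord a
  refine LeC.trans (Sur.leC hd (f := lam d fun x => app f (app g x)) (sur_lam (by fun_prop)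
    (fun x hx => h.mem (hg.1.mem hx)) fun y hy => ?_)) (EqC.le ⟨g, hg⟩)
  obtain ⟨x, hx, rfl⟩ := h.sur hy
  exact ⟨finv g d x, hg.finv_mem hx, by rw [hg.app_finv hx]⟩
open Classical in
theorem LeC.sur {a b : M} (h : LeC a b) (hne : ∃ x, x ∈ a) : ∃ f, Sur f b a := by
  obtain ⟨f, hf⟩ := h
  obtain ⟨x0, hx0⟩ := hne
  have d : DP full (fun y : M => bex a fun x => app f x = y) := by fun_prop
  let F : M → M := fun y => if (bex a fun x => app f x = y) then finv f a y else x0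
  have F1 : ∀ y, (bex a fun x => app f x = y) → F y = finv f a y := fun y h => if_pos h
  refine ⟨_, sur_lam (F := F) (by fun_prop) ?_ ?_⟩
  · intro y hy
    by_cases hb : bex a fun x => app f x = y
    · rw [F1 y hb]; obtain ⟨x, hx, rfl⟩ := hb; rwa [hf.finv hx]
    · rw [show F y = x0 from if_neg hb]; exact hx0
  · intro x hx
    exact ⟨app f x, hf.mem hx, by rw [F1 _ ⟨x, hx, rfl⟩, hf.finv hx]⟩
/-- next cardinal -/
theorem next_cd (X : M) : ∃ b : M, Cd b ∧ ¬ LeC b X := by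
  obtain ⟨b, hb, e⟩ := eqC_cd (pow X)
  exact ⟨b, hb, fun h => cantor X (e.symm.le.trans h)⟩
theorem Cd.lt_of_not_le {a b : M} (ha : Ord a) (hb : Ord b) (h : ¬ LeC b a) : a ∈ b := by
  rcases ha.lt_or_le hb with h' | h'
  · exact h'
  · exact (h (leC_sub h')).elim
theorem Cd.lim {a : M} (h : Cd a) (hw : om ⊆ a) : Lim a := by
  rcases ord_cases h.1 with e | ⟨b, hb, e⟩ | hl
  · have := hw _ emp_om; rw [e] at this; exact (mem_emp this).elim
  ·
    exfalso
    have hwb : om ⊆ b := by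
      intro n hn
      have := hw _ (suc_om hn)
      rw [e] at this
      rcases mem_suc.1 this with h | h
      · exact hb.trans h (self_mem_suc n)
      · rw [← h]; exact self_mem_suc n
    refine h.not_le (b := b) (by rw [e]; exact self_mem_suc b) ?_
    classical
    let F : M → M := fun x => if x = b then emp else if x ∈ (om : M) then suc x else x
    have F1 : F b = emp := if_pos rfl
    have F2 : ∀ x, x ∈ b → x ∈ (om : M) → F x = suc x := fun x h h' => by
      have : x ≠ b := fun e => mem_irrefl b (e ▸ h)
      show (if x = b then emp else if x ∈ (om : M) then suc x else x) = _; rw [if_neg this, if_pos h']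
    have F3 : ∀ x, x ∈ b → ¬ x ∈ (om : M) → F x = x := fun x h h' => by
      have : x ≠ b := fun e => mem_irrefl b (e ▸ h)
      show (if x = b then emp else if x ∈ (om : M) then suc x else x) = _; rw [if_neg this, if_neg h']
    have sne : ∀ x : M, suc x ≠ (emp : M) := fun x e => by have := self_mem_suc x; rw [e] at this; exact mem_emp this
    refine leC_of F (by fun_prop) ?_ ?_
    · intro x hx
      rw [e] at hx
      rcases mem_suc.1 hx with hx | rfl
      · by_cases hxo : x ∈ (om : M)
        · rw [F2 x hx hxo]; exact hwb _ (suc_om hxo)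
        · rwa [F3 x hx hxo]
      · rw [F1]; exact hwb _ emp_om
    · intro x hx y hy exy
      rw [e] at hx hy
      rcases mem_suc.1 hx with hx | rfl <;> rcases mem_suc.1 hy with hy | rfl
      · by_cases hxo : x ∈ (om : M) <;> by_cases hyo : y ∈ (om : M)
        · rw [F2 x hx hxo, F2 y hy hyo] at exy; exact suc_inj exy
        · rw [F2 x hx hxo, F3 y hy hyo] at exy; exact (hyo (exy ▸ suc_om hxo)).elim
        · rw [F3 x hx hxo, F2 y hy hyo] at exy; exact (hxo (exy ▸ suc_om hyo)).elim
        · rwa [F3 x hx hxo, F3 y hy hyo] at exy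
      · by_cases hxo : x ∈ (om : M)
        · rw [F2 x hx hxo, F1] at exy; exact (sne _ exy).elim
        · rw [F3 x hx hxo, F1] at exy; exact (hxo (exy ▸ emp_om)).elim
      · by_cases hyo : y ∈ (om : M)
        · rw [F2 y hy hyo, F1] at exy; exact (sne _ exy.symm).elim
        · rw [F3 y hy hyo, F1] at exy; exact (hyo (exy ▸ emp_om)).elim
      · rfl
  · exact hl
end Card
end Paper
namespace Paper
section Pairing
variable {M : Type} [ZFM M] {G : Type} [Ctx M G] {c : Calc M}

theorem pigeon {n : M} (hn : n ∈ (om : M)) : ¬ LeC (suc n) n := by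
  refine om_ind (P := fun n : M => ¬ LeC (suc n) n) (by fun_prop) ?_ ?_ n hn
  · rintro ⟨f, hf⟩; exact mem_emp (hf.mem (self_mem_suc emp))
  · rintro n hn ih ⟨f, hf⟩
    refine ih ?_
    classical
    let F : M → M := fun x => if app f x = n then app f (suc n) else app f x
    have F1 : ∀ x, app f x = n → F x = app f (suc n) := fun x h => if_pos h
    have F2 : ∀ x, app f x ≠ n → F x = app f x := fun x h => if_neg h
    have up' : ∀ x, x ∈ suc n → x ∈ suc (suc n) := fun x h => sub_suc _ _ h
    have ne : ∀ x, x ∈ suc n → app f x ≠ app f (suc n) := fun x hx e => by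
      have := hf.inj (up' x hx) (self_mem_suc _) e
      rw [this] at hx; exact mem_irrefl _ hx
    have lt : ∀ x, x ∈ suc (suc n) → app f x ≠ n → app f x ∈ n := fun x hx h =>
      (mem_suc.1 (hf.mem hx)).resolve_right h
    refine leC_of F (by fun_prop) ?_ ?_
    · intro x hx
      by_cases h : app f x = n
      · rw [F1 x h]; exact lt _ (self_mem_suc _) (h ▸ (ne x hx).symm)
      · rw [F2 x h]; exact lt _ (up' x hx) h
    · intro x hx y hy e
      by_cases h : app f x = n <;> by_cases h' : app f y = n
      · exact hf.inj (up' x hx) (up' y hy) (h.trans h'.symm)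
      · rw [F1 x h, F2 y h'] at e; exact (ne y hy e.symm).elim
      · rw [F2 x h, F1 y h'] at e; exact (ne x hx e).elim
      · rw [F2 x h, F2 y h'] at e; exact hf.inj (up' x hx) (up' y hy) e

/-- ordinal addition -/
noncomputable def add (a b : M) : M := recF (fun x f => cup a (img x fun y => app f y)) b
@[fun_prop] theorem DF.add (f g : G → M) (hf : DF c f) (hg : DF c g) : DF c (fun x => add (f x) (g x)) := by
  unfold Paper.add; fun_prop
theorem add_eq (a b : M) : add a b = cup a (img b (add a)) := by
  have d : DF full (fun x : M => add a x) := by fun_prop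
  conv_lhs => rw [add, recF_spec (by unfold DF2; fun_prop)]
  congr 1
  exact img_congr (by fun_prop) d fun y hy => app_lam d hy
theorem mem_add {a b z : M} : z ∈ add a b ↔ z ∈ a ∨ ∃ y, y ∈ b ∧ z = add a y := by
  rw [add_eq, mem_cup, mem_img (by fun_prop)]
theorem ord_add {a b : M} (ha : Ord a) (hb : Ord b) : Ord (add a b) := by
  refine ord_ind (P := fun b => Ord (add a b)) (by fun_prop) ?_ _ hb
  intro b hb ih
  refine ord_of_tr ?_ ?_
  · intro y hy z hz
    rcases mem_add.1 hy with h | ⟨w, hw, rfl⟩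
    · exact mem_add.2 (.inl (ha.trans h hz))
    · rcases mem_add.1 hz with h | ⟨u, hu, rfl⟩
      · exact mem_add.2 (.inl h)
      · exact mem_add.2 (.inr ⟨u, hb.trans hw hu, rfl⟩)
  · intro y hy
    rcases mem_add.1 hy with h | ⟨w, hw, rfl⟩
    · exact ha.mem h
    · exact ih w hw
theorem add_lt {a b d : M} (h : b ∈ d) : add a b ∈ add a d := mem_add.2 (.inr ⟨b, h, rfl⟩)
theorem le_add (a b : M) : a ⊆ add a b := fun z hz => mem_add.2 (.inl hz)
theorem add_emp (a : M) : add a emp = a := ext fun z => by simp [mem_add]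
theorem add_suc (a b : M) : add a (suc b) = suc (add a b) := ext fun z => by
  rw [mem_add, mem_suc, mem_add]
  constructor
  · rintro (h | ⟨y, hy, rfl⟩)
    · exact .inl (.inl h)
    · rcases mem_suc.1 hy with h | rfl
      · exact .inl (.inr ⟨y, h, rfl⟩)
      · exact .inr rfl
  · rintro ((h | ⟨y, hy, rfl⟩) | rfl)
    · exact .inl h
    · exact .inr ⟨y, sub_suc _ _ hy, rfl⟩
    · exact .inr ⟨b, self_mem_suc b, rfl⟩
theorem add_om {a b : M} (ha : a ∈ (om : M)) (hb : b ∈ (om : M)) : add a b ∈ (om : M) := by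
  refine om_ind (P := fun b => add a b ∈ (om : M)) (by fun_prop) (by rwa [add_emp]) ?_ _ hb
  intro n hn h; rw [add_suc]; exact suc_om h
theorem add_inj {a b d : M} (hb : Ord b) (hd : Ord d) (e : add a b = add a d) : b = d := by
  rcases ord_tri hb hd with h | h | h
  · have := add_lt (a := a) h; rw [e] at this; exact (mem_irrefl _ this).elim
  · exact h
  · have := add_lt (a := a) h; rw [e] at this; exact (mem_irrefl _ this).elim

noncomputable def gB : M → M := recF fun x f => sU (img x fun k => suc (add (add (app f k) k) k))
@[fun_prop] theorem DF.gB (f : G → M) (hf : DF c f) : DF c (fun x => gB (f x)) := by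
  unfold Paper.gB; fun_prop
theorem gB_eq (m : M) : gB m = sU (img m fun k => suc (add (add (gB k) k) k)) := by
  have d : DF full (fun x : M => gB x) := by fun_prop
  conv_lhs => rw [gB, recF_spec (by unfold DF2; fun_prop)]
  congr 1
  exact img_congr (by fun_prop) (by fun_prop) fun y hy => by
    rw [show app (lam m (recF _)) y = gB y from app_lam d hy]
theorem mem_gB {m z : M} : z ∈ gB m ↔ ∃ k, k ∈ m ∧ (z ∈ add (add (gB k) k) k ∨ z = add (add (gB k) k) k) := by
  rw [gB_eq, mem_sU]
  simp only [mem_img (show DF full (fun k : M => suc (add (add (gB k) k) k)) by fun_prop)]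
  constructor
  · rintro ⟨y, ⟨k, hk, rfl⟩, hz⟩; exact ⟨k, hk, mem_suc.1 hz⟩
  · rintro ⟨k, hk, hz⟩; exact ⟨_, ⟨k, hk, rfl⟩, mem_suc.2 hz⟩
theorem ord_gB {m : M} (hm : Ord m) : Ord (gB m) := by
  refine ord_ind (P := fun m : M => Ord (gB m)) (by fun_prop) ?_ _ hm
  intro m hm ih
  rw [gB_eq]
  apply ord_sU
  intro x hx
  rw [mem_img (by fun_prop)] at hx
  obtain ⟨k, hk, rfl⟩ := hx
  exact (ord_add (ord_add (ih k hk) (hm.mem hk)) (hm.mem hk)).suc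
open Classical in
noncomputable def p (a b : M) : M := if a ∈ b then add (gB b) a else add (add (gB a) a) b
@[fun_prop] theorem DF.p (f g : G → M) (hf : DF c f) (hg : DF c g) : DF c (fun x => p (f x) (g x)) := by
  unfold Paper.p; fun_prop
theorem p_lt {a b : M} (h : a ∈ b) : p a b = add (gB b) a := if_pos h
theorem p_ge {a b : M} (h : ¬ a ∈ b) : p a b = add (add (gB a) a) b := if_neg h
theorem ord_p {a b : M} (ha : Ord a) (hb : Ord b) : Ord (p a b) := by
  by_cases h : a ∈ b
  · rw [p_lt h]; exact ord_add (ord_gB hb) ha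
  · rw [p_ge h]; exact ord_add (ord_add (ord_gB ha) ha) hb
theorem p_bounds {a b : M} (ha : Ord a) (hb : Ord b) : gB (cup a b) ⊆ p a b ∧
    ∀ m : M, Ord m → a ∈ m → b ∈ m → p a b ∈ gB m := by
  by_cases h : a ∈ b
  · have e : cup a b = b := ext fun z => by
      rw [mem_cup]; exact ⟨fun h' => h'.elim (hb.trans h) id, .inr⟩
    rw [e, p_lt h]
    exact ⟨le_add _ _, fun m hm _ hbm => mem_gB.2 ⟨b, hbm, .inl (le_add _ _ _ (add_lt h))⟩⟩
  · have h' := (ha.not_lt hb).1 h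
    have e : cup a b = a := ext fun z => by
      rw [mem_cup]; exact ⟨fun h => h.elim id (h' z), .inl⟩
    rw [e, p_ge h]
    refine ⟨Sub.trans (le_add _ _) (le_add _ _), fun m hm ham _ => mem_gB.2 ⟨a, ham, ?_⟩⟩
    rcases (hb.le_iff ha).1 h' with h | h
    · exact .inl (add_lt h)
    · exact .inr (by rw [h])
theorem p_inj {a b a' b' : M} (ha : Ord a) (hb : Ord b) (ha' : Ord a') (hb' : Ord b') (e : p a b = p a' b') :
    a = a' ∧ b = b' := by
  have key : ∀ {a b a' b' : M}, Ord a → Ord b → Ord a' → Ord b' → p a b = p a' b' → ¬ cup a b ∈ cup a' b' := by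
    intro a b a' b' ha hb ha' hb' e h
    have hc := ha.cup hb; have hc' := ha'.cup hb'
    have h1 := (p_bounds ha hb).2 _ hc' (ha.lt_of_le_of_lt hc' (fun z hz => mem_cup.2 (.inl hz)) h)
      (hb.lt_of_le_of_lt hc' (fun z hz => mem_cup.2 (.inr hz)) h)
    have h2 := (p_bounds ha' hb').1 _ h1
    rw [e] at h2; exact mem_irrefl _ h2
  have hm : cup a b = cup a' b' := by
    rcases ord_tri (ha.cup hb) (ha'.cup hb') with h | h | h
    · exact (key ha hb ha' hb' e h).elim
    · exact h
    · exact (key ha' hb' ha hb e.symm h).elim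
  have cl : ∀ {a b : M}, Ord b → a ∈ b → cup a b = b := fun {a b} hb h => ext fun z => by
    rw [mem_cup]; exact ⟨fun h' => h'.elim (hb.trans h) id, .inr⟩
  have cg : ∀ {a b : M}, Ord a → Ord b → ¬ a ∈ b → cup a b = a := fun {a b} ha hb h => ext fun z => by
    rw [mem_cup]; exact ⟨fun h' => h'.elim id ((ha.not_lt hb).1 h z), .inl⟩
  have key2 : ∀ {a b a' b' : M}, Ord a → Ord b → Ord a' → Ord b' → a ∈ b → ¬ a' ∈ b' → b = a' → p a b ≠ p a' b' := by
    intro a b a' b' ha hb ha' hb' h h' e ep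
    rw [p_lt h, p_ge h', e] at ep
    have := le_add (add (gB a') a') b' _ (add_lt (a := gB a') (e ▸ h))
    rw [← ep] at this; exact mem_irrefl _ this
  by_cases h : a ∈ b <;> by_cases h' : a' ∈ b'
  · rw [cl hb h, cl hb' h'] at hm; subst hm
    rw [p_lt h, p_lt h'] at e; exact ⟨add_inj ha ha' e, rfl⟩
  · rw [cl hb h, cg ha' hb' h'] at hm; exact (key2 ha hb ha' hb' h h' hm e).elim
  · rw [cg ha hb h, cl hb' h'] at hm; exact (key2 ha' hb' ha hb h' h hm.symm e.symm).elim
  · rw [cg ha hb h, cg ha' hb' h'] at hm; subst hm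
    rw [p_ge h, p_ge h'] at e; exact ⟨rfl, add_inj hb hb' e⟩
theorem p_sur {m v : M} (hm : Ord m) (hv : v ∈ gB m) : ∃ a b, a ∈ m ∧ b ∈ m ∧ v = p a b := by
  suffices h : ∀ v, v ∈ gB m → ∃ a b, a ∈ m ∧ b ∈ m ∧ v = p a b from h v hv
  refine ord_ind (P := fun m : M => ∀ v, v ∈ gB m → ∃ a b, a ∈ m ∧ b ∈ m ∧ v = p a b) (by fun_prop) ?_ _ hm
  intro m hm ih v hv
  obtain ⟨k, hk, h⟩ := mem_gB.1 hv
  have hko := hm.mem hk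
  have : v ∈ add (add (gB k) k) (suc k) := by rw [add_suc]; exact mem_suc.2 h
  rcases mem_add.1 this with h | ⟨y, hy, rfl⟩
  · rcases mem_add.1 h with h | ⟨y, hy, rfl⟩
    · obtain ⟨a, b, ha, hb, e⟩ := ih k hk v h
      exact ⟨a, b, hm.trans hk ha, hm.trans hk hb, e⟩
    · exact ⟨y, k, hm.trans hk hy, hk, (p_lt hy).symm⟩
  · have hyk : y ∈ m ∧ ¬ k ∈ y := by
      rcases mem_suc.1 hy with h | rfl
      · exact ⟨hm.trans hk h, mem_asymm h⟩
      · exact ⟨hk, mem_irrefl _⟩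
    exact ⟨k, y, hk, hyk.1, (p_ge hyk.2).symm⟩

theorem lt_of_incr {F : M → M} (hF : DF full F) (ho : ∀ a, Ord a → Ord (F a))
    (h : ∀ a, Ord a → ∀ b, b ∈ a → F b ∈ F a) {a : M} (ha : Ord a) : a ⊆ F a := by
  refine ord_ind (P := fun a => a ⊆ F a) (by fun_prop) ?_ _ ha
  intro a ha ih z hz
  exact (ha.mem hz).lt_of_le_of_lt (ho a ha) (ih z hz) (h a ha z hz)
theorem p_mono_l {a a' b : M} (ha : Ord a) (hb : Ord b) (h : a' ∈ a) : p a' b ∈ p a b := by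
  by_cases hab : a ∈ b
  · rw [p_lt hab, p_lt (hb.trans hab h)]; exact add_lt h
  · have hba := (ha.not_lt hb).1 hab
    by_cases h' : a' ∈ b
    · rw [p_lt h', p_ge hab]
      rcases (hb.le_iff ha).1 hba with h2 | rfl
      · apply le_add _ _ _ (le_add _ _ _ _)
        exact mem_gB.2 ⟨b, h2, .inl (le_add _ _ _ (add_lt h'))⟩
      · exact le_add _ _ _ (add_lt h)
    · rw [p_ge h', p_ge hab]
      apply le_add _ _ _ (le_add _ _ _ _)
      refine mem_gB.2 ⟨a', h, ?_⟩
      rcases (hb.le_iff (ha.mem h)).1 (((ha.mem h).not_lt hb).1 h') with h | rfl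
      · exact .inl (add_lt h)
      · exact .inr rfl
theorem p_mono_r {a b b' : M} (ha : Ord a) (hb : Ord b) (h : b' ∈ b) : p a b' ∈ p a b := by
  by_cases hab : a ∈ b
  · rw [p_lt hab]
    by_cases h' : a ∈ b'
    · rw [p_lt h']; exact le_add _ _ _ (mem_gB.2 ⟨b', h, .inl (le_add _ _ _ (add_lt h'))⟩)
    · rw [p_ge h']
      refine le_add _ _ _ (mem_gB.2 ⟨a, hab, ?_⟩)
      rcases ((hb.mem h).le_iff ha).1 ((ha.not_lt (hb.mem h)).1 h') with h | rfl
      · exact .inl (add_lt h)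
      · exact .inr rfl
  · have h' : ¬ a ∈ b' := fun h' => hab (hb.trans h h')
    rw [p_ge hab, p_ge h']; exact add_lt h
theorem le_p_r {a b : M} (ha : Ord a) (hb : Ord b) : b ⊆ p a b :=
  lt_of_incr (F := fun b => p a b) (by fun_prop) (fun b hb => ord_p ha hb) (fun b hb b' h => p_mono_r ha hb h) hb
theorem le_p_l {a b : M} (ha : Ord a) (hb : Ord b) : a ⊆ p a b :=
  lt_of_incr (F := fun a => p a b) (by fun_prop) (fun a ha => ord_p ha hb) (fun a ha b' h => p_mono_l ha hb h) ha
theorem lt_p {a b : M} (ha : Ord a) (hb : Ord b) (h0 : a ≠ emp) : b ∈ p a b :=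
  hb.lt_of_le_of_lt (ord_p ha hb) (le_p_r ord_emp hb) (p_mono_l ha hb (ha.emp_mem h0))

/-- the projections -/
noncomputable def u0 (v : M) : M := sU (sep (suc v) fun a => bex (suc v) fun b => Ord a ∧ Ord b ∧ p a b = v)
noncomputable def u1 (v : M) : M := sU (sep (suc v) fun b => bex (suc v) fun a => Ord a ∧ Ord b ∧ p a b = v)
@[fun_prop] theorem DF.u0 (f : G → M) (hf : DF c f) : DF c (fun x => u0 (f x)) := by
  unfold Paper.u0; fun_prop
@[fun_prop] theorem DF.u1 (f : G → M) (hf : DF c f) : DF c (fun x => u1 (f x)) := by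
  unfold Paper.u1; fun_prop
theorem sU_uniq {s x : M} (h : ∀ z, z ∈ s ↔ z = x) : sU s = x := ext fun z => by
  rw [mem_sU]; constructor
  · rintro ⟨y, hy, hz⟩; rwa [(h y).1 hy] at hz
  · intro hz; exact ⟨x, (h x).2 rfl, hz⟩
@[simp] theorem u0_p {a b : M} (ha : Ord a) (hb : Ord b) : u0 (p a b) = a := by
  apply sU_uniq; intro z
  rw [mem_sep (by fun_prop)]
  constructor
  · rintro ⟨-, b', -, h1, h2, e⟩; exact (p_inj h1 h2 ha hb e).1
  · rintro rfl
    exact ⟨(ha.mem_suc_iff (ord_p ha hb)).2 (le_p_l ha hb), b, (hb.mem_suc_iff (ord_p ha hb)).2 (le_p_r ha hb), ha, hb, rfl⟩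
@[simp] theorem u1_p {a b : M} (ha : Ord a) (hb : Ord b) : u1 (p a b) = b := by
  apply sU_uniq; intro z
  rw [mem_sep (by fun_prop)]
  constructor
  · rintro ⟨-, b', -, h1, h2, e⟩; exact (p_inj h1 h2 ha hb e).2
  · rintro rfl
    exact ⟨(hb.mem_suc_iff (ord_p ha hb)).2 (le_p_r ha hb), a, (ha.mem_suc_iff (ord_p ha hb)).2 (le_p_l ha hb), ha, hb, rfl⟩

theorem gB_om {n : M} (h : n ∈ (om : M)) : gB n ∈ (om : M) := by
  refine om_ind (P := fun n : M => gB n ∈ (om : M)) (by fun_prop) ?_ ?_ _ h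
  · have : gB (emp : M) = emp := ext fun z => by rw [mem_gB]; simp
    rw [this]; exact emp_om
  · intro n hn ih
    have : gB (suc n) ⊆ suc (add (add (gB n) n) n) := by
      intro z hz
      obtain ⟨k, hk, h⟩ := mem_gB.1 hz
      rcases mem_suc.1 hk with hk | rfl
      · exact sub_suc _ _ (le_add _ _ _ (le_add _ _ _ (mem_gB.2 ⟨k, hk, h⟩)))
      · exact mem_suc.2 h
    exact (ord_gB (ord_om.mem (suc_om hn))).lt_of_le_of_lt ord_om this (suc_om (add_om (add_om ih hn) hn))
theorem p_om {a b : M} (ha : a ∈ (om : M)) (hb : b ∈ (om : M)) : p a b ∈ (om : M) := by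
  by_cases h : a ∈ b
  · rw [p_lt h]; exact add_om (gB_om hb) ha
  · rw [p_ge h]; exact add_om (add_om (gB_om ha) ha) hb
theorem gB_of_closed {k : M} (hk : Lim k) (h : ∀ m, m ∈ k → gB m ∈ k) {a b : M} (ha : a ∈ k) (hb : b ∈ k) : p a b ∈ k := by
  have ho := hk.1
  have hc : cup a b ∈ k := by
    rcases ord_tri (ho.mem ha) (ho.mem hb) with h | h | h
    · rwa [show cup a b = b from ext fun z => by
        rw [mem_cup]; exact ⟨fun h' => h'.elim ((ho.mem hb).trans h) id, .inr⟩]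
    · rw [h, show cup b b = b from ext fun z => by simp]; exact hb
    · rwa [show cup a b = a from ext fun z => by
        rw [mem_cup]; exact ⟨fun h' => h'.elim id ((ho.mem ha).trans h), .inl⟩]
  have hs := hk.2.2 _ hc
  have os := ho.mem hs
  have oc := ho.mem hc
  refine ho.trans (h _ hs) ((p_bounds (ho.mem ha) (ho.mem hb)).2 _ os ?_ ?_)
  · exact ((ho.mem ha).mem_suc_iff oc).2 fun z hz => mem_cup.2 (.inl hz)
  · exact ((ho.mem hb).mem_suc_iff oc).2 fun z hz => mem_cup.2 (.inr hz)
theorem gB_cd {k : M} (hk : Cd k) (hw : om ⊆ k) : ∀ m, m ∈ k → gB m ∈ k := by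
  refine (ord_ind (P := fun k : M => Cd k → (om : M) ⊆ k → ∀ m, m ∈ k → gB m ∈ k) (by fun_prop) ?_ _ hk.1) hk hw
  clear hw hk k
  intro k ho ih hk hw m hm
  by_cases hmo : m ∈ (om : M)
  · exact hw _ (gB_om hmo)
  have om_ := ho.mem hm
  have hwm := (om_.not_lt ord_om).1 hmo
  obtain ⟨u, hu, f, hf⟩ := eqC_cd m
  have hum : u ⊆ m := (om_.not_lt hu.1).1 fun h => hu.not_le h (EqC.le ⟨f, hf⟩)
  have huk : u ∈ k := hu.1.lt_of_le_of_lt ho hum hm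
  have hwu : om ⊆ u := (hu.1.not_lt ord_om).1 fun h =>
    pigeon h ((leC_sub (Sub.trans (ord_om.sub (suc_om h)) hwm)).trans (EqC.le (EqC.symm ⟨f, hf⟩)))
  have cl := fun a b => gB_of_closed (a := a) (b := b) (hu.lim hwu) (ih u huk hu hwu)
  have key : LeC (gB m) u := by
    refine leC_of (fun v => p (finv f u (u0 v)) (finv f u (u1 v))) (by fun_prop) ?_ ?_
    · intro v hv
      obtain ⟨a, b, ha, hb, rfl⟩ := p_sur om_ hv
      rw [u0_p (om_.mem ha) (om_.mem hb), u1_p (om_.mem ha) (om_.mem hb)]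
      exact cl _ _ (hf.finv_mem ha) (hf.finv_mem hb)
    · intro v hv w hw e
      obtain ⟨a, b, ha, hb, rfl⟩ := p_sur om_ hv
      obtain ⟨a', b', ha', hb', rfl⟩ := p_sur om_ hw
      rw [u0_p (om_.mem ha) (om_.mem hb), u1_p (om_.mem ha) (om_.mem hb), u0_p (om_.mem ha') (om_.mem hb'),
        u1_p (om_.mem ha') (om_.mem hb')] at e
      obtain ⟨e1, e2⟩ := p_inj (hu.1.mem (hf.finv_mem ha)) (hu.1.mem (hf.finv_mem hb))
        (hu.1.mem (hf.finv_mem ha')) (hu.1.mem (hf.finv_mem hb')) e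
      rw [← hf.app_finv ha, e1, hf.app_finv ha', ← hf.app_finv hb, e2, hf.app_finv hb']
  rcases (ord_gB om_).lt_or_le ho with h | h
  · exact h
  · exact (hk.not_le huk ((leC_sub h).trans key)).elim
theorem p_cd {k a b : M} (hk : Cd k) (hw : om ⊆ k) (ha : a ∈ k) (hb : b ∈ k) : p a b ∈ k :=
  gB_of_closed (hk.lim hw) (gB_cd hk hw) ha hb
end Pairing
end Paper
namespace Paper

/-- relativized satisfaction -/
def Rl {M : Type} (E : M → M → Prop) (S : M → Prop) : ∀ {n : ℕ}, SetFormula n → (Fin n → M) → Prop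
  | _, .mem i j, v => E (v i) (v j)
  | _, .eq i j, v => v i = v j
  | _, .fal, _ => False
  | _, .imp φ ψ, v => Rl E S φ v → Rl E S ψ v
  | _, .all φ, v => ∀ a, S a → Rl E S φ (Fin.snoc v a)

theorem realize_sub {M : Type} (E : M → M → Prop) (S : M → Prop) {n : ℕ} (φ : SetFormula n) :
    ∀ v : Fin n → {x : M // S x}, Realize (fun a b : {x : M // S x} => E a.1 b.1) φ v ↔
      Rl E S φ (fun i => (v i).1) := by
  induction φ with
  | mem i j => intro v; rfl
  | eq i j => intro v; simp only [Realize, Rl]; exact Subtype.ext_iff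
  | fal => intro v; rfl
  | imp φ ψ h1 h2 => intro v; simp only [Realize, Rl, h1, h2]
  | all φ ih =>
    intro v
    simp only [Realize, Rl, ih]
    have e : ∀ a : {x : M // S x}, (fun i => ((Fin.snoc v a : Fin _ → {x : M // S x}) i).1) =
      (Fin.snoc (fun i => (v i).1) a.1 : Fin _ → M) := by
      intro a; funext i; refine Fin.lastCases ?_ (fun i => ?_) i <;> simp
    constructor
    · intro h a ha; have := h ⟨a, ha⟩; rwa [e] at this
    · intro h a; rw [e]; exact h a.1 a.2

theorem realizeIn_iff {M : Type} {E : M → M → Prop} {S : M → Prop} {n : ℕ} {φ : SetFormula n} {v : Fin n → M} :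
    RealizeIn E S φ v ↔ (∀ i, S (v i)) ∧ Rl E S φ v := by
  constructor
  · rintro ⟨h, h'⟩; exact ⟨h, (realize_sub E S φ _).1 h'⟩
  · rintro ⟨h, h'⟩; exact ⟨h, (realize_sub E S φ _).2 h'⟩
theorem rl_true {M : Type} {E : M → M → Prop} {n : ℕ} {φ : SetFormula n} {v : Fin n → M} :
    Rl E (fun _ => True) φ v ↔ Realize E φ v := by
  induction φ with
  | mem i j => rfl
  | eq i j => rfl
  | fal => rfl
  | imp φ ψ h1 h2 => simp only [Realize, Rl, h1, h2]
  | all φ ih => simp only [Realize, Rl, ih, true_implies]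
theorem rl_congr {M : Type} {E : M → M → Prop} {S S' : M → Prop} (h : ∀ x, S x ↔ S' x) {n : ℕ} {φ : SetFormula n}
    {v : Fin n → M} : Rl E S φ v ↔ Rl E S' φ v := by
  have : S = S' := funext fun x => propext (h x)
  rw [this]
section
variable {M : Type} {E : M → M → Prop} {S : M → Prop} {n : ℕ}
@[simp] theorem rl_mem {i j : Fin n} {v : Fin n → M} : Rl E S (.mem i j) v ↔ E (v i) (v j) := Iff.rfl
@[simp] theorem rl_eq {i j : Fin n} {v : Fin n → M} : Rl E S (.eq i j) v ↔ v i = v j := Iff.rfl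
@[simp] theorem rl_imp {φ ψ : SetFormula n} {v : Fin n → M} : Rl E S (.imp φ ψ) v ↔ (Rl E S φ v → Rl E S ψ v) := Iff.rfl
@[simp] theorem rl_fal {v : Fin n → M} : Rl E S .fal v ↔ False := Iff.rfl
@[simp] theorem rl_all {φ : SetFormula (n+1)} {v : Fin n → M} : Rl E S (.all φ) v ↔ ∀ a, S a → Rl E S φ (Fin.snoc v a) := Iff.rfl
@[simp] theorem rl_not {φ : SetFormula n} {v : Fin n → M} : Rl E S φ.not v ↔ ¬ Rl E S φ v := Iff.rfl
@[simp] theorem rl_and {φ ψ : SetFormula n} {v : Fin n → M} : Rl E S (φ.and ψ) v ↔ (Rl E S φ v ∧ Rl E S ψ v) := by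
  simp [SetFormula.and]
@[simp] theorem rl_ex {φ : SetFormula (n+1)} {v : Fin n → M} : Rl E S φ.ex v ↔ ∃ a, S a ∧ Rl E S φ (Fin.snoc v a) := by
  simp [SetFormula.ex]
theorem rl_ren {n : ℕ} (φ : SetFormula n) : ∀ {m : ℕ} (σ : Fin n → Fin m) (v : Fin m → M),
    Rl E S (φ.ren σ) v ↔ Rl E S φ (v ∘ σ) := by
  induction φ with
  | mem i j => intros; rfl
  | eq i j => intros; rfl
  | fal => intros; rfl
  | imp φ ψ h1 h2 => intro m σ v; simp only [SetFormula.ren, Rl, h1, h2]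
  | all φ ih => intro m σ v; simp only [SetFormula.ren, Rl, ih]; simp only [snoc_comp_lift]
end

section Sat
variable {M : Type} [ZFM M] {G : Type} [Ctx M G] {c : Calc M}

noncomputable def num : ℕ → M
  | 0 => emp
  | n+1 => suc (num n)
theorem num_om : ∀ n : ℕ, (num n : M) ∈ (om : M)
  | 0 => emp_om
  | n+1 => suc_om (num_om n)
@[fun_prop] theorem DF.num (n : ℕ) : DF c (fun _ : G => (num n : M)) := by
  induction n with
  | zero => exact DF.emp
  | succ n ih => exact DF.suc _ ih
theorem ord_num (n : ℕ) : Ord (num n : M) := ord_om.mem (num_om n)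
theorem num_lt {i k : ℕ} (h : i < k) : (num i : M) ∈ (num k : M) := by
  induction k with
  | zero => omega
  | succ k ih =>
    rcases Nat.lt_succ_iff_lt_or_eq.1 h with h | rfl
    · exact sub_suc _ _ (ih h)
    · exact self_mem_suc _
theorem num_inj {i k : ℕ} (h : (num i : M) = num k) : i = k := by
  rcases lt_trichotomy i k with h' | h' | h'
  · have := num_lt (M := M) h'; rw [h] at this; exact (mem_irrefl _ this).elim
  · exact h'
  · have := num_lt (M := M) h'; rw [h] at this; exact (mem_irrefl _ this).elim
theorem mem_num {k : ℕ} {x : M} : x ∈ (num k : M) ↔ ∃ i : Fin k, x = num i := by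
  induction k with
  | zero => simp [num]
  | succ k ih =>
    rw [show (num (k+1) : M) = suc (num k) from rfl, mem_suc, ih]
    constructor
    · rintro (⟨i, rfl⟩ | rfl)
      · exact ⟨i.castSucc, rfl⟩
      · exact ⟨Fin.last k, rfl⟩
    · rintro ⟨i, rfl⟩
      refine Fin.lastCases (.inr rfl) (fun i => .inl ⟨i, rfl⟩) i

/-! finite sequences -/
noncomputable def dm (s : M) : M := sep (sU (sU s)) fun x => bex (sU (sU s)) fun y => pair x y ∈ s
@[fun_prop] theorem DF.dm (f : G → M) (hf : DF c f) : DF c (fun x => dm (f x)) := by unfold Paper.dm; fun_prop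
theorem mem_dm {s x : M} : x ∈ dm s ↔ ∃ y, pair x y ∈ s := by
  rw [dm, mem_sep (by fun_prop)]
  exact ⟨fun ⟨_, y, _, h⟩ => ⟨y, h⟩, fun ⟨y, h⟩ => ⟨(pair_mem_UU h).1, y, (pair_mem_UU h).2, h⟩⟩
theorem Fn.dm {s n : M} (h : Fn s n) : Paper.dm s = n := Paper.ext fun x => by
  rw [mem_dm]; simp only [h.pair_mem]; simp
noncomputable def snc (s a : M) : M := cup s (sing (pair (dm s) a))
@[fun_prop] theorem DF.snc (f g : G → M) (hf : DF c f) (hg : DF c g) : DF c (fun x => snc (f x) (g x)) := by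
  unfold Paper.snc; fun_prop
theorem pair_mem_snc {s a n x y : M} (h : Fn s n) : pair x y ∈ snc s a ↔ (x ∈ n ∧ y = app s x) ∨ (x = n ∧ y = a) := by
  rw [snc, mem_cup, mem_sing, h.pair_mem, h.dm, pair_inj]
theorem snc_last {s a n : M} (h : Fn s n) : app (snc s a) n = a := by
  apply app_eq
  · rw [pair_mem_snc h]; exact .inr ⟨rfl, rfl⟩
  · intro y; rw [pair_mem_snc h]; rintro (⟨h, -⟩ | ⟨-, h⟩)
    · exact (mem_irrefl _ h).elim
    · exact h
theorem snc_app {s a n i : M} (h : Fn s n) (hi : i ∈ n) : app (snc s a) i = app s i := by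
  apply app_eq
  · rw [pair_mem_snc h]; exact .inl ⟨hi, rfl⟩
  · intro y; rw [pair_mem_snc h]; rintro (⟨-, h⟩ | ⟨h, -⟩)
    · exact h
    · rw [h] at hi; exact (mem_irrefl _ hi).elim
theorem fn_snc {s a n : M} (h : Fn s n) : Fn (snc s a) (suc n) := by
  apply fn_of
  · intro q hq
    rw [snc, mem_cup, mem_sing, h.mem, h.dm] at hq
    rcases hq with ⟨x, hx, rfl⟩ | rfl
    · exact ⟨_, _, sub_suc _ _ hx, rfl⟩
    · exact ⟨_, _, self_mem_suc _, rfl⟩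
  · intro x hx
    simp only [pair_mem_snc h]
    rcases mem_suc.1 hx with hx | rfl
    · exact ⟨_, .inl ⟨hx, rfl⟩⟩
    · exact ⟨_, .inr ⟨rfl, rfl⟩⟩
  · intro x y y'
    simp only [pair_mem_snc h]
    rintro (⟨h1, rfl⟩ | ⟨h1, rfl⟩) (⟨h2, rfl⟩ | ⟨h2, rfl⟩)
    · rfl
    · rw [h2] at h1; exact (mem_irrefl _ h1).elim
    · rw [h1] at h2; exact (mem_irrefl _ h2).elim
    · rfl
theorem fn_emp : Fn (emp : M) emp := fn_of (fun q h => (mem_emp h).elim) (fun q h => (mem_emp h).elim)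
  (fun x y y' h => (mem_emp h).elim)
theorem sU_suc {n : M} (h : Tr n) : sU (suc n) = n := ext fun z => by
  rw [mem_sU]
  constructor
  · rintro ⟨y, hy, hz⟩
    rcases mem_suc.1 hy with hy | rfl
    · exact h y hy z hz
    · exact hz
  · intro hz; exact ⟨n, self_mem_suc n, hz⟩
open Classical in
noncomputable def fsn (T n : M) : M := recF (fun x f => if x = emp then sing emp else
  sU (img (app f (sU x)) fun s => img T fun a => snc s a)) n
@[fun_prop] theorem DF.fsn (f g : G → M) (hf : DF c f) (hg : DF c g) : DF c (fun x => fsn (f x) (g x)) := by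
  unfold Paper.fsn; fun_prop
theorem fsn_emp (T : M) : fsn T emp = sing emp := by
  rw [fsn, recF_spec (by unfold DF2; fun_prop), if_pos rfl]
theorem fsn_suc (T : M) {n : M} (hn : Tr n) : fsn T (suc n) = sU (img (fsn T n) fun s => img T fun a => snc s a) := by
  have d : DF full (fun x : M => fsn T x) := by fun_prop
  conv_lhs => rw [fsn, recF_spec (by unfold DF2; fun_prop)]
  rw [if_neg (fun e => by have := self_mem_suc n; rw [e] at this; exact mem_emp this), sU_suc hn]
  rw [show app (lam (suc n) (recF _)) n = fsn T n from app_lam d (self_mem_suc n)]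
theorem mem_fsn {T n : M} (hn : n ∈ (om : M)) : ∀ s, s ∈ fsn T n ↔ FnTo s n T := by
  refine om_ind (P := fun n : M => ∀ s, s ∈ fsn T n ↔ FnTo s n T) (by fun_prop) ?_ ?_ n hn
  · intro s
    rw [fsn_emp, mem_sing]
    constructor
    · rintro rfl; exact ⟨fn_emp, fun x hx => (mem_emp hx).elim⟩
    · intro h; exact Fn.ext h.1 fn_emp fun x hx => (mem_emp hx).elim
  · intro n hn ih s
    rw [fsn_suc T (ord_om.mem hn).1, mem_sU]
    simp only [mem_img (show DF full (fun s : M => img T fun a => snc s a) by fun_prop)]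
    constructor
    · rintro ⟨-, ⟨s, hs, rfl⟩, h⟩
      rw [mem_img (by fun_prop)] at h
      obtain ⟨a, ha, rfl⟩ := h
      have hs' := (ih s).1 hs
      refine ⟨fn_snc hs'.1, fun x hx => ?_⟩
      rcases mem_suc.1 hx with hx | rfl
      · rw [snc_app hs'.1 hx]; exact hs'.2 x hx
      · rw [snc_last hs'.1]; exact ha
    · intro h
      have d : DF full (fun x => app s x) := by fun_prop
      have hl := fn_lam n d
      refine ⟨_, ⟨lam n (fun x => app s x), (ih _).2 (fnTo_lam d fun x hx => h.2 x (sub_suc _ _ hx)), rfl⟩, ?_⟩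
      rw [mem_img (by fun_prop)]
      refine ⟨app s n, h.2 n (self_mem_suc n), Fn.ext h.1 (fn_snc hl) fun x hx => ?_⟩
      rcases mem_suc.1 hx with hx | rfl
      · rw [snc_app hl hx, app_lam d hx]
      · rw [snc_last hl]
noncomputable def FS (T : M) : M := sU (img om (fsn T))
@[fun_prop] theorem DF.FS (f : G → M) (hf : DF c f) : DF c (fun x => FS (f x)) := by unfold Paper.FS; fun_prop
theorem mem_FS {T s : M} : s ∈ FS T ↔ ∃ n, n ∈ (om : M) ∧ FnTo s n T := by
  rw [FS, mem_sU]
  simp only [mem_img (show DF full (fsn T) by fun_prop)]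
  constructor
  · rintro ⟨-, ⟨n, hn, rfl⟩, h⟩; exact ⟨n, hn, (mem_fsn hn s).1 h⟩
  · rintro ⟨n, hn, h⟩; exact ⟨_, ⟨n, hn, rfl⟩, (mem_fsn hn s).2 h⟩
theorem snc_FS {T s a : M} (h : s ∈ FS T) (ha : a ∈ T) : snc s a ∈ FS T := by
  obtain ⟨n, hn, hs⟩ := mem_FS.1 h
  refine mem_FS.2 ⟨suc n, suc_om hn, fn_snc hs.1, fun x hx => ?_⟩
  rcases mem_suc.1 hx with hx | rfl
  · rw [snc_app hs.1 hx]; exact hs.2 x hx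
  · rw [snc_last hs.1]; exact ha

noncomputable def sq : ∀ {k : ℕ}, (Fin k → M) → M
  | 0, _ => emp
  | _+1, v => snc (sq (Fin.init v)) (v (Fin.last _))
theorem sq_snoc {k : ℕ} (v : Fin k → M) (a : M) : sq (Fin.snoc v a : Fin (k+1) → M) = snc (sq v) a := by
  rw [sq, Fin.init_snoc, Fin.snoc_last]
theorem fn_sq : ∀ {k : ℕ} (v : Fin k → M), Fn (sq v) (num k)
  | 0, _ => fn_emp
  | _+1, v => fn_snc (fn_sq _)
theorem app_sq : ∀ {k : ℕ} (v : Fin k → M) (i : Fin k), app (sq v) (num i) = v i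
  | 0, _, i => i.elim0
  | k+1, v, i => by
    refine Fin.lastCases ?_ (fun i => ?_) i
    · exact snc_last (fn_sq (Fin.init v))
    · exact (snc_app (fn_sq (Fin.init v)) (num_lt i.2)).trans (app_sq _ i)
theorem sq_FS {k : ℕ} {v : Fin k → M} {T : M} : sq v ∈ FS T ↔ ∀ i, v i ∈ T := by
  constructor
  · intro h i
    obtain ⟨n, hn, h⟩ := mem_FS.1 h
    have := (fn_sq v).dm; rw [h.1.dm] at this; subst this
    rw [← app_sq v i]; exact h.2 _ (num_lt i.2)
  · intro h
    refine mem_FS.2 ⟨num k, num_om k, fn_sq v, fun x hx => ?_⟩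
    obtain ⟨i, rfl⟩ := mem_num.1 hx
    rw [app_sq]; exact h i
theorem eq_sq {T s : M} {k : ℕ} (h : FnTo s (num k) T) : s = sq fun i : Fin k => app s (num i) := by
  refine Fn.ext h.1 (fn_sq _) fun x hx => ?_
  obtain ⟨i, rfl⟩ := mem_num.1 hx
  rw [app_sq]
@[fun_prop] theorem DF.sq {k : ℕ} (f : G → Fin k → M) (hf : ∀ i, DF c (fun x => f x i)) : DF c (fun x => sq (f x)) := by
  induction k with
  | zero => exact DF.emp
  | succ k ih => exact DF.snc _ _ (ih (fun x => Fin.init (f x)) fun i => hf i.castSucc) (hf (Fin.last k))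

/-! satisfaction -/
open Classical in
noncomputable def Sa (T d : M) : M := recF (fun x f => sep (FS T) fun s =>
  (u0 x = num 1 ∧ app s (u0 (u1 x)) ∈ app s (u1 (u1 x))) ∨
  (u0 x = num 2 ∧ app s (u0 (u1 x)) = app s (u1 (u1 x))) ∨
  (u0 x = num 3 ∧ (s ∈ app f (u0 (u1 x)) → s ∈ app f (u1 (u1 x)))) ∨
  (u0 x = num 4 ∧ ball T fun a => snc s a ∈ app f (u1 x))) d
@[fun_prop] theorem DF.Sa (f g : G → M) (hf : DF c f) (hg : DF c g) : DF c (fun x => Sa (f x) (g x)) := by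
  unfold Paper.Sa; fun_prop
theorem mem_Sa' {T d s : M} : s ∈ Sa T d ↔ s ∈ FS T ∧ (
  (u0 d = num 1 ∧ app s (u0 (u1 d)) ∈ app s (u1 (u1 d))) ∨
  (u0 d = num 2 ∧ app s (u0 (u1 d)) = app s (u1 (u1 d))) ∨
  (u0 d = num 3 ∧ (s ∈ app (lam d (Sa T)) (u0 (u1 d)) → s ∈ app (lam d (Sa T)) (u1 (u1 d)))) ∨
  (u0 d = num 4 ∧ ball T fun a => snc s a ∈ app (lam d (Sa T)) (u1 d))) := by
  conv_lhs => rw [Sa, recF_spec (by unfold DF2; fun_prop), mem_sep (by fun_prop)]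
  rfl
theorem Sa_sub {T d : M} : Sa T d ⊆ FS T := fun s h => (mem_Sa'.1 h).1
theorem num_ne {i k : ℕ} (h : i ≠ k) : (num i : M) ≠ num k := fun e => h (num_inj e)
theorem Sa_mem {T i j s : M} (hi : Ord i) (hj : Ord j) : s ∈ Sa T (p (num 1) (p i j)) ↔ s ∈ FS T ∧ app s i ∈ app s j := by
  rw [mem_Sa', u0_p (ord_num 1) (ord_p hi hj), u1_p (ord_num 1) (ord_p hi hj), u0_p hi hj, u1_p hi hj]
  simp [num_ne]
theorem Sa_eq {T i j s : M} (hi : Ord i) (hj : Ord j) : s ∈ Sa T (p (num 2) (p i j)) ↔ s ∈ FS T ∧ app s i = app s j := by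
  rw [mem_Sa', u0_p (ord_num 2) (ord_p hi hj), u1_p (ord_num 2) (ord_p hi hj), u0_p hi hj, u1_p hi hj]
  simp [num_ne]
theorem nz (k : ℕ) : (num (k+1) : M) ≠ emp := num_ne (i := k+1) (k := 0) (by omega)
theorem Sa_imp {T i j s : M} (hi : Ord i) (hj : Ord j) :
    s ∈ Sa T (p (num 3) (p i j)) ↔ s ∈ FS T ∧ (s ∈ Sa T i → s ∈ Sa T j) := by
  have o := ord_p (ord_num 3) (ord_p hi hj)
  have h := lt_p (ord_num 3) (ord_p hi hj) (nz 2)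
  have h1 : i ∈ p (num 3) (p i j) := hi.lt_of_le_of_lt o (le_p_l hi hj) h
  have h2 : j ∈ p (num 3) (p i j) := hj.lt_of_le_of_lt o (le_p_r hi hj) h
  rw [mem_Sa', u0_p (ord_num 3) (ord_p hi hj), u1_p (ord_num 3) (ord_p hi hj), u0_p hi hj, u1_p hi hj,
    app_lam (by fun_prop) h1, app_lam (by fun_prop) h2]
  simp [num_ne]
theorem Sa_all {T i s : M} (hi : Ord i) :
    s ∈ Sa T (p (num 4) i) ↔ s ∈ FS T ∧ ∀ a, a ∈ T → snc s a ∈ Sa T i := by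
  rw [mem_Sa', u0_p (ord_num 4) hi, u1_p (ord_num 4) hi, app_lam (by fun_prop) (lt_p (ord_num 4) hi (nz 3))]
  simp [num_ne, ball]
theorem Sa_fal {T s : M} : ¬ s ∈ Sa T (p (num 0) emp) := by
  rw [mem_Sa', u0_p (ord_num 0) ord_emp]
  simp [num_ne]
noncomputable def code : ∀ {k : ℕ}, SetFormula k → M
  | _, .mem i j => p (num 1) (p (num i) (num j))
  | _, .eq i j => p (num 2) (p (num i) (num j))
  | _, .fal => p (num 0) emp
  | _, .imp φ ψ => p (num 3) (p (code φ) (code ψ))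
  | _, .all φ => p (num 4) (code φ)
theorem code_om {k : ℕ} (φ : SetFormula k) : (code φ : M) ∈ (om : M) := by
  induction φ with
  | mem i j => exact p_om (num_om _) (p_om (num_om _) (num_om _))
  | eq i j => exact p_om (num_om _) (p_om (num_om _) (num_om _))
  | fal => exact p_om (num_om _) emp_om
  | imp φ ψ h1 h2 => exact p_om (num_om _) (p_om h1 h2)
  | all φ ih => exact p_om (num_om _) ih
theorem ord_code {k : ℕ} (φ : SetFormula k) : Ord (code φ : M) := ord_om.mem (code_om φ)
@[fun_prop] theorem DF.code {k : ℕ} (φ : SetFormula k) : DF c (fun _ : G => (code φ : M)) := by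
  induction φ with
  | mem i j => simp only [Paper.code]; fun_prop
  | eq i j => simp only [Paper.code]; fun_prop
  | fal => simp only [Paper.code]; fun_prop
  | imp φ ψ h1 h2 => simp only [Paper.code]; fun_prop
  | all φ ih => simp only [Paper.code]; fun_prop
theorem sat_iff {T : M} {k : ℕ} (φ : SetFormula k) : ∀ v : Fin k → M, (∀ i, v i ∈ T) →
    (sq v ∈ Sa T (code φ) ↔ Rl ZFM.E (fun x => x ∈ T) φ v) := by
  induction φ with
  | mem i j => intro v hv; rw [code, Sa_mem (ord_num _) (ord_num _), app_sq, app_sq]; simp [sq_FS.2 hv, mem_def]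
  | eq i j => intro v hv; rw [code, Sa_eq (ord_num _) (ord_num _), app_sq, app_sq]; simp [sq_FS.2 hv]
  | fal => intro v hv; simp [code, Sa_fal]
  | imp φ ψ h1 h2 =>
    intro v hv
    rw [code, Sa_imp (ord_code _) (ord_code _), h1 v hv, h2 v hv, rl_imp]; simp [sq_FS.2 hv]
  | all φ ih =>
    intro v hv
    rw [code, Sa_all (ord_code _), rl_all]
    simp only [sq_FS.2 hv, true_and]
    refine forall_congr' fun a => imp_congr_right fun ha => ?_
    rw [← sq_snoc, ih _ fun i => ?_]
    refine Fin.lastCases ?_ (fun i => ?_) i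
    · simpa using ha
    · simpa using hv i
theorem realizeIn_sat {T : M} {k : ℕ} {φ : SetFormula k} {v : Fin k → M} :
    RealizeIn ZFM.E (fun x => x ∈ T) φ v ↔ sq v ∈ Sa T (code φ) := by
  rw [realizeIn_iff]
  constructor
  · rintro ⟨h, h'⟩; exact (sat_iff φ v h).2 h'
  · intro h
    have hv := sq_FS.1 (Sa_sub _ h)
    exact ⟨hv, (sat_iff φ v hv).1 h⟩
end Sat
end Paper
namespace Paper

theorem sigma_ind {p q : ∀ (k : ℕ) {n : ℕ}, SetFormula n → Prop}
    (h1 : ∀ {k n : ℕ} {φ : SetFormula n}, IsDelta0 φ → p k φ)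
    (h2 : ∀ {k n : ℕ} {φ : SetFormula n}, IsPi k φ → q k φ → p (k+1) φ)
    (h3 : ∀ {k n : ℕ} {φ : SetFormula (n+1)}, IsSigma (k+1) φ → p (k+1) φ → p (k+1) φ.ex)
    (h4 : ∀ {k n : ℕ} {φ : SetFormula n}, IsDelta0 φ → q k φ)
    (h5 : ∀ {k n : ℕ} {φ : SetFormula n}, IsSigma k φ → p k φ → q (k+1) φ)
    (h6 : ∀ {k n : ℕ} {φ : SetFormula (n+1)}, IsPi (k+1) φ → q (k+1) φ → q (k+1) φ.all) :
    (∀ {k n : ℕ} {φ : SetFormula n}, IsSigma k φ → p k φ) ∧ (∀ {k n : ℕ} {φ : SetFormula n}, IsPi k φ → q k φ) :=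
  ⟨fun h => IsSigma.rec (motive_1 := fun k n φ _ => p k φ) (motive_2 := fun k n φ _ => q k φ)
    h1 h2 h3 h4 h5 h6 h,
   fun h => IsPi.rec (motive_1 := fun k n φ _ => p k φ) (motive_2 := fun k n φ _ => q k φ)
    h1 h2 h3 h4 h5 h6 h⟩

theorem sigma_dual {M : Type} (E : M → M → Prop) :
    (∀ {k n : ℕ} {φ : SetFormula n}, IsSigma k φ → ∃ ψ : SetFormula n, IsPi k ψ ∧ ∀ v : Fin n → M, Realize E ψ v ↔ ¬ Realize E φ v) ∧
    (∀ {k n : ℕ} {φ : SetFormula n}, IsPi k φ → ∃ ψ : SetFormula n, IsSigma k ψ ∧ ∀ v : Fin n → M, Realize E ψ v ↔ ¬ Realize E φ v) := by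
  apply sigma_ind
    (p := fun k n φ => ∃ ψ : SetFormula n, IsPi k ψ ∧ ∀ v : Fin n → M, Realize E ψ v ↔ ¬ Realize E φ v)
    (q := fun k n φ => ∃ ψ : SetFormula n, IsSigma k ψ ∧ ∀ v : Fin n → M, Realize E ψ v ↔ ¬ Realize E φ v)
  · intro k n φ h; exact ⟨φ.not, .ofDelta0 (.imp h .fal), fun v => Iff.rfl⟩
  · rintro k n φ - ⟨ψ, h, h'⟩; exact ⟨ψ, .ofSigma h, h'⟩
  · rintro k n φ - ⟨ψ, h, h'⟩; exact ⟨ψ.all, .all h, fun v => by simp [h']⟩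
  · intro k n φ h; exact ⟨φ.not, .ofDelta0 (.imp h .fal), fun v => Iff.rfl⟩
  · rintro k n φ - ⟨ψ, h, h'⟩; exact ⟨ψ, .ofPi h, h'⟩
  · rintro k n φ - ⟨ψ, h, h'⟩; exact ⟨ψ.ex, .ex h, fun v => by simp [h']⟩

theorem sigma_mono :
    (∀ {k n : ℕ} {φ : SetFormula n}, IsSigma k φ → IsSigma (k+1) φ) ∧
    (∀ {k n : ℕ} {φ : SetFormula n}, IsPi k φ → IsPi (k+1) φ) := by
  apply sigma_ind (p := fun k n φ => IsSigma (k+1) φ) (q := fun k n φ => IsPi (k+1) φ)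
  · intro k n φ h; exact .ofDelta0 h
  · rintro k n φ - h; exact .ofPi h
  · rintro k n φ - h; exact .ex h
  · intro k n φ h; exact .ofDelta0 h
  · rintro k n φ - h; exact .ofSigma h
  · rintro k n φ - h; exact .all h
theorem sigma_le {k l n : ℕ} {φ : SetFormula n} (h : IsSigma k φ) (hl : k ≤ l) : IsSigma l φ := by
  induction hl with
  | refl => exact h
  | step _ ih => exact sigma_mono.1 ih

theorem delta0_abs {M : Type} {E : M → M → Prop} {S : M → Prop} (hS : ∀ x y, S y → E x y → S x) {n : ℕ}
    {φ : SetFormula n} (h : IsDelta0 φ) : ∀ v : Fin n → M, (∀ i, S (v i)) → (Rl E S φ v ↔ Realize E φ v) := by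
  have hs : ∀ {n : ℕ} {v : Fin n → M} (hv : ∀ i, S (v i)) {a : M} (ha : S a),
      ∀ i, S ((Fin.snoc v a : Fin (n+1) → M) i) := by
    intro n v hv a ha i; refine Fin.lastCases ?_ (fun i => ?_) i
    · simpa using ha
    · simpa using hv i
  induction h with
  | mem i j => intros; rfl
  | eq i j => intros; rfl
  | fal => intros; rfl
  | imp _ _ h1 h2 => intro v hv; simp [h1 v hv, h2 v hv]
  | ball j _ ih =>
    intro v hv
    simp only [rl_all, rl_imp, rl_mem, realize_all, realize_imp, realize_mem, Fin.snoc_last, Fin.snoc_castSucc]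
    exact ⟨fun h a ha => (ih _ (hs hv (hS _ _ (hv j) ha))).1 (h a (hS _ _ (hv j) ha) ha),
      fun h a ha' ha => (ih _ (hs hv ha')).2 (h a ha)⟩
  | bex j _ ih =>
    intro v hv
    simp only [rl_ex, rl_and, rl_mem, realize_ex, realize_and, realize_mem, Fin.snoc_last, Fin.snoc_castSucc]
    exact ⟨fun ⟨a, ha', ha, h⟩ => ⟨a, ha, (ih _ (hs hv ha')).1 h⟩,
      fun ⟨a, ha, h⟩ => ⟨a, hS _ _ (hv j) ha, ha, (ih _ (hs hv (hS _ _ (hv j) ha))).2 h⟩⟩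

section Up
variable {M : Type} [ZFM M] {G : Type} [Ctx M G]

def UpQ (c : Calc M) {k : ℕ} (P : (Fin k → M) → Prop) : Prop :=
  ∃ R : (Fin (k+1) → M) → Prop, c.Q R ∧ ∀ v, P v ↔ ∃ y, ¬ R (Fin.snoc v y)
theorem UpQ.neg {c : Calc M} {k : ℕ} {P : (Fin k → M) → Prop} (h : c.Q P) : UpQ c (fun v => ¬ P v) := by
  refine ⟨_, c.re Fin.castSucc h, fun v => ?_⟩
  have : ∀ y, (Fin.snoc v y : Fin (k+1) → M) ∘ Fin.castSucc = v := fun y => by funext i; simp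
  simp only [this]; simp [show Nonempty M from ⟨emp⟩]
theorem Calc.congr (c : Calc M) {k : ℕ} {P R : (Fin k → M) → Prop} (h : c.Q P) (e : ∀ v, R v ↔ P v) : c.Q R := by
  have : R = P := funext fun v => propext (e v)
  rwa [this]
theorem UpQ.congr {c : Calc M} {k : ℕ} {P R : (Fin k → M) → Prop} (h : UpQ c P) (e : ∀ v, R v ↔ P v) : UpQ c R := by
  have : R = P := funext fun v => propext (e v)
  rwa [this]
theorem Calc.bex (c : Calc M) {k : ℕ} {P : (Fin (k+1) → M) → Prop} (j : Fin k) (h : c.Q P) :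
    c.Q (fun v => ∃ y, y ∈ v j ∧ P (Fin.snoc v y)) := by
  have := c.ex (c.and (c.re ![Fin.last k, j.castSucc] c.mem) h)
  refine c.congr this fun v => ?_
  simp
theorem UpQ.ex {c : Calc M} {k : ℕ} {P : (Fin (k+1) → M) → Prop} (h : UpQ c P) : UpQ c (fun v => ∃ y, P (Fin.snoc v y)) := by
  obtain ⟨A, h1, h2⟩ := h
  have d := c.ball (Fin.last k) (c.ball (Fin.last k).castSucc (c.re (Fin.snoc (Fin.snoc (fun i => i.castSucc.castSucc.castSucc) (Fin.last (k+1)).castSucc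
        : Fin (k+1) → Fin (k+3)) (Fin.last (k+2)) : Fin (k+2) → Fin (k+3)) h1))
  refine ⟨_, d, fun v => ?_⟩
  simp only [snoc3c, Fin.snoc_castSucc, Fin.snoc_last, h2]
  push Not
  constructor
  · rintro ⟨y, z, hz⟩
    exact ⟨up y z, y, by simp, z, by simp, hz⟩
  · rintro ⟨w, y, -, z, -, hz⟩; exact ⟨y, z, hz⟩
theorem UpQ.and {c : Calc M} {k : ℕ} {P R : (Fin k → M) → Prop} (h : UpQ c P) (h' : UpQ c R) : UpQ c (fun v => P v ∧ R v) := by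
  obtain ⟨A, h1, h2⟩ := h; obtain ⟨B, h3, h4⟩ := h'
  have d := c.ball (Fin.last k) (c.ball (Fin.last k).castSucc (c.or (c.re (Fin.snoc (fun i => i.castSucc.castSucc.castSucc) (Fin.last (k+1)).castSucc :
    Fin (k+1) → Fin (k+3)) h1) (c.re (Fin.snoc (fun i => i.castSucc.castSucc.castSucc)
    (Fin.last (k+2)) : Fin (k+1) → Fin (k+3)) h3)))
  refine ⟨_, d, fun v => ?_⟩
  simp only [snoc3a, snoc3b, Fin.snoc_castSucc, Fin.snoc_last, h2, h4]
  push Not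
  constructor
  · rintro ⟨⟨y, hy⟩, ⟨z, hz⟩⟩
    exact ⟨up y z, y, by simp, z, by simp, hy, hz⟩
  · rintro ⟨w, y, -, z, -, hy, hz⟩; exact ⟨⟨y, hy⟩, ⟨z, hz⟩⟩
theorem UpQ.or {c : Calc M} {k : ℕ} {P R : (Fin k → M) → Prop} (h : UpQ c P) (h' : UpQ c R) : UpQ c (fun v => P v ∨ R v) := by
  obtain ⟨A, h1, h2⟩ := h; obtain ⟨B, h3, h4⟩ := h'
  refine ⟨_, c.and h1 h3, fun v => ?_⟩
  simp only [h2, h4, ← exists_or, not_and_or]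
theorem UpQ.re {c : Calc M} {k l : ℕ} {P : (Fin k → M) → Prop} (σ : Fin k → Fin l) (h : UpQ c P) :
    UpQ c (fun v => P (v ∘ σ)) := by
  obtain ⟨A, h1, h2⟩ := h
  refine ⟨_, c.re (Fin.snoc (fun i => (σ i).castSucc) (Fin.last l)) h1, fun v => ?_⟩
  simp only [snoc_comp_lift, h2]
theorem UpQ.le {c : Calc M} {k : ℕ} {P : (Fin k → M) → Prop} (h : UpQ c P) : AnyQ (fun _ => True) P := by
  obtain ⟨A, h1, h2⟩ := h
  exact (c.le h1).neg.ex.congr h2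
theorem any_dp2 {k : ℕ} {A : (Fin (k+2) → M) → Prop} (h1 : AnyQ (fun _ => True) A) (v : Fin k → M) :
    DP full (fun q : M × M => A (Fin.snoc (Fin.snoc v q.1 : Fin (k+1) → M) q.2)) := by
  refine SQ.dp ⟨fun u : Fin 2 → M => A (Fin.snoc (Fin.snoc v (u 0) : Fin (k+1) → M) (u 1)), ?_, fun q => ?_⟩
  · obtain ⟨m, p, φ, -, hφ⟩ := h1
    refine ⟨m + k, Fin.append p v, φ, fun _ => trivial, ?_⟩
    intro (u : Fin 2 → M)
    beta_reduce
    rw [hφ]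
    have e : u = Fin.snoc (fun _ : Fin 1 => u 0) (u 1) := by
      funext i; fin_cases i <;> rfl
    conv_rhs => rw [e, append_snoc', Fin.append_right_eq_snoc]
    rw [append_snoc', append_snoc']
  · have e1 : Ctx.get q 0 = q.1 := rfl
    have e2 : Ctx.get q 1 = q.2 := rfl
    beta_reduce; rw [e1, e2]
theorem UpQ.ball {c : Calc M} {k : ℕ} {P : (Fin (k+1) → M) → Prop} (j : Fin k) (h : UpQ c P) :
    UpQ c (fun v => ∀ y, y ∈ v j → P (Fin.snoc v y)) := by
  obtain ⟨A, h1, h2⟩ := h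
  have d := c.bex j.castSucc (c.ball (Fin.last k).castSucc (c.re (Fin.snoc (Fin.snoc (fun i => i.castSucc.castSucc.castSucc) (Fin.last (k+1)).castSucc
        : Fin (k+1) → Fin (k+3)) (Fin.last (k+2)) : Fin (k+2) → Fin (k+3)) h1))
  refine ⟨_, d, fun v => ?_⟩
  simp only [snoc3c, Fin.snoc_castSucc, Fin.snoc_last, h2]
  push Not
  constructor
  · intro h
    obtain ⟨b, hb⟩ := collection (P := fun x y => ¬ A (Fin.snoc (Fin.snoc v x : Fin (k+1) → M) y)) (any_dp2 (c.le h1) v).not (v j)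
    exact ⟨b, fun x hx => hb x hx (h x hx)⟩
  · rintro ⟨w, h⟩ y hy
    obtain ⟨z, -, hz⟩ := h y hy; exact ⟨z, hz⟩
def upc (c : Calc M) : Calc M where
  Q := UpQ c
  le := UpQ.le
  mem := (UpQ.neg c.nmem).congr fun v => by simp
  nmem := UpQ.neg c.mem
  eq := (UpQ.neg c.neq).congr fun v => by simp
  neq := UpQ.neg c.eq
  tt := (UpQ.neg c.ff).congr fun v => by simp
  ff := (UpQ.neg c.tt).congr fun v => by simp
  and := UpQ.and
  or := UpQ.or
  ex := UpQ.ex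
  ball := UpQ.ball
  re := UpQ.re
/-- `sg m`: the class of `Σ_{m+1}` relations -/
def sg : ℕ → Calc M
  | 0 => sig1 M
  | m+1 => upc (sg m)
theorem SQ.up {m : ℕ} {P : G → Prop} (h : SQ (sg m) P) : SQ (sg (m+1)) (fun x => ¬ P x) := by
  obtain ⟨R, h1, h2⟩ := h
  exact ⟨_, UpQ.neg h1, fun g => not_congr (h2 g)⟩
theorem sg_form {m : ℕ} : ∀ {k : ℕ} {P : (Fin k → M) → Prop}, (sg m).Q P →
    ∃ φ : SetFormula k, IsSigma (m+1) φ ∧ ∀ v, P v ↔ Realize ZFM.E φ v := by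
  induction m with
  | zero =>
    rintro k P ⟨R, ⟨φ, h1, h2⟩, h3⟩
    exact ⟨φ.ex, .ex (.ofDelta0 h1), fun v => by simp [h3, h2]⟩
  | succ m ih =>
    rintro k P ⟨R, h1, h3⟩
    obtain ⟨φ, h4, h5⟩ := ih h1
    obtain ⟨ψ, h6, h7⟩ := (sigma_dual (ZFM.E (M := M))).1 h4
    exact ⟨ψ.ex, .ex (.ofPi h6), fun v => by simp [h3, h7, h5]⟩
end Up
end Paper
namespace Paper
section
variable {M : Type} [ZFM M] {G : Type} [Ctx M G] {c : Calc M}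

/-- `s'` is a function on `K` extending `s` -/
def Ex (s s' K : M) : Prop := Fn s' K ∧ s ⊆ s'
@[fun_prop] theorem DP.Ex (f g h : G → M) (hf : DF c f) (hg : DF c g) (hh : DF c h) :
    DP c (fun x => Ex (f x) (g x) (h x)) := by unfold Paper.Ex; fun_prop
def BB : ℕ → M → M → Prop
  | 0, C, s => ∃ T, Tr T ∧ s ∈ Sa T C
  | m+1, C, s => ¬ ∃ s', Ex s s' (u0 C) ∧ BB m (u1 C) s'
def W (m : ℕ) (C s : M) : Prop := ∃ s', Ex s s' (u0 C) ∧ BB m (u1 C) s'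
theorem BB_zero {C s : M} : BB 0 C s ↔ ∃ T, Tr T ∧ s ∈ Sa T C := Iff.rfl
theorem BB_succ {m : ℕ} {C s : M} : BB (m+1) C s ↔ ¬ W m C s := Iff.rfl
theorem DP.BB [c.Full] (m : ℕ) : ∀ {G : Type} [Ctx M G] (f g : G → M) (hf : DF c f) (hg : DF c g),
    DP c (fun x => Paper.BB m (f x) (g x)) := by
  induction m with
  | zero => intro G _ f g hf hg; unfold Paper.BB; fun_prop
  | succ m ih =>
    intro G _ f g hf hg; unfold Paper.BB
    refine DP.not _ (DP.ex _ (DP.and _ _ (by fun_prop) ?_))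
    exact ih (fun q : G × M => u1 (f q.1)) (fun q : G × M => q.2) (by fun_prop) (by fun_prop)
@[fun_prop] theorem DP.BB' [c.Full] (m : ℕ) (f g : G → M) (hf : DF c f) (hg : DF c g) :
    DP c (fun x => Paper.BB m (f x) (g x)) := DP.BB m f g hf hg
@[fun_prop] theorem DP.W [c.Full] (m : ℕ) (f g : G → M) (hf : DF c f) (hg : DF c g) :
    DP c (fun x => W m (f x) (g x)) := by unfold Paper.W; fun_prop
theorem SQ.BB (m : ℕ) : ∀ {G : Type} [Ctx M G] (f g : G → M) (hf : DF (sg m) f) (hg : DF (sg m) g),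
    SQ (sg m) (fun x => Paper.BB m (f x) (g x)) := by
  have key : SQ (sg m) (fun x : M × M => Paper.BB m x.1 x.2) := by
    induction m with
    | zero =>
      exact SQ.ex (P := fun (x : M × M) T => Tr T ∧ x.2 ∈ Sa T x.1) (DP.and _ _ (by fun_prop) (by fun_prop)).1
    | succ m ih =>
      refine SQ.up (P := fun x : M × M => ∃ s', Ex x.2 s' (u0 x.1) ∧ Paper.BB m (u1 x.1) s') ?_
      refine SQ.ex (P := fun (x : M × M) s' => Ex x.2 s' (u0 x.1) ∧ Paper.BB m (u1 x.1) s') (SQ.and (DP.Ex _ _ _ ?_ ?_ ?_).1 ?_)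
      · fun_prop
      · fun_prop
      · fun_prop
      · exact SQ.comp ih (f := fun q : (M × M) × M => (u1 q.1.1, q.2)) (by fun_prop)
  intro G _ f g hf hg
  exact key.comp (f := fun x => (f x, g x)) (by fun_prop)

theorem W_ex {m : ℕ} {C s n : M} (hs : Fn s n) (hn : n ∈ u0 C) : W m C s ↔ ∃ a, W m C (snc s a) := by
  constructor
  · rintro ⟨s', ⟨h1, h2⟩, h3⟩
    refine ⟨app s' n, s', ⟨h1, fun q hq => ?_⟩, h3⟩
    rw [snc, mem_cup, mem_sing, hs.dm] at hq
    rcases hq with hq | rfl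
    · exact h2 _ hq
    · exact h1.pair_mem.2 ⟨hn, rfl⟩
  · rintro ⟨a, s', ⟨h1, h2⟩, h3⟩
    exact ⟨s', ⟨h1, fun q hq => h2 _ (by rw [snc, mem_cup]; exact .inl hq)⟩, h3⟩
theorem Ex.self {s n s' : M} (hs : Fn s n) : Ex s s' n ↔ s' = s := by
  constructor
  · rintro ⟨h1, h2⟩
    refine Fn.ext h1 hs fun x hx => ?_
    have := h2 _ (hs.pair_mem.2 ⟨hx, rfl⟩)
    exact (h1.pair_mem.1 this).2.symm
  · rintro rfl; exact ⟨hs, Sub.refl _⟩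
theorem W_p {m : ℕ} {C s n : M} (hs : Fn s n) (hn : Ord n) (hC : Ord C) : W m (p n C) s ↔ BB m C s := by
  rw [W, u0_p hn hC, u1_p hn hC]; simp [Ex.self hs]

def SCode (M : Type) [ZFM M] (m : ℕ) {k : ℕ} (φ : SetFormula k) : Prop :=
  ∃ C : M, C ∈ (om : M) ∧ (num k : M) ⊆ u0 C ∧ ∀ v : Fin k → M, Realize ZFM.E φ v ↔ W m C (sq v)
theorem delta0_sat {k : ℕ} {φ : SetFormula k} (h : IsDelta0 φ) (v : Fin k → M) :
    Realize ZFM.E φ v ↔ ∃ T : M, Tr T ∧ sq v ∈ Sa T (code φ) := by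
  constructor
  · intro hv
    have : ∀ i, v i ∈ (trcl (img (num k) (app (sq v))) : M) := fun i => by
      apply sub_trcl
      rw [mem_img (by fun_prop)]
      exact ⟨num i, num_lt i.2, (app_sq v i).symm⟩
    refine ⟨_, tr_trcl _, (sat_iff φ v this).2 ((delta0_abs ?_ h v this).2 hv)⟩
    intro x y hy hx; exact (tr_trcl _).mem hy hx
  · rintro ⟨T, h1, h2⟩
    have h3 := realizeIn_iff.1 (realizeIn_sat.2 h2)
    exact (delta0_abs (fun x y hy hx => h1.mem hy hx) h v h3.1).1 h3.2
theorem SCode.of_neg {m : ℕ} {k : ℕ} {φ ψ : SetFormula k} (h : SCode M m ψ)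
    (e : ∀ v : Fin k → M, Realize ZFM.E φ v ↔ ¬ Realize ZFM.E ψ v) : SCode M (m+1) φ := by
  obtain ⟨C, h1, h2, h3⟩ := h
  refine ⟨p (num k) C, p_om (num_om k) h1, by rw [u0_p (ord_num k) (ord_om.mem h1)]; exact Sub.refl _, fun v => ?_⟩
  rw [W_p (fn_sq v) (ord_num k) (ord_om.mem h1), e, h3]; rfl
theorem delta0_code {k : ℕ} {φ : SetFormula k} (h : IsDelta0 φ) (m : ℕ) : SCode M m φ := by
  induction m generalizing φ with
  | zero =>
    refine ⟨p (num k) (code φ), p_om (num_om k) (code_om φ),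
      by rw [u0_p (ord_num k) (ord_code φ)]; exact Sub.refl _, fun v => ?_⟩
    rw [W_p (fn_sq v) (ord_num k) (ord_code φ), delta0_sat h]; rfl
  | succ m ih => exact (ih (φ := φ.not) (.imp h .fal)).of_neg fun v => by simp
theorem sigma_code (M : Type) [ZFM M] :
    (∀ {k n : ℕ} {φ : SetFormula n}, IsSigma k φ → (k = 0 → IsDelta0 φ) ∧ ∀ m, k = m+1 → SCode M m φ) ∧
    (∀ {k n : ℕ} {φ : SetFormula n}, IsPi k φ → (k = 0 → IsDelta0 φ) ∧ ∀ m, k = m+1 → SCode M m φ.not) := by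
  apply sigma_ind (p := fun k n φ => (k = 0 → IsDelta0 φ) ∧ ∀ m, k = m+1 → SCode M m φ)
    (q := fun k n φ => (k = 0 → IsDelta0 φ) ∧ ∀ m, k = m+1 → SCode M m φ.not)
  · intro k n φ h; exact ⟨fun _ => h, fun m _ => delta0_code h m⟩
  · rintro k n φ - ⟨h1, h2⟩
    refine ⟨by omega, fun m hm => ?_⟩
    obtain rfl : k = m := by omega
    cases k with
    | zero => exact delta0_code (h1 rfl) 0
    | succ m => exact (h2 m rfl).of_neg fun v => by simp
  · rintro k n φ - ⟨-, h2⟩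
    refine ⟨by omega, fun m hm => ?_⟩
    obtain ⟨C, h3, h4, h5⟩ := h2 m hm
    refine ⟨C, h3, Sub.trans (sub_suc _) h4, fun v => ?_⟩
    rw [W_ex (fn_sq v) (h4 _ (self_mem_suc _)), realize_ex]
    exact exists_congr fun a => by rw [h5, sq_snoc]
  · intro k n φ h; exact ⟨fun _ => h, fun m _ => delta0_code (.imp h .fal) m⟩
  · rintro k n φ - ⟨h1, h2⟩
    refine ⟨by omega, fun m hm => ?_⟩
    obtain rfl : k = m := by omega
    cases k with
    | zero => exact delta0_code (.imp (h1 rfl) .fal) 0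
    | succ m => exact (h2 m rfl).of_neg fun v => by simp
  · rintro k n φ - ⟨-, h2⟩
    refine ⟨by omega, fun m hm => ?_⟩
    obtain ⟨C, h3, h4, h5⟩ := h2 m hm
    refine ⟨C, h3, Sub.trans (sub_suc _) h4, fun v => ?_⟩
    rw [W_ex (fn_sq v) (h4 _ (self_mem_suc _)), realize_not, realize_all, not_forall]
    exact exists_congr fun a => by rw [← sq_snoc, ← h5, realize_not]
end
end Paper
namespace Paper
section
variable {M : Type} [ZFM M] {G : Type} [Ctx M G] {c : Calc M}

theorem Lim.ord {a : M} (h : Lim a) : Ord a := h.1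
theorem Lim.suc {a b : M} (h : Lim a) (hb : b ∈ a) : Paper.suc b ∈ a := h.2.2 b hb
theorem Vs_bd {a x b : M} (ha : Lim a) (hb : b ∈ a) (h : ∀ y, y ∈ x → rank y ∈ b) : x ∈ Vs a := by
  rw [mem_Vs ha.ord]
  exact (ord_rank x).lt_of_le_of_lt ha.ord (rank_le (ha.ord.mem hb) h) hb
theorem Vs_up {a x y : M} (ha : Lim a) (hx : x ∈ Vs a) (hy : y ∈ Vs a) : up x y ∈ Vs a := by
  rw [mem_Vs ha.ord] at hx hy
  have h1 := ha.suc hx; have h2 := ha.suc hy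
  rcases (ha.ord.mem h1).lt_or_le (ha.ord.mem h2) with h | h
  · refine Vs_bd ha h2 fun z hz => ?_
    rcases mem_up.1 hz with rfl | rfl
    · exact (ha.ord.mem h2).tr.mem h (self_mem_suc _)
    · exact self_mem_suc _
  · refine Vs_bd ha h1 fun z hz => ?_
    rcases mem_up.1 hz with rfl | rfl
    · exact self_mem_suc _
    · exact h _ (self_mem_suc _)
theorem Vs_pair {a x y : M} (ha : Lim a) (hx : x ∈ Vs a) (hy : y ∈ Vs a) : pair x y ∈ Vs a :=
  Vs_up ha (Vs_up ha hx hx) (Vs_up ha hx hy)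
theorem Vs_sU {a x : M} (ha : Lim a) (hx : x ∈ Vs a) : sU x ∈ Vs a := by
  rw [mem_Vs ha.ord] at hx
  refine Vs_bd ha hx fun z hz => ?_
  obtain ⟨y, hy, hz⟩ := mem_sU.1 hz
  exact (ord_rank x).tr.mem (rank_mem hy) (rank_mem hz)
theorem Vs_cup {a x y : M} (ha : Lim a) (hx : x ∈ Vs a) (hy : y ∈ Vs a) : cup x y ∈ Vs a := Vs_sU ha (Vs_up ha hx hy)
theorem Vs_pow {a x : M} (ha : Lim a) (hx : x ∈ Vs a) : pow x ∈ Vs a := by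
  rw [mem_Vs ha.ord] at hx
  refine Vs_bd ha (ha.suc hx) fun z hz => ?_
  have := rank_mono (mem_pow.1 hz)
  exact (ord_rank z).mem_suc_iff (ord_rank x) |>.2 this
theorem Vs_dm {a x : M} (ha : Lim a) (hx : x ∈ Vs a) : dm x ∈ Vs a :=
  Vs_sub ha.ord (fun y hy => by rw [dm, mem_sep (by fun_prop)] at hy; exact hy.1) (Vs_sU ha (Vs_sU ha hx))
theorem Vs_snc {a x y : M} (ha : Lim a) (hx : x ∈ Vs a) (hy : y ∈ Vs a) : snc x y ∈ Vs a :=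
  Vs_cup ha hx (Vs_up ha (Vs_pair ha (Vs_dm ha hx) hy) (Vs_pair ha (Vs_dm ha hx) hy))
theorem Vs_emp {a : M} (ha : Lim a) : emp ∈ Vs a := (ord_mem_Vs ha.ord ord_emp).2 (ha.ord.emp_mem ha.2.1)
theorem Vs_sq {a : M} (ha : Lim a) {k : ℕ} {v : Fin k → M} (hv : ∀ i, v i ∈ Vs a) : sq v ∈ Vs a := by
  induction k with
  | zero => exact Vs_emp ha
  | succ k ih => exact Vs_snc ha (ih fun i => hv i.castSucc) (hv _)
theorem Vs_app {a s i n : M} (ha : Ord a) (hs : s ∈ Vs a) (h : Fn s n) (hi : i ∈ n) : app s i ∈ Vs a := by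
  have := h.pair_mem.2 ⟨hi, rfl⟩
  exact (tr_Vs ha).mem ((tr_Vs ha).mem ((tr_Vs ha).mem hs this) (mem_up.2 (.inr rfl))) (mem_up.2 (.inr rfl))

/-- closure form of `Σ_{n+1}`-correctness -/
def TV (n : ℕ) (ν : M) : Prop := Lim ν ∧ om ∈ ν ∧ ∀ m : Fin (n+1), ∀ C, C ∈ (om : M) → ∀ s, s ∈ Vs ν → W m C s →
  ∃ s', s' ∈ Vs ν ∧ Ex s s' (u0 C) ∧ BB m (u1 C) s'
theorem DP.finAll (n : ℕ) (P : Fin n → G → Prop) (h : ∀ i, DP c (P i)) : DP c (fun x => ∀ i, P i x) := by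
  induction n with
  | zero => exact DP.true.congr fun v => by simp
  | succ n ih => exact ((h 0).and _ _ (ih (fun i => P i.succ) fun i => h i.succ)).congr fun v => Fin.forall_fin_succ
@[fun_prop] theorem DP.TV [c.Full] (n : ℕ) (f : G → M) (hf : DF c f) : DP c (fun x => TV n (f x)) := by
  unfold Paper.TV
  refine DP.and _ _ (by fun_prop) (DP.and _ _ (by fun_prop) (DP.finAll _ _ fun m => ?_))
  fun_prop

theorem cn_abs {n : ℕ} {ν : M} (h : CnE ZFM.E n ν) {k : ℕ} {φ : SetFormula k} (hφ : IsSigma n φ) {v : Fin k → M}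
    (hv : ∀ i, v i ∈ Vs ν) : Rl ZFM.E (fun x => x ∈ Vs ν) φ v ↔ Realize ZFM.E φ v := by
  have o := ordE_iff.1 h.1
  have e : ∀ x, VMemE ZFM.E x ν ↔ x ∈ Vs ν := fun x => by rw [vMemE_iff]; simp [o]
  have := h.2.2 φ hφ v (fun i => (e _).2 (hv i))
  rw [realizeIn_iff, realizeIn_iff, rl_true, rl_congr e] at this
  simp only [e] at this
  simpa [hv] using this
theorem cn_of {n : ℕ} {ν : M} (o : Ord ν) (h : ∀ {k : ℕ} {φ : SetFormula k} (hφ : IsSigma n φ) {v : Fin k → M}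
    (hv : ∀ i, v i ∈ Vs ν), Rl ZFM.E (fun x => x ∈ Vs ν) φ v ↔ Realize ZFM.E φ v) : CnE ZFM.E n ν := by
  have e : ∀ x, VMemE ZFM.E x ν ↔ x ∈ Vs ν := fun x => by rw [vMemE_iff]; simp [o]
  refine ⟨ordE_iff.2 o, fun _ _ => trivial, fun k φ hφ v hv => ?_⟩
  have hv' := fun i => (e _).1 (hv i)
  rw [realizeIn_iff, realizeIn_iff, rl_true, rl_congr e, h hφ hv']
  simp [hv]
theorem hsnoc {S : M → Prop} {n : ℕ} {v : Fin n → M} (hv : ∀ i, S (v i)) {a : M} (ha : S a) :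
      ∀ i, S ((Fin.snoc v a : Fin (n+1) → M) i) := by
    intro i; refine Fin.lastCases ?_ (fun i => ?_) i
    · simpa using ha
    · simpa using hv i
theorem cn_ex {n m : ℕ} {ν : M} (h : CnE ZFM.E (n+1) ν) (hm : m ≤ n) {k : ℕ} {P : (Fin (k+1) → M) → Prop} (hP : (sg m).Q P)
    {v : Fin k → M} (hv : ∀ i, v i ∈ Vs ν) (he : ∃ y, P (Fin.snoc v y)) : ∃ y, y ∈ Vs ν ∧ P (Fin.snoc v y) := by
  obtain ⟨φ, h1, h2⟩ := sg_form hP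
  have h1 := sigma_le h1 (show m+1 ≤ n+1 by omega)
  have := (cn_abs h h1.ex hv).2 (by rw [realize_ex]; simpa only [← h2] using he)
  rw [rl_ex] at this
  obtain ⟨a, ha, h3⟩ := this
  exact ⟨a, ha, (h2 _).2 ((cn_abs h h1 (hsnoc (S := fun x => x ∈ Vs ν) hv ha)).1 h3)⟩
theorem cn_exG {n m : ℕ} {ν : M} (h : CnE ZFM.E (n+1) ν) (hm : m ≤ n) {P : G → M → Prop} (hP : SQ (sg m) (fun q : G × M => P q.1 q.2))
    {g : G} (hv : ∀ i, Ctx.get g i ∈ Vs ν) (he : ∃ y, P g y) : ∃ y, y ∈ Vs ν ∧ P g y := by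
  obtain ⟨R, h1, h2⟩ := hP
  have e : ∀ y, P g y ↔ R (Fin.snoc (Ctx.get g) y) := fun y => by rw [← get_snoc]; exact h2 (g, y)
  simp only [e] at he ⊢
  exact cn_ex h hm h1 hv he
theorem cn_om {n : ℕ} {ν : M} (h : CnE ZFM.E (n+1) ν) : om ∈ ν := by
  have d : SQ (sg 0) (fun x : M => x = om) := (DP.eq _ _ DF.id DF.om).1
  obtain ⟨R, h1, h2⟩ := d
  have e : ∀ y : M, y = om ↔ R (Fin.snoc (Fin.elim0 : Fin 0 → M) y) := fun y => by
    rw [show y = om ↔ _ from h2 y]; exact iff_of_eq (congrArg R (by funext i; fin_cases i; rfl))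
  obtain ⟨y, hy, h3⟩ := cn_ex h (Nat.zero_le n) (k := 0) (v := Fin.elim0) h1 (fun i => i.elim0) ⟨om, (e _).1 rfl⟩
  rw [(e y).2 h3] at hy
  exact (ord_mem_Vs (ordE_iff.1 h.1) ord_om).1 hy
theorem cn_fn {n : ℕ} {ν : M} (h : CnE ZFM.E (n+1) ν) {f : G → M} (hf : DF (sg 0) f) {g : G} (hv : ∀ i, Ctx.get g i ∈ Vs ν) : f g ∈ Vs ν := by
  obtain ⟨y, hy, e⟩ := cn_exG h (Nat.zero_le n) (P := fun g y => y = f g) (hf.graph).1 hv ⟨_, rfl⟩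
  exact e ▸ hy
theorem cn_lim {n : ℕ} {ν : M} (h : CnE ZFM.E (n+1) ν) : Lim ν := by
  have o := ordE_iff.1 h.1
  refine ⟨o, fun e => mem_emp (e ▸ cn_om h), fun x hx => ?_⟩
  have := cn_fn h (f := fun x : M => suc x) (by fun_prop) (g := x) (fun i => (ord_mem_Vs o (o.mem hx)).2 hx)
  exact (ord_mem_Vs o (o.mem hx).suc).1 this
theorem cn_tv {n : ℕ} {ν : M} (h : CnE ZFM.E (n+1) ν) : TV n ν := by
  have o := ordE_iff.1 h.1
  refine ⟨cn_lim h, cn_om h, fun ⟨m, hm⟩ C hC s hs hW => ?_⟩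
  refine cn_exG h (show m ≤ n by omega) (G := M × M) (g := (C, s)) (P := fun g s' => Ex g.2 s' (u0 g.1) ∧ BB m (u1 g.1) s') ?_ ?_ hW
  · refine SQ.and (DP.Ex _ _ _ ?_ ?_ ?_).1 (SQ.BB m _ _ ?_ ?_) <;> fun_prop
  · intro i
    have : C ∈ Vs ν := (ord_mem_Vs o (ord_om.mem hC)).2 (o.tr.mem (cn_om h) hC)
    fin_cases i
    · exact this
    · exact hs
theorem tv_cn {n : ℕ} {ν : M} (h : TV n ν) : CnE ZFM.E (n+1) ν := by
  have o := h.1.ord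
  have tr : ∀ x y, y ∈ Vs ν → ZFM.E x y → x ∈ Vs ν := fun x y hy hx => (tr_Vs o).mem hy hx
  have := sigma_ind (p := fun k l φ => k ≤ n+1 → ∀ v : Fin l → M, (∀ i, v i ∈ Vs ν) → (Rl ZFM.E (fun x => x ∈ Vs ν) φ v ↔ Realize ZFM.E φ v))
    (q := fun k l φ => k ≤ n+1 → ∀ v : Fin l → M, (∀ i, v i ∈ Vs ν) → (Rl ZFM.E (fun x => x ∈ Vs ν) φ v ↔ Realize ZFM.E φ v))
    (fun hd hk v hv => delta0_abs tr hd v hv) (fun _ ih hk => ih (by omega)) ?_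
    (fun hd hk v hv => delta0_abs tr hd v hv) (fun _ ih hk => ih (by omega)) ?_
  · exact cn_of o fun hφ v hv => this.1 hφ le_rfl v hv
  · intro k l φ hφ ih hk v hv
    rw [rl_ex, realize_ex]
    constructor
    · rintro ⟨a, ha, h⟩; exact ⟨a, (ih hk _ (hsnoc (S := fun x => x ∈ Vs ν) hv ha)).1 h⟩
    · rintro ⟨a, ha⟩
      obtain ⟨C, h1, h2, h3⟩ := ((sigma_code M).1 hφ).2 k rfl
      rw [h3, sq_snoc] at ha
      have hl := h2 _ (self_mem_suc _)
      obtain ⟨s', h4, h5, h6⟩ := h.2.2 ⟨k, by omega⟩ C h1 (sq v) (Vs_sq h.1 hv) ((W_ex (fn_sq v) hl).2 ⟨a, ha⟩)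
      have ha' := Vs_app o h4 h5.1 hl
      refine ⟨app s' (num l), ha', (ih hk _ (hsnoc (S := fun x => x ∈ Vs ν) hv ha')).2 ?_⟩
      rw [h3, sq_snoc]
      refine ⟨s', ⟨h5.1, fun q hq => ?_⟩, h6⟩
      rw [snc, mem_cup, mem_sing, (fn_sq v).dm] at hq
      rcases hq with hq | rfl
      · exact h5.2 _ hq
      · exact h5.1.pair_mem.2 ⟨hl, rfl⟩
  · intro k l φ hφ ih hk v hv
    rw [rl_all, realize_all]
    constructor
    · intro hh a
      by_contra ha
      obtain ⟨C, h1, h2, h3⟩ := ((sigma_code M).2 hφ).2 k rfl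
      rw [← realize_not, h3, sq_snoc] at ha
      have hl := h2 _ (self_mem_suc _)
      obtain ⟨s', h4, h5, h6⟩ := h.2.2 ⟨k, by omega⟩ C h1 (sq v) (Vs_sq h.1 hv) ((W_ex (fn_sq v) hl).2 ⟨a, ha⟩)
      have ha' := Vs_app o h4 h5.1 hl
      have h7 := (ih hk _ (hsnoc (S := fun x => x ∈ Vs ν) hv ha')).1 (hh _ ha')
      refine ((h3 (Fin.snoc v (app s' (num l)))).2 ?_) h7
      rw [sq_snoc]
      refine ⟨s', ⟨h5.1, fun q hq => ?_⟩, h6⟩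
      rw [snc, mem_cup, mem_sing, (fn_sq v).dm] at hq
      rcases hq with hq | rfl
      · exact h5.2 _ hq
      · exact h5.1.pair_mem.2 ⟨hl, rfl⟩
    · intro hh a ha; exact (ih hk _ (hsnoc (S := fun x => x ∈ Vs ν) hv ha)).2 (hh a)
theorem cn_iff {n : ℕ} {ν : M} : CnE ZFM.E (n+1) ν ↔ TV n ν := ⟨cn_tv, tv_cn⟩
end
end Paper
namespace Paper
section
variable {M : Type} [ZFM M] {G : Type} [Ctx M G] {c : Calc M}

theorem DP.finEx (n : ℕ) (P : Fin n → G → Prop) (h : ∀ i, DP c (P i)) : DP c (fun x => ∃ i, P i x) :=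
  (DP.finAll n (fun i x => ¬ P i x) fun i => (h i).not).not.congr fun v => by simp
theorem DF.snocI {k : ℕ} (f : G → Fin k → M) (hf : ∀ i, DF c (fun x => f x i)) (i : Fin (k+1)) :
    DF c (fun q : G × M => (Fin.snoc (f q.1) q.2 : Fin (k+1) → M) i) := by
  refine Fin.lastCases ?_ (fun i => ?_) i
  · simp only [Fin.snoc_last]; fun_prop
  · simp only [Fin.snoc_castSucc]; exact DF.comp (fun x => f x i) (fun q : G × M => q.1) (hf i) (by fun_prop)
theorem DP.rl [c.Full] {k : ℕ} (φ : SetFormula k) : ∀ {G : Type} [Ctx M G] (S : G → M → Prop)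
    (hS : DP c (fun q : G × M => S q.1 q.2)) (f : G → Fin k → M)
    (hf : ∀ i, DF c (fun x => f x i)), DP c (fun x => Rl ZFM.E (S x) φ (f x)) := by
  induction φ with
  | mem i j => intro G _ S hS f hf; exact DP.mem _ _ (hf i) (hf j)
  | eq i j => intro G _ S hS f hf; exact DP.eq _ _ (hf i) (hf j)
  | fal => intro G _ S hS f hf; exact DP.false
  | imp φ ψ h1 h2 => intro G _ S hS f hf; exact DP.imp _ _ (h1 S hS f hf) (h2 S hS f hf)
  | all φ ih =>
    intro G _ S hS f hf
    refine DP.all _ (DP.imp _ _ hS (ih (fun q : G × M => S q.1) ?_ (fun q : G × M => Fin.snoc (f q.1) q.2) (DF.snocI f hf)))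
    exact hS.comp (f := fun q : (G × M) × M => (q.1.1, q.2)) (by fun_prop)
theorem DP.realize [c.Full] {k : ℕ} (φ : SetFormula k) (f : G → Fin k → M)
    (hf : ∀ i, DF c (fun x => f x i)) : DP c (fun x => Realize ZFM.E φ (f x)) :=
  (DP.rl φ (fun _ _ => True) DP.true f hf).congr fun v => rl_true.symm

open Classical in
/-- iteration -/
noncomputable def it (F : M → M) (a n : M) : M := recF (fun x f => if x = emp then a else F (app f (sU x))) n
open Classical in
theorem it_df {F : M → M} (hF : DF full F) (a : M) : DF full (it F a) := by
  unfold it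
  exact DF.recF (fun (_ : M) x f => if x = emp then a else F (app f (sU x))) (fun x => x)
    (DF.ite _ _ _ (by fun_prop) (by fun_prop) (DF.comp F (fun q : (M × M) × M => app q.2 (sU q.1.2)) hF (by fun_prop))) (by fun_prop)
open Classical in
theorem it_df2 {F : M → M} (hF : DF full F) (a : M) : DF2 (fun x f : M => if x = emp then a else F (app f (sU x))) := by
  unfold DF2
  exact (DF.ite _ _ _ (by fun_prop) (by fun_prop) (DF.comp F (fun q : (M × M) => app q.2 (sU q.1)) hF (by fun_prop)))
open Classical in
theorem it_emp {F : M → M} (hF : DF full F) (a : M) : it F a emp = a := by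
  rw [it, recF_spec (it_df2 hF a), if_pos rfl]
open Classical in
theorem it_suc {F : M → M} (hF : DF full F) (a : M) {n : M} (hn : Tr n) : it F a (suc n) = F (it F a n) := by
  conv_lhs => rw [it, recF_spec (it_df2 hF a)]
  rw [if_neg (fun e => by have := self_mem_suc n; rw [e] at this; exact mem_emp this), sU_suc hn]
  rw [show app (lam (suc n) (recF _)) n = it F a n from app_lam (it_df hF a) (self_mem_suc n)]

/-- `V_ν` is closed under witnesses for `R` -/
def Clo (R : M → M → Prop) (ν : M) : Prop := ∀ x, x ∈ Vs ν → (∃ y, R x y) → ∃ y, y ∈ Vs ν ∧ R x y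
theorem cd_of_lim {ν : M} (h : Ord ν) (hk : ∀ a, a ∈ ν → ∃ k, k ⊆ ν ∧ Cd k ∧ a ∈ k) : Cd ν := by
  refine ⟨h, fun a ha e => ?_⟩
  obtain ⟨k, h1, h2, h3⟩ := hk a ha
  exact h2.not_le h3 ((leC_sub h1).trans e.symm.le)
theorem cd_above (a : M) : ∃ k : M, Cd k ∧ rank a ∈ k := by
  obtain ⟨k, h1, h2⟩ := next_cd (rank a)
  exact ⟨k, h1, Cd.lt_of_not_le (ord_rank a) h1.ord h2⟩
theorem clo_exists {R : M → M → Prop} (hR : DP full (fun q : M × M => R q.1 q.2)) (a : M) :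
    ∃ ν, Lim ν ∧ om ∈ ν ∧ Cd ν ∧ a ∈ Vs ν ∧ Clo R ν := by
  let Q : M → M → Prop := fun α β => (∃ k, k ∈ β ∧ Cd k ∧ α ∈ k) ∧
    ∀ x, x ∈ Vs α → (∃ y, R x y) → ∃ y, y ∈ Vs β ∧ R x y
  have dQ : DP full (fun q : M × M => Q q.1 q.2) := by
    have d2 := hR.comp (f := fun q : ((M × M) × M) × M => (q.1.2, q.2)) (by fun_prop)
    refine DP.and _ _ (by fun_prop) (DP.all _ (DP.imp _ _ (by fun_prop) (DP.imp _ _ (DP.ex _ d2) (DP.ex _ (DP.and _ _ (by fun_prop) d2)))))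
  have hQ : ∀ α, Ord α → ∃ β, Ord β ∧ Q α β := by
    intro α hα
    obtain ⟨b, hb⟩ := collection (P := fun x y => R x y) hR (Vs α)
    obtain ⟨k, h1, h2⟩ := cd_above α
    rw [rank_ord hα] at h2
    have o := (h1.ord.cup (ord_rank b)).suc
    refine ⟨suc (cup k (rank b)), o, ⟨k, ?_, h1, h2⟩, fun x hx hy => ?_⟩
    · rw [h1.ord.mem_suc_iff (h1.ord.cup (ord_rank b))]; intro z hz; simp [hz]
    · obtain ⟨y, h3, h4⟩ := hb x hx hy
      refine ⟨y, ?_, h4⟩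
      rw [mem_Vs o, (ord_rank y).mem_suc_iff (h1.ord.cup (ord_rank b))]
      intro z hz; rw [mem_cup]; exact .inr ((ord_rank b).trans (rank_mem h3) hz)
  let F : M → M := fun α => mu (fun β => Q α β)
  have dF : DF full F := DF.mu _ dQ
  have dQ1 : ∀ α, DP full (Q α) := fun α => dQ.comp (f := fun β : M => (α, β)) (by fun_prop)
  have F1 : ∀ α, Ord α → Q α (F α) := fun α hα => (mu_spec (dQ1 α) (hQ α hα)).2.1
  have F2 : ∀ α, Ord (F α) := fun α => ord_mu
  let a0 := suc (cup (rank a) om)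
  have o0 : Ord a0 := ((ord_rank a).cup ord_om).suc
  let g := it F a0
  have dg : DF full g := it_df dF a0
  have og : ∀ n, n ∈ (om : M) → Ord (g n) := by
    intro n hn
    rcases om_cases hn with rfl | ⟨k, hk, rfl⟩
    · show Ord (it F a0 emp); rw [it_emp dF]; exact o0
    · show Ord (it F a0 (suc k)); rw [it_suc dF _ (ord_om.mem hk).tr]; exact F2 _
  have gs : ∀ n, n ∈ (om : M) → Q (g n) (g (suc n)) := by
    intro n hn
    show Q (g n) (it F a0 (suc n)); rw [it_suc dF _ (ord_om.mem hn).tr]; exact F1 _ (og n hn)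
  have mg : ∀ x, x ∈ sU (img om g) ↔ ∃ n, n ∈ (om : M) ∧ x ∈ g n := by
    intro x; rw [mem_sU]; simp only [mem_img dg]
    exact ⟨fun ⟨y, ⟨n, hn, e⟩, hy⟩ => ⟨n, hn, e ▸ hy⟩, fun ⟨n, hn, h⟩ => ⟨_, ⟨n, hn, rfl⟩, h⟩⟩
  have o : Ord (sU (img om g)) := ord_sU fun x hx => by
    rw [mem_img dg] at hx; obtain ⟨n, hn, rfl⟩ := hx; exact og n hn
  have g0 : g emp = a0 := it_emp dF a0
  have gg : ∀ n, n ∈ (om : M) → g n ∈ g (suc n) := fun n hn => by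
    obtain ⟨k, h1, h2, h3⟩ := (gs n hn).1; exact (og _ (suc_om hn)).trans h1 h3
  have aν : ∀ x, x ∈ a0 → x ∈ sU (img om g) := fun x hx => (mg x).2 ⟨emp, emp_om, g0.symm ▸ hx⟩
  have om0 : om ∈ a0 := by
    rw [ord_om.mem_suc_iff ((ord_rank a).cup ord_om)]; intro z hz; rw [mem_cup]; exact .inr hz
  refine ⟨sU (img om g), ⟨o, fun e => mem_emp (e ▸ aν _ om0), fun x hx => ?_⟩, aν _ om0, ?_, ?_, ?_⟩
  · obtain ⟨n, hn, h⟩ := (mg x).1 hx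
    refine (mg _).2 ⟨suc n, suc_om hn, ?_⟩
    exact (((og n hn).mem h).suc).lt_of_le_of_lt (og _ (suc_om hn)) ((og n hn).suc_sub h) (gg n hn)
  · refine cd_of_lim o fun x hx => ?_
    obtain ⟨n, hn, h⟩ := (mg x).1 hx
    obtain ⟨k, h1, h2, h3⟩ := (gs n hn).1
    exact ⟨k, fun z hz => (mg z).2 ⟨suc n, suc_om hn, (og _ (suc_om hn)).trans h1 hz⟩, h2, h2.ord.trans h3 h⟩
  · rw [mem_Vs o]; apply aν
    rw [(ord_rank a).mem_suc_iff ((ord_rank a).cup ord_om)]; intro z hz; rw [mem_cup]; exact .inl hz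
  · intro x hx hy
    rw [mem_Vs o, mg] at hx
    obtain ⟨n, hn, h⟩ := hx
    obtain ⟨y, h1, h2⟩ := (gs n hn).2 x ((mem_Vs (og n hn)).2 h) hy
    exact ⟨y, (mem_Vs o).2 ((mg _).2 ⟨_, suc_om hn, (mem_Vs (og _ (suc_om hn))).1 h1⟩), h2⟩

/-- `Q` is implied by closure of `V_ν` under some definable relation -/
def CloQ (Q : M → Prop) : Prop := ∃ R : M → M → Prop, DP full (fun q : M × M => R q.1 q.2) ∧ ∀ ν, Lim ν → om ∈ ν → Clo R ν → Q ν
theorem CloQ.mono {Q Q' : M → Prop} (h : CloQ Q) (i : ∀ ν, Lim ν → om ∈ ν → Q ν → Q' ν) : CloQ Q' := by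
  obtain ⟨R, h1, h2⟩ := h; exact ⟨R, h1, fun ν a b d => i ν a b (h2 ν a b d)⟩
theorem CloQ.rel {R : M → M → Prop} (h : DP full (fun q : M × M => R q.1 q.2)) : CloQ (Clo R) := ⟨R, h, fun _ _ _ h => h⟩
theorem CloQ.and {Q Q' : M → Prop} (h : CloQ Q) (h' : CloQ Q') : CloQ (fun ν => Q ν ∧ Q' ν) := by
  obtain ⟨R, h1, h2⟩ := h; obtain ⟨R', h3, h4⟩ := h'
  refine ⟨fun x y => (∃ z, x = pair (num 0) z ∧ R z y) ∨ (∃ z, x = pair (num 1) z ∧ R' z y), ?_, fun ν hν ho hc => ⟨h2 ν hν ho ?_, h4 ν hν ho ?_⟩⟩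
  · have a := h1.comp (f := fun q : (M × M) × M => (q.2, q.1.2)) (by fun_prop)
    have b := h3.comp (f := fun q : (M × M) × M => (q.2, q.1.2)) (by fun_prop)
    exact DP.or _ _ (DP.ex _ (DP.and _ _ (by fun_prop) a)) (DP.ex _ (DP.and _ _ (by fun_prop) b))
  · rintro x hx ⟨y, hy⟩
    obtain ⟨y, h5, h6⟩ := hc (pair (num 0) x) (Vs_pair hν ((ord_mem_Vs hν.ord (ord_num _)).2 (hν.om_le _ (num_om _))) hx) ⟨y, .inl ⟨x, rfl, hy⟩⟩
    refine ⟨y, h5, ?_⟩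
    rcases h6 with ⟨z, e, h6⟩ | ⟨z, e, h6⟩
    · rw [(pair_inj.1 e).2]; exact h6
    · exact (num_ne (by omega) (pair_inj.1 e).1).elim
  · rintro x hx ⟨y, hy⟩
    obtain ⟨y, h5, h6⟩ := hc (pair (num 1) x) (Vs_pair hν ((ord_mem_Vs hν.ord (ord_num _)).2 (hν.om_le _ (num_om _))) hx) ⟨y, .inr ⟨x, rfl, hy⟩⟩
    refine ⟨y, h5, ?_⟩
    rcases h6 with ⟨z, e, h6⟩ | ⟨z, e, h6⟩
    · exact (num_ne (by omega) (pair_inj.1 e).1).elim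
    · rw [(pair_inj.1 e).2]; exact h6
theorem CloQ.exists {Q : M → Prop} (h : CloQ Q) (a : M) : ∃ ν, Lim ν ∧ om ∈ ν ∧ Cd ν ∧ a ∈ Vs ν ∧ Q ν := by
  obtain ⟨R, h1, h2⟩ := h
  obtain ⟨ν, a, b, d, e, f⟩ := clo_exists h1 a
  exact ⟨ν, a, b, d, e, h2 ν a b f⟩
theorem CloQ.fin (n : ℕ) {Q : Fin n → M → Prop} (h : ∀ i, CloQ (Q i)) : CloQ (fun ν => ∀ i, Q i ν) := by
  induction n with
  | zero => exact (CloQ.rel (R := fun x y : M => x = y) (by fun_prop)).mono fun ν _ _ _ i => i.elim0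
  | succ n ih => exact ((h 0).and (ih fun i => h i.succ)).mono fun ν _ _ h => Fin.forall_fin_succ.2 h
/-- reflection of a formula -/
theorem CloQ.form {k : ℕ} (φ : SetFormula k) : CloQ (fun ν : M => ∀ v : Fin k → M, (∀ i, v i ∈ Vs ν) →
    (Rl ZFM.E (fun x => x ∈ Vs ν) φ v ↔ Realize ZFM.E φ v)) := by
  induction φ with
  | mem i j => exact (CloQ.rel (R := fun x y : M => x = y) (by fun_prop)).mono fun ν _ _ _ v hv => Iff.rfl
  | eq i j => exact (CloQ.rel (R := fun x y : M => x = y) (by fun_prop)).mono fun ν _ _ _ v hv => Iff.rfl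
  | fal => exact (CloQ.rel (R := fun x y : M => x = y) (by fun_prop)).mono fun ν _ _ _ v hv => Iff.rfl
  | imp φ ψ h1 h2 => exact (h1.and h2).mono fun ν _ _ ⟨h1, h2⟩ v hv => by rw [rl_imp, realize_imp, h1 v hv, h2 v hv]
  | @all k φ ih =>
    refine (ih.and (CloQ.rel (R := fun s y => ¬ Realize ZFM.E φ (Fin.snoc (fun i : Fin k => app s (num i)) y)) ?_)).mono ?_
    · exact DP.not _ (DP.realize φ _ (DF.snocI (fun s (i : Fin k) => app s (num i)) fun i => by fun_prop))
    · rintro ν hν ho ⟨h1, h2⟩ v hv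
      rw [rl_all, realize_all]
      constructor
      · intro h a
        by_contra ha
        obtain ⟨y, h3, h4⟩ := h2 (sq v) (Vs_sq hν hv) ⟨a, by simpa only [app_sq] using ha⟩
        simp only [app_sq] at h4
        exact h4 ((h1 _ (hsnoc (S := fun x => x ∈ Vs ν) hv h3)).1 (h y h3))
      · intro h a ha; exact (h1 _ (hsnoc (S := fun x => x ∈ Vs ν) hv ha)).2 (h a)
theorem CloQ.tv (n : ℕ) : CloQ (fun ν : M => TV n ν) := by
  refine (CloQ.fin (n+1) (Q := fun m => Clo fun x s' => ∃ C s, x = pair C s ∧ Ex s s' (u0 C) ∧ BB m (u1 C) s') fun m => CloQ.rel (by fun_prop)).mono ?_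
  intro ν h1 h2 h
  refine ⟨h1, h2, fun m C hC s hs ⟨s', h3⟩ => ?_⟩
  obtain ⟨y, hy, C', s', e, h4⟩ := h m (pair C s) (Vs_pair h1 ((ord_mem_Vs h1.ord (ord_om.mem hC)).2 (h1.ord.trans h2 hC)) hs) ⟨s', C, s, rfl, h3⟩
  obtain ⟨rfl, rfl⟩ := pair_inj.1 e
  exact ⟨y, hy, h4⟩

/-- cardinals in `C⁽ⁿ⁺¹⁾` -/
def CC (n : ℕ) (θ : M) : Prop := TV n θ ∧ Cd θ
@[fun_prop] theorem DP.CC [c.Full] (n : ℕ) (f : G → M) (hf : DF c f) : DP c (fun x => CC n (f x)) := by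
  unfold Paper.CC; fun_prop
theorem cc_above (n : ℕ) (a : M) : ∃ θ : M, CC n θ ∧ a ∈ Vs θ := by
  obtain ⟨ν, a, b, d, e, f⟩ := (CloQ.tv n).exists a
  exact ⟨ν, ⟨f, d⟩, e⟩
theorem tv_lim {n : ℕ} {ν : M} (h : Lim ν) (hk : ∀ a, a ∈ ν → ∃ k, k ⊆ ν ∧ TV n k ∧ a ∈ k) : TV n ν := by
  have ho := h.ord.emp_mem h.2.1
  obtain ⟨k, h1, h2, -⟩ := hk _ ho
  refine ⟨h, h1 _ h2.2.1, fun m C hC s hs hW => ?_⟩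
  obtain ⟨k, h1, h2, h3⟩ := hk _ ((mem_Vs h.ord).1 hs)
  obtain ⟨s', h4, h5⟩ := h2.2.2 m C hC s ((mem_Vs h2.1.ord).2 h3) hW
  exact ⟨s', Vs_mono' h2.1.ord h.ord h1 _ h4, h5⟩
end
end Paper
namespace Paper
section
variable {M : Type} [ZFM M] {G A B : Type} [Ctx M G] [Ctx M A] [Ctx M B] {c : Calc M}

@[simp] theorem gv_M {S : M → Prop} {x : M} : (∀ i, S (Ctx.get x i)) ↔ S x := ⟨fun h => h (0 : Fin 1), fun h _ => h⟩
@[simp] theorem gv_prod {S : M → Prop} {x : A} {y : B} : (∀ i, S (Ctx.get (x, y) i)) ↔ (∀ i, S (Ctx.get x i)) ∧ ∀ i, S (Ctx.get y i) := by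
  constructor
  · intro h
    exact ⟨fun i => by simpa [Ctx.get] using h (Fin.castAdd _ i), fun i => by simpa [Ctx.get] using h (Fin.natAdd _ i)⟩
  · rintro ⟨h1, h2⟩ i
    refine Fin.addCases (fun i => ?_) (fun i => ?_) i
    · simpa [Ctx.get] using h1 i
    · simpa [Ctx.get] using h2 i

/-- predicates expressible in `V_θ` for `θ ∈ C⁽ⁿ⁺¹⁾`; the first argument is `V_θ` -/
def RD (n : ℕ) (P : M → G → Prop) : Prop := ∃ φ : SetFormula (Ctx.k G), ∀ θ, TV n θ → ∀ g, (∀ i, Ctx.get g i ∈ Vs θ) →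
  (P (Vs θ) g ↔ Rl ZFM.E (fun x => x ∈ Vs θ) φ (Ctx.get g))
variable {n : ℕ}
theorem RD.of {m : ℕ} (hm : m ≤ n) {P : G → Prop} (h : SQ (sg m) P) : RD n (fun _ => P) := by
  obtain ⟨R, h1, h2⟩ := h
  obtain ⟨φ, h3, h4⟩ := sg_form h1
  refine ⟨φ, fun θ hθ g hg => ?_⟩
  beta_reduce; rw [cn_abs (tv_cn hθ) (sigma_le h3 (by omega)) hg, h2, h4]
theorem RD.not {P : M → G → Prop} (h : RD n P) : RD n (fun v g => ¬ P v g) := by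
  obtain ⟨φ, h⟩ := h; exact ⟨φ.not, fun θ hθ g hg => by beta_reduce; rw [rl_not, h θ hθ g hg]⟩
theorem RD.and {P R : M → G → Prop} (h : RD n P) (h' : RD n R) : RD n (fun v g => P v g ∧ R v g) := by
  obtain ⟨φ, h⟩ := h; obtain ⟨ψ, h'⟩ := h'
  exact ⟨φ.and ψ, fun θ hθ g hg => by beta_reduce; rw [rl_and, h θ hθ g hg, h' θ hθ g hg]⟩
theorem RD.imp {P R : M → G → Prop} (h : RD n P) (h' : RD n R) : RD n (fun v g => P v g → R v g) := by
  obtain ⟨φ, h⟩ := h; obtain ⟨ψ, h'⟩ := h'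
  exact ⟨φ.imp ψ, fun θ hθ g hg => by beta_reduce; rw [rl_imp, h θ hθ g hg, h' θ hθ g hg]⟩
theorem RD.all {P : M → G → M → Prop} (h : RD n (fun v (q : G × M) => P v q.1 q.2)) : RD n (fun v g => ∀ y, y ∈ v → P v g y) := by
  obtain ⟨φ, h⟩ := h
  refine ⟨φ.all, fun θ hθ g hg => ?_⟩
  rw [rl_all]
  refine forall_congr' fun y => imp_congr_right fun hy => ?_
  rw [← get_snoc]; exact h θ hθ (g, y) (gv_prod.2 ⟨hg, gv_M.2 hy⟩)
theorem RD.ex {P : M → G → M → Prop} (h : RD n (fun v (q : G × M) => P v q.1 q.2)) : RD n (fun v g => ∃ y, y ∈ v ∧ P v g y) := by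
  obtain ⟨φ, h⟩ := h
  refine ⟨φ.ex, fun θ hθ g hg => ?_⟩
  rw [rl_ex]
  refine exists_congr fun y => and_congr_right fun hy => ?_
  rw [← get_snoc]; exact h θ hθ (g, y) (gv_prod.2 ⟨hg, gv_M.2 hy⟩)
theorem RD.fin (k : ℕ) {P : Fin k → M → G → Prop} (h : ∀ i, RD n (P i)) : RD n (fun v g => ∀ i, P i v g) := by
  induction k with
  | zero => exact ⟨SetFormula.fal.not, fun θ hθ g hg => by simp⟩
  | succ k ih =>
    obtain ⟨φ, h'⟩ := (h 0).and (ih fun i => h i.succ)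
    exact ⟨φ, fun θ hθ g hg => by rw [← h' θ hθ g hg]; exact Fin.forall_fin_succ⟩
theorem RD.congr {P R : M → G → Prop} (h : RD n P) (e : ∀ θ, TV n θ → ∀ g, (∀ i, Ctx.get g i ∈ Vs θ) → (R (Vs θ) g ↔ P (Vs θ) g)) : RD n R := by
  obtain ⟨φ, h⟩ := h; exact ⟨φ, fun θ hθ g hg => by rw [e θ hθ g hg, h θ hθ g hg]⟩

theorem TV.ord {θ : M} (h : TV n θ) : Ord θ := h.1.1
theorem TV.om {θ : M} (h : TV n θ) : om ∈ θ := h.2.1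
theorem CC.ord {θ : M} (h : CC n θ) : Ord θ := h.1.1.1
theorem tv_eqC {θ x : M} (h : TV n θ) (hx : x ∈ Vs θ) : ∃ b, b ∈ θ ∧ EqC b x := by
  have ⟨a, ha⟩ := eqC_ord x
  obtain ⟨b, hb, h1, h2⟩ := cn_exG (tv_cn h) (Nat.zero_le n) (P := fun x b : M => Ord b ∧ EqC b x)
    (SQ.and (by fun_prop : DP (sg 0) fun q : M × M => Ord q.2).1 (SQ.ex (by fun_prop : DP (sg 0) fun q : (M × M) × M => Bij q.2 q.1.2 q.1.1).1))
    (g := x) (gv_M.2 hx) ⟨a, ha⟩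
  exact ⟨b, (ord_mem_Vs h.ord h1).1 hb, h2⟩
theorem rank_sur {t : M} (ht : Tr t) : ∀ x, x ⊆ t → ∀ a, a ∈ rank x → ∃ y, y ∈ t ∧ rank y = a := by
  refine eps_ind (by fun_prop) fun x ih hx a ha => ?_
  obtain ⟨y, hy, h | h⟩ := mem_rank.1 ha
  · exact ih y hy (fun z hz => ht.mem (hx y hy) hz) a h
  · exact ⟨y, hx y hy, h.symm⟩
/-- `H(θ) = V_θ` -/
theorem hMemE_iff {θ x : M} (h : CC n θ) : HMemE ZFM.E x θ ↔ x ∈ Vs θ := by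
  constructor
  · rintro ⟨t, h1, h2, b, f, hb, hf⟩
    have h1 : Tr t := transE_iff.1 h1
    have h2 : x ⊆ t := subE_iff.1 h2
    have hf := surjE_iff.1 hf
    have h3 : LeC (rank t) b := by
      refine LeC.trans ?_ (leC_of_sur hf)
      refine leC_of_sur (f := lam t rank) (sur_lam (by fun_prop) (fun y hy => rank_mem hy) ?_)
      exact rank_sur h1 t (Sub.refl t)
    have : rank t ∈ θ := Cd.lt_of_not_le (ord_rank t) h.ord fun h4 => h.2.not_le hb (h4.trans h3)
    rw [mem_Vs h.ord]; exact (ord_rank x).lt_of_le_of_lt h.ord (rank_mono h2) this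
  · intro hx
    have h1 : trcl x ∈ Vs θ := cn_fn (tv_cn h.1) (f := fun x : M => trcl x) (by fun_prop) (gv_M.2 hx)
    obtain ⟨b, hb, f, hf⟩ := tv_eqC h.1 h1
    exact ⟨trcl x, transE_iff.2 (tr_trcl x), subE_iff.2 (sub_trcl x), b, f, hb, surjE_iff.2 hf.2⟩

/-- relativized version of `TV` -/
def TVr (n : ℕ) (v θ : M) : Prop := (Lim θ ∧ om ∈ θ) ∧ ∀ m : Fin (n+1), ∀ C, C ∈ v → ∀ s, s ∈ v → (C ∈ (om : M) ∧ rank s ∈ θ ∧ W m C s) →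
  ∃ s', s' ∈ v ∧ (rank s' ∈ θ ∧ Ex s s' (u0 C) ∧ BB m (u1 C) s')
theorem tvr_iff {n : ℕ} {ρ θ : M} (hρ : TV n ρ) (h : θ ∈ Vs ρ) : TV n θ ↔ TVr n (Vs ρ) θ := by
  constructor
  · intro hθ
    have hl : θ ∈ ρ := (ord_mem_Vs hρ.ord hθ.ord).1 h
    refine ⟨⟨hθ.1, hθ.om⟩, fun m C _ s _ ⟨h1, h2, h3⟩ => ?_⟩
    obtain ⟨s', h4, h5⟩ := hθ.2.2 m C h1 s ((mem_Vs hθ.ord).2 h2) h3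
    exact ⟨s', Vs_mono hρ.ord hl _ h4, (mem_Vs hθ.ord).1 h4, h5⟩
  · rintro ⟨⟨h1, h2⟩, h3⟩
    have hl : θ ∈ ρ := (ord_mem_Vs hρ.ord h1.ord).1 h
    refine ⟨h1, h2, fun m C hC s hs hW => ?_⟩
    obtain ⟨s', h4, h5, h6⟩ := h3 m C ((ord_mem_Vs hρ.ord (ord_om.mem hC)).2 (hρ.ord.trans hρ.om hC)) s (Vs_mono hρ.ord hl _ hs) ⟨hC, (mem_Vs h1.ord).1 hs, hW⟩
    exact ⟨s', (mem_Vs h1.ord).2 h5, h6⟩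
theorem RD.tvr (f : G → M) (hf : DF (sg 0) f) (hf' : ∀ m, DF (sg m) f) : RD n (fun v g => TVr n v (f g)) := by
  refine RD.and (RD.of (Nat.zero_le n) (by fun_prop : DP (sg 0) fun g => Lim (f g) ∧ Paper.om ∈ f g).1) (RD.fin _ fun m => RD.all (P := fun v g C => _) (RD.all (P := fun v g s => _) (RD.imp (RD.and ?_ (RD.and ?_ ?_)) (RD.ex (P := fun v g s' => _) (RD.and ?_ (RD.and ?_ ?_))))))
  · exact RD.of (Nat.zero_le n) (by fun_prop : DP (sg 0) _).1
  · exact RD.of (Nat.zero_le n) (by fun_prop : DP (sg 0) _).1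
  · refine RD.of (m := m) (by omega) (SQ.ex (SQ.and (by fun_prop : DP (sg m) _).1 (SQ.BB m _ _ ?_ ?_))) <;> fun_prop
  · exact RD.of (Nat.zero_le n) (by fun_prop : DP (sg 0) _).1
  · exact RD.of (Nat.zero_le n) (by fun_prop : DP (sg 0) _).1
  · refine RD.of (m := m) (by omega) (SQ.BB m _ _ ?_ ?_) <;> fun_prop
def Cdr (v θ : M) : Prop := Ord θ ∧ ∀ a, a ∈ v → ¬ (a ∈ θ ∧ EqC a θ)
theorem cdr_iff {ρ θ : M} (hρ : Ord ρ) (h : θ ∈ Vs ρ) : Cd θ ↔ Cdr (Vs ρ) θ :=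
  and_congr_right fun o => ⟨fun h1 a _ h2 => h1 a h2.1 h2.2, fun h1 a ha e =>
    h1 a ((tr_Vs hρ).mem h ha) ⟨ha, e⟩⟩
theorem RD.cdr (f : G → M) (hf : DF (sg 0) f) : RD n (fun v g => Cdr v (f g)) := by
  refine RD.and (RD.of (Nat.zero_le n) (by fun_prop : DP (sg 0) _).1) (RD.all (P := fun v g a => _) (RD.not (RD.of (Nat.zero_le n) (SQ.and (by fun_prop : DP (sg 0) _).1 (SQ.ex (by fun_prop : DP (sg 0) _).1)))))

/-- weak shrewdness; `B` is a restriction on the reflected structure -/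
def WS (n : ℕ) (κ : M) (B : M → Prop) : Prop := Cd κ ∧ ∀ (φ : SetFormula 2) (θ z : M), CC n θ → κ ∈ θ → z ⊆ κ →
  Rl ZFM.E (fun x => x ∈ Vs θ) φ ![z, κ] → ∃ κ' θ', Cd κ' ∧ CC n θ' ∧ κ' ∈ θ' ∧ κ' ∈ κ ∧ B θ' ∧
    Rl ZFM.E (fun x => x ∈ Vs θ') φ ![cap z κ', κ']
theorem in2 {θ κ z : M} (h : Ord θ) (hκ : κ ∈ θ) (hz : z ⊆ κ) : ∀ i, (![z, κ] : Fin 2 → M) i ∈ Vs θ := by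
  have : κ ∈ Vs θ := (ord_mem_Vs h (h.mem hκ)).2 hκ
  intro i; fin_cases i
  · exact Vs_sub h hz this
  · exact this
theorem cap_sub_r (a b : M) : cap a b ⊆ b := fun z hz => (mem_cap.1 hz).2
theorem cap_sub_l (a b : M) : cap a b ⊆ a := fun z hz => (mem_cap.1 hz).1
theorem ws_iff {κ : M} : CnWeaklyShrewdE ZFM.E (n+1) κ ↔ WS n κ (fun _ => True) := by
  have e : ∀ {φ : SetFormula 2} {θ z κ : M}, CC n θ → κ ∈ θ → z ⊆ κ → (RealizeIn ZFM.E (fun x => HMemE ZFM.E x θ) φ ![z, κ] ↔ Rl ZFM.E (fun x => x ∈ Vs θ) φ ![z, κ]) := by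
    intro φ θ z κ h1 h2 h3
    rw [realizeIn_iff, rl_congr (fun x => hMemE_iff h1)]
    exact ⟨fun h => h.2, fun h => ⟨fun i => (hMemE_iff h1).2 (in2 h1.ord h2 h3 i), h⟩⟩
  refine and_congr cardE_iff ⟨fun h φ θ z h1 h2 h3 h4 => ?_, fun h φ θ z h1 h2 h3 h4 h5 => ?_⟩
  · obtain ⟨κ', θ', z', a1, a2, a3, a4, a5, a6, a7⟩ := h φ θ z (cardE_iff.2 h1.2) (cn_iff.2 h1.1) h2 (subE_iff.2 h3) ((e h1 h2 h3).2 h4)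
    obtain rfl := interE_iff.1 a6
    have hc : CC n θ' := ⟨cn_iff.1 a3, cardE_iff.1 a2⟩
    exact ⟨κ', θ', cardE_iff.1 a1, hc, a4, a5, trivial, (e hc a4 (cap_sub_r _ _)).1 a7⟩
  · have hc : CC n θ := ⟨cn_iff.1 h2, cardE_iff.1 h1⟩
    obtain ⟨κ', θ', a1, a2, a3, a4, -, a5⟩ := h φ θ z hc h3 (subE_iff.1 h4) ((e hc h3 (subE_iff.1 h4)).1 h5)
    exact ⟨κ', θ', cap z κ', cardE_iff.2 a1, cardE_iff.2 a2.2, cn_iff.2 a2.1, a3, a4, interE_iff.2 rfl, (e a2 a3 (cap_sub_r _ _)).2 a5⟩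

noncomputable def eC (n : ℕ) (θ : M) : M := sep (Vs θ) (TV n)
theorem mem_eC {θ x : M} : x ∈ eC n θ ↔ x ∈ Vs θ ∧ TV n x := mem_sep (by fun_prop)
/-- reflection of `Δ₁` statements about `V_θ` -/
theorem WS.refl {κ : M} {Bd : M → Prop} (h : WS n κ Bd) (hB : ∀ a b, Ord b → a ∈ b → Bd b → Bd a)
    {P : M → M → M → M → Prop} (hP : SQ (sg 0) (fun q : ((M × M) × M) × M => P q.1.1.1 q.1.1.2 q.1.2 q.2)) {θ z : M}
    (h1 : CC n θ) (h2 : κ ∈ θ) (h3 : z ⊆ κ) (h4 : P (Vs θ) (eC n θ) z κ) :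
    ∃ κ' θ', Cd κ' ∧ CC n θ' ∧ κ' ∈ θ' ∧ κ' ∈ κ ∧ Bd θ' ∧ P (Vs θ') (eC n θ') (cap z κ') κ' := by
  let Q : M → M × M → Prop := fun v g => ∃ θ, θ ∈ v ∧ ∃ w, w ∈ v ∧ ∃ e, e ∈ v ∧ (TVr n v θ ∧ Cdr v θ ∧ (g.2 ∈ θ ∧ w ⊆ w) ∧
    (∀ x, x ∈ v → (x ∈ w ↔ rank x ∈ θ)) ∧ (∀ x, x ∈ v → ((x ∈ e → x ∈ w) ∧ (x ∈ w → ((x ∈ e → TVr n v x) ∧ (TVr n v x → x ∈ e))))) ∧ P w e g.1 g.2)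
  have rQ : RD n Q := by
    refine RD.ex (P := fun v g θ => _) (RD.ex (P := fun v g w => _) (RD.ex (P := fun v g e => _) (RD.and (RD.tvr _ ?_ ?_) (RD.and (RD.cdr _ ?_) (RD.and ?_ (RD.and (RD.all (P := fun v g x => _) ?_) (RD.and (RD.all (P := fun v g x => _) (RD.and ?_ (RD.imp ?_ (RD.and (RD.imp ?_ (RD.tvr _ ?_ ?_)) (RD.imp (RD.tvr _ ?_ ?_) ?_))))) ?_)))))))
    any_goals fun_prop
    any_goals first | exact RD.of (Nat.zero_le n) (hP.comp (f := fun q : (((M × M) × M) × M) × M => (((q.1.2, q.2), q.1.1.1.1), q.1.1.1.2)) (by fun_prop)) | skip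
    any_goals exact RD.of (Nat.zero_le n) (by fun_prop : DP (sg 0) _).1
  have key : ∀ ρ κ z, TV n ρ → κ ∈ ρ → z ⊆ κ → (Q (Vs ρ) (z, κ) ↔ ∃ θ, θ ∈ ρ ∧ CC n θ ∧ κ ∈ θ ∧ P (Vs θ) (eC n θ) z κ) := by
    intro ρ κ z hρ hκ hz
    have hV : ∀ θ, θ ∈ ρ → Vs θ ∈ Vs ρ := fun θ hθ => Vs_mem hρ.ord hθ
    have tV : ∀ {x y}, x ∈ Vs ρ → y ∈ x → y ∈ Vs ρ := fun hx hy => (tr_Vs hρ.ord).mem hx hy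
    constructor
    · rintro ⟨θ, b1, w, b2, e, b3, b4, b5, b6, b7, b8, b9⟩
      have tv := (tvr_iff hρ b1).2 b4
      have hθ := (ord_mem_Vs hρ.ord tv.ord).1 b1
      obtain rfl : w = Vs θ := ext fun x => ⟨fun hx => (mem_Vs tv.ord).2 ((b7 x (tV b2 hx)).1 hx),
        fun hx => (b7 x (tV (hV θ hθ) hx)).2 ((mem_Vs tv.ord).1 hx)⟩
      obtain rfl : e = eC n θ := ext fun x => by
        rw [mem_eC]
        constructor
        · intro hx
          have h1 := tV b3 hx
          have h2 := (b8 x h1).1 hx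
          exact ⟨h2, (tvr_iff hρ h1).2 (((b8 x h1).2 h2).1 hx)⟩
        · rintro ⟨hx, ht⟩
          have h1 := tV b2 hx
          exact ((b8 x h1).2 hx).2 ((tvr_iff hρ h1).1 ht)
      exact ⟨θ, hθ, ⟨tv, (cdr_iff hρ.ord b1).2 b5⟩, b6.1, b9⟩
    · rintro ⟨θ, hθ, hc, h1, h2⟩
      have b1 := (ord_mem_Vs hρ.ord hc.ord).2 hθ
      refine ⟨θ, b1, Vs θ, hV θ hθ, eC n θ, Vs_sub hρ.ord (fun x hx => (mem_eC.1 hx).1) (hV θ hθ), (tvr_iff hρ b1).1 hc.1, (cdr_iff hρ.ord b1).1 hc.2, ⟨h1, Sub.refl _⟩, fun x hx => mem_Vs hc.ord, fun x hx => ⟨fun h => (mem_eC.1 h).1, fun h => ⟨fun h' => (tvr_iff hρ hx).1 (mem_eC.1 h').2, fun h' => mem_eC.2 ⟨h, (tvr_iff hρ hx).2 h'⟩⟩⟩, h2⟩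
  obtain ⟨φ, hφ⟩ := rQ
  have gg : ∀ z κ : M, Ctx.get (z, κ) = (![z, κ] : Fin 2 → M) := fun z κ => by funext i; fin_cases i <;> rfl
  obtain ⟨ρ, hρ, h5⟩ := cc_above n θ
  have h5 : θ ∈ ρ := (ord_mem_Vs hρ.ord h1.ord).1 h5
  have h6 : κ ∈ ρ := hρ.ord.trans h5 h2
  have mm : ∀ {ρ κ z : M}, Ord ρ → κ ∈ ρ → z ⊆ κ → ∀ i, Ctx.get (z, κ) i ∈ Vs ρ := fun a b d => by rw [gg]; exact in2 a b d
  have h7 := (hφ ρ hρ.1 (z, κ) (mm hρ.ord h6 h3)).1 ((key ρ κ z hρ.1 h6 h3).2 ⟨θ, h5, h1, h2, h4⟩)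
  rw [gg] at h7
  obtain ⟨κ', ρ', a1, a2, a3, a4, a5, a6⟩ := h.2 φ ρ z hρ h6 h3 h7
  rw [← gg] at a6
  obtain ⟨θ', b1, b2, b3, b4⟩ := (key _ _ _ a2.1 a3 (cap_sub_r _ _)).1 ((hφ ρ' a2.1 _ (mm a2.ord a3 (cap_sub_r _ _))).2 a6)
  exact ⟨κ', θ', a1, b2, b3, a4, hB _ _ a2.ord b1 a5, b4⟩
end
end Paper
namespace Paper
section
variable {M : Type} [ZFM M] {G : Type} [Ctx M G] {c : Calc M} {n : ℕ}

/-- slices of sets of ordinals -/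
noncomputable def sl (i : ℕ) (z : M) : M := sep (sU z) fun ξ => p (num i) ξ ∈ z
@[fun_prop] theorem DF.sl (i : ℕ) (f : G → M) (hf : DF c f) : DF c (fun x => sl i (f x)) := by unfold Paper.sl; fun_prop
theorem mem_sl {i : ℕ} {z κ ξ : M} (hκ : Ord κ) (hz : z ⊆ κ) : ξ ∈ sl (i+1) z ↔ Ord ξ ∧ p (num (i+1)) ξ ∈ z := by
  unfold sl
  rw [mem_sep (by fun_prop)]
  constructor
  · rintro ⟨h1, h2⟩
    obtain ⟨y, hy, hξ⟩ := mem_sU.1 h1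
    exact ⟨(hκ.mem (hz y hy)).mem hξ, h2⟩
  · rintro ⟨h1, h2⟩
    exact ⟨mem_sU.2 ⟨_, h2, lt_p (ord_num _) h1 (nz i)⟩, h2⟩
theorem sl_cap {i : ℕ} {z κ κ' : M} (hκ : Ord κ) (hz : z ⊆ κ) (hk : Cd κ') (hw : om ⊆ κ') : sl (i+1) (cap z κ') = cap (sl (i+1) z) κ' := ext fun ξ => by
  rw [mem_cap, mem_sl hk.ord (cap_sub_r _ _), mem_sl hκ hz, mem_cap]
  constructor
  · rintro ⟨h1, h2, h3⟩
    exact ⟨⟨h1, h2⟩, hk.ord.trans h3 (lt_p (ord_num _) h1 (nz i))⟩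
  · rintro ⟨⟨h1, h2⟩, h3⟩
    exact ⟨h1, h2, p_cd hk hw (hw _ (num_om _)) h3⟩
theorem sl_sub {i : ℕ} {z κ : M} (hκ : Ord κ) (hz : z ⊆ κ) : sl (i+1) z ⊆ κ := fun ξ h => by
  obtain ⟨h1, h2⟩ := (mem_sl hκ hz).1 h
  exact hκ.trans (hz _ h2) (lt_p (ord_num _) h1 (nz i))
theorem join {κ x y w : M} (hk : Cd κ) (hw : om ⊆ κ) (hx : x ⊆ κ) (hy : y ⊆ κ) (hww : w ⊆ κ) :
    ∃ z, z ⊆ κ ∧ sl 1 z = x ∧ sl 2 z = y ∧ sl 3 z = w := by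
  have d : DP full (fun η : M => (u0 η = num 1 ∧ u1 η ∈ x) ∨ (u0 η = num 2 ∧ u1 η ∈ y) ∨ (u0 η = num 3 ∧ u1 η ∈ w)) := by fun_prop
  have hz : sep κ (fun η : M => (u0 η = num 1 ∧ u1 η ∈ x) ∨ (u0 η = num 2 ∧ u1 η ∈ y) ∨ (u0 η = num 3 ∧ u1 η ∈ w)) ⊆ κ := fun _ h => ((mem_sep d).1 h).1
  have key : ∀ (i : ℕ) ξ, ξ ∈ sl (i+1) (sep κ (fun η : M => (u0 η = num 1 ∧ u1 η ∈ x) ∨ (u0 η = num 2 ∧ u1 η ∈ y) ∨ (u0 η = num 3 ∧ u1 η ∈ w))) ↔ ξ ∈ κ ∧ ((i+1 = 1 ∧ ξ ∈ x) ∨ (i+1 = 2 ∧ ξ ∈ y) ∨ (i+1 = 3 ∧ ξ ∈ w)) := by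
    intro i ξ
    rw [mem_sl hk.ord hz, mem_sep d]
    have e : ∀ k l : ℕ, (num k : M) = num l ↔ k = l := fun k l => ⟨num_inj, fun h => by rw [h]⟩
    constructor
    · rintro ⟨h1, h2, h3⟩
      rw [u0_p (ord_num _) h1, u1_p (ord_num _) h1, e, e, e] at h3
      exact ⟨hk.ord.trans h2 (lt_p (ord_num _) h1 (nz i)), h3⟩
    · rintro ⟨h1, h2⟩
      have o := hk.ord.mem h1
      rw [u0_p (ord_num _) o, u1_p (ord_num _) o, e, e, e]
      exact ⟨o, p_cd hk hw (hw _ (num_om _)) h1, h2⟩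
  refine ⟨_, hz, ext fun ξ => ?_, ext fun ξ => ?_, ext fun ξ => ?_⟩
  · rw [key 0]; simpa using hx ξ
  · rw [key 1]; simpa using hy ξ
  · rw [key 2]; simpa using hww ξ

section WSb
variable {κ : M} {Bd : M → Prop}
theorem WS.up (h : WS n κ Bd) (hB : ∀ a b, Ord b → a ∈ b → Bd b → Bd a) {α : M} (hα : α ∈ κ) : ∃ κ' θ', Cd κ' ∧ CC n θ' ∧ κ' ∈ θ' ∧ κ' ∈ κ ∧ Bd θ' ∧ α ∈ κ' := by
  obtain ⟨θ, h1, h2⟩ := cc_above n κ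
  have o := h.1.ord
  obtain ⟨κ', θ', a1, a2, a3, a4, a5, a6⟩ := h.refl hB (P := fun _ _ z k => z ∈ k) (by fun_prop : DP (sg 0) _).1 h1 ((ord_mem_Vs h1.ord o).1 h2) (o.sub hα) hα
  refine ⟨κ', θ', a1, a2, a3, a4, a5, ?_⟩
  have a6 : cap α κ' ∈ κ' := a6
  rcases (o.mem hα).lt_or_le a1.ord with h3 | h3
  · exact h3
  · rw [show cap α κ' = κ' from ext fun z => by rw [mem_cap]; exact ⟨fun h => h.2, fun h => ⟨h3 z h, h⟩⟩] at a6
    exact (mem_irrefl _ a6).elim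
theorem WS.lim (h : WS n κ Bd) (hB : ∀ a b, Ord b → a ∈ b → Bd b → Bd a) : Lim κ := by
  have o := h.1.ord
  refine ⟨o, ?_, fun α hα => ?_⟩
  · rintro rfl
    obtain ⟨θ, h1, h2⟩ := cc_above n (emp : M)
    obtain ⟨κ', θ', a1, a2, a3, a4, a5, a6⟩ := h.refl hB (P := fun _ _ z k => True) (by fun_prop : DP (sg 0) _).1 h1 ((ord_mem_Vs h1.ord o).1 h2) (Sub.refl _) trivial
    exact mem_emp a4
  · obtain ⟨κ', θ', a1, a2, a3, a4, a5, a6⟩ := h.up hB hα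
    exact (o.mem hα).suc.lt_of_le_of_lt o (a1.ord.suc_sub a6) a4
theorem WS.om_le (h : WS n κ Bd) (hB : ∀ a b, Ord b → a ∈ b → Bd b → Bd a) : om ⊆ κ := (h.lim hB).om_le
theorem WS.refl3 (h : WS n κ Bd) (hB : ∀ a b, Ord b → a ∈ b → Bd b → Bd a) {P : M → M → M → M → M → M → Prop} (hP : SQ (sg 0) (fun q : ((((M × M) × M) × M) × M) × M => P q.1.1.1.1.1 q.1.1.1.1.2 q.1.1.1.2 q.1.1.2 q.1.2 q.2)) {θ x y w : M}
    (h1 : CC n θ) (h2 : κ ∈ θ) (hx : x ⊆ κ) (hy : y ⊆ κ) (hw : w ⊆ κ) (h4 : P (Vs θ) (eC n θ) x y w κ) :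
    ∃ κ' θ', Cd κ' ∧ CC n θ' ∧ κ' ∈ θ' ∧ κ' ∈ κ ∧ Bd θ' ∧ om ⊆ κ' ∧ P (Vs θ') (eC n θ') (cap x κ') (cap y κ') (cap w κ') κ' := by
  obtain ⟨z, hz, e1, e2, e3⟩ := join h.1 (h.om_le hB) hx hy hw
  obtain ⟨κ', θ', a1, a2, a3, a4, a5, a6, a7⟩ := h.refl hB (P := fun v e z k => (om ⊆ k) ∧ P v e (sl 1 z) (sl 2 z) (sl 3 z) k)
    (SQ.and (by fun_prop : DP (sg 0) _).1 (hP.comp (f := fun q : ((M × M) × M) × M => (((((q.1.1.1, q.1.1.2), sl 1 q.1.2), sl 2 q.1.2), sl 3 q.1.2), q.2)) (by fun_prop))) h1 h2 hz ⟨h.om_le hB, by rw [e1, e2, e3]; exact h4⟩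
  rw [sl_cap h.1.ord hz a1 a6, sl_cap h.1.ord hz a1 a6, sl_cap h.1.ord hz a1 a6, e1, e2, e3] at a7
  exact ⟨κ', θ', a1, a2, a3, a4, a5, a6, a7⟩
theorem WS.om_mem (h : WS n κ Bd) (hB : ∀ a b, Ord b → a ∈ b → Bd b → Bd a) : om ∈ κ := by
  obtain ⟨θ, h1, h2⟩ := cc_above n κ
  obtain ⟨κ', θ', a1, a2, a3, a4, a5, a6, a7⟩ := h.refl3 hB (P := fun _ _ _ _ _ _ => True) (by fun_prop : DP (sg 0) _).1 h1 ((ord_mem_Vs h1.ord h.1.ord).1 h2) (Sub.refl _) (Sub.refl _) (Sub.refl _) trivial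
  exact ord_om.lt_of_le_of_lt h.1.ord a6 a4
end WSb

def Club (C κ : M) : Prop := C ⊆ κ ∧ ball κ (fun α => bex C fun β => α ∈ β) ∧
  ball κ fun l => l ≠ emp → (ball l fun α => bex C fun β => α ∈ β ∧ β ∈ l) → l ∈ C
@[fun_prop] theorem DP.Club (f g : G → M) (hf : DF c f) (hg : DF c g) : DP c (fun x => Club (f x) (g x)) := by unfold Paper.Club; fun_prop
theorem clubE_iff {C κ : M} : ClubInE ZFM.E C κ ↔ Club C κ := by
  unfold Club
  simp only [ne_emp, ball, bex]
  exact and_congr subE_iff Iff.rfl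
/-- `f`, `C` witness that `κ` is not subtle -/
def Wt (κ f C : M) : Prop := Fn f κ ∧ (ball κ fun α => app f α ⊆ α) ∧ Club C κ ∧ ball C fun β => ball C fun α => α ∈ β → app f α ≠ cap (app f β) α
@[fun_prop] theorem DP.Wt (k f g : G → M) (hk : DF c k) (hf : DF c f) (hg : DF c g) : DP c (fun x => Wt (k x) (f x) (g x)) := by unfold Paper.Wt; fun_prop
theorem subtleE_iff {κ : M} : SubtleE ZFM.E κ ↔ Cd κ ∧ om ⊆ κ ∧ ∀ f C, ¬ Wt κ f C := by
  constructor
  · rintro ⟨⟨h1, h2⟩, h3⟩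
    refine ⟨cardE_iff.1 h1, (infiniteOrdE_iff.1 h2).2, fun f C ⟨w1, w2, w3, w4⟩ => ?_⟩
    obtain ⟨α, β, a1, a2, a3, A, B, a4, a5, a6⟩ := h3 f (fun α hα => ⟨⟨app f α, pairMemE_iff.2 (w1.pair_mem.2 ⟨hα, rfl⟩), subE_iff.2 (w2 α hα)⟩, fun A A' hA hA' => by
      rw [(w1.pair_mem.1 (pairMemE_iff.1 hA)).2, (w1.pair_mem.1 (pairMemE_iff.1 hA')).2]⟩) C (clubE_iff.2 w3)
    rw [pairMemE_iff, w1.pair_mem] at a4 a5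
    obtain ⟨-, rfl⟩ := a4
    obtain ⟨-, rfl⟩ := a5
    exact w4 β a2 α a1 a3 (interE_iff.1 a6)
  · rintro ⟨h1, h2, h3⟩
    refine ⟨⟨cardE_iff.2 h1, infiniteOrdE_iff.2 ⟨h1.ord, h2⟩⟩, fun f hf C hC => ?_⟩
    by_contra hn
    have hv : ∀ α, α ∈ κ → pair α (app f α) ∈ f ∧ app f α ⊆ α := by
      intro α hα
      obtain ⟨⟨A, a1, a2⟩, a3⟩ := hf α hα
      have a1' := pairMemE_iff.1 a1
      obtain rfl : app f α = A := app_eq a1' fun y hy => a3 _ _ (pairMemE_iff.2 hy) a1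
      exact ⟨a1', subE_iff.1 a2⟩
    have hC' := clubE_iff.1 hC
    have ap : ∀ α, α ∈ κ → app (lam κ (app f)) α = app f α := fun α hα => app_lam (by fun_prop) hα
    refine h3 (lam κ (app f)) C ⟨fn_lam _ (by fun_prop), fun α hα => by beta_reduce; rw [ap α hα]; exact (hv α hα).2, hC', fun β hβ α hα hl e => hn ?_⟩
    rw [ap α (hC'.1 α hα), ap β (hC'.1 β hβ)] at e
    exact ⟨α, β, hα, hβ, hl, app f α, app f β, pairMemE_iff.2 (hv α (hC'.1 α hα)).1, pairMemE_iff.2 (hv β (hC'.1 β hβ)).1, interE_iff.2 e⟩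
end
end Paper
namespace Paper
section
variable {M : Type} [ZFM M] {G : Type} [Ctx M G] {c : Calc M} {n : ℕ}

noncomputable def s2 (a b : M) : M := snc (snc emp a) b
@[fun_prop] theorem DF.s2 (f g : G → M) (hf : DF c f) (hg : DF c g) : DF c (fun x => s2 (f x) (g x)) := by unfold Paper.s2; fun_prop
theorem s2_sq (a b : M) : s2 a b = sq ![a, b] := by
  have : (![a, b] : Fin 2 → M) = Fin.snoc (Fin.snoc (Fin.elim0 : Fin 0 → M) a : Fin 1 → M) b := by funext i; fin_cases i <;> rfl
  rw [this, sq_snoc, sq_snoc]; rfl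
def Bad (n : ℕ) (κ d z : M) : Prop := ∃ θ : M, (CC n θ ∧ κ ∈ θ ∧ s2 z κ ∈ Sa (Vs θ) d) ∧ ball κ fun κ' => Cd κ' → ∀ θ', CC n θ' → κ' ∈ θ' → ¬ s2 (cap z κ') κ' ∈ Sa (Vs θ') d
@[fun_prop] theorem DP.Bad [c.Full] (f g h : G → M) (hf : DF c f) (hg : DF c g) (hh : DF c h) : DP c (fun x => Bad n (f x) (g x) (h x)) := by unfold Paper.Bad; fun_prop
theorem ws_of_bad {κ : M} (hκ : Cd κ) (h : ∀ d z, d ∈ (om : M) → z ⊆ κ → ¬ Bad n κ d z) : WS n κ (fun _ => True) := by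
  refine ⟨hκ, fun φ θ z h1 h2 h3 h4 => ?_⟩
  by_contra hn
  refine h (code φ) z (code_om φ) h3 ⟨θ, ⟨h1, h2, ?_⟩, fun κ' hk hc θ' ht hl hs => hn ⟨κ', θ', hc, ht, hl, hk, trivial, ?_⟩⟩
  · rw [s2_sq]; exact (sat_iff φ _ (in2 h1.ord h2 h3)).2 h4
  · rw [s2_sq] at hs; exact (sat_iff φ _ (in2 ht.ord hl (cap_sub_r _ _))).1 hs

section Sub
variable {δ : M}
theorem subtle_om (h1 : Cd δ) (h2 : om ⊆ δ) (h3 : ∀ f C, ¬ Wt δ f C) : om ∈ δ := by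
  rcases ord_om.lt_or_le h1.ord with h | h
  · exact h
  obtain rfl := Sub.antisymm h h2
  exfalso
  have ap : ∀ b, b ∈ (om : M) → app (lam om fun b => sep b fun x => suc x = b) b = sep b fun x => suc x = b := fun b hb => app_lam (by fun_prop) hb
  have mC : ∀ {b : M}, b ∈ sep om (fun b => b ≠ emp) ↔ b ∈ om ∧ b ≠ emp := mem_sep (by fun_prop)
  refine h3 (lam om fun b => sep b fun x => suc x = b) (sep om fun b => b ≠ emp) ⟨fn_lam _ (by fun_prop), fun a ha => ?_, ⟨fun b hb => (mC.1 hb).1, fun b hb => ⟨suc b, mC.2 ⟨suc_om hb, ne_emp.2 ⟨b, self_mem_suc b⟩⟩, self_mem_suc b⟩, fun l hl h0 _ => mC.2 ⟨hl, h0⟩⟩, fun β hβ α hα hl e => ?_⟩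
  · beta_reduce; rw [ap a ha]; exact fun x hx => ((mem_sep (by fun_prop)).1 hx).1
  · rw [mC] at hα hβ
    rw [ap _ hα.1, ap _ hβ.1] at e
    rcases om_cases hα.1 with h | ⟨m, hm, rfl⟩
    · exact hα.2 h
    · have : m ∈ sep (suc m) fun x => suc x = suc m := (mem_sep (by fun_prop)).2 ⟨self_mem_suc m, rfl⟩
      rw [e, mem_cap, mem_sep (by fun_prop)] at this
      rw [this.1.2] at hl
      exact mem_irrefl _ hl
theorem subtle_pow (h1 : Cd δ) (h2 : om ⊆ δ) (h3 : ∀ f C, ¬ Wt δ f C) {μ : M} (hμ : μ ∈ δ) : ¬ LeC δ (pow μ) := by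
  rintro ⟨g, hg⟩
  have o := h1.ord
  have ap : ∀ b, b ∈ δ → app (lam δ fun b => cap (app g b) b) b = cap (app g b) b := fun b hb => app_lam (by fun_prop) hb
  have mC : ∀ {b : M}, b ∈ sep δ (fun b => μ ⊆ b) ↔ b ∈ δ ∧ μ ⊆ b := mem_sep (by fun_prop)
  refine h3 (lam δ fun b => cap (app g b) b) (sep δ fun b => μ ⊆ b) ⟨fn_lam _ (by fun_prop), fun a ha => ?_, ⟨fun b hb => (mC.1 hb).1, fun b hb => ⟨suc (cup b μ), mC.2 ⟨?_, ?_⟩, ?_⟩, fun l hl h0 h => mC.2 ⟨hl, ?_⟩⟩, fun β hβ α hα hl e => ?_⟩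
  · beta_reduce; rw [ap a ha]; exact cap_sub_r _ _
  · refine (h1.lim h2).suc ?_
    rcases (o.mem hb).lt_or_le (o.mem hμ) with h | h
    · rwa [show cup b μ = μ from ext fun z => by rw [mem_cup]; exact ⟨fun h' => h'.elim ((o.mem hμ).sub h z) id, .inr⟩]
    · rwa [show cup b μ = b from ext fun z => by rw [mem_cup]; exact ⟨fun h' => h'.elim id (h z), .inl⟩]
  · exact fun z hz => mem_suc.2 (.inl (mem_cup.2 (.inr hz)))
  · beta_reduce; rw [Ord.mem_suc_iff (o.mem hb) ((o.mem hb).cup (o.mem hμ))]; exact fun z hz => mem_cup.2 (.inl hz)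
  · obtain ⟨w, hw⟩ := ne_emp.1 h0
    obtain ⟨β, hβ, -, hl'⟩ := h w hw
    exact Sub.trans (mC.1 hβ).2 ((o.mem hl).sub hl')
  · rw [mC] at hα hβ
    rw [ap _ hα.1, ap _ hβ.1] at e
    have e1 : app g α ⊆ μ := mem_pow.1 (hg.mem hα.1)
    have e2 : app g β ⊆ μ := mem_pow.1 (hg.mem hβ.1)
    have : app g α = app g β := ext fun z => by
      have := ext_iff'.1 e z
      simp only [mem_cap] at this
      constructor
      · exact fun h => (this.1 ⟨h, hα.2 z (e1 z h)⟩).1.1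
      · exact fun h => (this.2 ⟨⟨h, hβ.2 z (e2 z h)⟩, hα.2 z (e2 z h)⟩).1
    rw [hg.inj hα.1 hβ.1 this] at hl
    exact mem_irrefl _ hl
theorem subtle_ws (h1 : Cd δ) (h2 : om ⊆ δ) (h3 : ∀ f C, ¬ Wt δ f C) (n : ℕ) : ∃ κ, κ ∈ δ ∧ om ⊆ κ ∧ WS n κ (fun _ => True) := by
  by_contra hn
  have o := h1.ord
  have ho := subtle_om h1 h2 h3
  have mC : ∀ {b : M}, b ∈ sep δ (fun b => Cd b ∧ om ⊆ b) ↔ b ∈ δ ∧ Cd b ∧ om ⊆ b := mem_sep (by fun_prop)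
  obtain ⟨g, hg⟩ := choice_fn (pow δ)
  let T : M → M := fun α => sep (pow α) fun A => sl 1 A ∈ (om : M) ∧ Bad n α (sl 1 A) (sl 2 A)
  have dT : DF full T := by fun_prop
  have mT : ∀ {α A : M}, A ∈ T α ↔ A ⊆ α ∧ sl 1 A ∈ (om : M) ∧ Bad n α (sl 1 A) (sl 2 A) := fun {α A} => by rw [mem_sep (by fun_prop), mem_pow]
  have hT : ∀ α, α ∈ δ → Cd α → om ⊆ α → app g (T α) ∈ T α := by
    intro α hα hc hw
    refine hg _ (fun A hA => mem_pow.2 (Sub.trans (mT.1 hA).1 (o.sub hα))) ?_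
    by_contra h
    refine hn ⟨α, hα, hw, ws_of_bad hc fun d z hd hz hb => h ?_⟩
    obtain ⟨A, a1, a2, a3, -⟩ := join hc hw (Sub.trans (ord_om.sub hd) hw) hz hz
    exact ⟨A, mT.2 ⟨a1, a2 ▸ hd, by rw [a2, a3]; exact hb⟩⟩
  have dT' : DF full (fun α => cap (app g (T α)) α) := DF.cap _ _ (DF.app _ _ (by fun_prop) dT) (by fun_prop)
  have ap : ∀ b, b ∈ δ → app (lam δ fun b => cap (app g (T b)) b) b = cap (app g (T b)) b := fun b hb => app_lam dT' hb
  refine h3 (lam δ fun b => cap (app g (T b)) b) (sep δ fun b => Cd b ∧ om ⊆ b) ⟨fn_lam _ dT', fun a ha => ?_, ⟨fun b hb => (mC.1 hb).1, fun b hb => ?_, fun l hl h0 h => mC.2 ⟨hl, ?_, ?_⟩⟩, fun β hβ α hα hl e => ?_⟩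
  · beta_reduce; rw [ap a ha]; exact cap_sub_r _ _
  · have oc := (o.mem hb).cup ord_om
    have hm : cup b om ∈ δ := by
      rcases (o.mem hb).lt_or_le ord_om with h | h
      · rwa [show cup b om = om from ext fun z => by rw [mem_cup]; exact ⟨fun h' => h'.elim (ord_om.sub h z) id, .inr⟩]
      · rwa [show cup b om = b from ext fun z => by rw [mem_cup]; exact ⟨fun h' => h'.elim id (h z), .inl⟩]
    obtain ⟨a, ha, he⟩ := eqC_cd (pow (cup b om))
    have h4 : cup b om ∈ a := Cd.lt_of_not_le oc ha.ord fun h => cantor _ (he.symm.le.trans h)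
    refine ⟨a, mC.2 ⟨Cd.lt_of_not_le ha.ord o fun h => subtle_pow h1 h2 h3 hm (h.trans he.le), ha, ?_⟩, ?_⟩
    · exact Sub.trans (fun z hz => mem_cup.2 (.inr hz)) (ha.ord.sub h4)
    · exact (o.mem hb).lt_of_le_of_lt ha.ord (fun z hz => mem_cup.2 (.inl hz)) h4
  · refine cd_of_lim (o.mem hl) fun a ha => ?_
    obtain ⟨β, hβ, h5, h6⟩ := h a ha
    exact ⟨β, (o.mem hl).sub h6, (mC.1 hβ).2.1, h5⟩
  · obtain ⟨w, hw⟩ := ne_emp.1 h0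
    obtain ⟨β, hβ, -, hl'⟩ := h w hw
    exact Sub.trans (mC.1 hβ).2.2 ((o.mem hl).sub hl')
  · obtain ⟨a1, a2, a3⟩ := mC.1 hα
    obtain ⟨b1, b2, b3⟩ := mC.1 hβ
    obtain ⟨t1, t2, t3⟩ := mT.1 (hT α a1 a2 a3)
    obtain ⟨r1, r2, r3⟩ := mT.1 (hT β b1 b2 b3)
    rw [ap _ a1, ap _ b1] at e
    have ce : ∀ {a b : M}, a ⊆ b → cap a b = a := fun h => ext fun z => by rw [mem_cap]; exact ⟨fun h => h.1, fun h' => ⟨h', h z h'⟩⟩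
    rw [ce t1, ce r1] at e
    rw [e, sl_cap b2.ord r1 a2 a3, sl_cap b2.ord r1 a2 a3, ce (Sub.trans (ord_om.sub r2) a3)] at t3
    obtain ⟨θ, ⟨c1, c2, c3⟩, -⟩ := t3
    obtain ⟨θ', -, d⟩ := r3
    exact d α hl a2 θ c1 c2 c3
end Sub
end
end Paper
namespace Paper
section
variable {M : Type} [ZFM M] {G : Type} [Ctx M G] {c : Calc M} {n : ℕ}

theorem any_form {A P : M → Prop} (h : SQ (any A) P) : ∃ (m : ℕ) (q : Fin m → M) (ψ : SetFormula (m+1)), (∀ i, A (q i)) ∧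
    ∀ y, P y ↔ Realize ZFM.E ψ (Fin.snoc q y : Fin (m+1) → M) := by
  obtain ⟨R, ⟨m, q, φ, hA, h1⟩, h2⟩ := h
  refine ⟨m, q, φ, hA, fun y => ?_⟩
  rw [h2, h1]
  have : (Fin.append q (Ctx.get y) : Fin (m+1) → M) = Fin.snoc q y := Fin.append_right_eq_snoc q _
  exact Iff.of_eq (congrArg (Realize ZFM.E φ) this)
theorem any_form' {m : ℕ} {q : Fin m → M} {P : M → Prop} (h : SQ (any fun x => ∃ i, x = q i) P) : ∃ (ψ : SetFormula (m+1)),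
    ∀ y, P y ↔ Realize ZFM.E ψ (Fin.snoc q y : Fin (m+1) → M) := by
  obtain ⟨m', q', ψ, h1, h2⟩ := any_form h
  choose σ hσ using h1
  refine ⟨ψ.ren (Fin.snoc (fun i => (σ i).castSucc) (Fin.last m) : Fin (m'+1) → Fin (m+1)), fun y => ?_⟩
  rw [h2, realize_ren]
  refine Iff.of_eq (congrArg (Realize ZFM.E ψ) (funext fun i => ?_))
  refine Fin.lastCases ?_ (fun i => ?_) i <;> simp [hσ]

/-- the ordinal `γ` codes a definition of `x` -/
def Df (γ x : M) : Prop := ∀ y, (y ∈ Vs (u0 γ) ∧ snc emp y ∈ Sa (Vs (u0 γ)) (u1 γ)) ↔ y = x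
@[fun_prop] theorem DP.Df [c.Full] (f g : G → M) (hf : DF c f) (hg : DF c g) : DP c (fun x => Df (f x) (g x)) := by unfold Paper.Df; fun_prop
theorem Df.uniq {γ x y : M} (h : Df γ x) (h' : Df γ y) : x = y := (h' x).1 ((h x).2 rfl)
def OD (x : M) : Prop := ∃ γ, Ord γ ∧ Df γ x
@[fun_prop] theorem DP.OD [c.Full] (f : G → M) (hf : DF c f) : DP c (fun x => OD (f x)) := by unfold Paper.OD; fun_prop

theorem od_aux : ∀ (m : ℕ) (q : Fin m → M) (hq : ∀ i, OD (q i)) (ψ : SetFormula (m+1)) (a : M)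
    (h : ∀ y, Realize ZFM.E ψ (Fin.snoc q y : Fin (m+1) → M) ↔ y = a), OD a := by
  intro m
  induction m with
  | zero =>
    intro q hq ψ a h
    obtain ⟨ν, h1, h2, h3, h4, h5⟩ := (CloQ.form (M := M) ψ).exists a
    refine ⟨p ν (code ψ), ord_p h1.ord (ord_code ψ), fun y => ?_⟩
    rw [u0_p h1.ord (ord_code ψ), u1_p h1.ord (ord_code ψ)]
    have e : snc emp y = sq (Fin.snoc q y : Fin 1 → M) := by rw [sq_snoc]; rfl
    have hv : y ∈ Vs ν → ∀ i, (Fin.snoc q y : Fin 1 → M) i ∈ Vs ν := fun hy i => by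
      have : i = Fin.last 0 := Fin.ext (by omega)
      subst this; rw [Fin.snoc_last]; exact hy
    constructor
    · rintro ⟨h6, h7⟩
      rw [e, sat_iff ψ _ (hv h6), h5 _ (hv h6)] at h7
      exact (h y).1 h7
    · rintro rfl
      refine ⟨h4, ?_⟩
      rw [e, sat_iff ψ _ (hv h4), h5 _ (hv h4)]
      exact (h y).2 rfl
  | succ m ih =>
    intro q hq ψ a h
    by_contra hn
    let q' : Fin m → M := fun i => q i.castSucc
    let B : M → M → Prop := fun γ a => ∃ x, Df γ x ∧ (∀ y, Realize ZFM.E ψ (Fin.snoc (Fin.snoc q' x : Fin (m+1) → M) y : Fin (m+2) → M) ↔ y = a) ∧ ¬ OD a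
    let C := any fun x : M => ∃ i, x = q' i
    have dB : DP C (fun r : M × M => B r.1 r.2) := by
      refine DP.ex _ (DP.and _ _ (by fun_prop) (DP.and _ _ (DP.all _ (DP.iff _ _ (DP.realize ψ (fun r : ((M × M) × M) × M => (Fin.snoc (Fin.snoc q' r.1.2 : Fin (m+1) → M) r.2 : Fin (m+2) → M)) ?_) (by fun_prop))) (by fun_prop)))
      intro i
      refine Fin.lastCases ?_ (fun i => Fin.lastCases ?_ (fun i => ?_) i) i
      · simp only [Fin.snoc_last]; fun_prop
      · simp only [Fin.snoc_castSucc, Fin.snoc_last]; fun_prop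
      · simp only [Fin.snoc_castSucc]; exact DF.par ⟨i, rfl⟩
    have uB : ∀ {γ a a'}, B γ a → B γ a' → a = a' := by
      rintro γ a a' ⟨x, h1, h2, h3⟩ ⟨x', h4, h5, h6⟩
      obtain rfl := h1.uniq h4
      exact (h5 a).1 ((h2 a).2 rfl)
    obtain ⟨γ, g1, g2⟩ := hq (Fin.last m)
    have hB : B γ a := by
      refine ⟨q (Fin.last m), g2, ?_, hn⟩
      have : (Fin.snoc q' (q (Fin.last m)) : Fin (m+1) → M) = q := Fin.snoc_init_self q
      rw [this]; exact h
    have dB' : DP C (fun γ : M => ∃ a, B γ a) := DP.ex _ dB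
    obtain ⟨μ, m1, ⟨a', m2⟩, m3⟩ := ord_min dB'.le ⟨γ, g1, a, hB⟩
    have dR : DP C (fun y : M => ∃ μ, Ord μ ∧ (∀ ν, ν ∈ μ → ¬ ∃ a, B ν a) ∧ B μ y) :=
      DP.ex _ (DP.and _ _ (by fun_prop) (DP.and _ _ (DP.all _ (DP.imp _ _ (by fun_prop) (DP.not _ (dB'.comp (f := fun r : (M × M) × M => r.2) (by fun_prop))))) (dB.comp (f := fun r : M × M => (r.2, r.1)) (by fun_prop))))
    obtain ⟨ψ', hψ⟩ := any_form' dR.1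
    have : OD a' := by
      refine ih q' (fun i => hq _) ψ' a' fun y => ?_
      rw [← hψ]
      constructor
      · rintro ⟨μ', k1, k2, k3⟩
        rcases ord_tri m1 k1 with t | rfl | t
        · exact (k2 _ t ⟨_, m2⟩).elim
        · exact uB k3 m2
        · exact (m3 _ t ⟨_, k3⟩).elim
      · rintro rfl
        exact ⟨μ, m1, m3, m2⟩
    obtain ⟨x, -, -, h6⟩ := m2
    exact h6 this
theorem od_of {a : M} (h : DF (any (OD : M → Prop)) (fun _ : M => a)) : OD a := by
  have h1 : DP (any (OD : M → Prop)) (fun y : M => y = a) := DP.eq _ _ (by fun_prop) h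
  obtain ⟨m, q, ψ, h2, h3⟩ := any_form h1.1
  exact od_aux m q h2 ψ a fun y => (h3 y).symm
theorem OD.df {a : M} (h : OD a) : DF (any (OD : M → Prop)) (fun _ : G => a) := DF.par h
theorem ord_od {a : M} (h : Ord a) : OD a := by
  by_contra hn
  obtain ⟨μ, m1, m2, m3⟩ := ord_min (P := fun y : M => ¬ OD y) (by fun_prop) ⟨a, h, hn⟩
  refine m2 (od_of ?_)
  rw [← mu_eq m1 m2 m3]
  fun_prop

def HOD (x : M) : Prop := ∃ t : M, (Tr t ∧ x ∈ t) ∧ ball t OD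
@[fun_prop] theorem DP.HOD [c.Full] (f : G → M) (hf : DF c f) : DP c (fun x => HOD (f x)) := by unfold Paper.HOD; fun_prop
theorem HOD.od {x : M} (h : HOD x) : OD x := by obtain ⟨t, ⟨h1, h2⟩, h3⟩ := h; exact h3 x h2
theorem HOD.mem {x y : M} (h : HOD x) (hy : y ∈ x) : HOD y := by obtain ⟨t, ⟨h1, h2⟩, h3⟩ := h; exact ⟨t, ⟨h1, h1.mem h2 hy⟩, h3⟩
theorem hod_of {x : M} (h : OD x) (h' : ∀ y, y ∈ x → HOD y) : HOD x := by
  have mS : ∀ {z}, z ∈ sep (trcl x) HOD ↔ z ∈ trcl x ∧ HOD z := mem_sep (by fun_prop)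
  have h1 : trcl x ⊆ sep (trcl x) HOD := trcl_min (fun z hz w hw => mS.2 ⟨(tr_trcl x).mem (mS.1 hz).1 hw, (mS.1 hz).2.mem hw⟩) x fun z hz => mS.2 ⟨sub_trcl x z hz, h' z hz⟩
  refine ⟨cup (trcl x) (sing x), ⟨fun z hz w hw => ?_, mem_cup.2 (.inr (mem_sing.2 rfl))⟩, fun z hz => ?_⟩
  · rcases mem_cup.1 hz with hz | hz
    · exact mem_cup.2 (.inl ((tr_trcl x).mem hz hw))
    · rw [mem_sing.1 hz] at hw; exact mem_cup.2 (.inl (sub_trcl x w hw))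
  · rcases mem_cup.1 hz with hz | hz
    · exact (mS.1 (h1 z hz)).2.od
    · rw [mem_sing.1 hz]; exact h
theorem ord_hod {a : M} (h : Ord a) : HOD a := ⟨suc a, ⟨h.suc.tr, self_mem_suc a⟩, fun b hb => ord_od (h.suc.mem hb)⟩
end
end Paper
namespace Paper
section
variable {M : Type} [ZFM M] {G : Type} [Ctx M G] {c : Calc M} {n : ℕ}

def HE (M : Type) [ZFM M] (a b : {x : M // HOD x}) : Prop := ZFM.E a.1 b.1
theorem he_iff {a b : {x : M // HOD x}} : HE M a b ↔ a.1 ∈ b.1 := Iff.rfl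
theorem cons_val {S : M → Prop} {k : ℕ} (z : {x : M // S x}) (q : Fin k → {x : M // S x}) :
    (fun i => ((Fin.cons z q : Fin (k+1) → {x : M // S x}) i).1) = (Fin.cons z.1 (fun i => (q i).1) : Fin (k+1) → M) := by
  funext i; refine Fin.cases rfl (fun i => rfl) i
theorem hod_sub {a : M} {P : M → Prop} (ha : OD a) (h : DP (any (OD : M → Prop)) P) (hh : ∀ z, z ∈ a → P z → HOD z) : HOD (sep a P) := by
  refine hod_of (od_of ?_) fun y hy => ?_
  · exact DF.sep _ (fun _ => P) ha.df (h.comp (f := fun q : M × M => q.2) (by fun_prop))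
  · rw [mem_sep h.le] at hy; exact hh y hy.1 hy.2
noncomputable def ix (z : M) : M := mu fun γ => Df γ z
@[fun_prop] theorem DF.ix [c.Full] (f : G → M) (hf : DF c f) : DF c (fun x => ix (f x)) := by unfold Paper.ix; fun_prop
theorem ix_spec {z : M} (h : OD z) : Ord (ix z) ∧ Df (ix z) z := by
  have := mu_spec (P := fun γ => Df γ z) (by fun_prop) h
  exact ⟨this.1, this.2.1⟩

theorem hod_zfc : IsZFCE (HE M) := by
  have rs : ∀ {k : ℕ} (φ : SetFormula k) (v : Fin k → {x : M // HOD x}), Realize (HE M) φ v ↔ Rl ZFM.E HOD φ (fun i => (v i).1) := fun φ v => realize_sub ZFM.E HOD φ v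
  refine ⟨⟨⟨emp, ord_hod ord_emp⟩⟩, ⟨?_, ?_, ?_, ?_, ?_, ?_, ?_⟩, ?_, ?_⟩
  · intro x y h
    refine Subtype.ext (ext fun z => ⟨fun hz => ?_, fun hz => ?_⟩)
    · exact (h ⟨z, x.2.mem hz⟩).1 hz
    · exact (h ⟨z, y.2.mem hz⟩).2 hz
  · intro a b
    refine ⟨⟨up a.1 b.1, hod_of (od_of ?_) ?_⟩, fun z => ?_⟩
    · have := a.2.od.df (G := M); have := b.2.od.df (G := M); fun_prop
    · intro y hy; rcases mem_up.1 hy with rfl | rfl; exacts [a.2, b.2]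
    · rw [he_iff, mem_up, Subtype.ext_iff, Subtype.ext_iff]
  · intro a
    refine ⟨⟨sU a.1, hod_of (od_of ?_) ?_⟩, fun z => ?_⟩
    · have := a.2.od.df (G := M); fun_prop
    · intro y hy; obtain ⟨w, h1, h2⟩ := mem_sU.1 hy; exact (a.2.mem h1).mem h2
    · rw [he_iff, mem_sU]
      exact ⟨fun ⟨w, h1, h2⟩ => ⟨⟨w, a.2.mem h1⟩, h1, h2⟩, fun ⟨w, h1, h2⟩ => ⟨w.1, h1, h2⟩⟩
  · refine ⟨⟨om, ord_hod ord_om⟩, ⟨⟨emp, ord_hod ord_emp⟩, emp_om, fun z h => mem_emp h⟩, fun y hy => ⟨⟨suc y.1, ord_hod (ord_om.mem (suc_om hy))⟩, suc_om hy, fun z => ?_⟩⟩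
    rw [he_iff, mem_suc, Subtype.ext_iff]; rfl
  · rintro a ⟨z, hz⟩
    obtain ⟨m, h1, h2⟩ := found (a := a.1) ⟨z.1, hz⟩
    exact ⟨⟨m, a.2.mem h1⟩, h1, fun z hz hz' => h2 z.1 hz hz'⟩
  · intro k φ q a
    have d : DP (any (OD : M → Prop)) (fun z : M => Rl ZFM.E HOD φ (Fin.cons z fun i => (q i).1)) := by
      refine DP.rl φ (fun _ => HOD) (by fun_prop) _ fun i => Fin.cases ?_ (fun i => ?_) i
      · simp only [Fin.cons_zero]; fun_prop
      · simp only [Fin.cons_succ]; exact (q i).2.od.df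
    refine ⟨⟨_, hod_sub a.2.od d fun z hz _ => a.2.mem hz⟩, fun z => ?_⟩
    rw [he_iff, mem_sep d.le, rs, cons_val]; rfl
  · intro k φ q a hf
    have d : DP (any (OD : M → Prop)) (fun r : M × M => HOD r.2 ∧ Rl ZFM.E HOD φ (Fin.cons r.1 (Fin.cons r.2 fun i => (q i).1))) := by
      refine DP.and _ _ (by fun_prop) (DP.rl φ (fun _ => HOD) (by fun_prop) _ fun i => Fin.cases ?_ (fun i => Fin.cases ?_ (fun i => ?_) i) i)
      · simp only [Fin.cons_zero]; fun_prop
      · simp only [Fin.cons_succ, Fin.cons_zero]; fun_prop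
      · simp only [Fin.cons_succ]; exact (q i).2.od.df
    obtain ⟨b, hb⟩ := collection (P := fun x y => HOD y ∧ Rl ZFM.E HOD φ (Fin.cons x (Fin.cons y fun i => (q i).1))) d.le a.1
    have d' : DP (any (OD : M → Prop)) (fun y : M => bex a.1 fun x => HOD y ∧ Rl ZFM.E HOD φ (Fin.cons x (Fin.cons y fun i => (q i).1))) :=
      DP.bex _ _ a.2.od.df (d.comp (f := fun r : M × M => (r.2, r.1)) (by fun_prop))
    have e : ∀ x y : {x : M // HOD x}, Realize (HE M) φ (Fin.cons x (Fin.cons y q)) ↔ Rl ZFM.E HOD φ (Fin.cons x.1 (Fin.cons y.1 fun i => (q i).1)) := fun x y => by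
      rw [rs, cons_val, cons_val]
    have hV : OD (Vs (rank b)) := od_of (by have := (ord_od (ord_rank b)).df (G := M); fun_prop)
    refine ⟨⟨_, hod_sub hV d' fun z hz ⟨x, _, h⟩ => h.1⟩, fun z => ?_⟩
    rw [he_iff, mem_sep d'.le]
    constructor
    · rintro ⟨h1, x, h2, h3, h4⟩
      exact ⟨⟨x, a.2.mem h2⟩, h2, (e _ _).2 h4⟩
    · rintro ⟨x, h1, h2⟩
      rw [e] at h2
      obtain ⟨y, h3, h4, h5⟩ := hb x.1 h1 ⟨z.1, z.2, h2⟩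
      have : (⟨y, h4⟩ : {x : M // HOD x}) = z := hf x h1 _ _ ((e x ⟨y, h4⟩).2 h5) ((e _ _).2 h2)
      obtain rfl : y = z.1 := congrArg Subtype.val this
      exact ⟨(mem_Vs (ord_rank b)).2 (rank_mem h3), x.1, h1, z.2, h2⟩
  · intro a
    have hP : OD (pow a.1) := od_of (by have := a.2.od.df (G := M); fun_prop)
    have d : DP (any (OD : M → Prop)) (fun z : M => HOD z) := by fun_prop
    refine ⟨⟨_, hod_sub hP d fun z _ h => h⟩, fun z => ?_⟩
    rw [he_iff, mem_sep d.le, mem_pow]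
    exact ⟨fun h w hw => h.1 w.1 hw, fun h => ⟨fun w hw => h ⟨w, z.2.mem hw⟩ hw, z.2⟩⟩
  · intro a h1 h2
    have hS : OD (sU a.1) := od_of (by have := a.2.od.df (G := M); fun_prop)
    have d : DP (any (OD : M → Prop)) (fun z : M => bex a.1 fun x => z ∈ x ∧ ball x fun z' => ix z ⊆ ix z') := by
      have := a.2.od.df (G := M); fun_prop
    refine ⟨⟨_, hod_sub hS d fun z _ ⟨x, hx, hz, _⟩ => (a.2.mem hx).mem hz⟩, fun x hx => ?_⟩
    obtain ⟨w, hw⟩ := h1 x hx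
    have odx : ∀ {z}, z ∈ x.1 → OD z := fun hz => (x.2.mem hz).od
    obtain ⟨μ, m1, ⟨z, m2, rfl⟩, m3⟩ := ord_min (P := fun μ : M => bex x.1 fun z => μ = ix z) (by fun_prop) ⟨_, (ix_spec (odx hw)).1, w.1, hw, rfl⟩
    have hmin : ∀ z', z' ∈ x.1 → ix z ⊆ ix z' := fun z' hz' => ((ix_spec (odx hz')).1.lt_or_le m1).elim (fun h => (m3 _ h ⟨z', hz', rfl⟩).elim) id
    refine ⟨⟨z, x.2.mem m2⟩, ?_, m2, fun z' hz' hx' => ?_⟩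
    · rw [he_iff, mem_sep d.le]; exact ⟨mem_sU.2 ⟨_, hx, m2⟩, x.1, hx, m2, hmin⟩
    · rw [he_iff, mem_sep d.le] at hz'
      obtain ⟨-, x', k1, k2, k3⟩ := hz'
      have : x' = x.1 := by
        by_contra hne
        exact h2 ⟨x', a.2.mem k1⟩ x k1 hx (fun e => hne (congrArg Subtype.val e)) ⟨z', k2, hx'⟩
      subst this
      have e : ix z'.1 = ix z := Sub.antisymm (k3 z m2) (hmin z'.1 k2)
      have i1 := (ix_spec (odx m2)).2
      have i2 := (ix_spec (odx k2)).2
      rw [e] at i2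
      exact Subtype.ext (i2.uniq i1)
end
end Paper
namespace Paper
section
variable {M : Type} [ZFM M] {G : Type} [Ctx M G] {c : Calc M} {n : ℕ}

/-- `q = ⟨f, C⟩` is a witness for the failure of subtlety at `γ` -/
def WB (γ q : M) : Prop := app q (num 1) ⊆ γ ∧ (ball γ fun α => bex (app q (num 1)) fun β => α ⊆ β) ∧
  (ball γ fun l => l ≠ emp → (ball l fun α => bex (app q (num 1)) fun β => α ∈ β ∧ β ∈ l) → l ∈ app q (num 1)) ∧
  (ball (app q (num 1)) fun α => app (app q (num 0)) α ⊆ α) ∧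
  ball (app q (num 1)) fun β => ball (app q (num 1)) fun α => α ∈ β → app (app q (num 0)) α ≠ cap (app (app q (num 0)) β) α
@[fun_prop] theorem DP.WB (f g : G → M) (hf : DF c f) (hg : DF c g) : DP c (fun x => WB (f x) (g x)) := by unfold Paper.WB; fun_prop
theorem s2_0 (a b : M) : app (s2 a b) (num 0) = a := by rw [s2_sq]; exact app_sq ![a, b] 0
theorem s2_1 (a b : M) : app (s2 a b) (num 1) = b := by rw [s2_sq]; exact app_sq ![a, b] 1

section
variable {a b p f x y : {x : M // HOD x}}
theorem h_up : UPairE (HE M) p a b ↔ UPairE ZFM.E p.1 a.1 b.1 := by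
  constructor
  · intro h z
    constructor
    · intro hz
      exact ((h ⟨z, p.2.mem hz⟩).1 hz).imp (congrArg Subtype.val) (congrArg Subtype.val)
    · rintro (rfl | rfl)
      · exact (h a).2 (.inl rfl)
      · exact (h b).2 (.inr rfl)
  · intro h z
    exact (h z.1).trans (or_congr Subtype.ext_iff.symm Subtype.ext_iff.symm)
theorem h_pm : PairMemE (HE M) f x y ↔ pair x.1 y.1 ∈ f.1 := by
  constructor
  · rintro ⟨q, h1, s, t, h2, h3, h4⟩
    have : OPairE ZFM.E q.1 x.1 y.1 := ⟨s.1, t.1, h_up.1 h2, h_up.1 h3, h_up.1 h4⟩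
    rw [← opairE_iff.1 this]; exact h1
  · intro h
    obtain ⟨s, t, h2, h3, h4⟩ := opairE_iff.2 (rfl : pair x.1 y.1 = pair x.1 y.1)
    have hq := f.2.mem h
    refine ⟨⟨_, hq⟩, h, ⟨s, hq.mem ((h4 s).2 (.inl rfl))⟩, ⟨t, hq.mem ((h4 t).2 (.inr rfl))⟩, h_up.2 h2, h_up.2 h3, h_up.2 h4⟩
theorem h_pair {x y f : M} (hf : HOD f) (h : pair x y ∈ f) : HOD y := by
  obtain ⟨s, t, h2, h3, h4⟩ := opairE_iff.2 (rfl : pair x y = pair x y)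
  exact ((hf.mem h).mem ((h4 t).2 (.inr rfl))).mem ((h3 y).2 (.inr rfl))
theorem h_ord : OrdE (HE M) x ↔ OrdE ZFM.E x.1 := by
  constructor
  · intro ⟨h1, h2⟩
    exact ⟨fun y hy z hz => h1 ⟨y, x.2.mem hy⟩ hy ⟨z, (x.2.mem hy).mem hz⟩ hz,
      fun y hy z hz w hw => h2 ⟨y, x.2.mem hy⟩ hy ⟨z, (x.2.mem hy).mem hz⟩ hz ⟨w, ((x.2.mem hy).mem hz).mem hw⟩ hw⟩
  · intro ⟨h1, h2⟩
    exact ⟨fun y hy z hz => h1 y.1 hy z.1 hz, fun y hy z hz w hw => h2 y.1 hy z.1 hz w.1 hw⟩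
theorem h_lim : LimitE (HE M) x ↔ LimitE ZFM.E x.1 := by
  refine and_congr h_ord (and_congr ⟨fun ⟨w, h⟩ => ⟨w.1, h⟩, fun ⟨w, h⟩ => ⟨⟨w, x.2.mem h⟩, h⟩⟩ ⟨fun h α hα => ?_, fun h α hα => ?_⟩)
  · obtain ⟨β, h1, h2⟩ := h ⟨α, x.2.mem hα⟩ hα
    exact ⟨β.1, h1, h2⟩
  · obtain ⟨β, h1, h2⟩ := h α.1 hα
    exact ⟨⟨β, x.2.mem h1⟩, h1, h2⟩
end

theorem od_wit (hN : ∀ κ, ¬ SubtleE (HE M) κ) {γ : M} (hγ : Ord γ) (hw : om ⊆ γ) : ∃ q, OD q ∧ WB γ q := by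
  by_contra hno
  refine hN ⟨γ, ord_hod hγ⟩ ⟨⟨⟨h_ord.2 (ordE_iff.2 hγ), fun α hα ⟨f, ⟨hf, hs⟩, _⟩ => hno ?_⟩, h_ord.2 (ordE_iff.2 hγ), ⟨om, ord_hod ord_om⟩, ?_, ?_⟩, fun f hf C hC => ?_⟩
  · have dS : DF full (fun ξ : M => sep α.1 fun x => pair x ξ ∈ f.1) := by fun_prop
    have mC : ∀ {b : M}, b ∈ sep γ (fun ξ => α.1 ⊆ ξ) ↔ b ∈ γ ∧ α.1 ⊆ b := mem_sep (by fun_prop)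
    have mS : ∀ {ξ x : M}, x ∈ sep α.1 (fun x => pair x ξ ∈ f.1) ↔ x ∈ α.1 ∧ pair x ξ ∈ f.1 := mem_sep (by fun_prop)
    have ap : ∀ ξ, ξ ∈ γ → app (lam γ fun ξ => sep α.1 fun x => pair x ξ ∈ f.1) ξ = sep α.1 fun x => pair x ξ ∈ f.1 := fun ξ h => app_lam dS h
    have hα' : α.1 ∈ γ := hα
    refine ⟨s2 (lam γ fun ξ => sep α.1 fun x => pair x ξ ∈ f.1) (sep γ fun ξ => α.1 ⊆ ξ), od_of ?_, ?_⟩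
    · have := (ord_od hγ).df (G := M)
      have := (f.2.od).df (G := M)
      have := (α.2.od).df (G := M)
      refine DF.s2 _ _ (DF.lam _ _ ‹_› (DF.sep _ _ ?_ (DP.mem _ _ (by fun_prop) ?_))) (DF.sep _ _ ‹_› (DP.sub _ _ ?_ (by fun_prop)))
      · exact α.2.od.df
      · exact f.2.od.df
      · exact α.2.od.df
    · unfold WB
      rw [s2_0, s2_1]
      refine ⟨fun b hb => (mC.1 hb).1, fun b hb => ?_, fun l hl h0 h => mC.2 ⟨hl, ?_⟩, fun a ha => ?_, fun β hβ ξ hξ hl e => ?_⟩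
      · rcases (hγ.mem hb).lt_or_le (hγ.mem hα') with h | h
        · exact ⟨α.1, mC.2 ⟨hα', Sub.refl _⟩, (hγ.mem hα').sub h⟩
        · exact ⟨b, mC.2 ⟨hb, h⟩, Sub.refl _⟩
      · obtain ⟨w, hw⟩ := ne_emp.1 h0
        obtain ⟨β, hβ, -, hl'⟩ := h w hw
        exact Sub.trans (mC.1 hβ).2 ((hγ.mem hl).sub hl')
      · beta_reduce; rw [ap a (mC.1 ha).1]
        exact fun x hx => (mC.1 ha).2 x (mS.1 hx).1
      · rw [mC] at hβ hξ
        rw [ap _ hβ.1, ap _ hξ.1] at e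
        obtain ⟨x, h1, h2⟩ := hs ⟨ξ, ord_hod (hγ.mem hξ.1)⟩ hξ.1
        have h3 : x.1 ∈ sep α.1 (fun x => pair x ξ ∈ f.1) := mS.2 ⟨h1, h_pm.1 h2⟩
        rw [e, mem_cap] at h3
        have := (hf.2 x h1).2 _ ⟨β, ord_hod (hγ.mem hβ.1)⟩ h2 (h_pm.2 (mS.1 h3.1).2)
        have : ξ = β := congrArg Subtype.val this
        subst this; exact mem_irrefl _ hl
  · have h := omegaSpecE_iff.2 (rfl : (om : M) = om)
    exact ⟨h_lim.2 h.1, fun x hx hl => h.2 x.1 hx (h_lim.1 hl)⟩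
  · rcases (ord_om.le_iff hγ).1 hw with h | h
    · exact .inl h
    · exact .inr (Subtype.ext h)
  · by_contra hc
    refine hno ⟨s2 f.1 C.1, od_of ?_, ?_⟩
    · have := (f.2.od).df (G := M)
      have := (C.2.od).df (G := M)
      fun_prop
    · have ho : ∀ {α}, α ∈ γ → HOD α := fun h => ord_hod (hγ.mem h)
      have hv : ∀ α, α ∈ γ → pair α (app f.1 α) ∈ f.1 ∧ app f.1 α ⊆ α := by
        intro α hα
        obtain ⟨⟨A, h1, h2⟩, h3⟩ := hf ⟨α, ho hα⟩ hα
        have h1' := h_pm.1 h1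
        have : app f.1 α = A.1 := app_eq h1' fun y hy => congrArg Subtype.val (h3 ⟨y, h_pair f.2 hy⟩ A (h_pm.2 hy) h1)
        rw [this]
        exact ⟨h1', fun z hz => h2 ⟨z, A.2.mem hz⟩ hz⟩
      have hCs : C.1 ⊆ γ := fun z hz => hC.1 ⟨z, C.2.mem hz⟩ hz
      unfold WB
      rw [s2_0, s2_1]
      refine ⟨hCs, fun b hb => ?_, fun l hl h0 h => ?_, fun a ha => (hv a (hCs a ha)).2, fun β hβ ξ hξ hl e => hc ?_⟩
      · obtain ⟨β, h1, h2⟩ := hC.2.1 ⟨b, ho hb⟩ hb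
        exact ⟨β.1, h1, (hγ.mem (hCs _ h1)).sub h2⟩
      · obtain ⟨w, hw⟩ := ne_emp.1 h0
        refine hC.2.2 ⟨l, ho hl⟩ hl ⟨⟨w, ho (hγ.trans hl hw)⟩, hw⟩ fun α hα => ?_
        obtain ⟨β, h1, h2, h3⟩ := h α.1 hα
        exact ⟨⟨β, C.2.mem h1⟩, h1, h2, h3⟩
      · have p1 := (hv ξ (hCs ξ hξ)).1
        have p2 := (hv β (hCs β hβ)).1
        refine ⟨⟨ξ, ho (hCs ξ hξ)⟩, ⟨β, ho (hCs β hβ)⟩, hξ, hβ, hl, ⟨_, h_pair f.2 p1⟩, ⟨_, h_pair f.2 p2⟩, h_pm.2 p1, h_pm.2 p2, fun z => ?_⟩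
        rw [he_iff, he_iff, he_iff]
        show z.1 ∈ app f.1 ξ ↔ _
        rw [e, mem_cap]
end
end Paper
namespace Paper
section
variable {M : Type} [ZFM M] {G : Type} [Ctx M G] {c : Calc M} {n : ℕ}

theorem tv_cd {θ : M} (h : TV n θ) : Cd θ := by
  refine ⟨h.ord, fun a ha he => ?_⟩
  have haV : a ∈ Vs θ := (ord_mem_Vs h.ord (h.ord.mem ha)).2 ha
  obtain ⟨b, hb, he'⟩ := tv_eqC h (Vs_pow h.1 haV)
  exact cantor a (he'.symm.le.trans ((leC_sub (h.ord.sub hb)).trans he.symm.le))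
theorem u0_ord (g : M) : Ord (u0 g) := ord_sU fun x hx => by
  obtain ⟨-, b, hb, h, -⟩ := (mem_sep (by fun_prop)).1 hx; exact h
theorem u0_le {g : M} (hg : Ord g) : u0 g ⊆ g := fun z hz => by
  obtain ⟨x, hx, hz'⟩ := mem_sU.1 hz
  rcases mem_suc.1 ((mem_sep (by fun_prop)).1 hx).1 with h | h
  · exact hg.trans h hz'
  · rwa [h] at hz'
noncomputable def Vr (v a : M) : M := sep v fun x => rank x ∈ a
@[fun_prop] theorem DF.Vr (f g : G → M) (hf : DF c f) (hg : DF c g) : DF c (fun x => Vr (f x) (g x)) := by unfold Paper.Vr; fun_prop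
theorem Vr_eq {θ a : M} (hθ : Ord θ) (ha : Ord a) (h : a ⊆ θ) : Vr (Vs θ) a = Vs a := ext fun z => by
  rw [Vr, mem_sep (by fun_prop), mem_Vs hθ, mem_Vs ha]; exact ⟨fun h => h.2, fun h' => ⟨h _ h', h'⟩⟩

def Dfr (v g x : M) : Prop := x ∈ v ∧ ball v fun y => (y ∈ Vr v (u0 g) ∧ snc emp y ∈ Sa (Vr v (u0 g)) (u1 g)) ↔ y = x
@[fun_prop] theorem DP.Dfr (e f g : G → M) (he : DF c e) (hf : DF c f) (hg : DF c g) : DP c (fun x => Dfr (e x) (f x) (g x)) := by unfold Paper.Dfr; fun_prop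
theorem dfr_iff {θ g x : M} (hθ : Ord θ) (hg : g ∈ θ) : Dfr (Vs θ) g x ↔ Df g x := by
  have hs : u0 g ⊆ θ := Sub.trans (u0_le (hθ.mem hg)) (hθ.sub hg)
  unfold Dfr Df
  rw [Vr_eq hθ (u0_ord g) hs]
  constructor
  · intro ⟨h1, h2⟩ y
    constructor
    · intro h; exact (h2 y (Vs_mono' (u0_ord g) hθ hs y h.1)).1 h
    · rintro rfl; exact (h2 _ h1).2 rfl
  · intro h; exact ⟨Vs_mono' (u0_ord g) hθ hs _ ((h x).2 rfl).1, fun y _ => h y⟩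
def WC (γ q : M) : Prop := om ⊆ γ → WB γ q
@[fun_prop] theorem DP.WC (f g : G → M) (hf : DF c f) (hg : DF c g) : DP c (fun x => WC (f x) (g x)) := by unfold Paper.WC; fun_prop
def Gd (v g γ q : M) : Prop := Ord g ∧ Dfr v g q ∧ WC γ q ∧ ball g fun g' => ball v fun q' => ¬ (Dfr v g' q' ∧ WC γ q')
@[fun_prop] theorem DP.Gd (d e f g : G → M) (hd : DF c d) (he : DF c e) (hf : DF c f) (hg : DF c g) : DP c (fun x => Gd (d x) (e x) (f x) (g x)) := by unfold Paper.Gd; fun_prop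
theorem gd_iff {θ g γ q : M} (hθ : Ord θ) (hg : g ∈ Vs θ) : Gd (Vs θ) g γ q ↔ Ord g ∧ Df g q ∧ WC γ q ∧ ∀ g', g' ∈ g → ∀ q', ¬ (Df g' q' ∧ WC γ q') := by
  refine and_congr_right fun ho => ?_
  have hg := (ord_mem_Vs hθ ho).1 hg
  rw [dfr_iff hθ hg]
  refine and_congr_right fun _ => and_congr_right fun _ => forall_congr' fun g' => imp_congr_right fun hg' => ?_
  simp only [dfr_iff hθ (hθ.trans hg hg')]
  refine ⟨fun h q' hq => h q' ?_ hq, fun h q' _ => h q'⟩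
  exact ((dfr_iff hθ (hθ.trans hg hg')).2 hq.1).1
def FF (v δ F : M) : Prop := Fn F (suc δ) ∧ ball (suc δ) fun γ => bex v fun g => Gd v g γ (app F γ)
@[fun_prop] theorem DP.FF (e f g : G → M) (he : DF c e) (hf : DF c f) (hg : DF c g) : DP c (fun x => FF (e x) (f x) (g x)) := by unfold Paper.FF; fun_prop
theorem ff_uniq {θ θ' δ F F' : M} (hθ : Ord θ) (hθ' : Ord θ') (h : FF (Vs θ) δ F) (h' : FF (Vs θ') δ F') : F = F' := by
  refine h.1.ext h'.1 fun γ hγ => ?_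
  obtain ⟨g, hg, hh⟩ := h.2 γ hγ
  obtain ⟨g', hg', hh'⟩ := h'.2 γ hγ
  rw [gd_iff hθ hg] at hh
  rw [gd_iff hθ' hg'] at hh'
  obtain ⟨a1, a2, a3, a4⟩ := hh
  obtain ⟨b1, b2, b3, b4⟩ := hh'
  rcases ord_tri a1 b1 with h | rfl | h
  · exact (b4 _ h _ ⟨a2, a3⟩).elim
  · exact a2.uniq b2
  · exact (a4 _ h _ ⟨b2, b3⟩).elim
theorem ff_wb {θ δ F γ : M} (h : FF (Vs θ) δ F) (hγ : γ ∈ suc δ) (hw : om ⊆ γ) : WB γ (app F γ) := by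
  obtain ⟨g, hg, -, -, hh, -⟩ := h.2 γ hγ
  exact hh hw
noncomputable def gs (γ : M) : M := mu fun g => ∃ q, Df g q ∧ WC γ q
@[fun_prop] theorem DF.gs [c.Full] (f : G → M) (hf : DF c f) : DF c (fun x => gs (f x)) := by unfold Paper.gs; fun_prop
theorem ff_ex (hN : ∀ κ, ¬ SubtleE (HE M) κ) {δ : M} (hδ : Ord δ) : ∃ F B : M, ∀ θ, Ord θ → B ∈ Vs θ → F ∈ Vs θ ∧ FF (Vs θ) δ F := by
  let K : M → M := fun γ => sU (sep (Vs (u0 (gs γ))) (Df (gs γ)))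
  have dK : DF full K := by unfold K; fun_prop
  let F : M := lam (suc δ) K
  refine ⟨F, up F (img (suc δ) gs), fun θ hθ hB => ?_⟩
  have hF : F ∈ Vs θ := (tr_Vs hθ).mem hB (mem_up.2 (.inl rfl))
  refine ⟨hF, fn_lam _ dK, fun γ hγ => ?_⟩
  have hI := (tr_Vs hθ).mem hB (mem_up.2 (.inr rfl))
  have hg : gs γ ∈ Vs θ := (tr_Vs hθ).mem hI ((mem_img (by fun_prop)).2 ⟨γ, hγ, rfl⟩)
  refine ⟨gs γ, hg, (gd_iff hθ hg).2 ?_⟩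
  have oγ := hδ.suc.mem hγ
  have ex : ∃ g, Ord g ∧ ∃ q, Df g q ∧ WC γ q := by
    by_cases hw : om ⊆ γ
    · obtain ⟨q, ⟨g, h1, h2⟩, h3⟩ := od_wit hN oγ hw
      exact ⟨g, h1, q, h2, fun _ => h3⟩
    · obtain ⟨g, h1, h2⟩ := ord_od oγ
      exact ⟨g, h1, γ, h2, fun h => (hw h).elim⟩
  obtain ⟨a1, ⟨q, a2, a3⟩, a4⟩ := mu_spec (by fun_prop) ex
  have e : app F γ = q := by
    unfold F; rw [app_lam dK hγ]
    refine sU_uniq fun z => ?_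
    rw [mem_sep (by fun_prop)]
    refine ⟨fun h => h.2.uniq a2, ?_⟩
    rintro rfl
    exact ⟨((a2 z).2 rfl).1, a2⟩
  beta_reduce
  rw [e]
  exact ⟨a1, a2, a3, fun g' hg' q' h => a4 g' hg' ⟨q', h⟩⟩

noncomputable def st (q η : M) : M := sU (sep (app q (num 1)) fun β => η ⊆ β ∧ ball (app q (num 1)) fun β' => η ⊆ β' → β ⊆ β')
@[fun_prop] theorem DF.st (f g : G → M) (hf : DF c f) (hg : DF c g) : DF c (fun x => st (f x) (g x)) := by unfold Paper.st; fun_prop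
theorem st_spec {q η γ : M} (hγ : Ord γ) (hs : app q (num 1) ⊆ γ) (h : ∃ β, β ∈ app q (num 1) ∧ η ⊆ β) : st q η ∈ app q (num 1) ∧ η ⊆ st q η := by
  obtain ⟨β, h1, ⟨h2, h3⟩, h4⟩ := ord_min (P := fun β => β ∈ app q (num 1) ∧ η ⊆ β) (by fun_prop) (by obtain ⟨β, h⟩ := h; exact ⟨β, hγ.mem (hs _ h.1), h⟩)
  have : st q η = β := sU_uniq fun z => by
    rw [mem_sep (by fun_prop)]
    constructor
    · intro ⟨h5, h6, h7⟩
      refine Sub.antisymm (h7 β h2 h3) ((Ord.not_lt (hγ.mem (hs _ h5)) h1).1 fun h => h4 z h ⟨h5, h6⟩)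
    · rintro rfl
      exact ⟨h2, h3, fun β' h5 h6 => (Ord.not_lt (hγ.mem (hs _ h5)) h1).1 fun h => h4 β' h ⟨h5, h6⟩⟩
  rw [this]; exact ⟨h2, h3⟩
open Classical in
noncomputable def hh (F δ σ : M) : M := recF (fun x f => if u0 x = emp then δ else st (app F (app f (u1 x))) (u0 x)) σ
@[fun_prop] theorem DF.hh (e f g : G → M) (he : DF c e) (hf : DF c f) (hg : DF c g) : DF c (fun x => hh (e x) (f x) (g x)) := by unfold Paper.hh; fun_prop
theorem hh_emp {F δ b : M} (hb : Ord b) : hh F δ (p emp b) = δ := by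
  rw [hh, recF_spec (by unfold DF2; fun_prop), if_pos (u0_p ord_emp hb)]
theorem hh_ne {F δ a b : M} (ha : Ord a) (hb : Ord b) (h : a ≠ emp) : hh F δ (p a b) = st (app F (hh F δ b)) a := by
  conv_lhs => rw [hh, recF_spec (by unfold DF2; fun_prop), u0_p ha hb, if_neg h, u1_p ha hb]
  rw [app_lam (by fun_prop) (lt_p ha hb h)]; rfl

def Pr (φ : SetFormula 2) (v x α δ : M) : Prop := α ∈ δ ∧ s2 x α ∈ Sa (Vr v δ) (code φ)
@[fun_prop] theorem DP.Pr (φ : SetFormula 2) (d e f g : G → M) (hd : DF c d) (he : DF c e) (hf : DF c f) (hg : DF c g) : DP c (fun x => Pr φ (d x) (e x) (f x) (g x)) := by unfold Paper.Pr; fun_prop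
def PB (φ : SetFormula 2) (b : Prop) (v e x y w k : M) : Prop := y ∈ k ∧ bex e fun δ => (Pr φ v x (u0 y) δ ∧ ball δ fun δ' => δ' ∈ e → ¬ Pr φ v x (u0 y) δ') ∧
  bex v fun F => FF v δ F ∧ (b → k = hh F δ (u1 y)) ∧ (¬ b → k ∈ app (app F (hh F δ (u1 y))) (num 1) ∧ w = app (app (app F (hh F δ (u1 y))) (num 0)) k)
theorem PB_dp (φ : SetFormula 2) (b : Prop) : DP c (fun q : ((((M × M) × M) × M) × M) × M => PB φ b q.1.1.1.1.1 q.1.1.1.1.2 q.1.1.1.2 q.1.1.2 q.1.2 q.2) := by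
  have hb : DP c (fun q : (((((((M × M) × M) × M) × M) × M) × M) × M) => b) := DP.const b
  have hb' : DP c (fun q : (((((((M × M) × M) × M) × M) × M) × M) × M) => ¬ b) := DP.const (¬ b)
  unfold PB
  refine DP.and _ _ (by fun_prop) (DP.bex _ _ (by fun_prop) (DP.and _ _ (by fun_prop) (DP.bex _ _ (by fun_prop) (DP.and _ _ (by fun_prop) (DP.and _ _ (DP.imp _ _ hb (by fun_prop)) (DP.imp _ _ hb' (by fun_prop)))))))

theorem cap_ord_mem {y k : M} (hy : Ord y) (hk : Ord k) (h : cap y k ∈ k) : y ∈ k := by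
  rcases hy.lt_or_le hk with h3 | h3
  · exact h3
  · rw [show cap y k = k from ext fun z => by rw [mem_cap]; exact ⟨fun h => h.2, fun h => ⟨h3 z h, h⟩⟩] at h
    exact (mem_irrefl _ h).elim
theorem cap_eq {y k : M} (h : y ⊆ k) : cap y k = y := ext fun z => by rw [mem_cap]; exact ⟨fun h => h.1, fun h' => ⟨h', h z h'⟩⟩

/-- the least `Σₙ`-correct `δ` with `V_δ ⊨ φ(a, α)` -/
def LD (n : ℕ) (φ : SetFormula 2) (a α δ : M) : Prop := (TV n δ ∧ α ∈ δ ∧ s2 a α ∈ Sa (Vs δ) (code φ)) ∧ ∀ δ', δ' ∈ δ → ¬ (TV n δ' ∧ α ∈ δ' ∧ s2 a α ∈ Sa (Vs δ') (code φ))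
theorem ld_iff {φ : SetFormula 2} {θ a α δ : M} (hθ : Ord θ) : (δ ∈ eC n θ ∧ Pr φ (Vs θ) a α δ ∧ ball δ fun δ' => δ' ∈ eC n θ → ¬ Pr φ (Vs θ) a α δ') ↔ δ ∈ θ ∧ LD n φ a α δ := by
  have e : ∀ δ, TV n δ → δ ∈ θ → (Pr φ (Vs θ) a α δ ↔ α ∈ δ ∧ s2 a α ∈ Sa (Vs δ) (code φ)) := fun δ h1 h2 => by
    rw [Pr, Vr_eq hθ h1.ord (hθ.sub h2)]
  constructor
  · rintro ⟨h1, h2, h3⟩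
    obtain ⟨h1, h4⟩ := mem_eC.1 h1
    have h5 := (ord_mem_Vs hθ h4.ord).1 h1
    exact ⟨h5, ⟨h4, (e δ h4 h5).1 h2⟩, fun δ' hd ⟨h6, h7⟩ => h3 δ' hd (mem_eC.2 ⟨(ord_mem_Vs hθ h6.ord).2 (hθ.trans h5 hd), h6⟩) ((e δ' h6 (hθ.trans h5 hd)).2 h7)⟩
  · rintro ⟨h5, ⟨h4, h2⟩, h3⟩
    exact ⟨mem_eC.2 ⟨(ord_mem_Vs hθ h4.ord).2 h5, h4⟩, (e δ h4 h5).2 h2, fun δ' hd h6 h7 => h3 δ' hd ⟨(mem_eC.1 h6).2, (e δ' (mem_eC.1 h6).2 (hθ.trans h5 hd)).1 h7⟩⟩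
theorem ld_uniq {φ : SetFormula 2} {a α δ δ' : M} (h : LD n φ a α δ) (h' : LD n φ a α δ') : δ = δ' := by
  rcases ord_tri h.1.1.ord h'.1.1.ord with h1 | h1 | h1
  · exact (h'.2 _ h1 h.1).elim
  · exact h1
  · exact (h.2 _ h1 h'.1).elim

theorem thmB (hN : ∀ κ, ¬ SubtleE (HE M) κ) {κ : M} (h : WS n κ (fun _ => True)) : WS n κ (fun θ => θ ∈ κ) := by
  have hB : ∀ a b : M, Ord b → a ∈ b → True → True := fun _ _ _ _ _ => trivial
  have o := h.1.ord
  have hw : om ⊆ κ := h.om_le hB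
  have hl := h.lim hB
  refine ⟨h.1, fun φ θ0 z h1 h2 h3 h4 => ?_⟩
  by_contra hno
  obtain ⟨α, θ1, a1, a2, a3, a4, -, a5⟩ := h.2 φ θ0 z h1 h2 h3 h4
  obtain ⟨δ, d1, d2, d3⟩ := ord_min (P := fun δ => TV n δ ∧ α ∈ δ ∧ s2 (cap z α) α ∈ Sa (Vs δ) (code φ)) (by fun_prop)
    ⟨θ1, a2.ord, a2.1, a3, by rw [s2_sq]; exact (sat_iff φ _ (in2 a2.ord a3 (cap_sub_r _ _))).2 a5⟩
  have hδ : κ ⊆ δ := (Ord.not_lt d1 o).1 fun hd => hno ⟨α, δ, a1, ⟨d2.1, tv_cd d2.1⟩, d2.2.1, a4, hd, by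
    have := d2.2.2
    rw [s2_sq] at this; exact (sat_iff φ _ (in2 d1 d2.2.1 (cap_sub_r _ _))).1 this⟩
  have ld : LD n φ (cap z α) α δ := ⟨d2, d3⟩
  obtain ⟨F, B, hF⟩ := ff_ex hN d1
  obtain ⟨θ, t1, t2⟩ := cc_above n (up δ B)
  have oθ := t1.ord
  have hδθ : δ ∈ θ := (ord_mem_Vs oθ d1).1 ((tr_Vs oθ).mem t2 (mem_up.2 (.inl rfl)))
  obtain ⟨f1, f2⟩ := hF θ oθ ((tr_Vs oθ).mem t2 (mem_up.2 (.inr rfl)))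
  have hκθ : κ ∈ θ := Ord.lt_of_le_of_lt o oθ hδ hδθ
  have e0 : emp ∈ κ := hw _ emp_om
  obtain ⟨γ, g1, ⟨g2, σ, g3, g4⟩, g5⟩ := ord_min (P := fun γ => κ ⊆ γ ∧ ∃ σ, σ ∈ κ ∧ hh F δ σ = γ) (by fun_prop)
    ⟨δ, d1, hδ, p emp emp, p_cd h.1 hw e0 e0, hh_emp ord_emp⟩
  have gδ : γ ∈ suc δ := (Ord.mem_suc_iff g1 d1).2 ((Ord.not_lt d1 g1).1 fun hd => g5 δ hd ⟨hδ, p emp emp, p_cd h.1 hw e0 e0, hh_emp ord_emp⟩)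
  obtain ⟨w1, w2, w3, w4, w5⟩ := ff_wb f2 gδ (Sub.trans hw g2)
  have oα := a1.ord
  have oσ := o.mem g3
  have hκC : ¬ κ = γ → κ ∈ app (app F γ) (num 1) := by
    intro hne
    have hκγ : κ ∈ γ := ((o.le_iff g1).1 g2).resolve_right hne
    by_contra hC
    refine hC (w3 κ hκγ (ne_emp.2 ⟨_, e0⟩) fun η hη => ?_)
    by_contra hno
    have oη := o.mem hη
    have hsη := hl.suc hη
    obtain ⟨s1, s2⟩ := st_spec g1 w1 (w2 (suc η) (g2 _ hsη))
    have oS := g1.mem (w1 _ s1)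
    refine g5 _ (w1 _ s1) ⟨(Ord.not_lt oS o).1 fun hS => hno ⟨_, s1, s2 _ (self_mem_suc η), hS⟩, p (suc η) σ, p_cd h.1 hw hsη g3, ?_⟩
    rw [hh_ne oη.suc oσ (ne_emp.2 ⟨η, self_mem_suc η⟩), g4]
  have hy : p α σ ∈ κ := p_cd h.1 hw a4 g3
  have haκ : cap z α ⊆ κ := Sub.trans (cap_sub_l _ _) h3
  have P0 : PB φ (κ = γ) (Vs θ) (eC n θ) (cap z α) (p α σ) (cap (app (app (app F γ) (num 0)) κ) κ) κ := by
    obtain ⟨l1, l2, l3⟩ := (ld_iff oθ).2 ⟨hδθ, ld⟩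
    refine ⟨hy, δ, l1, ⟨by rw [u0_p oα oσ]; exact l2, by rw [u0_p oα oσ]; exact l3⟩, F, f1, f2, ?_, ?_⟩
    · rw [u1_p oα oσ, g4]; exact id
    · rw [u1_p oα oσ, g4]; intro hne
      exact ⟨hκC hne, cap_eq (w4 κ (hκC hne))⟩
  obtain ⟨k, θ', k1, k2, k3, k4, -, k5, k6, δ', k7, ⟨k8, k9⟩, F', k10, k11, k12, k13⟩ := h.refl3 hB (PB_dp φ (κ = γ)).1 t1 hκθ haκ (o.sub hy) (cap_sub_r _ _) P0
  have hyk := cap_ord_mem (ord_p oα oσ) k1.ord k6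
  rw [cap_eq (k1.ord.sub hyk), u0_p oα oσ] at k8 k9
  rw [cap_eq (k1.ord.sub hyk), u1_p oα oσ] at k12 k13
  have hαk : α ∈ k := Ord.lt_of_le_of_lt oα k1.ord (le_p_l oα oσ) hyk
  rw [cap_eq (Sub.trans (cap_sub_r _ _) (k1.ord.sub hαk))] at k8 k9
  obtain ⟨-, ld'⟩ := (ld_iff k2.ord).1 ⟨k7, k8, k9⟩
  obtain rfl := ld_uniq ld ld'
  obtain rfl := ff_uniq oθ k2.ord f2 k11
  rw [g4] at k12 k13
  by_cases hc : κ = γ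
  · rw [k12 hc, ← hc] at k4; exact mem_irrefl _ k4
  · obtain ⟨m1, m2⟩ := k13 hc
    refine w5 κ (hκC hc) k m1 k4 ?_
    rw [← m2]
    exact ext fun z => by simp only [mem_cap]; exact ⟨fun h => ⟨h.1.1, h.2⟩, fun h => ⟨⟨h.1, o.trans k4 h.2⟩, h.2⟩⟩
end
end Paper
namespace Paper
section
variable {M : Type} [ZFM M] {G : Type} [Ctx M G] {c : Calc M} {n : ℕ}

section
variable {κ : M}
theorem WS.hB (h : WS n κ (fun θ => θ ∈ κ)) : ∀ a b : M, Ord b → a ∈ b → b ∈ κ → a ∈ κ := fun a b _ hab hb => h.1.ord.trans hb hab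
theorem WS.cd (h : WS n κ (fun θ => θ ∈ κ)) : Cd κ := h.1
theorem WS.tv (h : WS n κ (fun θ => θ ∈ κ)) : TV n κ := tv_lim (h.lim h.hB) fun a ha => by
  obtain ⟨κ', θ', h1, h2, h3, h4, h5, h6⟩ := h.up h.hB ha
  exact ⟨θ', h.cd.ord.sub h5, h2.1, h2.ord.trans h3 h6⟩
def Reg (κ : M) : Prop := ∀ γ f, γ ∈ κ → FnTo f γ κ → ∃ β, β ∈ κ ∧ ∀ x, x ∈ γ → app f x ∈ β
theorem regularE_iff {κ : M} : RegularE ZFM.E κ ↔ Ord κ ∧ Reg κ := by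
  unfold RegularE Reg
  simp only [ordE_iff, isFuncE_iff, pairMemE_iff]
  refine and_congr_right fun _ => forall_congr' fun γ => forall_congr' fun f => imp_congr_right fun _ => imp_congr_right fun hf => exists_congr fun β => and_congr_right fun _ => ?_
  constructor
  · intro h x hx; exact h x _ (hf.1.pair_mem.2 ⟨hx, rfl⟩)
  · intro h x y hxy
    obtain ⟨h1, rfl⟩ := hf.1.pair_mem.1 hxy
    exact h x h1
theorem WS.reg (h : WS n κ (fun θ => θ ∈ κ)) : Reg κ := fun γ f hγ hf => by
  have oκ := h.cd.ord
  have hw := h.om_le h.hB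
  let y := img γ fun ξ => p ξ (app f ξ)
  have hy : ∀ z, z ∈ y ↔ ∃ ξ, ξ ∈ γ ∧ z = p ξ (app f ξ) := fun z => mem_img (by fun_prop)
  have hyκ : y ⊆ κ := fun z hz => by
    obtain ⟨ξ, h1, rfl⟩ := (hy z).1 hz
    exact p_cd h.cd hw (oκ.trans hγ h1) (hf.2 ξ h1)
  obtain ⟨θ, h1, h2⟩ := cc_above n κ
  obtain ⟨κ', θ', a1, a2, a3, a4, a5, a6, a7, a8⟩ := h.refl3 h.hB (P := fun v e x y w k => x ∈ k ∧ ball x fun ξ => bex k fun η => p ξ η ∈ y) (DP.and _ _ (by fun_prop) (by fun_prop)).1 h1 ((ord_mem_Vs h1.ord oκ).1 h2) (oκ.sub hγ) hyκ (emp_sub κ) ⟨hγ, fun ξ hξ => ⟨app f ξ, hf.2 ξ hξ, (hy _).2 ⟨ξ, hξ, rfl⟩⟩⟩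
  have oγ := oκ.mem hγ
  have hγk := cap_ord_mem oγ a1.ord a7
  rw [cap_eq (a1.ord.sub hγk)] at a8
  refine ⟨κ', a4, fun ξ hξ => ?_⟩
  obtain ⟨η, b1, b2⟩ := a8 ξ hξ
  obtain ⟨ξ', b3, b4⟩ := (hy _).1 (mem_cap.1 b2).1
  have := p_inj (oγ.mem hξ) (a1.ord.mem b1) (oγ.mem b3) (oκ.mem (hf.2 ξ' b3)) b4
  rw [← this.1] at this
  exact this.2 ▸ b1
def SLim (κ : M) : Prop := ∀ α, α ∈ κ → ∃ β, β ∈ κ ∧ LeC (pow α) β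
theorem inaccE_iff {κ : M} : InaccE ZFM.E κ ↔ Cd κ ∧ om ∈ κ ∧ Reg κ ∧ SLim κ := by
  unfold InaccE StrongLimitE SLim LeC
  simp only [cardE_iff, omegaSpecE_iff, regularE_iff, powE_iff, injE_iff, exists_eq_left, forall_eq, exists_and_left, mem_def]
  constructor
  · rintro ⟨h1, h2, h3, h4⟩; exact ⟨h1, h2, h3.2, h4⟩
  · rintro ⟨h1, h2, h3, h4⟩; exact ⟨h1, h2, ⟨h1.ord, h3⟩, h4⟩
theorem tv_slim (h : TV n κ) : SLim κ := fun α hα => by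
  have haV : α ∈ Vs κ := (ord_mem_Vs h.ord (h.ord.mem hα)).2 hα
  obtain ⟨b, hb, he'⟩ := tv_eqC h (Vs_pow h.1 haV)
  exact ⟨b, hb, he'.symm.le⟩
theorem WS.inacc (h : WS n κ (fun θ => θ ∈ κ)) : InaccE ZFM.E κ :=
  inaccE_iff.2 ⟨h.cd, h.om_mem h.hB, h.reg, tv_slim h.tv⟩
end

section
variable {m κ : M}
theorem zm_sing (hz : ZFMinusModelE ZFM.E m) (ht : Tr m) {x : M} (hx : x ∈ m) : sing x ∈ m := by
  obtain ⟨q, hq⟩ := hz.2.1 ⟨x, hx⟩ ⟨x, hx⟩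
  have : q.1 = sing x := ext fun z => by
    rw [mem_sing]
    constructor
    · intro h
      have := (hq ⟨z, ht.mem q.2 h⟩).1 h
      simpa using this
    · rintro rfl; exact (hq ⟨z, hx⟩).2 (.inl rfl)
  exact this ▸ q.2
theorem zm_sU (hz : ZFMinusModelE ZFM.E m) (ht : Tr m) {x : M} (hx : x ∈ m) : sU x ∈ m := by
  obtain ⟨q, hq⟩ := hz.2.2.1 ⟨x, hx⟩
  have : q.1 = sU x := ext fun z => by
    rw [mem_sU]
    constructor
    · intro h
      obtain ⟨y, h1, h2⟩ := (hq ⟨z, ht.mem q.2 h⟩).1 h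
      exact ⟨y.1, h1, h2⟩
    · rintro ⟨y, h1, h2⟩
      exact (hq ⟨z, ht.mem (ht.mem hx h1) h2⟩).2 ⟨⟨y, ht.mem hx h1⟩, h1, h2⟩
  exact this ▸ q.2
theorem zm_diff (hz : ZFMinusModelE ZFM.E m) (ht : Tr m) {x y : M} (hx : x ∈ m) (hy : y ∈ m) : diff x y ∈ m := by
  obtain ⟨q, hq⟩ := hz.2.2.2.2.2.1 1 (SetFormula.mem 0 1).not ![⟨y, hy⟩] ⟨x, hx⟩
  have : q.1 = diff x y := ext fun z => by
    rw [mem_diff]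
    constructor
    · intro h
      exact (hq ⟨z, ht.mem q.2 h⟩).1 h
    · rintro h
      exact (hq ⟨z, ht.mem hx h.1⟩).2 h
  exact this ▸ q.2
theorem Vs_sub_m (ht : Tr m) (hz : ZFMinusModelE ZFM.E m) (hκ : TV n κ) (hκm : κ ∈ m) (hs : SmallSeqClosedE ZFM.E m κ) : Vs κ ⊆ m := by
  have key : ∀ x : M, x ∈ Vs κ → x ∈ m := eps_ind (P := fun x => x ∈ Vs κ → x ∈ m) (by fun_prop) fun x ih hx => by
    obtain ⟨β, hβ, f, hf⟩ := tv_eqC hκ hx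
    have oβ := hκ.ord.mem hβ
    have hm : ∀ z, z ∈ x → sing (sing z) ∈ m := fun z hz' => zm_sing hz ht (zm_sing hz ht (ih z hz' ((tr_Vs hκ.ord).mem hx hz')))
    let g := lam β fun ξ => sing (sing (app f ξ))
    have dg : DF full fun ξ : M => sing (sing (app f ξ)) := by fun_prop
    have hg : g ∈ m := hs β g hβ (isFuncE_iff.2 (fnTo_lam dg fun ξ hξ => hm _ (hf.2.mem hξ)))
    have h1 := zm_diff hz ht (zm_sU hz ht (zm_sU hz ht hg)) (ht.mem hκm hβ)
    have e : x = sU (sU (diff (sU (sU g)) β)) := ext fun z => by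
      have h2 : ∀ u, u ∈ diff (sU (sU g)) β ↔ ∃ ξ, ξ ∈ β ∧ u = sing (sing (app f ξ)) := fun u => by
        have h3 : ∀ t, ∀ b : M, Ord b → sing (sing t) ∉ b := fun t b hb h => by
          have h4 := hb.mem h
          have := h4.emp_mem (fun h5 => mem_emp (h5 ▸ mem_sing.2 rfl))
          rw [mem_sing] at this
          exact mem_emp (this ▸ mem_sing.2 rfl)
        rw [mem_diff, mem_sU]
        constructor
        · rintro ⟨⟨y, h4, h5⟩, h6⟩
          obtain ⟨q, h7, h8⟩ := mem_sU.1 h4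
          obtain ⟨ξ, h9, rfl⟩ := (mem_lam dg).1 h7
          rw [pair, mem_up] at h8
          refine ⟨ξ, h9, ?_⟩
          rcases h8 with rfl | rfl
          · rw [mem_up, or_self] at h5; exact (h6 (h5 ▸ h9)).elim
          · rw [mem_up] at h5
            exact h5.resolve_left fun h => h6 (h ▸ h9)
        · rintro ⟨ξ, h4, rfl⟩
          refine ⟨⟨up ξ (sing (sing (app f ξ))), mem_sU.2 ⟨pair ξ (sing (sing (app f ξ))), (mem_lam dg).2 ⟨ξ, h4, rfl⟩, ?_⟩, mem_up.2 (.inr rfl)⟩, h3 _ _ oβ⟩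
          rw [pair, mem_up]; exact .inr rfl
      simp only [mem_sU, h2]
      constructor
      · intro hz
        obtain ⟨ξ, h3, rfl⟩ := hf.2.sur hz
        exact ⟨_, ⟨_, ⟨ξ, h3, rfl⟩, mem_sing.2 rfl⟩, mem_sing.2 rfl⟩
      · rintro ⟨y, ⟨u, ⟨ξ, h3, rfl⟩, h4⟩, h5⟩
        rw [mem_sing] at h4; subst h4
        rw [mem_sing] at h5; subst h5
        exact hf.2.mem h3
    rw [e]; exact zm_sU hz ht (zm_sU hz ht h1)
  exact key
end

/-! decoding finite sequences -/
open Classical in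
noncomputable def dc (b σ : M) : M := recF (fun x f => if u0 x = emp then emp else snc (app f (u1 x)) (app b (sU (u0 x)))) σ
@[fun_prop] theorem DF.dc (f g : G → M) (hf : DF c f) (hg : DF c g) : DF c (fun x => dc (f x) (g x)) := by unfold Paper.dc; fun_prop
theorem dc_emp {b t : M} (ht : Ord t) : dc b (p emp t) = emp := by
  rw [dc, recF_spec (by unfold DF2; fun_prop), if_pos (u0_p ord_emp ht)]
theorem suc_ne {x : M} : suc x ≠ emp := fun h => mem_emp (h ▸ self_mem_suc x)
theorem dc_suc {b a t : M} (ha : Ord a) (ht : Ord t) : dc b (p (suc a) t) = snc (dc b t) (app b a) := by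
  conv_lhs => rw [dc, recF_spec (by unfold DF2; fun_prop), u0_p ha.suc ht, if_neg suc_ne, u1_p ha.suc ht, sU_suc ha.tr]
  rw [app_lam (by fun_prop) (lt_p ha.suc ht suc_ne)]; rfl
noncomputable def jc (j s : M) : M := lam (dm s) fun i => app j (app s i)
@[fun_prop] theorem DF.jc (f g : G → M) (hf : DF c f) (hg : DF c g) : DF c (fun x => jc (f x) (g x)) := by unfold Paper.jc; fun_prop
theorem fn_jc {j s l : M} (hs : Fn s l) : Fn (jc j s) l := by
  have := fn_lam (dm s) (F := fun i => app j (app s i)) (by fun_prop)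
  rw [hs.dm] at this; unfold jc; rw [hs.dm]; exact this
theorem jc_app {j s l i : M} (hs : Fn s l) (hi : i ∈ l) : app (jc j s) i = app j (app s i) := by
  unfold jc; rw [hs.dm, app_lam (by fun_prop) hi]
theorem dc_sur {κ m b b' j : M} (hk : Cd κ) (hw : om ⊆ κ) (hb : Sur b κ m) (hj : ∀ ξ, ξ ∈ κ → app j (app b ξ) = app b' ξ) {s : M} (hs : s ∈ FS m) : ∃ σ, σ ∈ κ ∧ dc b σ = s ∧ dc b' σ = jc j s := by
  have oκ := hk.ord
  have h0 : (emp : M) ∈ κ := hw _ emp_om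
  have key : ∀ l : M, l ∈ (om : M) → ∀ s, FnTo s l m → ∃ σ, σ ∈ κ ∧ dc b σ = s ∧ dc b' σ = jc j s := om_ind (P := fun l => ∀ s, FnTo s l m → ∃ σ, σ ∈ κ ∧ dc b σ = s ∧ dc b' σ = jc j s) (by fun_prop)
    (fun s hs => ⟨p emp emp, p_cd hk hw h0 h0, by rw [dc_emp ord_emp]; exact fn_emp.ext hs.1 fun x hx => (mem_emp hx).elim, by rw [dc_emp ord_emp]; exact fn_emp.ext (fn_jc hs.1) fun x hx => (mem_emp hx).elim⟩)
    (fun l hl ih s hs => by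
      have d : DF full (fun x => app s x) := by fun_prop
      have ht : FnTo (lam l fun x => app s x) l m := fnTo_lam d fun x hx => hs.2 x (sub_suc l x hx)
      obtain ⟨τ, h1, h2, h2'⟩ := ih _ ht
      obtain ⟨ξ, h3, h4⟩ := hb.sur (hs.2 l (self_mem_suc l))
      refine ⟨p (suc ξ) τ, p_cd hk hw ((hk.lim hw).suc h3) h1, ?_, ?_⟩
      · rw [dc_suc (oκ.mem h3) (oκ.mem h1), h2, h4]
        refine (fn_snc ht.1).ext hs.1 fun x hx => ?_
        rcases mem_suc.1 hx with hx | rfl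
        · rw [snc_app ht.1 hx, app_lam d hx]
        · rw [snc_last ht.1]
      · rw [dc_suc (oκ.mem h3) (oκ.mem h1), h2', ← hj ξ h3, h4]
        refine (fn_snc (fn_jc ht.1)).ext (fn_jc hs.1) fun x hx => ?_
        rw [jc_app hs.1 hx]
        rcases mem_suc.1 hx with hx | rfl
        · rw [snc_app (fn_jc ht.1) hx, jc_app ht.1 hx, app_lam d hx]
        · rw [snc_last (fn_jc ht.1)])
  obtain ⟨l, h1, h2⟩ := mem_FS.1 hs
  exact key l h1 s h2
theorem dc_eq {κ m b ξ η : M} (hk : Cd κ) (hw : om ⊆ κ) (hb : Sur b κ m) (h1 : ξ ∈ κ) (h2 : η ∈ κ) : p (suc η) (p (suc ξ) (p emp emp)) ∈ κ ∧ dc b (p (suc η) (p (suc ξ) (p emp emp))) = s2 (app b ξ) (app b η) := by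
  have h0 : (emp : M) ∈ κ := hw _ emp_om
  have oκ := hk.ord
  have a1 := p_cd hk hw h0 h0
  have a2 := p_cd hk hw ((hk.lim hw).suc h1) a1
  refine ⟨p_cd hk hw ((hk.lim hw).suc h2) a2, ?_⟩
  rw [dc_suc (oκ.mem h2) (oκ.mem a2), dc_suc (oκ.mem h1) (oκ.mem a1), dc_emp ord_emp]; rfl
end
end Paper
namespace Paper
section
variable {M : Type} [ZFM M] {G : Type} [Ctx M G] {c : Calc M} {n : ℕ}

def Gdd (L l m K k N j k' : M) : Prop := (Tr N ∧ L ⊆ N ∧ FnTo j m N) ∧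
  (ball om fun c => ball (FS m) fun s => s ∈ Sa m c ↔ jc j s ∈ Sa N c) ∧
  (ball k fun α => app j α = α) ∧ (app j k = k' ∧ l ∈ k' ∧ Ord k') ∧
  ball K fun C => ball (FS L) fun s => dm s = u0 C → (s ∈ Sa L (u1 C) ↔ s ∈ Sa (Vr N k') (u1 C))
@[fun_prop] theorem DP.Gdd (f1 f2 f3 f4 f5 f6 f7 f8 : G → M) (h1 : DF c f1) (h2 : DF c f2) (h3 : DF c f3) (h4 : DF c f4) (h5 : DF c f5) (h6 : DF c f6) (h7 : DF c f7) (h8 : DF c f8) :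
    DP c (fun x => Gdd (f1 x) (f2 x) (f3 x) (f4 x) (f5 x) (f6 x) (f7 x) (f8 x)) := by
  unfold Paper.Gdd
  refine DP.and _ _ (by fun_prop) (DP.and _ _ (by fun_prop) (DP.and _ _ (by fun_prop) (DP.and _ _ (by fun_prop) (by fun_prop))))
def Kq (n : ℕ) (C : M) : Prop := ∀ ρ ρ' : M, TV n ρ → TV n ρ' → ρ ∈ ρ' → ball (FS (Vs ρ)) fun s => dm s = u0 C → (s ∈ Sa (Vs ρ) (u1 C) ↔ s ∈ Sa (Vs ρ') (u1 C))
theorem DP.Kq : DP (full : Calc M) (fun C : M => Kq n C) := by unfold Paper.Kq; fun_prop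
noncomputable def Kn (M : Type) [ZFM M] (n : ℕ) : M := sep om (Kq n)
theorem mem_Kn {C : M} : C ∈ Kn M n ↔ C ∈ (om : M) ∧ Kq n C := mem_sep DP.Kq
theorem code_Kn {k : ℕ} {φ : SetFormula k} (h : IsSigma (n+1) φ) : p (num k) (code φ) ∈ Kn M n := by
  refine mem_Kn.2 ⟨p_om (num_om k) (code_om φ), fun ρ ρ' h1 h2 h3 s hs => ?_⟩
  rw [u0_p (ord_num k) (ord_code φ), u1_p (ord_num k) (ord_code φ)]
  intro hd
  obtain ⟨l, hl, hf⟩ := mem_FS.1 hs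
  rw [hf.1.dm] at hd; subst hd
  rw [eq_sq hf] at hs ⊢
  have h4 := sq_FS.1 hs
  have h5 : ∀ i : Fin k, app s (num i) ∈ Vs ρ' := fun i => Vs_mono' h1.ord h2.ord (h2.ord.sub h3) _ (h4 i)
  rw [sat_iff φ _ h4, sat_iff φ _ h5, cn_abs (cn_iff.2 h1) h h4, cn_abs (cn_iff.2 h2) h h5]

theorem su_of_gdd {lam m κ N j κ' : M} (hl : TV n lam) (h : Gdd (Vs lam) lam m (Kn M n) κ N j κ') (hκ : κ ∈ m) (hm : κ ⊆ m) :
    TransE ZFM.E N ∧ (∀ x, VMemE ZFM.E x lam → ZFM.E x N) ∧ IsFuncE ZFM.E j m N ∧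
        (∀ ⦃k : ℕ⦄ (φ : SetFormula k) (v w : Fin k → M), (∀ i, ZFM.E (v i) m) →
          (∀ i, PairMemE ZFM.E j (v i) (w i)) →
          (RealizeIn ZFM.E (fun x => ZFM.E x m) φ v ↔ RealizeIn ZFM.E (fun x => ZFM.E x N) φ w)) ∧
        (∀ α, ZFM.E α κ → PairMemE ZFM.E j α α) ∧ PairMemE ZFM.E j κ κ' ∧ ZFM.E lam κ' ∧
        SigmaElemPairE ZFM.E (n+1) (fun x => VMemE ZFM.E x lam) fun x => ZFM.E x N ∧ VMemE ZFM.E x κ' := by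
  obtain ⟨⟨h1, h2, h3⟩, h4, h5, ⟨h6, h7, h8⟩, h9⟩ := h
  have e1 : (fun x => VMemE ZFM.E x lam) = fun x => x ∈ Vs lam := funext fun x => by rw [vMemE_iff]; simp [hl.ord]
  have e2 : (fun x => ZFM.E x N ∧ VMemE ZFM.E x κ') = fun x => x ∈ Vr N κ' := funext fun x => by
    rw [vMemE_iff, Vr, mem_sep (by fun_prop), mem_Vs h8]; simp [h8, mem_def]
  refine ⟨transE_iff.2 h1, fun x hx => h2 x ((vMemE_iff.1 hx).2), isFuncE_iff.2 h3, fun k φ v w hv hw => ?_, fun α hα => ?_, ?_, h7, ?_⟩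
  · have e3 : sq w = jc j (sq v) := by
      refine (fn_sq w).ext (fn_jc (fn_sq v)) fun x hx => ?_
      obtain ⟨i, rfl⟩ := mem_num.1 hx
      rw [jc_app (fn_sq v) hx, app_sq, app_sq]
      exact (h3.1.pair_mem.1 (pairMemE_iff.1 (hw i))).2
    have := @realizeIn_sat M _ m k φ v
    have h' := @realizeIn_sat M _ N k φ w
    refine this.trans (Iff.trans ?_ h'.symm)
    rw [e3]
    exact h4 (code φ) (code_om φ) (sq v) (sq_FS.2 hv)
  · exact pairMemE_iff.2 (h3.1.pair_mem.2 ⟨hm α hα, (h5 α hα).symm⟩)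
  · exact pairMemE_iff.2 (h3.1.pair_mem.2 ⟨hκ, h6.symm⟩)
  · rw [e1, e2]
    refine ⟨fun x hx => ?_, fun k φ hφ v hv => ?_⟩
    · show x ∈ Vr N κ'
      rw [Vr, mem_sep (by fun_prop)]
      exact ⟨h2 x hx, h8.trans h7 ((mem_Vs hl.ord).1 hx)⟩
    · rw [realizeIn_sat, realizeIn_sat]
      have := h9 _ (code_Kn hφ) (sq v) (sq_FS.2 hv)
      rw [u0_p (ord_num k) (ord_code φ), u1_p (ord_num k) (ord_code φ)] at this
      exact this (fn_sq v).dm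

def PA (v e x y w k : M) : Prop := bex e fun l => bex v fun m => bex v fun b => (k ∈ l ∧ Sur b k m) ∧
  ((ball k fun α => app b (p (num 1) α) = α) ∧ app b (p (num 0) emp) = k) ∧
  (ball om fun c => ball k fun σ => p c σ ∈ x ↔ dc b σ ∈ Sa m c) ∧
  ¬ bex v fun N => bex v fun j => bex v fun k' => Gdd (Vr v l) l m y k N j k'
theorem PA_dp : DP c (fun q : ((((M × M) × M) × M) × M) × M => PA q.1.1.1.1.1 q.1.1.1.1.2 q.1.1.1.2 q.1.1.2 q.1.2 q.2) := by
  unfold PA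
  refine DP.bex _ _ (by fun_prop) (DP.bex _ _ (by fun_prop) (DP.bex _ _ (by fun_prop) (DP.and _ _ (DP.and _ _ (by fun_prop) (by unfold Sur; fun_prop)) (DP.and _ _ (by fun_prop) (DP.and _ _ (by fun_prop) (by fun_prop))))))

theorem u1_ord (g : M) : Ord (u1 g) := ord_sU fun x hx => by
  obtain ⟨-, b, hb, -, h, -⟩ := (mem_sep (by fun_prop)).1 hx; exact h
theorem u1_le {g : M} (hg : Ord g) : u1 g ⊆ g := fun z hz => by
  obtain ⟨x, hx, hz'⟩ := mem_sU.1 hz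
  rcases mem_suc.1 ((mem_sep (by fun_prop)).1 hx).1 with h | h
  · exact hg.trans h hz'
  · rwa [h] at hz'
theorem thmA1 {κ l₀ m : M} (h : WS n κ (fun θ => θ ∈ κ)) (hl : TV n l₀) (hkl : κ ∈ l₀) (ht : Tr m) (hz : ZFMinusModelE ZFM.E m)
    (hc : EqC κ m) (hkm : κ ∈ m) (hs : SmallSeqClosedE ZFM.E m κ) : ∃ N j κ', Gdd (Vs l₀) l₀ m (Kn M n) κ N j κ' := by
  by_contra hno
  have hk := h.cd
  have oκ := hk.ord
  have hw := h.om_le h.hB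
  have htv := h.tv
  have hVm := Vs_sub_m ht hz htv hkm hs
  have h0 : (emp : M) ∈ κ := hw _ emp_om
  obtain ⟨b0, hb0⟩ := hc
  -- the good surjection
  obtain ⟨b, hb, hb1, hb2⟩ : ∃ b, Sur b κ m ∧ (∀ α, α ∈ κ → app b (p (num 1) α) = α) ∧ app b (p (num 0) emp) = κ := by
    classical
    let F : M → M := fun ζ => if u0 ζ = num 1 then u1 ζ else if u0 ζ = num 0 then κ else app b0 (u1 ζ)
    have dF : DF full F := by unfold F; fun_prop
    have F1 : ∀ α, Ord α → F (p (num 1) α) = α := fun α hα => by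
      unfold F; rw [u0_p (ord_num 1) hα, if_pos rfl, u1_p (ord_num 1) hα]
    have F2 : ∀ α, Ord α → F (p (num 0) α) = κ := fun α hα => by
      unfold F; rw [u0_p (ord_num 0) hα, if_neg (num_ne (by decide)), if_pos rfl]
    have F3 : ∀ a α, Ord a → a ≠ num 1 → a ≠ num 0 → Ord α → F (p a α) = app b0 α := fun a α ha h1 h2 hα => by
      unfold F; rw [u0_p ha hα, if_neg h1, if_neg h2, u1_p ha hα]
    have hn : ∀ i α, α ∈ κ → p (num i) α ∈ κ := fun i α hα => p_cd hk hw (hw _ (num_om i)) hα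
    refine ⟨lam κ F, ⟨fnTo_lam dF fun ζ hζ => ?_, fun y hy => ?_⟩, fun α hα => ?_, ?_⟩
    · have hακ : u1 ζ ∈ κ := (u1_ord ζ).lt_of_le_of_lt oκ (u1_le (oκ.mem hζ)) hζ
      unfold F
      split_ifs
      · exact ht.mem hkm hακ
      · exact hkm
      · exact hb0.2.mem hακ
    · obtain ⟨ξ, h1, h2⟩ := hb0.2.sur hy
      refine ⟨p (num 2) ξ, hn 2 ξ h1, ?_⟩
      beta_reduce
      rw [app_lam dF (hn 2 ξ h1), F3 _ _ (ord_num 2) (num_ne (by decide)) (num_ne (by decide)) (oκ.mem h1), h2]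
    · rw [app_lam dF (hn 1 α hα), F1 α (oκ.mem hα)]
    · rw [app_lam dF (hn 0 _ h0), F2 _ ord_emp]
  let x := sep κ fun ζ => dc b (u1 ζ) ∈ Sa m (u0 ζ)
  have hx : ∀ c, c ∈ (om : M) → ∀ σ, σ ∈ κ → (p c σ ∈ x ↔ dc b σ ∈ Sa m c) := fun c hc σ hσ => by
    unfold x
    rw [mem_sep (by fun_prop), u0_p (ord_om.mem hc) (oκ.mem hσ), u1_p (ord_om.mem hc) (oκ.mem hσ)]
    exact ⟨fun h => h.2, fun h => ⟨p_cd hk hw (hw _ hc) hσ, h⟩⟩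
  have hKκ : Kn M n ⊆ κ := fun z hz => hw _ (mem_Kn.1 hz).1
  obtain ⟨θ, h1, h2⟩ := cc_above n (up (up l₀ m) b)
  have tθ := tr_Vs h1.ord
  have hlm := tθ.mem h2 (mem_up.2 (.inl rfl))
  have hlV := tθ.mem hlm (mem_up.2 (.inl rfl))
  have hlθ := (ord_mem_Vs h1.ord hl.ord).1 hlV
  obtain ⟨κ', θ', a1, a2, a3, a4, a5, a6, l', a7, m', a8, b', a9, ⟨a10, a11⟩, ⟨a12, a13⟩, a14, a15⟩ := h.refl3 h.hB (P := PA) PA_dp.1 h1 (h1.ord.trans hlθ hkl) (x := x) (y := Kn M n) (w := emp) (fun z hz => ((mem_sep (by fun_prop)).1 hz).1) hKκ (emp_sub κ)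
    ⟨l₀, mem_eC.2 ⟨hlV, hl⟩, m, tθ.mem hlm (mem_up.2 (.inr rfl)), b, tθ.mem h2 (mem_up.2 (.inr rfl)), ⟨hkl, hb⟩, ⟨hb1, hb2⟩, hx, by
      rintro ⟨N, -, j, -, k', -, h3⟩
      rw [Vr_eq h1.ord hl.ord (h1.ord.sub hlθ)] at h3
      exact hno ⟨N, j, k', h3⟩⟩
  obtain ⟨c1, c2⟩ := mem_eC.1 a7
  have c3 := (ord_mem_Vs a2.ord c2.ord).1 c1
  have c4 : l' ∈ κ := oκ.trans a5 c3
  have ok' := a1.ord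
  have hsub : ∀ z, z ∈ κ' → z ∈ κ := fun z hz => oκ.trans a4 hz
  rw [cap_eq (show Kn M n ⊆ κ' from fun z hz => a6 _ (mem_Kn.1 hz).1), Vr_eq a2.ord c2.ord (a2.ord.sub c3)] at a15
  have hx' : ∀ c, c ∈ (om : M) → ∀ σ, σ ∈ κ' → (dc b' σ ∈ Sa m' c ↔ dc b σ ∈ Sa m c) := fun c hc σ hσ => by
    rw [← hx c hc σ (hsub σ hσ), ← (show p c σ ∈ cap x κ' ↔ _ from a14 c hc σ hσ), mem_cap]
    exact ⟨fun h => h.1, fun h => ⟨h, p_cd a1 a6 (a6 _ hc) hσ⟩⟩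
  have heq : ∀ ξ η, ξ ∈ κ' → η ∈ κ' → app b' ξ = app b' η → app b ξ = app b η := fun ξ η h3 h4 h5 => by
    obtain ⟨d1, d2⟩ := dc_eq a1 a6 a11 h3 h4
    obtain ⟨-, d3⟩ := dc_eq hk hw hb (hsub _ h3) (hsub _ h4)
    have := hx' _ (code_om (.eq 0 1 : SetFormula 2)) _ d1
    rw [d2, d3, s2_sq, s2_sq, sat_iff _ _ (Fin.forall_fin_two.2 ⟨a11.mem h3, a11.mem h4⟩), sat_iff _ _ (Fin.forall_fin_two.2 ⟨hb.mem (hsub _ h3), hb.mem (hsub _ h4)⟩)] at this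
    exact this.1 h5
  let F : M → M := fun y => app b (mu fun ξ => ξ ∈ κ' ∧ app b' ξ = y)
  have dF : DF full F := by unfold F; fun_prop
  let j := lam m' F
  have hj : ∀ ξ, ξ ∈ κ' → app j (app b' ξ) = app b ξ := fun ξ hξ => by
    unfold j
    rw [app_lam dF (a11.mem hξ)]
    obtain ⟨d1, ⟨d2, d3⟩, -⟩ := mu_spec (P := fun ξ' => ξ' ∈ κ' ∧ app b' ξ' = app b' ξ) (by fun_prop) ⟨ξ, ok'.mem hξ, hξ, rfl⟩
    exact heq _ _ d2 hξ d3
  have hjN : FnTo j m' m := ⟨fn_lam _ dF, fun y hy => by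
    obtain ⟨ξ, d1, rfl⟩ := a11.sur hy
    beta_reduce
    rw [hj ξ d1]; exact hb.mem (hsub _ d1)⟩
  have hnk : ∀ i α, α ∈ κ' → p (num i) α ∈ κ' := fun i α hα => p_cd a1 a6 (a6 _ (num_om i)) hα
  have good : Gdd (Vs l') l' m' (Kn M n) κ' m j κ := by
    refine ⟨⟨ht, Sub.trans (Vs_mono' c2.ord oκ (oκ.sub c4)) hVm, hjN⟩, fun c hc s hs => ?_, fun α hα => ?_, ⟨?_, c4, oκ⟩, fun C hC s hs hd => ?_⟩
    · obtain ⟨σ, d1, d2, d3⟩ := dc_sur a1 a6 a11 hj hs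
      have := hx' c hc σ d1
      rwa [d2, d3] at this
    · have := hj _ (hnk 1 α hα)
      rwa [a12 α hα, hb1 α (hsub α hα)] at this
    · have := hj _ (hnk 0 emp (a6 _ emp_om))
      rwa [a13, hb2] at this
    · have e : Vr m κ = Vs κ := ext fun z => by
        rw [Vr, mem_sep (by fun_prop), mem_Vs oκ]
        exact ⟨fun h => h.2, fun h => ⟨hVm z ((mem_Vs oκ).2 h), h⟩⟩
      rw [e]
      exact (mem_Kn.1 hC).2 l' κ c2 htv c4 s hs hd
  have hVθ : Vs l' ∈ Vs θ' := Vs_mem a2.ord c3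
  have hK : Kn M n ∈ Vs θ' := by
    refine (mem_Vs a2.ord).2 (Ord.lt_of_le_of_lt (ord_rank _) a2.ord (b := om) ?_ a2.1.om)
    have := rank_mono (show Kn M n ⊆ om from fun z hz => (mem_Kn.1 hz).1)
    rwa [rank_ord ord_om] at this
  have key := cn_exG (n := n) (m := 0) (cn_iff.2 a2.1) (Nat.zero_le n) (G := (((M × M) × M) × M) × M) (g := ((((Vs l', l'), m'), Kn M n), κ'))
    (P := fun g q => ∃ N j k', q = pair (pair N j) k' ∧ Gdd g.1.1.1.1 g.1.1.1.2 g.1.1.2 g.1.2 g.2 N j k') ?_ ?_ ⟨_, m, j, κ, rfl, good⟩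
  · obtain ⟨q, e1, N, j', k', rfl, e2⟩ := key
    have tV := tr_Vs a2.ord
    have hp : ∀ y z : M, pair y z ∈ Vs θ' → y ∈ Vs θ' ∧ z ∈ Vs θ' := fun y z h => by
      have h1 := tV.mem h (show up y z ∈ pair y z by rw [pair, mem_up]; exact .inr rfl)
      exact ⟨tV.mem h1 (mem_up.2 (.inl rfl)), tV.mem h1 (mem_up.2 (.inr rfl))⟩
    obtain ⟨e3, e4⟩ := hp _ _ e1
    obtain ⟨e5, e6⟩ := hp _ _ e3
    exact a15 ⟨N, e5, j', e6, k', e4, e2⟩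
  · refine SQ.ex (SQ.ex (SQ.ex ?_))
    exact (DP.and _ _ (by fun_prop) (by fun_prop)).1
  · intro i
    fin_cases i
    · exact hVθ
    · exact c1
    · exact a8
    · exact hK
    · exact (ord_mem_Vs a2.ord ok').2 a3
theorem thmA {κ : M} (h : WS n κ (fun θ => θ ∈ κ)) : CnStronglyUnfoldableE ZFM.E (n+1) κ := by
  refine ⟨h.inacc, fun lam hl hkl m ht hz hc hkm hs => ?_⟩
  obtain ⟨f, hf⟩ := hc
  have ht' := transE_iff.1 ht
  obtain ⟨N, j, κ', h1⟩ := thmA1 h (cn_iff.1 hl) hkl ht' hz ⟨f, bijE_iff.1 hf⟩ hkm hs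
  exact ⟨N, j, κ', su_of_gdd (cn_iff.1 hl) h1 hkm (fun z hz => ht'.mem hkm hz)⟩
end
end Paper
namespace Paper
section
variable {M : Type} [ZFM M] {G : Type} [Ctx M G] {c : Calc M} {n : ℕ}

theorem ch {g X : M} (hg : ∀ s, s ⊆ X → (∃ z, z ∈ s) → app g s ∈ s) {P : M → Prop} (d : DP full P) (h : ∃ z, z ∈ X ∧ P z) :
    app g (sep X P) ∈ X ∧ P (app g (sep X P)) := by
  obtain ⟨z, h1, h2⟩ := h
  exact (mem_sep d).1 (hg _ (fun z hz => ((mem_sep d).1 hz).1) ⟨z, (mem_sep d).2 ⟨h1, h2⟩⟩)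
theorem leC_sU {A ζ τ : M} (oζ : Ord ζ) (hp : ∀ a b, a ∈ ζ → b ∈ ζ → p a b ∈ τ) (hA : LeC A ζ) (h : ∀ a, a ∈ A → LeC a ζ) :
    LeC (sU A) τ := by
  obtain ⟨i, hi⟩ := hA
  obtain ⟨B, hB⟩ := collection (P := fun a f : M => Inj f a ζ) (by fun_prop) A
  obtain ⟨g, hg⟩ := choice_fn B
  obtain ⟨g2, hg2⟩ := choice_fn A
  have h1 : ∀ a, a ∈ A → Inj (app g (sep B fun f => Inj f a ζ)) a ζ := fun a ha => by
    exact (ch hg (P := fun f => Inj f a ζ) (by fun_prop) (hB a ha (h a ha))).2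
  have h2 : ∀ z, z ∈ sU A → app g2 (sep A fun a => z ∈ a) ∈ A ∧ z ∈ app g2 (sep A fun a => z ∈ a) := fun z hz => by
    exact ch hg2 (P := fun a => z ∈ a) (by fun_prop) (mem_sU.1 hz)
  refine leC_of (fun z => p (app i (app g2 (sep A fun a => z ∈ a))) (app (app g (sep B fun f => Inj f (app g2 (sep A fun a => z ∈ a)) ζ)) z)) (by fun_prop) (fun z hz => ?_) fun z hz w hw e => ?_
  · obtain ⟨a1, a2⟩ := h2 z hz
    exact hp _ _ (hi.mem a1) ((h1 _ a1).mem a2)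
  · obtain ⟨a1, a2⟩ := h2 z hz
    obtain ⟨b1, b2⟩ := h2 w hw
    beta_reduce at e
    obtain ⟨e1, e2⟩ := p_inj (oζ.mem (hi.mem a1)) (oζ.mem ((h1 _ a1).mem a2)) (oζ.mem (hi.mem b1)) (oζ.mem ((h1 _ b1).mem b2)) e
    have e3 := hi.inj a1 b1 e1
    rw [← e3] at e2 b2
    exact (h1 _ a1).inj a2 b2 e2

theorem leC_pow {a b : M} (h : LeC a b) : LeC (pow a) (pow b) := by
  obtain ⟨f, hf⟩ := h
  refine leC_of (fun x => img x (app f)) (by fun_prop) (fun x hx => mem_pow.2 fun z hz => ?_) fun x hx y hy e => ?_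
  · obtain ⟨w, w1, rfl⟩ := (mem_img (by fun_prop)).1 hz
    exact hf.mem (mem_pow.1 hx _ w1)
  · have key : ∀ x y, x ⊆ a → y ⊆ a → img x (app f) = img y (app f) → x ⊆ y := fun x y hx hy e z hz => by
      have : app f z ∈ img y (app f) := e ▸ (mem_img (by fun_prop)).2 ⟨z, hz, rfl⟩
      obtain ⟨w, w1, w2⟩ := (mem_img (by fun_prop)).1 this
      rwa [hf.inj (hx z hz) (hy w w1) w2]
    exact Sub.antisymm (key _ _ (mem_pow.1 hx) (mem_pow.1 hy) e) (key _ _ (mem_pow.1 hy) (mem_pow.1 hx) e.symm)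

theorem leC_img {F : M → M} (d : DF full F) (a : M) : LeC (img a F) a :=
  leC_of_sur (sur_lam d (fun x hx => (mem_img d).2 ⟨x, hx, rfl⟩) fun y hy => by
    obtain ⟨x, h1, h2⟩ := (mem_img d).1 hy; exact ⟨x, h1, h2.symm⟩)

section Ina
variable {κ : M} (hk : Cd κ) (hw : om ∈ κ) (hr : Reg κ) (hs : SLim κ)

theorem reg_fn {w : M} (hr : Reg κ) {γ : M} (hγ : γ ∈ κ) (hl : LeC w γ) {F : M → M} (d : DF full F) (h0 : ∃ z, z ∈ κ) (h : ∀ y, y ∈ w → F y ∈ κ) :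
    ∃ β, β ∈ κ ∧ ∀ y, y ∈ w → F y ∈ β := by
  by_cases hne : ∃ y, y ∈ w
  · obtain ⟨s, hs⟩ := hl.sur hne
    obtain ⟨β, b1, b2⟩ := hr γ (lam γ fun x => F (app s x)) hγ (fnTo_lam (DF.comp F (app s) d (by fun_prop)) fun x hx => h _ (hs.mem hx))
    refine ⟨β, b1, fun y hy => ?_⟩
    obtain ⟨x, x1, rfl⟩ := hs.sur hy
    have := b2 x x1
    rwa [app_lam (DF.comp F (app s) d (by fun_prop)) x1] at this
  · obtain ⟨z, hz⟩ := h0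
    exact ⟨z, hz, fun y hy => absurd ⟨y, hy⟩ hne⟩

theorem om_sub (hk : Cd κ) (hw : om ∈ κ) : om ⊆ κ := hk.ord.sub hw

theorem Vs_small (hk : Cd κ) (hw : om ∈ κ) (hr : Reg κ) (hs : SLim κ) {α : M} (hα : α ∈ κ) : ∃ β, β ∈ κ ∧ LeC (Vs α) β := by
  have o := hk.ord
  have : α ∈ κ → ∃ β, β ∈ κ ∧ LeC (Vs α) β := by
    refine ord_ind (P := fun α => α ∈ κ → ∃ β, β ∈ κ ∧ LeC (Vs α) β) (by fun_prop) (fun α oα ih hα => ?_) α (o.mem hα)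
    have h1 : ∀ y, y ∈ α → ∃ β, β ∈ κ ∧ LeC (pow (Vs y)) β := fun y hy => by
      obtain ⟨β, b1, b2⟩ := ih y hy (o.trans hα hy)
      obtain ⟨β', c1, c2⟩ := hs β b1
      exact ⟨β', c1, (leC_pow b2).trans c2⟩
    have d : DF full (fun y : M => mu fun β => LeC (pow (Vs y)) β) := by fun_prop
    obtain ⟨β, b1, b2⟩ := reg_fn hr hα (LeC.refl α) d ⟨_, hw⟩ fun y hy => by
      obtain ⟨β, b1, b2⟩ := h1 y hy
      exact ord_mu.lt_of_le_of_lt o (mu_le (P := fun β => LeC (pow (Vs y)) β) (by fun_prop) (o.mem b1) b2) b1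
    have oβ := o.mem b1
    have hζ : cup α β ∈ κ := by
      rcases oα.lt_or_le oβ with h | h
      · rwa [show cup α β = β from ext fun z => by rw [mem_cup]; exact ⟨fun h' => h'.elim (oβ.trans h) id, .inr⟩]
      · rwa [show cup α β = α from ext fun z => by rw [mem_cup]; exact ⟨fun h' => h'.elim id (h z), .inl⟩]
    have oζ := o.mem hζ
    refine ⟨p (cup α β) (cup α β), p_cd hk (om_sub hk hw) hζ hζ, ?_⟩
    rw [Vs_eq]
    refine leC_sU oζ (fun a b ha hb => ((ord_p oζ oζ).trans (p_mono_l oζ oζ ha) (p_mono_r (oζ.mem ha) oζ hb))) ((leC_img (by fun_prop) _).trans (leC_sub fun z hz => mem_cup.2 (.inl hz))) fun a ha => ?_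
    obtain ⟨y, hy, rfl⟩ := (mem_img (by fun_prop)).1 ha
    obtain ⟨β', c1, c2⟩ := h1 y hy
    have := (mu_spec (P := fun β => LeC (pow (Vs y)) β) (by fun_prop) ⟨β', o.mem c1, c2⟩).2.1
    exact this.trans (leC_sub fun z hz => mem_cup.2 (.inr (oβ.trans (b2 y hy) hz)))
  exact this hα

theorem Vs_mem_small (hk : Cd κ) (hw : om ∈ κ) (hr : Reg κ) (hs : SLim κ) {x : M} (hx : x ∈ Vs κ) : ∃ β, β ∈ κ ∧ LeC x β := by
  obtain ⟨b, b1, b2⟩ := mem_Vs'.1 hx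
  obtain ⟨β, c1, c2⟩ := Vs_small hk hw hr hs b1
  exact ⟨β, c1, (leC_sub b2).trans c2⟩

theorem Vs_img (hk : Cd κ) (hw : om ∈ κ) (hr : Reg κ) (hs : SLim κ) {w : M} (hx : w ∈ Vs κ) {F : M → M} (d : DF full F) (h : ∀ y, y ∈ w → F y ∈ Vs κ) : img w F ∈ Vs κ := by
  obtain ⟨γ, b1, b2⟩ := Vs_mem_small hk hw hr hs hx
  obtain ⟨β, c1, c2⟩ := reg_fn hr b1 b2 (F := fun y => rank (F y)) (DF.comp rank F (by fun_prop) d) ⟨_, hw⟩ fun y hy => (mem_Vs hk.ord).1 (h y hy)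
  refine Vs_bd (hk.lim (om_sub hk hw)) c1 fun y hy => ?_
  obtain ⟨z, hz, rfl⟩ := (mem_img d).1 hy
  exact c2 z hz

theorem Vs_leC (hk : Cd κ) (hw : om ∈ κ) (hr : Reg κ) (hs : SLim κ) : LeC (Vs κ) κ := by
  have o := hk.ord
  rw [Vs_eq]
  refine leC_sU o (fun a b => p_cd hk (om_sub hk hw)) (leC_img (by fun_prop) _) fun a ha => ?_
  obtain ⟨y, hy, rfl⟩ := (mem_img (by fun_prop)).1 ha
  obtain ⟨β, c1, c2⟩ := Vs_small hk hw hr hs ((hk.lim (om_sub hk hw)).suc hy)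
  exact (leC_sub fun z hz => mem_Vs'.2 ⟨y, self_mem_suc y, mem_pow.1 hz⟩).trans (c2.trans (leC_sub (o.sub c1)))

/-- the set of all sets hereditarily of cardinality at most `κ` -/
theorem ex_H (hk : Cd κ) (hw : om ⊆ κ) : ∃ H : M, Tr H ∧ (∀ y, y ∈ H → LeC y κ) ∧ ∀ x, x ⊆ H → LeC x κ → x ∈ H := by
  obtain ⟨b, b1, b2⟩ := next_cd κ
  obtain ⟨μ, oμ, m1, m2⟩ := ord_min (P := fun a : M => ¬ LeC a κ) (by fun_prop) ⟨b, b1.ord, b2⟩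
  have d : DP full (fun x : M => LeC x κ ∧ ball (trcl x) fun y => LeC y κ) := by fun_prop
  refine ⟨sep (Vs μ) fun x => LeC x κ ∧ ball (trcl x) fun y => LeC y κ, fun x hx y hy => ?_, fun y hy => ((mem_sep d).1 hy).2.1, fun x hx hl => ?_⟩
  · obtain ⟨h1, h2, h3⟩ := (mem_sep d).1 hx
    exact (mem_sep d).2 ⟨(tr_Vs oμ).mem h1 hy, h3 y (sub_trcl x _ hy), fun z hz => h3 z (mem_trcl.2 (.inr ⟨y, hy, hz⟩))⟩
  · have hx' := fun y hy => (mem_sep d).1 (hx y hy)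
    refine (mem_sep d).2 ⟨(mem_Vs oμ).2 ?_, hl, fun z hz => ?_⟩
    · rcases (ord_rank x).lt_or_le oμ with h | h
      · exact h
      · exfalso
        refine m1 ((leC_sub h).trans ?_)
        rw [rank_eq]
        refine leC_sU hk.ord (fun a b => p_cd hk hw) ((leC_img (by fun_prop) _).trans hl) fun a ha => ?_
        obtain ⟨y, hy, rfl⟩ := (mem_img (by fun_prop)).1 ha
        have h1 : LeC (rank y) κ := not_not.1 (m2 _ ((mem_Vs oμ).1 (hx' y hy).1))
        have e : suc (rank y) = sU (up (rank y) (sing (rank y))) := ext fun z => by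
          rw [mem_suc, mem_sU]
          constructor
          · rintro (h | rfl)
            · exact ⟨_, mem_up.2 (.inl rfl), h⟩
            · exact ⟨_, mem_up.2 (.inr rfl), mem_sing.2 rfl⟩
          · rintro ⟨y, hy, hz⟩
            rcases mem_up.1 hy with rfl | rfl
            · exact .inl hz
            · exact .inr (mem_sing.1 hz)
        have h0 : (emp : M) ∈ κ := hw _ emp_om
        have h01 : (suc emp : M) ∈ κ := hw _ (suc_om emp_om)
        rw [e]
        refine leC_sU hk.ord (fun a b => p_cd hk hw) ?_ fun a ha => ?_
        · classical
          refine leC_of (fun z => if z = rank y then emp else suc emp) (by fun_prop) (fun z hz => ?_) fun z hz w hw' e => ?_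
          · beta_reduce; split_ifs <;> assumption
          · have ne : (emp : M) ≠ suc emp := fun h => mem_irrefl (emp : M) (by have := self_mem_suc (emp : M); rwa [← h] at this)
            beta_reduce at e
            rcases mem_up.1 hz with rfl | rfl <;> rcases mem_up.1 hw' with rfl | rfl
            · rfl
            · rw [if_pos rfl] at e; split_ifs at e with h
              · exact h.symm
              · exact absurd e ne
            · rw [if_pos rfl] at e; split_ifs at e with h
              · exact h
              · exact absurd e.symm ne
            · rfl
        · rcases mem_up.1 ha with rfl | rfl
          · exact h1
          · exact leC_of (fun _ => emp) (by fun_prop) (fun _ _ => h0) fun x hx y hy _ => by rw [mem_sing.1 hx, mem_sing.1 hy]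
    · rcases mem_trcl.1 hz with h | ⟨y, hy, h⟩
      · exact (hx' z h).2.1
      · exact (hx' y hy).2.2 z h
end Ina
end
end Paper
namespace Paper
section
variable {M : Type} [ZFM M] {G : Type} [Ctx M G] {c : Calc M} {n : ℕ}

noncomputable def sk (H g c s : M) : M := app g (sep H fun z => snc s z ∈ Sa H c)
@[fun_prop] theorem DF.sk (f1 f2 f3 f4 : G → M) (h1 : DF c f1) (h2 : DF c f2) (h3 : DF c f3) (h4 : DF c f4) :
    DF c (fun x => sk (f1 x) (f2 x) (f3 x) (f4 x)) := by unfold Paper.sk; fun_prop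
noncomputable def skS (H g a c s : M) : M := img (sep a fun x => bex H fun z => snc (snc s x) z ∈ Sa H c) fun x => sk H g c (snc s x)
@[fun_prop] theorem DF.skS (f1 f2 f3 f4 f5 : G → M) (h1 : DF c f1) (h2 : DF c f2) (h3 : DF c f3) (h4 : DF c f4) (h5 : DF c f5) :
    DF c (fun x => skS (f1 x) (f2 x) (f3 x) (f4 x) (f5 x)) := by unfold Paper.skS; fun_prop
open Classical in
/-- Skolem operations -/
noncomputable def raw (κ H g e u : M) : M :=
  if app u (num 0) = num 1 then κ else if app u (num 0) = num 2 then sU (app u (num 1)) else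
  if app u (num 0) = num 3 then app (app e (app (app u (num 1)) (num 0))) (app (app u (num 1)) (num 1)) else
  if app u (num 0) = num 4 then skS H g (app (app u (num 1)) (num 0)) (app (app (app u (num 1)) (num 1)) (num 0)) (app (app (app u (num 1)) (num 1)) (num 1)) else
  if app u (num 0) = num 5 then sk H g (app (app u (num 1)) (num 0)) (app (app u (num 1)) (num 1)) else emp
@[fun_prop] theorem DF.raw (f1 f2 f3 f4 f5 : G → M) (h1 : DF c f1) (h2 : DF c f2) (h3 : DF c f3) (h4 : DF c f4) (h5 : DF c f5) :
    DF c (fun x => raw (f1 x) (f2 x) (f3 x) (f4 x) (f5 x)) := by unfold Paper.raw; fun_prop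
open Classical in
noncomputable def opr (κ H g e u : M) : M := if raw κ H g e u ∈ H then raw κ H g e u else emp
@[fun_prop] theorem DF.opr (f1 f2 f3 f4 f5 : G → M) (h1 : DF c f1) (h2 : DF c f2) (h3 : DF c f3) (h4 : DF c f4) (h5 : DF c f5) :
    DF c (fun x => opr (f1 x) (f2 x) (f3 x) (f4 x) (f5 x)) := by unfold Paper.opr; fun_prop
open Classical in
/-- evaluation of names -/
noncomputable def ev (κ H g e : M) : M → M := recF fun x f =>
  if emp ∈ x then opr κ H g e (sU (img x fun y => app f y)) else img x fun y => app f y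
theorem ev_df {κ H g e : M} : DF full (ev κ H g e) := by unfold ev; fun_prop
@[fun_prop] theorem DF.ev (κ H g e : M) (f : G → M) (h : DF full f) : DF full (fun x => ev κ H g e (f x)) := DF.comp _ _ ev_df h
open Classical in
theorem ev_eq (κ H g e x : M) : ev κ H g e x = if emp ∈ x then opr κ H g e (sU (img x (ev κ H g e))) else img x (ev κ H g e) := by
  have : (img x fun y => app (lam x (ev κ H g e)) y) = img x (ev κ H g e) := img_congr (by fun_prop) ev_df fun y hy => app_lam ev_df hy
  conv_lhs => rw [ev, recF_spec (by unfold DF2; fun_prop)]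
  show (if emp ∈ x then opr κ H g e (sU (img x fun y => app (lam x (ev κ H g e)) y)) else img x fun y => app (lam x (ev κ H g e)) y) = _
  rw [this]
theorem app_emp (x : M) : app emp x = emp := ext fun z => by
  refine ⟨fun h => ?_, fun h => absurd h (by simp)⟩
  obtain ⟨y, hy, -⟩ := mem_sU.1 (show z ∈ sU (sep _ _) from h)
  exact absurd ((mem_sep (by fun_prop)).1 hy).2 (by simp)
theorem opr_emp (κ H g e : M) : opr κ H g e emp = emp := by
  have h : ∀ k, (emp : M) = num (k+1) → False := fun k h => num_ne (Nat.succ_ne_zero k).symm h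
  unfold opr raw
  rw [app_emp, if_neg (h 0), if_neg (h 1), if_neg (h 2), if_neg (h 3), if_neg (h 4)]
  split_ifs <;> rfl

section Mod
variable {κ : M} (hk : Cd κ) (hw : om ∈ κ) (hr : Reg κ) (hs : SLim κ)

theorem ex_m (hk : Cd κ) (hw : om ∈ κ) (hr : Reg κ) (hs : SLim κ) : ∃ X H : M, Tr X ∧ Vs κ ⊆ X ∧ κ ∈ X ∧ LeC X κ ∧
    (∀ γ f, γ ∈ κ → FnTo f γ X → f ∈ X) ∧ (∀ a, a ∈ X → ∀ b, b ∈ X → up a b ∈ X) ∧ (∀ a, a ∈ X → sU a ∈ X) ∧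
    (∀ (k : ℕ) (φ : SetFormula k) (v : Fin k → M), (∀ i, v i ∈ X) → (Rl ZFM.E (fun x => x ∈ X) φ v ↔ Rl ZFM.E (fun x => x ∈ H) φ v)) ∧
    (∀ (k : ℕ) (φ : SetFormula (k+2)) (v : Fin k → M) (a : M), (∀ i, v i ∈ X) → a ∈ X →
      ∃ b, b ∈ X ∧ (∀ y, y ∈ b → ∃ x, x ∈ a ∧ Rl ZFM.E (fun x => x ∈ H) φ (Fin.snoc (Fin.snoc v x) y)) ∧
        ∀ x, x ∈ a → (∃ y, y ∈ H ∧ Rl ZFM.E (fun x => x ∈ H) φ (Fin.snoc (Fin.snoc v x) y)) → ∃ y, y ∈ b ∧ Rl ZFM.E (fun x => x ∈ H) φ (Fin.snoc (Fin.snoc v x) y)) := by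
  classical
  have o := hk.ord
  have hwk := om_sub hk hw
  have hl := hk.lim hwk
  obtain ⟨H, tH, H1, H2⟩ := ex_H hk hwk
  obtain ⟨g, hg⟩ := choice_fn H
  obtain ⟨B, hB⟩ := collection (P := fun y f : M => Sur f κ y) (by fun_prop) H
  obtain ⟨g3, hg3⟩ := choice_fn B
  obtain ⟨e, he⟩ : ∃ e : M, ∀ y, y ∈ H → (∃ z, z ∈ y) → Sur (app e y) κ y := by
    refine ⟨lam H fun y => app g3 (sep B fun f => Sur f κ y), fun y hy hne => ?_⟩
    rw [app_lam (by fun_prop) hy]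
    exact (ch hg3 (P := fun f => Sur f κ y) (by fun_prop) (hB y hy ((H1 y hy).sur hne))).2
  have eH : (emp : M) ∈ H := H2 _ (emp_sub _) ((leC_sub (emp_sub κ)))
  let ev := ev κ H g e
  have de : DF full ev := ev_df
  let op := opr κ H g e
  let X := img (Vs κ) ev
  have hX : ∀ a, a ∈ X ↔ ∃ z, z ∈ Vs κ ∧ a = ev z := fun a => mem_img de
  have ev0 : ev emp = emp := by
    show Paper.ev κ H g e emp = _
    rw [ev_eq, if_neg (by simp)]; exact ext fun z => by rw [mem_img de]; simp
  have imgE : ∀ z : M, ev (up emp z) = op (ev z) := fun z => by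
    show Paper.ev κ H g e _ = _
    rw [ev_eq, if_pos (mem_up.2 (.inl rfl))]
    show op _ = op _
    congr 1
    refine ext fun w => ?_
    rw [mem_sU]
    constructor
    · rintro ⟨y, hy, hwy⟩
      obtain ⟨q, hq, rfl⟩ := (mem_img de).1 hy
      rcases mem_up.1 hq with rfl | rfl
      · exact absurd (ev0 ▸ hwy) (by simp)
      · exact hwy
    · exact fun h => ⟨_, (mem_img de).2 ⟨z, mem_up.2 (.inr rfl), rfl⟩, h⟩
  have nmE : ∀ a, a ∈ X → ∃ z, z ∈ Vs κ ∧ z ≠ emp ∧ ev z = a := fun a ha => by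
    obtain ⟨z, h1, rfl⟩ := (hX a).1 ha
    by_cases h : z = emp
    · refine ⟨up emp emp, Vs_up hl (Vs_emp hl) (Vs_emp hl), ne_emp.2 ⟨emp, mem_up.2 (.inl rfl)⟩, ?_⟩
      rw [imgE, h, ev0]; exact opr_emp _ _ _ _
    · exact ⟨z, h1, h, rfl⟩
  have Xop : ∀ a, a ∈ X → op a ∈ X := fun a ha => by
    obtain ⟨z, h1, rfl⟩ := (hX a).1 ha
    exact (hX _).2 ⟨up emp z, Vs_up hl (Vs_emp hl) h1, (imgE z).symm⟩
  obtain ⟨g4, hg4⟩ := choice_fn (Vs κ)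
  have Ximg : ∀ w, w ∈ Vs κ → ∀ F : M → M, DF full F → (∀ y, y ∈ w → F y ∈ X) → img w F ∈ X := fun w hww F dF hF => by
    let nm : M → M := fun y => app g4 (sep (Vs κ) fun z => z ≠ emp ∧ ev z = F y)
    have dn : DF full nm := by unfold nm; fun_prop
    have h1 : ∀ y, y ∈ w → nm y ∈ Vs κ ∧ nm y ≠ emp ∧ ev (nm y) = F y := fun y hy =>
      ch hg4 (P := fun z => z ≠ emp ∧ ev z = F y) (by fun_prop) (nmE _ (hF y hy))
    refine (hX _).2 ⟨img w nm, Vs_img hk hw hr hs hww dn fun y hy => (h1 y hy).1, ?_⟩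
    show _ = Paper.ev κ H g e _
    rw [ev_eq, if_neg]
    · refine ext fun z => ?_
      rw [mem_img dF, mem_img de]
      constructor
      · rintro ⟨y, hy, rfl⟩
        exact ⟨nm y, (mem_img dn).2 ⟨y, hy, rfl⟩, (h1 y hy).2.2.symm⟩
      · rintro ⟨q, hq, rfl⟩
        obtain ⟨y, hy, rfl⟩ := (mem_img dn).1 hq
        exact ⟨y, hy, (h1 y hy).2.2⟩
    · intro h
      obtain ⟨y, hy, h2⟩ := (mem_img dn).1 h
      exact (h1 y hy).2.1 h2.symm
  have XH : X ⊆ H := fun a ha => by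
    obtain ⟨z, h1, rfl⟩ := (hX a).1 ha
    refine eps_ind (P := fun z => z ∈ Vs κ → ev z ∈ H) (by fun_prop) (fun x ih hx => ?_) z h1
    show Paper.ev κ H g e _ ∈ H
    rw [ev_eq]
    split_ifs with h
    · unfold opr; split_ifs with h
      · exact h
      · exact eH
    · refine H2 _ (fun y hy => ?_) ?_
      · obtain ⟨q, hq, rfl⟩ := (mem_img de).1 hy
        exact ih q hq ((tr_Vs o).mem hx hq)
      · obtain ⟨β, b1, b2⟩ := Vs_mem_small hk hw hr hs hx
        exact (leC_img de x).trans (b2.trans (leC_sub (o.sub b1)))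
  have VX : Vs κ ⊆ X := fun a ha => by
    refine eps_ind (P := fun z => z ∈ Vs κ → z ∈ X) (by fun_prop) (fun x ih hx => ?_) a ha
    have := Ximg x hx (fun y => y) (by fun_prop) fun y hy => ih y hy ((tr_Vs o).mem hx hy)
    rwa [show (img x fun y => y) = x from ext fun z => by rw [mem_img (by fun_prop)]; simp] at this
  have kV : ∀ α, α ∈ κ → α ∈ Vs κ := fun α hα => (ord_mem_Vs o (o.mem hα)).2 hα
  have kX : ∀ α, α ∈ κ → α ∈ X := fun α hα => VX _ (kV α hα)
  have nX : ∀ k, (num k : M) ∈ X := fun k => kX _ (hwk _ (num_om k))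
  have Xup : ∀ a, a ∈ X → ∀ b, b ∈ X → up a b ∈ X := fun a ha b hb => by
    have := Ximg (num 2) (kV _ (hwk _ (num_om 2))) (fun z => if z = num 0 then a else b) (by fun_prop) fun y _ => by split_ifs <;> assumption
    rwa [show (img (num 2) fun z => if z = num 0 then a else b) = up a b from ext fun z => by
      rw [mem_img (by fun_prop), mem_up]
      constructor
      · rintro ⟨x, hx, h⟩
        split_ifs at h
        · exact .inl h
        · exact .inr h
      · rintro (h | h)
        · exact ⟨num 0, num_lt (by decide), by rw [if_pos rfl]; exact h⟩
        · exact ⟨num 1, num_lt (by decide), by rw [if_neg (num_ne (by decide))]; exact h⟩] at this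
  have Xseq : ∀ γ f, γ ∈ κ → FnTo f γ X → f ∈ X := fun γ f hγ hf => by
    rw [show f = img γ fun x => pair x (app f x) from hf.1]
    refine Ximg γ (kV γ hγ) _ (by fun_prop) fun y hy => ?_
    have h1 := kX y (o.trans hγ hy)
    exact Xup _ (Xup _ h1 _ h1) _ (Xup _ h1 _ (hf.2 y hy))
  have Xsq : ∀ {k : ℕ} (v : Fin k → M), (∀ i, v i ∈ X) → sq v ∈ X := fun {k} v hv =>
    Xseq (num k) _ (hwk _ (num_om k)) ⟨fn_sq v, fun x hx => by
      obtain ⟨i, rfl⟩ := mem_num.1 hx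
      rw [app_sq]; exact hv i⟩
  have Xs2 : ∀ a b, a ∈ X → b ∈ X → s2 a b ∈ X := fun a b ha hb => by
    rw [s2_sq]; exact Xsq _ fun i => by fin_cases i <;> assumption
  have Xraw : ∀ u, u ∈ X → raw κ H g e u ∈ H → raw κ H g e u ∈ X := fun u hu h => by
    have := Xop u hu
    rwa [show op u = raw κ H g e u from if_pos h] at this
  have r : ∀ (i : ℕ) (v : M), v ∈ X → raw κ H g e (s2 (num i) v) ∈ H → raw κ H g e (s2 (num i) v) ∈ X := fun i v hv => Xraw _ (Xs2 _ _ (nX i) hv)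
  have ne : ∀ {i j : ℕ}, i ≠ j → (num i : M) ≠ num j := fun h => num_ne h
  have Xκ : κ ∈ X := by
    have := r 1 emp (nX 0)
    unfold raw at this
    rw [s2_0, if_pos rfl] at this
    exact this (H2 _ (fun α hα => XH _ (kX α hα)) (LeC.refl _))
  have XsU : ∀ a, a ∈ X → sU a ∈ X := fun a ha => by
    have := r 2 a ha
    unfold raw at this
    rw [s2_0, s2_1, if_neg (ne (by decide)), if_pos rfl] at this
    refine this (H2 _ (fun z hz => ?_) ?_)
    · obtain ⟨y, h1, h2⟩ := mem_sU.1 hz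
      exact tH.mem (tH.mem (XH a ha) h1) h2
    · exact leC_sU o (fun a b => p_cd hk hwk) (H1 _ (XH a ha)) fun y hy => H1 y (tH.mem (XH a ha) hy)
  have XTr : Tr X := fun y hy z hz => by
    have sj := he y (XH y hy) ⟨z, hz⟩
    obtain ⟨ξ, x1, x2⟩ := sj.sur hz
    have := r 3 (s2 y ξ) (Xs2 _ _ hy (kX ξ x1))
    unfold raw at this
    rw [s2_0, s2_1, if_neg (ne (by decide)), if_neg (ne (by decide)), if_pos rfl, s2_0, s2_1, x2] at this
    exact this (tH.mem (XH y hy) hz)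
  have skH : ∀ {c s : M}, (∃ z, z ∈ H ∧ snc s z ∈ Sa H c) → sk H g c s ∈ H ∧ snc s (sk H g c s) ∈ Sa H c := fun {c s} h =>
    ch hg (P := fun z => snc s z ∈ Sa H c) (by fun_prop) h
  have hcode : ∀ {k : ℕ} (φ : SetFormula k), (code φ : M) ∈ X := fun φ => kX _ (hwk _ (code_om φ))
  have Xsk : ∀ {k : ℕ} (φ : SetFormula (k+1)) (v : Fin k → M), (∀ i, v i ∈ X) → (∃ z, z ∈ H ∧ Rl ZFM.E (fun x => x ∈ H) φ (Fin.snoc v z)) →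
      ∃ z, z ∈ X ∧ Rl ZFM.E (fun x => x ∈ H) φ (Fin.snoc v z) := fun {k} φ v hv h => by
    have hv' : ∀ z, z ∈ H → ∀ i, (Fin.snoc v z : Fin (k+1) → M) i ∈ H := fun z hz i => by
      refine Fin.lastCases ?_ (fun i => ?_) i
      · simpa using hz
      · simpa using XH _ (hv i)
    obtain ⟨z, z1, z2⟩ := h
    rw [← sat_iff φ _ (hv' z z1), sq_snoc] at z2
    obtain ⟨s1, s2'⟩ := skH ⟨z, z1, z2⟩
    rw [← sq_snoc, sat_iff φ _ (hv' _ s1)] at s2'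
    refine ⟨_, ?_, s2'⟩
    have := r 5 (s2 (code φ) (sq v)) (Xs2 _ _ (hcode φ) (Xsq v hv))
    unfold raw at this
    rw [s2_0, s2_1, if_neg (ne (by decide)), if_neg (ne (by decide)), if_neg (ne (by decide)), if_neg (ne (by decide)), if_pos rfl, s2_0, s2_1] at this
    exact this s1
  refine ⟨X, H, XTr, VX, Xκ, (leC_img de _).trans (Vs_leC hk hw hr hs), Xseq, Xup, XsU, fun k φ => ?_, fun k φ v a hv ha => ?_⟩
  · induction φ with
    | mem i j => exact fun v hv => Iff.rfl
    | eq i j => exact fun v hv => Iff.rfl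
    | fal => exact fun v hv => Iff.rfl
    | imp φ ψ h1 h2 => exact fun v hv => imp_congr (h1 v hv) (h2 v hv)
    | all φ ih =>
      intro v hv
      have hv' : ∀ z, z ∈ X → ∀ i, (Fin.snoc v z : Fin _ → M) i ∈ X := fun z hz i => by
        refine Fin.lastCases ?_ (fun i => ?_) i
        · simpa using hz
        · simpa using hv i
      rw [rl_all, rl_all]
      constructor
      · intro h
        by_contra hn
        push Not at hn
        obtain ⟨z, z1, z2⟩ := Xsk φ.not v hv (by obtain ⟨z, z1, z2⟩ := hn; exact ⟨z, z1, rl_not.2 z2⟩)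
        exact rl_not.1 z2 ((ih _ (hv' z z1)).1 (h z z1))
      · exact fun h a ha => (ih _ (hv' a ha)).2 (h a (XH a ha))
  · have hv' : ∀ x, x ∈ a → ∀ z, z ∈ H → ∀ i, (Fin.snoc (Fin.snoc v x : Fin (k+1) → M) z : Fin (k+2) → M) i ∈ H := fun x hx z hz i => by
      refine Fin.lastCases ?_ (fun i => Fin.lastCases ?_ (fun i => ?_) i) i
      · simpa using hz
      · simpa using tH.mem (XH a ha) hx
      · simpa using XH _ (hv i)
    have key : ∀ x, x ∈ a → ∀ z, z ∈ H → (snc (snc (sq v) x) z ∈ Sa H (code φ) ↔ Rl ZFM.E (fun x => x ∈ H) φ (Fin.snoc (Fin.snoc v x) z)) := fun x hx z hz => by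
      rw [← sat_iff φ _ (hv' x hx z hz), sq_snoc, sq_snoc]
    have d1 : DP full (fun x : M => bex H fun z => snc (snc (sq v) x) z ∈ Sa H (code φ)) := by fun_prop
    have d2 : DF full (fun x : M => sk H g (code φ) (snc (sq v) x)) := by fun_prop
    have hb : ∀ y, y ∈ skS H g a (code φ) (sq v) ↔ ∃ x, x ∈ a ∧ (∃ z, z ∈ H ∧ snc (snc (sq v) x) z ∈ Sa H (code φ)) ∧ y = sk H g (code φ) (snc (sq v) x) := fun y => by
      unfold skS
      rw [mem_img d2]
      simp only [mem_sep d1, and_assoc]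
      rfl
    refine ⟨skS H g a (code φ) (sq v), ?_, fun y hy => ?_, fun x hx ⟨z, z1, z2⟩ => ?_⟩
    · have := r 4 (s2 a (s2 (code φ) (sq v))) (Xs2 _ _ ha (Xs2 _ _ (hcode φ) (Xsq v hv)))
      unfold raw at this
      rw [s2_0, s2_1, if_neg (ne (by decide)), if_neg (ne (by decide)), if_neg (ne (by decide)), if_pos rfl, s2_0, s2_1, s2_0, s2_1] at this
      refine this (H2 _ (fun y hy => ?_) ?_)
      · obtain ⟨x, h1, h2, rfl⟩ := (hb y).1 hy
        exact (skH h2).1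
      · exact (leC_img d2 _).trans ((leC_sub fun z hz => ((mem_sep d1).1 hz).1).trans (H1 a (XH a ha)))
    · obtain ⟨x, h1, h2, rfl⟩ := (hb y).1 hy
      have := skH h2
      exact ⟨x, h1, (key x h1 _ this.1).1 this.2⟩
    · have h2 : ∃ z, z ∈ H ∧ snc (snc (sq v) x) z ∈ Sa H (code φ) := ⟨z, z1, (key x hx z z1).2 z2⟩
      have := skH h2
      exact ⟨_, (hb _).2 ⟨x, hx, h2, rfl⟩, (key x hx _ this.1).1 this.2⟩
end Mod
end
end Paper
namespace Paper
section
variable {M : Type} [ZFM M] {G : Type} [Ctx M G] {c : Calc M} {n : ℕ}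

theorem ex_model {κ : M} (hk : Cd κ) (hw : om ∈ κ) (hr : Reg κ) (hs : SLim κ) : ∃ X : M, Tr X ∧ Vs κ ⊆ X ∧ κ ∈ X ∧ EqC κ X ∧
    (∀ γ f, γ ∈ κ → FnTo f γ X → f ∈ X) ∧ ZFMinusModelE ZFM.E X := by
  obtain ⟨X, H, X1, X2, X3, X4, X5, X6, X7, X8, X9⟩ := ex_m hk hw hr hs
  have hl := hk.lim (om_sub hk hw)
  have hrepl : AxReplE (fun a b : {x : M // ZFM.E x X} => ZFM.E a.1 b.1) := by
    rintro k φ p ⟨a, ha⟩ hfun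
    let σ : Fin (k+2) → Fin (k+2) := Fin.cons (Fin.last k).castSucc (Fin.cons (Fin.last (k+1)) fun i => i.castSucc.castSucc)
    have hσ : ∀ x y : M, (Fin.snoc (Fin.snoc (fun i => (p i).1) x : Fin (k+1) → M) y : Fin (k+2) → M) ∘ σ = Fin.cons x (Fin.cons y fun i => (p i).1) := fun x y => by
      funext i
      refine Fin.cases ?_ (fun i => Fin.cases ?_ (fun i => ?_) i) i
      · simp [σ]
      · simp [σ]
      · simp [σ]
    have hR : ∀ x y : {x : M // ZFM.E x X}, Realize (fun a b : {x : M // ZFM.E x X} => ZFM.E a.1 b.1) φ (Fin.cons x (Fin.cons y p)) ↔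
        Rl ZFM.E (fun x => x ∈ H) (φ.ren σ) (Fin.snoc (Fin.snoc (fun i => (p i).1) x.1) y.1) := fun x y => by
      rw [realize_sub, ← X8 (k+2), rl_ren, hσ]
      · refine iff_of_eq (congrArg _ (funext fun i => ?_))
        refine Fin.cases ?_ (fun i => Fin.cases ?_ (fun i => ?_) i) i
        · rfl
        · rfl
        · rfl
      · intro i
        refine Fin.lastCases ?_ (fun i => Fin.lastCases ?_ (fun i => ?_) i) i
        · simp; exact y.2
        · simp; exact x.2
        · simp; exact (p i).2
    obtain ⟨b, b1, b2, b3⟩ := X9 k (φ.ren σ) (fun i => (p i).1) a (fun i => (p i).2) ha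
    refine ⟨⟨b, b1⟩, fun y => ⟨fun hy => ?_, ?_⟩⟩
    · obtain ⟨x, x1, x2⟩ := b2 y.1 hy
      exact ⟨⟨x, X1.mem ha x1⟩, x1, (hR ⟨x, X1.mem ha x1⟩ y).2 x2⟩
    · rintro ⟨x, x1, x2⟩
      have hex : ∃ y, y ∈ H ∧ Rl ZFM.E (fun x => x ∈ H) (φ.ren σ) (Fin.snoc (Fin.snoc (fun i => (p i).1) x.1) y) := by
        have := (hR x y).1 x2
        by_contra hno
        have h1 : Rl ZFM.E (fun x => x ∈ H) (φ.ren σ).not.all (Fin.snoc (fun i => (p i).1) x.1) := fun a ha h => hno ⟨a, ha, h⟩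
        rw [← X8] at h1
        · have h2 := h1 y.1 y.2
          rw [X8] at h2
          · exact h2 this
          · intro i
            refine Fin.lastCases ?_ (fun i => Fin.lastCases ?_ (fun i => ?_) i) i
            · simp; exact y.2
            · simp; exact x.2
            · simp; exact (p i).2
        · intro i
          refine Fin.lastCases ?_ (fun i => ?_) i
          · simp; exact x.2
          · simp; exact (p i).2
      obtain ⟨y', y1, y2⟩ := b3 x.1 x1 hex
      have hy' : ZFM.E y' X := X1.mem b1 y1
      have := hfun x x1 y ⟨y', hy'⟩ x2 ((hR x ⟨y', hy'⟩).2 y2)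
      rw [this]; exact y1
  refine ⟨X, X1, X2, X3, cantor_bernstein (leC_sub fun α hα => X2 _ ((ord_mem_Vs hk.ord (hk.ord.mem hα)).2 hα)) X4, X5, ?_, ?_, ?_, ?_, ?_, ?_, hrepl⟩
  · rintro ⟨x, hx⟩ ⟨y, hy⟩ h
    refine Subtype.ext (ext fun z => ⟨fun hz => (h ⟨z, X1.mem hx hz⟩).1 hz, fun hz => (h ⟨z, X1.mem hy hz⟩).2 hz⟩)
  · rintro ⟨a, ha⟩ ⟨b, hb⟩
    refine ⟨⟨up a b, X6 a ha b hb⟩, fun z => ?_⟩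
    rw [Subtype.ext_iff, Subtype.ext_iff]
    exact mem_up
  · rintro ⟨a, ha⟩
    refine ⟨⟨sU a, X7 a ha⟩, fun z => ⟨fun h => ?_, ?_⟩⟩
    · obtain ⟨y, y1, y2⟩ := mem_sU.1 h
      exact ⟨⟨y, X1.mem ha y1⟩, y1, y2⟩
    · rintro ⟨y, y1, y2⟩
      exact mem_sU.2 ⟨y.1, y1, y2⟩
  · have h0 : (om : M) ∈ X := X2 _ ((ord_mem_Vs hk.ord ord_om).2 hw)
    refine ⟨⟨om, h0⟩, ⟨⟨emp, X1.mem h0 emp_om⟩, emp_om, fun z hz => absurd (show z.1 ∈ (emp : M) from hz) (by simp)⟩, ?_⟩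
    rintro ⟨y, hy⟩ h
    refine ⟨⟨suc y, X1.mem h0 (suc_om h)⟩, suc_om h, fun z => ?_⟩
    rw [Subtype.ext_iff]
    exact mem_suc
  · rintro ⟨a, ha⟩ ⟨z, hz⟩
    obtain ⟨m, m1, m2⟩ := found (a := a) ⟨z.1, hz⟩
    exact ⟨⟨m, X1.mem ha m1⟩, m1, fun z => m2 z.1⟩
  · intro k φ p a
    obtain ⟨b, hb⟩ := hrepl k ((SetFormula.eq 0 1).and (φ.ren (Fin.cons 0 fun i => i.succ.succ))) p a (fun x hx y y' h h' => by
      rw [realize_and] at h h'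
      exact (show x = y from h.1).symm.trans h'.1)
    · refine ⟨b, fun z => (hb z).trans ?_⟩
      have e : ∀ x y : {x : M // ZFM.E x X}, (Fin.cons x (Fin.cons y p) : Fin (k+2) → _) ∘ (Fin.cons 0 fun i => i.succ.succ : Fin (k+1) → Fin (k+2)) = Fin.cons x p := fun x y => by
        funext i
        refine Fin.cases ?_ (fun i => ?_) i <;> simp
      constructor
      · rintro ⟨x, x1, x2⟩
        rw [realize_and, realize_ren, e] at x2
        have h : x = z := x2.1
        rw [← h]; exact ⟨x1, x2.2⟩
      · rintro ⟨h1, h2⟩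
        refine ⟨z, h1, ?_⟩
        rw [realize_and, realize_ren, e]
        exact ⟨rfl, h2⟩

end
end Paper
namespace Paper
section
variable {M : Type} [ZFM M] {G : Type} [Ctx M G] {c : Calc M} {n : ℕ}

theorem D0.memA {k : ℕ} (a b : Fin k) : D0 (fun w : Fin k → M => w a ∈ w b) := ⟨.mem a b, .mem _ _, fun _ => Iff.rfl⟩
theorem D0.eqA {k : ℕ} (a b : Fin k) : D0 (fun w : Fin k → M => w a = w b) := ⟨.eq a b, .eq _ _, fun _ => Iff.rfl⟩
theorem D0.ball' {k : ℕ} (j : Fin k) {P : (Fin k → M) → M → Prop}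
    (h : D0 (fun w : Fin (k+1) → M => P (fun i => w i.castSucc) (w (Fin.last k)))) : D0 (fun v => Paper.ball (v j) (P v)) :=
  (D0.ball j h).congr fun v => by simp [Paper.ball]
theorem D0.bex' {k : ℕ} (j : Fin k) {P : (Fin k → M) → M → Prop}
    (h : D0 (fun w : Fin (k+1) → M => P (fun i => w i.castSucc) (w (Fin.last k)))) : D0 (fun v => Paper.bex (v j) (P v)) :=
  (D0.bex j h).congr fun v => by simp [Paper.bex]

/-- the unordered pair of `x`, `y` belongs to `R`, in `Δ₀` form -/
def Um (R x y : M) : Prop := bex R fun q => x ∈ q ∧ y ∈ q ∧ ball q fun t => t = x ∨ t = y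
theorem um_iff {R x y : M} : Um R x y ↔ up x y ∈ R := by
  constructor
  · rintro ⟨q, h1, h2, h3, h4⟩
    have : q = up x y := ext fun t => by
      rw [mem_up]
      exact ⟨h4 t, by rintro (rfl | rfl) <;> assumption⟩
    rwa [← this]
  · intro h
    exact ⟨_, h, mem_up.2 (.inl rfl), mem_up.2 (.inr rfl), fun t => mem_up.1⟩
/-- a variant of `Wt` that only uses bounded quantifiers -/
def Wz (d R C : M) : Prop := ((ball C fun z => z ∈ d) ∧ (ball d fun α => bex C fun β => α ∈ β) ∧
  ball d fun l => (bex l fun z => z = z) → (ball l fun α => bex C fun β => α ∈ β ∧ β ∈ l) → l ∈ C) ∧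
  ball C fun β => ball C fun α => α ∈ β → bex α fun ξ => ¬ ((Um R ξ α → Um R ξ β) ∧ (Um R ξ β → Um R ξ α))
def Pz (d R C : M) : Prop := (bex d fun z => z = z) ∧ (ball d fun α => bex d fun β => α ∈ β) ∧ ¬ Wz d R C
theorem pz_D0 : D0 (fun v : Fin 4 → M => Pz (v 1) (v 2) (v 3)) := by
  unfold Pz Wz Um
  repeat' first
    | exact D0.memA _ _
    | exact D0.eqA _ _
    | refine D0.neg ?_
    | refine D0.and ?_ ?_
    | refine D0.or ?_ ?_
    | refine D0.ball' _ ?_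
    | refine D0.bex' _ ?_
    | refine D0.imp ?_ ?_
theorem wz_club {d R C : M} : Wz d R C ↔ Club C d ∧ ball C fun β => ball C fun α => α ∈ β → bex α fun ξ => ¬ (up ξ α ∈ R ↔ up ξ β ∈ R) := by
  unfold Wz Club
  have : ∀ l : M, (bex l fun _ => True) ↔ l ≠ emp := fun l => by rw [ne_emp]; simp [bex]
  have e2 : ∀ a b : Prop, ((a → b) ∧ (b → a)) ↔ (a ↔ b) := fun a b => iff_def.symm
  simp only [this, um_iff, e2]
  rfl
theorem mkR {d : M} (o : Ord d) (A : M → M → Prop) (hA : DP full (fun q : M × M => A q.1 q.2)) :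
    ∃ R, R ⊆ pow d ∧ ∀ α, α ∈ d → ∀ ξ, ξ ∈ α → (up ξ α ∈ R ↔ A ξ α) := by
  have dp : DP full (fun q : M => bex d fun α => bex α fun ξ => q = up ξ α ∧ A ξ α) := by
    refine DP.bex _ _ (by fun_prop) (DP.bex _ _ (by fun_prop) (DP.and _ _ (by fun_prop) (hA.comp (f := fun q : (M × M) × M => (q.2, q.1.2)) (by fun_prop))))
  refine ⟨sep (pow d) _, fun q hq => ((mem_sep dp).1 hq).1, fun α hα ξ hξ => ?_⟩
  rw [mem_sep dp]
  constructor
  · rintro ⟨-, α', a1, ξ', a2, e, a3⟩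
    have h1 : ξ ∈ up ξ' α' := by rw [← e]; simp
    have h2 : α ∈ up ξ' α' := by rw [← e]; simp
    rw [mem_up] at h1 h2
    rcases h1 with rfl | rfl
    · rcases h2 with rfl | rfl
      · exact absurd hξ (mem_irrefl _)
      · exact a3
    · rcases h2 with rfl | rfl
      · exact absurd hξ (mem_asymm a2)
      · exact absurd hξ (mem_irrefl _)
  · intro h
    refine ⟨mem_pow.2 fun z hz => ?_, α, hα, ξ, hξ, rfl, h⟩
    rcases mem_up.1 hz with rfl | rfl
    · exact o.trans hα hξ
    · exact hα
theorem L1 {d : M} (hl : Lim d) (h : ¬ SubtleE ZFM.E d) : ∃ R C, R ⊆ pow d ∧ C ⊆ d ∧ Wz d R C := by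
  have o := hl.ord
  simp only [wz_club]
  by_cases hc : Cd d
  · have : ∃ f C, Wt d f C := by
      by_contra hn
      exact h (subtleE_iff.2 ⟨hc, hl.om_le, fun f C hw => hn ⟨f, C, hw⟩⟩)
    obtain ⟨f, C, w1, w2, w3, w4⟩ := this
    obtain ⟨R, r1, r2⟩ := mkR o (fun ξ α => ξ ∈ app f α) (by fun_prop)
    refine ⟨R, C, r1, w3.1, w3, fun β hβ α hα hl => ?_⟩
    by_contra hn
    refine w4 β hβ α hα hl (ext fun ξ => ?_)
    rw [mem_cap]
    have key : ∀ ξ, ξ ∈ α → (ξ ∈ app f α ↔ ξ ∈ app f β) := fun ξ hξ => by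
      have hb := w3.1 β hβ
      rw [← r2 α (w3.1 α hα) ξ hξ, ← r2 β hb ξ ((o.mem hb).trans hl hξ)]
      by_contra h'
      exact hn ⟨ξ, hξ, h'⟩
    exact ⟨fun h => ⟨(key ξ (w2 α (w3.1 α hα) ξ h)).1 h, w2 α (w3.1 α hα) ξ h⟩, fun h => (key ξ h.2).2 h.1⟩
  · have : ∃ m, m ∈ d ∧ EqC m d := by
      by_contra hn
      exact hc ⟨o, fun x hx he => hn ⟨x, hx, he⟩⟩
    obtain ⟨m, hm, g, -, g2⟩ := this
    obtain ⟨R, r1, r2⟩ := mkR o (fun ξ α => app g ξ = α) (by fun_prop)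
    have mC : ∀ α, α ∈ sep d (fun α => m ∈ α) ↔ α ∈ d ∧ m ∈ α := fun α => mem_sep (P := fun α => m ∈ α) (by fun_prop)
    refine ⟨R, sep d (fun α => m ∈ α), r1, fun α hα => ((mC α).1 hα).1, ⟨fun α hα => ((mC α).1 hα).1, fun α hα => ?_, fun l hl hne hu => ?_⟩, fun β hβ α hα hl => ?_⟩
    · rcases (o.mem hα).lt_or_le (o.mem hm) with h | h
      · exact ⟨_, (mC _).2 ⟨hl.suc hm, self_mem_suc _⟩, mem_suc.2 (.inl h)⟩
      · exact ⟨_, (mC _).2 ⟨hl.suc hα, (Ord.mem_suc_iff (o.mem hm) (o.mem hα)).2 h⟩, self_mem_suc _⟩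
    · obtain ⟨z, hz⟩ := ne_emp.1 hne
      obtain ⟨β, b1, b2, b3⟩ := hu z hz
      exact (mC _).2 ⟨hl, (o.mem hl).trans b3 ((mC _).1 b1).2⟩
    · rw [mC] at hα hβ
      obtain ⟨ξ, x1, x2⟩ := g2.2 β hβ.1
      have hx : ξ ∈ α := (o.mem hα.1).trans hα.2 x1
      refine ⟨ξ, hx, fun hi => ?_⟩
      rw [r2 α hα.1 ξ hx, r2 β hβ.1 ξ ((o.mem hβ.1).trans hl hx)] at hi
      have := (hi.2 x2)
      rw [x2] at this
      rw [this] at hl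
      exact mem_irrefl _ hl
theorem L2 {d : M} (h : SubtleE ZFM.E d) (R C : M) : ¬ Wz d R C := by
  obtain ⟨h1, h2, h3⟩ := subtleE_iff.1 h
  rw [wz_club]
  rintro ⟨hC, hw⟩
  have dS : DF full (fun α : M => sep α fun ξ => up ξ α ∈ R) := by fun_prop
  have ap : ∀ α, α ∈ d → app (lam d fun α => sep α fun ξ => up ξ α ∈ R) α = sep α fun ξ => up ξ α ∈ R := fun α hα => app_lam dS hα
  have ms : ∀ ξ α, ξ ∈ (sep α fun ξ => up ξ α ∈ R) ↔ ξ ∈ α ∧ up ξ α ∈ R := fun ξ α => mem_sep (P := fun ξ => up ξ α ∈ R) (by fun_prop)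
  refine h3 (lam d fun α => sep α fun ξ => up ξ α ∈ R) C ⟨fn_lam _ dS, fun α hα => ?_, hC, fun β hβ α hα hl e => ?_⟩
  · beta_reduce; rw [ap α hα]; exact fun ξ hξ => ((ms _ _).1 hξ).1
  · rw [ap α (hC.1 α hα), ap β (hC.1 β hβ)] at e
    obtain ⟨ξ, x1, x2⟩ := hw β hβ α hα hl
    have hx : ξ ∈ β := (h1.ord.mem (hC.1 β hβ)).trans hl x1
    have := ext_iff'.1 e ξ
    rw [mem_cap, ms, ms] at this
    exact x2 (by tauto)
theorem pz_lim {d R C : M} (o : Ord d) : Pz d R C ↔ Lim d ∧ ¬ Wz d R C := by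
  rw [← limitE_iff, LimitE, ordE_iff, Pz]
  constructor
  · rintro ⟨⟨z, h1, -⟩, h2, h3⟩
    exact ⟨⟨o, ⟨z, h1⟩, h2⟩, h3⟩
  · rintro ⟨⟨-, ⟨z, h1⟩, h2⟩, h3⟩
    exact ⟨⟨z, h1, rfl⟩, h2, h3⟩

theorem thmD (n : ℕ) (h : ∃ κ : M, SubtleE ZFM.E κ) : ∃ κ : M, CnWeaklyShrewdE ZFM.E (n+1) κ ∧ ¬ CnStronglyUnfoldableE ZFM.E (n+1) κ := by
  obtain ⟨d, -, hd, hmin⟩ := ord_min (P := fun κ : M => Cd κ ∧ om ⊆ κ ∧ ∀ f C, ¬ Wt κ f C) (by fun_prop) (by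
    obtain ⟨κ, h⟩ := h
    have := subtleE_iff.1 h
    exact ⟨κ, this.1.ord, this⟩)
  have o := hd.1.ord
  obtain ⟨κ, k1, k2, k3⟩ := subtle_ws hd.1 hd.2.1 hd.2.2 n
  refine ⟨κ, ws_iff.2 k3, fun hu => ?_⟩
  obtain ⟨u1, u2⟩ := hu
  obtain ⟨i1, i2, i3, i4⟩ := inaccE_iff.1 u1
  obtain ⟨X, X1, X2, X3, ⟨g, hg⟩, X5, X6⟩ := ex_model i1 i2 i3 i4
  obtain ⟨θ, t1, t2⟩ := cc_above n d
  have oθ := t1.2.ord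
  have hdθ := (ord_mem_Vs oθ o).1 t2
  obtain ⟨N, j, κ', N1, N2, N3, N4, -, N5, N6, N7, -⟩ := u2 θ (cn_iff.2 t1.1) (oθ.trans hdθ k1) X (transE_iff.2 X1) X6 ⟨g, bijE_iff.2 hg⟩ X3
    (fun γ f hγ hf => X5 γ f hγ (isFuncE_iff.1 hf))
  have dN : d ∈ N := N2 d (vMemE_iff.2 ⟨oθ, t2⟩)
  have oκ' : Ord κ' := (vMemE_iff.1 (N7 d (vMemE_iff.2 ⟨oθ, t2⟩)).2).1
  have dκ' : d ∈ κ' := oκ'.trans N6 hdθ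
  obtain ⟨ψ, p1, p2⟩ := pz_D0 (M := M)
  let Q : SetFormula 1 := .ex ((SetFormula.mem (Fin.last 1) 0).and (.all (.all ψ)))
  have ev : ∀ S a : M, Tr S → a ∈ S → (Rl ZFM.E (fun x => x ∈ S) Q ![a] ↔ ∃ e, e ∈ S ∧ e ∈ a ∧ ∀ R, R ∈ S → ∀ C, C ∈ S → Pz e R C) := by
    intro S a hS ha
    rw [rl_ex]
    refine exists_congr fun e => and_congr_right fun he => ?_
    rw [rl_and, rl_all]
    refine and_congr Iff.rfl (forall_congr' fun R => imp_congr_right fun hR => ?_)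
    rw [rl_all]
    refine forall_congr' fun C => imp_congr_right fun hC => ?_
    rw [delta0_abs (E := ZFM.E) (S := fun x => x ∈ S) (fun x y hy hx => hS.mem hy hx) p1, ← p2]
    · rfl
    · intro i
      fin_cases i
      · exact ha
      · exact he
      · exact hR
      · exact hC
  have kN : κ' ∈ N := (isFuncE_iff.1 N3).1.pair_mem.1 (pairMemE_iff.1 N5) |>.2 ▸ (isFuncE_iff.1 N3).2 κ X3
  have q := N4 Q ![κ] ![κ'] (fun i => by fin_cases i; exact X3) (fun i => by fin_cases i; exact N5)
  rw [realizeIn_iff, realizeIn_iff] at q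
  have qN : Rl ZFM.E (fun x => x ∈ N) Q ![κ'] := (ev N κ' N1 kN).2 ⟨d, dN, dκ', fun R _ C _ =>
    (pz_lim o).2 ⟨hd.1.lim hd.2.1, L2 (subtleE_iff.2 hd) R C⟩⟩
  have qX := (q.2 ⟨fun i => by fin_cases i; exact kN, qN⟩).2
  obtain ⟨e, e1, e2, e3⟩ := (ev X κ X1 X3).1 qX
  have lk : Lim κ := i1.lim (i1.ord.sub i2)
  have oe := i1.ord.mem e2
  have eV : e ∈ Vs κ := (ord_mem_Vs i1.ord oe).2 e2
  have le : Lim e := ((pz_lim oe).1 (e3 e e1 e e1)).1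
  refine hmin e (o.trans k1 e2) (subtleE_iff.1 ?_)
  by_contra hn
  obtain ⟨R, C, r1, r2, r3⟩ := L1 le hn
  exact ((pz_lim oe).1 (e3 R (X2 _ (Vs_sub i1.ord r1 (Vs_pow lk eV))) C (X2 _ (Vs_sub i1.ord r2 eV)))).2 r3
end
theorem equiconsistent_shrewd_not_unfoldable_subtle (n : ℕ) (hn : 0 < n) :
    (∃ (M : Type) (E : M → M → Prop), IsZFCE E ∧
        ∃ κ, CnWeaklyShrewdE E n κ ∧ ¬ CnStronglyUnfoldableE E n κ) ↔
      ∃ (M : Type) (E : M → M → Prop), IsZFCE E ∧ ∃ κ, SubtleE E κ := by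
  obtain ⟨n, rfl⟩ := Nat.exists_eq_succ_of_ne_zero hn.ne'
  constructor
  · rintro ⟨M, E, hz, κ, h1, h2⟩
    letI : ZFM M := ⟨E, hz⟩
    refine ⟨{x : M // HOD x}, HE M, hod_zfc, ?_⟩
    by_contra hno
    exact h2 (thmA (thmB (fun κ h => hno ⟨κ, h⟩) (ws_iff.1 h1)))
  · rintro ⟨M, E, hz, h⟩
    letI : ZFM M := ⟨E, hz⟩
    exact ⟨M, E, hz, thmD n h⟩
end Paper
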